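/- Let n ≥ 3, p ≥ 2, let Ω ⊆ ℝⁿ be open, and let u : Ω → ℝ^p be an energy minimizing map into the unit sphere S^{p−1}. Then the Hausdorff dimension of the singular set satisfies dim_H(sing(u)) ≤ n − 3. -/

import Mathlib

open MeasureTheory Metric Filter Set

noncomputable section

/-- The pointwise energy density `|Du|²(x) = ∑_{i,j} ((g(x)eᵢ)_j)²` associated to a
(weak) gradient `g`. -/
def energyDensity (n p : ℕ)
    (g : EuclideanSpace ℝ (Fin n) →
      (EuclideanSpace ℝ (Fin n) →L[ℝ] EuclideanSpace ℝ (Fin p)))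
    (x : EuclideanSpace ℝ (Fin n)) : ℝ :=
  ∑ i : Fin n, ∑ j : Fin p, (g x (EuclideanSpace.single i 1) j) ^ 2

/-- `u` has weak gradient `g` on `Ω`: both are locally integrable on `Ω` and the
integration-by-parts identity holds against every smooth compactly supported test
function with support in `Ω`. -/
def HasWeakGradient (n p : ℕ) (Ω : Set (EuclideanSpace ℝ (Fin n)))
    (u : EuclideanSpace ℝ (Fin n) → EuclideanSpace ℝ (Fin p))
    (g : EuclideanSpace ℝ (Fin n) →
      (EuclideanSpace ℝ (Fin n) →L[ℝ] EuclideanSpace ℝ (Fin p))) : Prop :=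
  LocallyIntegrableOn u Ω volume ∧ LocallyIntegrableOn g Ω volume ∧
  ∀ φ : EuclideanSpace ℝ (Fin n) → ℝ, ContDiff ℝ (⊤ : ℕ∞) φ → HasCompactSupport φ →
    tsupport φ ⊆ Ω → ∀ i : Fin n, ∀ j : Fin p,
      ∫ x in Ω, u x j * fderiv ℝ φ x (EuclideanSpace.single i 1) =
        - ∫ x in Ω, φ x * g x (EuclideanSpace.single i 1) j

/-- `u : Ω → ℝᵖ` is an energy minimizing map into the unit sphere `S^(p-1)` with weak
gradient `g`: `u` has weak gradient `g` with locally integrable energy density,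
`‖u‖ = 1` a.e. on `Ω`, and `u` minimizes energy in every ball `B_ρ(y)` with closure in
`Ω` among sphere-valued competitors `w` agreeing with `u` a.e. outside a smaller
concentric ball. -/
def IsEnergyMinimizingToSphere (n p : ℕ) (Ω : Set (EuclideanSpace ℝ (Fin n)))
    (u : EuclideanSpace ℝ (Fin n) → EuclideanSpace ℝ (Fin p))
    (g : EuclideanSpace ℝ (Fin n) →
      (EuclideanSpace ℝ (Fin n) →L[ℝ] EuclideanSpace ℝ (Fin p))) : Prop :=
  HasWeakGradient n p Ω u g ∧
  LocallyIntegrableOn (energyDensity n p g) Ω volume ∧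
  (∀ᵐ x ∂volume.restrict Ω, ‖u x‖ = 1) ∧
  ∀ (y : EuclideanSpace ℝ (Fin n)) (ρ : ℝ), 0 < ρ → closedBall y ρ ⊆ Ω →
    ∀ (w : EuclideanSpace ℝ (Fin n) → EuclideanSpace ℝ (Fin p))
      (h : EuclideanSpace ℝ (Fin n) →
        (EuclideanSpace ℝ (Fin n) →L[ℝ] EuclideanSpace ℝ (Fin p))),
      HasWeakGradient n p Ω w h →
      LocallyIntegrableOn (energyDensity n p h) Ω volume →
      (∀ᵐ x ∂volume.restrict Ω, ‖w x‖ = 1) →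
      (∃ σ : ℝ, σ < ρ ∧ ∀ᵐ x ∂volume.restrict (Ω \ ball y σ), w x = u x) →
      ∫ x in ball y ρ, energyDensity n p g x ≤ ∫ x in ball y ρ, energyDensity n p h x

/-- The regular set of `u`: points of `Ω` having an open neighborhood (inside `Ω`) on
which `u` agrees almost everywhere with a `C^∞` map. -/
def regSet (n p : ℕ) (Ω : Set (EuclideanSpace ℝ (Fin n)))
    (u : EuclideanSpace ℝ (Fin n) → EuclideanSpace ℝ (Fin p)) :
    Set (EuclideanSpace ℝ (Fin n)) :=
  {x | x ∈ Ω ∧ ∃ V : Set (EuclideanSpace ℝ (Fin n)), IsOpen V ∧ x ∈ V ∧ V ⊆ Ω ∧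
    ∃ v : EuclideanSpace ℝ (Fin n) → EuclideanSpace ℝ (Fin p),
      ContDiffOn ℝ (⊤ : ℕ∞) v V ∧ ∀ᵐ z ∂volume.restrict V, u z = v z}

set_option linter.all false
set_option linter.deprecated false
local notation:25 M "⊸" N => ContinuousLinearMap (RingHom.id ℝ) M N
local notation "⊕ₚ" => (by positivity)
local notation "⊕ₛ" => (by simp)

section
open scoped ContDiff

abbrev Eu (n : ℕ) := EuclideanSpace ℝ (Fin n)

def psi : ℝ → ℝ := fun t => expNegInvGlue (1 - t)

def Prof (q : ℝ → ℝ) : Prop := ContDiff ℝ ∞ q ∧ ∀ t, 1 ≤ t → q t = 0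

lemma Prof.psi : Prof psi :=
  ⟨expNegInvGlue.contDiff.comp (contDiff_const.sub contDiff_id),
   fun t ht => expNegInvGlue.zero_of_nonpos (by linarith)⟩

lemma Prof.deriv {q : ℝ → ℝ} (h : Prof q) : Prof (deriv q) := by
  have hd : ContDiff ℝ ∞ (_root_.deriv q) := (contDiff_infty_iff_deriv.1 h.1).2
  refine ⟨hd, ?_⟩
  have h1 : ∀ t, 1 < t → _root_.deriv q t = 0 := by
    intro t ht
    have : q =ᶠ[nhds t] fun _ => 0 := by
      filter_upwards [lt_mem_nhds ht] with y hy using h.2 y hy.le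
    rw [this.deriv_eq]; simp
  intro t ht
  have hc : Continuous (_root_.deriv q) := hd.continuous
  have := (isClosed_singleton (x := (0:ℝ))).preimage hc
  have h2 : closure (Ioi (1:ℝ)) ⊆ _root_.deriv q ⁻¹' {0} :=
    closure_minimal (fun t ht => h1 t ht) this
  rw [closure_Ioi] at h2
  exact h2 ht

lemma Prof.mul {q a : ℝ → ℝ} (h : Prof q) (ha : ContDiff ℝ ∞ a) : Prof (fun t => a t * q t) :=
  ⟨ha.mul h.1, fun t ht => by simp [h.2 t ht]⟩

lemma Prof.add {q r : ℝ → ℝ} (h : Prof q) (h' : Prof r) : Prof (fun t => q t + r t) :=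
  ⟨h.1.add h'.1, fun t ht => by simp [h.2 t ht, h'.2 t ht]⟩

lemma Prof.neg {q : ℝ → ℝ} (h : Prof q) : Prof (fun t => - q t) :=
  ⟨h.1.neg, fun t ht => by simp [h.2 t ht]⟩

lemma Prof.bdd {q : ℝ → ℝ} (h : Prof q) : ∃ C, 0 < C ∧ ∀ t, 0 ≤ t → |q t| ≤ C := by
  obtain ⟨C, hC⟩ := (isCompact_Icc (a := (0:ℝ)) (b := 1)).exists_bound_of_continuousOn
    h.1.continuous.continuousOn
  refine ⟨max C 1, by positivity, fun t ht => ?_⟩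
  by_cases h1 : t ≤ 1
  · exact (hC t ⟨ht, h1⟩).trans (le_max_left _ _)
  · rw [h.2 t (by linarith)]; simp

variable {n : ℕ} {F : Type*} [NormedAddCommGroup F] [NormedSpace ℝ F]

def rad (q : ℝ → ℝ) (s : ℝ) (z : Eu n) : ℝ := q (‖z‖ ^ 2 / s ^ 2)

lemma rad_contDiff {q : ℝ → ℝ} (h : Prof q) (s : ℝ) : ContDiff ℝ ∞ (rad q s : Eu n → ℝ) :=
  h.1.comp ((contDiff_norm_sq ℝ).div_const _)

lemma rad_zero {q : ℝ → ℝ} (h : Prof q) {s : ℝ} (hs : 0 < s) {z : Eu n} (hz : s ≤ ‖z‖) :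
    rad q s z = 0 :=
  h.2 _ (by rw [le_div_iff₀ ⊕ₚ]; nlinarith)

lemma rad_hasFDerivAt {q : ℝ → ℝ} (h : Prof q) (s : ℝ) (z : Eu n) :
    HasFDerivAt (rad q s) ((2 / s ^ 2 * rad (deriv q) s z) • innerSL ℝ z) z := by
  have h1 : HasFDerivAt (fun z : Eu n => ‖z‖ ^ 2 / s ^ 2) ((1 / s ^ 2) • (2 • innerSL ℝ z)) z := by
    have := (hasStrictFDerivAt_norm_sq z).hasFDerivAt.mul_const (1 / s ^ 2)
    simpa [div_eq_mul_inv] using this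
  have h2 : HasDerivAt q (deriv q (‖z‖ ^ 2 / s ^ 2)) (‖z‖ ^ 2 / s ^ 2) :=
    (h.1.differentiable ⊕ₛ).differentiableAt.hasDerivAt
  have := h2.comp_hasFDerivAt z h1
  refine this.congr_fderiv (ContinuousLinearMap.ext fun e => ?_)
  simp [rad]; ring

lemma rad_fderiv {q : ℝ → ℝ} (h : Prof q) (s : ℝ) (z e : Eu n) :
    fderiv ℝ (rad q s) z e = 2 / s ^ 2 * rad (deriv q) s z * inner ℝ z e := by
  rw [(rad_hasFDerivAt h s z).fderiv]; simp

def Tst (U : Set (Eu n)) (φ : Eu n → ℝ) : Prop :=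
  ContDiff ℝ ∞ φ ∧ HasCompactSupport φ ∧ tsupport φ ⊆ U

lemma Tst.of_zero {U K : Set (Eu n)} {φ : Eu n → ℝ} (h : ContDiff ℝ ∞ φ) (hK : IsCompact K)
    (hKU : K ⊆ U) (h0 : ∀ z, z ∉ K → φ z = 0) : Tst U φ := by
  have : tsupport φ ⊆ K := closure_minimal (fun z hz => by
    by_contra h; exact hz (h0 z h)) hK.isClosed
  exact ⟨h, hK.of_isClosed_subset (isClosed_tsupport _) this, this.trans hKU⟩

lemma Tst.mono {U V : Set (Eu n)} {φ : Eu n → ℝ} (h : Tst U φ) (hUV : U ⊆ V) : Tst V φ :=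
  ⟨h.1, h.2.1, h.2.2.trans hUV⟩

lemma Tst.mul {U : Set (Eu n)} {φ a : Eu n → ℝ} (h : Tst U φ) (ha : ContDiff ℝ ∞ a) :
    Tst U (fun z => a z * φ z) :=
  Tst.of_zero (ha.mul h.1) h.2.1 h.2.2 fun z hz => by simp [image_eq_zero_of_notMem_tsupport hz]

lemma Tst.fderiv {U : Set (Eu n)} {φ : Eu n → ℝ} (h : Tst U φ) (e : Eu n) :
    Tst U (fun z => fderiv ℝ φ z e) := by
  refine Tst.of_zero ((h.1.fderiv_right (m := ∞) ⊕ₛ).clm_apply contDiff_const) h.2.1 h.2.2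
    fun z hz => ?_
  have := image_eq_zero_of_notMem_tsupport (f := _root_.fderiv ℝ φ)
    (fun h' => hz (tsupport_fderiv_subset ℝ h'))
  simp [this]

lemma Tst.rad {U : Set (Eu n)} {q : ℝ → ℝ} (h : Prof q) {s : ℝ} (hs : 0 < s) {x : Eu n}
    (hU : closedBall x s ⊆ U) : Tst U (fun z => rad q s (x - z)) :=
  Tst.of_zero ((rad_contDiff h s).comp (contDiff_const.sub contDiff_id))
    (isCompact_closedBall x s) hU fun z hz => rad_zero h hs (by
      rw [mem_closedBall', dist_eq_norm] at hz; linarith)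

/-- coordinate vectors -/
def be (i : Fin n) : Eu n := EuclideanSpace.single i 1

local notation:max "ⅇ" i:max => be i

def lap (φ : Eu n → ℝ) (z : Eu n) : ℝ := ∑ i, fderiv ℝ (fun y => fderiv ℝ φ y ⅇ i) z ⅇ i

lemma be_inner (i : Fin n) (z : Eu n) : inner ℝ z ⅇ i = z i := by
  rw [be, real_inner_comm, EuclideanSpace.inner_single_left]; simp

lemma norm_be (i : Fin n) : ‖(be i : Eu n)‖ = 1 := by simp [be]

lemma sum_be (z : Eu n) : ∑ i, z i • be i = z := by
  have := (EuclideanSpace.basisFun (Fin n) ℝ).sum_repr z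
  simpa [be] using this

lemma Tst.lap {U : Set (Eu n)} {φ : Eu n → ℝ} (h : Tst U φ) : Tst U (lap φ) := by
  have h1 := fun i => (h.fderiv ⅇ i).fderiv ⅇ i
  exact Tst.of_zero (ContDiff.sum fun i _ => (h1 i).1) h.2.1 h.2.2 fun z hz => by
    refine Finset.sum_eq_zero fun i _ => ?_
    have := image_eq_zero_of_notMem_tsupport (f := _root_.fderiv ℝ (fun y => _root_.fderiv ℝ φ y ⅇ i))
      (x := z) (fun h' => hz ?_)
    · simp [this]
    · have := tsupport_fderiv_subset ℝ h'
      refine tsupport_fderiv_subset ℝ (f := φ) (closure_mono ?_ this)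
      intro y hy h0; exact hy (by simp only [h0]; rfl)

/-- profile of the Laplacian -/
def Lq (n : ℕ) (q : ℝ → ℝ) (t : ℝ) : ℝ := 2 * n * deriv q t + 4 * t * deriv (deriv q) t

lemma Prof.Lq {q : ℝ → ℝ} (h : Prof q) : Prof (Lq n q) :=
  (h.deriv.mul contDiff_const).add (h.deriv.deriv.mul (contDiff_const.mul contDiff_id))

lemma lap_rad {q : ℝ → ℝ} (h : Prof q) {s : ℝ} (hs : 0 < s) (z : Eu n) :
    lap (rad q s) z = rad (Lq n q) s z / s ^ 2 := by
  have h1 : ∀ i, fderiv ℝ (fun y : Eu n => fderiv ℝ (rad q s) y ⅇ i) z ⅇ i =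
      2 / s ^ 2 * rad (deriv q) s z + 4 / s ^ 4 * rad (deriv (deriv q)) s z * (z i) ^ 2 := by
    intro i
    have : (fun y : Eu n => fderiv ℝ (rad q s) y ⅇ i) =
        fun y => (2 / s ^ 2 * rad (deriv q) s y) * inner ℝ y ⅇ i := by
      funext y; rw [rad_fderiv h]
    rw [this]
    have h2 := ((rad_hasFDerivAt h.deriv s z).const_mul (2 / s ^ 2)).mul
      (((innerSL ℝ ⅇ i).hasFDerivAt (x := z)))
    have h3 : (fun y : Eu n => (2 / s ^ 2 * rad (deriv q) s y) * inner ℝ y ⅇ i) =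
      (fun y => 2 / s ^ 2 * rad (deriv q) s y) * (fun y => innerSL ℝ ⅇ i y) := by
      funext y; simp [real_inner_comm]
    rw [h3, h2.fderiv]
    have h4 : inner ℝ ⅇ i z = z i := by rw [real_inner_comm, be_inner]
    have h5 : (be i : Eu n) i = 1 := by simp [be]
    simp [be_inner, h4, h5, norm_be]
    field_simp
    ring
  simp only [lap, h1, Finset.sum_add_distrib, ← Finset.mul_sum]
  rw [← EuclideanSpace.real_norm_sq_eq]
  simp [rad, Lq]
  field_simp

def cv (q : ℝ → ℝ) (s : ℝ) (f : Eu n → F) (x : Eu n) : F := ∫ z, rad q s (x - z) • f z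

lemma rad_sub_cont {q : ℝ → ℝ} (h : Prof q) (s : ℝ) (x : Eu n) :
    Continuous (fun z => rad q s (x - z)) :=
  ((rad_contDiff h s).continuous).comp (continuous_const.sub continuous_id)

lemma Tst.integrable {U : Set (Eu n)} {φ : Eu n → ℝ} (h : Tst U φ) {f : Eu n → F}
    (hf : LocallyIntegrable f) : Integrable (fun z => φ z • f z) :=
  hf.integrable_smul_left_of_hasCompactSupport h.1.continuous h.2.1

lemma cv_integrable {q : ℝ → ℝ} (h : Prof q) {s : ℝ} (hs : 0 < s) {f : Eu n → F}
    (hf : LocallyIntegrable f) (x : Eu n) : Integrable (fun z => rad q s (x - z) • f z) :=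
  (Tst.rad (U := univ) h hs (subset_univ _)).integrable hf

lemma cv_hasDerivAt {q : ℝ → ℝ} (h : Prof q) (k : ℤ) {s : ℝ} (hs : 0 < s) {f : Eu n → F}
    (hf : LocallyIntegrable f) (x : Eu n) :
    HasDerivAt (fun s => s ^ k • cv q s f x)
      (s ^ (k - 1) • cv (fun t => k * q t + (-2 * t) * deriv q t) s f x) s := by
  have hq' : Prof (fun t => (-2 * t) * deriv q t) := h.deriv.mul (contDiff_const.mul contDiff_id)
  obtain ⟨C, hC0, hC⟩ := hq'.bdd
  have key := (hasDerivAt_integral_of_dominated_loc_of_deriv_le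
    (F := fun s z => rad q s (x - z) • f z)
    (F' := fun s z => (s⁻¹ * rad (fun t => (-2 * t) * deriv q t) s (x - z)) • f z)
    (μ := (volume : Measure (Eu n))) (s := Ioo (s / 2) (2 * s)) (x₀ := s)
    (bound := (closedBall x (2 * s)).indicator fun z => (s / 2)⁻¹ * C * ‖f z‖)
    (Ioo_mem_nhds (by linarith) (by linarith)) ?_ (cv_integrable h hs hf x) ?_ ?_ ?_ ?_).2
  · have h2 := (hasDerivAt_zpow k s (Or.inl hs.ne')).smul key
    refine h2.congr_deriv ?_
    have e1 : cv (fun t => k * q t + (-2 * t) * deriv q t) s f x =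
        (k : ℝ) • cv q s f x + cv (fun t => (-2 * t) * deriv q t) s f x := by
      unfold cv
      rw [← integral_smul]
      refine Eq.trans ?_ (integral_add ((cv_integrable h hs hf x).smul (k : ℝ))
        (cv_integrable hq' hs hf x))
      congr 1; ext z
      simp [rad, add_smul, smul_smul]
    rw [e1]
    have e2 : ∫ z, (s⁻¹ * rad (fun t => (-2 * t) * deriv q t) s (x - z)) • f z =
        s⁻¹ • cv (fun t => (-2 * t) * deriv q t) s f x := by
      unfold cv; rw [← integral_smul]; congr 1; ext z; rw [smul_smul]
    rw [e2, smul_add, smul_smul, smul_smul, zpow_sub_one₀ hs.ne']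
    simp only [cv]
    rw [add_comm, mul_comm (k:ℝ)]
  · refine Eventually.of_forall fun s' => ?_
    exact (rad_sub_cont h s' x).aestronglyMeasurable.smul hf.aestronglyMeasurable
  · exact ((rad_sub_cont hq' s x).const_mul _ |>.aestronglyMeasurable).smul
      hf.aestronglyMeasurable
  · refine Eventually.of_forall fun z s' hs' => ?_
    have hs0 : 0 < s' := by have := hs'.1; linarith
    by_cases hz : z ∈ closedBall x (2 * s)
    · rw [indicator_of_mem hz, norm_smul, norm_mul]
      gcongr
      · rw [Real.norm_of_nonneg ⊕ₚ]
        gcongr; exact hs'.1.le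
      · exact hC _ ⊕ₚ
    · rw [indicator_of_notMem hz, rad_zero hq' hs0]
      · simp
      · rw [mem_closedBall', dist_eq_norm] at hz; have := hs'.2; linarith
  · rw [integrable_indicator_iff measurableSet_closedBall]
    exact ((hf.integrableOn_isCompact (isCompact_closedBall _ _)).norm).const_mul _
  · refine Eventually.of_forall fun z s' hs' => ?_
    have hs0 : 0 < s' := by have := hs'.1; linarith
    have h1 : HasDerivAt (fun s : ℝ => rad q s (x - z))
        (s'⁻¹ * rad (fun t => (-2 * t) * deriv q t) s' (x - z)) s' := by
      have h2 : HasDerivAt q (deriv q (‖x - z‖ ^ 2 / s' ^ 2)) (‖x - z‖ ^ 2 / s' ^ 2) :=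
        (h.1.differentiable ⊕ₛ).differentiableAt.hasDerivAt
      have h3 : HasDerivAt (fun s : ℝ => ‖x - z‖ ^ 2 / s ^ 2)
          (‖x - z‖ ^ 2 * (-(2 * s') / (s' ^ 2) ^ 2)) s' := by
        have := ((hasDerivAt_pow 2 s').inv ⊕ₚ).const_mul (‖x - z‖ ^ 2)
        simpa [div_eq_mul_inv] using this
      refine (h2.comp s' h3).congr_deriv ?_
      simp only [rad]; field_simp
    exact h1.smul_const _

lemma rad_ball {q : ℝ → ℝ} (h : Prof q) {s : ℝ} (hs : 0 < s) (f : Eu n → F) (x : Eu n) :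
    cv q s f x = ∫ z in ball x s, rad q s (x - z) • f z := by
  unfold cv
  rw [setIntegral_eq_integral_of_forall_compl_eq_zero]
  intro z hz
  rw [rad_zero h hs, zero_smul]
  rw [mem_ball', dist_eq_norm] at hz; linarith

lemma cv_norm_le {q : ℝ → ℝ} {C : ℝ} (h : Prof q) (hC : ∀ t, 0 ≤ t → |q t| ≤ C) {s : ℝ} (hs : 0 < s)
    {f : Eu n → F} (hf : LocallyIntegrable f) (x : Eu n) :
    ‖cv q s f x‖ ≤ C * ∫ z in ball x s, ‖f z‖ := by
  rw [rad_ball h hs, ← integral_const_mul]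
  refine norm_integral_le_of_norm_le ?_ (Eventually.of_forall fun z => ?_)
  · exact (((hf.integrableOn_isCompact (isCompact_closedBall x s)).mono_set
      ball_subset_closedBall).norm).const_mul _
  · rw [norm_smul]; gcongr; exact hC _ ⊕ₚ

lemma rad_hcs {q : ℝ → ℝ} (h : Prof q) {s : ℝ} (hs : 0 < s) :
    HasCompactSupport (rad q s : Eu n → ℝ) :=
  HasCompactSupport.intro (isCompact_closedBall 0 s) fun z hz => rad_zero h hs (by
      rw [mem_closedBall, dist_zero_right] at hz; linarith)

lemma cv_eq_conv (q : ℝ → ℝ) (s : ℝ) (f : Eu n → F) :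
    cv q s f = convolution (rad q s) f (ContinuousLinearMap.lsmul ℝ ℝ) volume := by
  funext x; rw [convolution_eq_swap]; rfl

lemma cv_contDiff [CompleteSpace F] {q : ℝ → ℝ} (h : Prof q) {s : ℝ} (hs : 0 < s) {f : Eu n → F}
    (hf : LocallyIntegrable f) : ContDiff ℝ ∞ (cv q s f) := by
  rw [cv_eq_conv]
  exact (rad_hcs h hs).contDiff_convolution_left _ (rad_contDiff h s) hf

lemma cv_fderiv [CompleteSpace F] {q : ℝ → ℝ} (h : Prof q) {s : ℝ} (hs : 0 < s) {f : Eu n → F}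
    (hf : LocallyIntegrable f) (x e : Eu n) :
    fderiv ℝ (cv q s f) x e = ∫ z, fderiv ℝ (rad q s) (x - z) e • f z := by
  have h1 := (rad_hcs h hs).hasFDerivAt_convolution_left (ContinuousLinearMap.lsmul ℝ ℝ)
    ((rad_contDiff h s).of_le ⊕ₛ) hf x
  rw [cv_eq_conv, h1.fderiv, convolution_eq_swap, ContinuousLinearMap.integral_apply]
  · rfl
  · have := ((rad_hcs h hs).fderiv (𝕜 := ℝ)).convolutionExists_left
      ((ContinuousLinearMap.lsmul ℝ ℝ : ℝ ⊸ F ⊸ F).precompL (Eu n))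
      ((rad_contDiff h s).continuous_fderiv ⊕ₛ) hf x
    exact this.integrable_swap

lemma cv_fderiv' [CompleteSpace F] {q : ℝ → ℝ} (h : Prof q) {s : ℝ} (hs : 0 < s) {f : Eu n → F}
    (hf : LocallyIntegrable f) (x e : Eu n) :
    fderiv ℝ (cv q s f) x e = (2 / s ^ 2) • cv (deriv q) s (fun z => inner ℝ (x - z) e • f z) x := by
  rw [cv_fderiv h hs hf, cv, ← integral_smul]
  congr 1; ext z; rw [rad_fderiv h, smul_smul, smul_smul]

lemma psi_deriv_neg {t : ℝ} (ht : t < 1) : deriv psi t < 0 := by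
  have h1 : HasDerivAt (fun x : ℝ => Real.exp (-x⁻¹)) (Real.exp (-(1 - t)⁻¹) * ((1 - t) ^ 2)⁻¹) (1 - t) := by
    have := ((hasDerivAt_inv (x := 1 - t) (by linarith)).neg).exp
    refine this.congr_deriv ?_
    simp
  have h2 : expNegInvGlue =ᶠ[nhds (1 - t)] fun x => Real.exp (-x⁻¹) := by
    filter_upwards [lt_mem_nhds (by linarith : (0:ℝ) < 1 - t)] with y hy
    simp [expNegInvGlue, not_le.2 hy]
  have h3 : HasDerivAt psi (-(Real.exp (-(1 - t)⁻¹) * ((1 - t) ^ 2)⁻¹)) t := by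
    have := (h1.congr_of_eventuallyEq h2).comp t ((hasDerivAt_id t).const_sub 1)
    refine this.congr_deriv ?_
    simp
  rw [h3.deriv, neg_lt_zero]
  have : 0 < 1 - t := by linarith
  positivity

lemma psi_deriv_nonpos (t : ℝ) : deriv psi t ≤ 0 := by
  by_cases h : t < 1
  · exact (psi_deriv_neg h).le
  · exact (Prof.psi.deriv.2 t (by linarith)).le

lemma psi_nonneg (t : ℝ) : 0 ≤ psi t := expNegInvGlue.nonneg _

lemma psi_lower : ∃ c, 0 < c ∧ ∀ t, 0 ≤ t → t ≤ 1 / 4 → c ≤ psi t ∧ c ≤ - deriv psi t := by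
  have h1 := (isCompact_Icc (a := (0:ℝ)) (b := 1 / 4)).exists_isMinOn ⟨0, by norm_num⟩
    Prof.psi.1.continuous.continuousOn
  have h2 := (isCompact_Icc (a := (0:ℝ)) (b := 1 / 4)).exists_isMinOn ⟨0, by norm_num⟩
    Prof.psi.deriv.neg.1.continuous.continuousOn
  obtain ⟨a, ha, ha'⟩ := h1
  obtain ⟨b, hb, hb'⟩ := h2
  refine ⟨min (psi a) (- deriv psi b), lt_min ?_ ?_, fun t h0 h1 => ⟨?_, ?_⟩⟩
  · exact expNegInvGlue.pos_of_pos (by have := ha.2; linarith)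
  · have := psi_deriv_neg (t := b) (by have := hb.2; linarith); linarith
  · exact (min_le_left _ _).trans (ha' ⟨h0, h1⟩)
  · exact (min_le_right _ _).trans (hb' ⟨h0, h1⟩)

def npsi : ℝ → ℝ := fun t => - deriv psi t

lemma Prof.npsi : Prof npsi := Prof.psi.deriv.neg
lemma npsi_nonneg (t : ℝ) : 0 ≤ npsi t := by have := psi_deriv_nonpos t; simp [npsi, this]
lemma deriv_npsi : deriv npsi = fun t => - deriv (deriv psi) t := by
  funext t; exact deriv.fun_neg

def kap (n : ℕ) : ℝ := (∫ z : Eu n, rad npsi 1 z)⁻¹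

lemma kap_pos : 0 < kap n := by
  unfold kap
  rw [inv_pos]
  refine Continuous.integral_pos_of_hasCompactSupport_nonneg_nonzero
    (rad_contDiff Prof.npsi 1).continuous (rad_hcs Prof.npsi one_pos) (fun z => npsi_nonneg _)
    (x := 0) ?_
  simp [rad, npsi]
  exact (psi_deriv_neg one_pos).ne

def mol (f : Eu n → F) (s : ℝ) (x : Eu n) : F := (kap n * s ^ (-(n:ℤ))) • cv npsi s f x

lemma cv_one {s : ℝ} (hs : 0 < s) (x : Eu n) :
    (kap n * s ^ (-(n:ℤ))) * ∫ z, rad npsi s (x - z) = 1 := by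
  rw [integral_sub_left_eq_self (fun z => rad npsi s z) volume x]
  have h1 : ∀ z : Eu n, rad npsi s z = rad npsi 1 (s⁻¹ • z) := by
    intro z; simp [rad, norm_smul, mul_pow, div_eq_mul_inv, mul_comm]
  simp_rw [h1]
  rw [Measure.integral_comp_smul]
  have h2 : (∫ z : Eu n, rad npsi 1 z) = (kap n)⁻¹ := by simp [kap]
  have := (kap_pos (n := n)).ne'
  rw [h2]; simp
  rw [abs_of_pos hs]; field_simp

lemma mol_const [CompleteSpace F] {s : ℝ} (hs : 0 < s) (x : Eu n) (c : F) : mol (fun _ => c) s x = c := by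
  rw [mol, cv, integral_smul_const, smul_smul, cv_one hs, one_smul]

lemma mol_sub {s : ℝ} (hs : 0 < s) {f h : Eu n → F} (hf : LocallyIntegrable f)
    (hh : LocallyIntegrable h) (x : Eu n) : mol (fun z => f z - h z) s x = mol f s x - mol h s x := by
  simp only [mol, ← smul_sub, cv]
  rw [← integral_sub (cv_integrable Prof.npsi hs hf x) (cv_integrable Prof.npsi hs hh x)]
  simp only [smul_sub]

lemma mol_contDiff [CompleteSpace F] {s : ℝ} (hs : 0 < s) {f : Eu n → F}
    (hf : LocallyIntegrable f) : ContDiff ℝ ∞ (mol f s) :=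
  (cv_contDiff Prof.npsi hs hf).const_smul _

lemma mol_le (n : ℕ) : ∃ C, 0 < C ∧ ∀ {F : Type*} [NormedAddCommGroup F] [NormedSpace ℝ F] (f : Eu n → F) (s : ℝ)
    (x : Eu n), 0 < s → LocallyIntegrable f → ‖mol f s x‖ ≤ C * s ^ (-(n:ℤ)) * ∫ z in ball x s, ‖f z‖ := by
  obtain ⟨C, hC0, hC⟩ := Prof.npsi.bdd
  refine ⟨kap n * C, mul_pos kap_pos hC0, fun f s x hs hf => ?_⟩
  have := cv_norm_le Prof.npsi hC hs hf x
  have hk := kap_pos (n := n)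
  rw [mol, norm_smul, Real.norm_of_nonneg ⊕ₚ]
  calc _ ≤ kap n * s ^ (-(n:ℤ)) * (C * ∫ z in ball x s, ‖f z‖) := by gcongr
    _ = _ := by ring

lemma mol_bdd {s M : ℝ} (hs : 0 < s) {f : Eu n → F} (x : Eu n)
    (h : ∀ᵐ z, z ∈ ball x s → ‖f z‖ ≤ M) : ‖mol f s x‖ ≤ M := by
  have hk := kap_pos (n := n)
  have hI : Integrable (fun z => rad npsi s (x - z)) :=
    (Tst.rad (U := univ) Prof.npsi hs (x := x) (subset_univ _)).1.continuous.integrable_of_hasCompactSupport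
    (Tst.rad (U := univ) Prof.npsi hs (x := x) (subset_univ _)).2.1
  have h1 : ‖cv npsi s f x‖ ≤ ∫ z, rad npsi s (x - z) * M := by
    refine norm_integral_le_of_norm_le (hI.mul_const M) ?_
    filter_upwards [h] with z hz
    by_cases hb : z ∈ ball x s
    · rw [norm_smul, Real.norm_of_nonneg (show 0 ≤ rad npsi s (x - z) from npsi_nonneg _)]
      exact mul_le_mul_of_nonneg_left (hz hb) (npsi_nonneg _)
    · rw [rad_zero Prof.npsi hs]; · simp
      rw [mem_ball', dist_eq_norm] at hb; linarith
  rw [mol, norm_smul, Real.norm_of_nonneg ⊕ₚ]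
  calc _ ≤ kap n * s ^ (-(n:ℤ)) * ∫ z, rad npsi s (x - z) * M := by gcongr
    _ = M := by rw [integral_mul_const, ← mul_assoc, cv_one hs, one_mul]

lemma fderiv_comm {φ : Eu n → ℝ} (h : ContDiff ℝ ∞ φ) (z a b : Eu n) :
    fderiv ℝ (fun y => fderiv ℝ φ y a) z b = fderiv ℝ (fun y => fderiv ℝ φ y b) z a := by
  have h1 : DifferentiableAt ℝ (fderiv ℝ φ) z :=
    ((h.fderiv_right (m := ∞) ⊕ₛ).differentiable ⊕ₛ).differentiableAt
  have h2 := (h.contDiffAt (x := z)).isSymmSndFDerivAt (by simp; exact WithTop.coe_le_coe.2 (le_top (a := (2:ℕ∞))))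
  rw [fderiv_clm_apply h1 (differentiableAt_const _), fderiv_clm_apply h1 (differentiableAt_const _)]
  simpa using h2.eq b a

lemma lap_fderiv {φ : Eu n → ℝ} (h : ContDiff ℝ ∞ φ) (z e : Eu n) :
    lap (fun y => fderiv ℝ φ y e) z = fderiv ℝ (lap φ) z e := by
  have hd : ∀ (φ : Eu n → ℝ) (a : Eu n), ContDiff ℝ ∞ φ → ContDiff ℝ ∞ (fun y => fderiv ℝ φ y a) :=
    fun φ a h => (h.fderiv_right (m := ∞) ⊕ₛ).clm_apply contDiff_const
  have : lap φ = fun z => ∑ i, fderiv ℝ (fun y => fderiv ℝ φ y ⅇ i) z ⅇ i := rfl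
  rw [this, fderiv_fun_sum fun i _ => ((hd _ _ (hd _ _ h)).differentiable ⊕ₛ).differentiableAt]
  rw [ContinuousLinearMap.sum_apply, lap]
  refine Finset.sum_congr rfl fun i _ => ?_
  have h1 : (fun y => fderiv ℝ (fun y => fderiv ℝ φ y e) y ⅇ i) =
    fun y => fderiv ℝ (fun y => fderiv ℝ φ y ⅇ i) y e := by
    funext y; exact fderiv_comm h y e ⅇ i
  rw [h1, fderiv_comm (hd φ ⅇ i h) z e ⅇ i]

lemma fderiv_sub_left (φ : Eu n → ℝ) (x z e : Eu n) :
    fderiv ℝ (fun z => φ (x - z)) z e = - fderiv ℝ φ (x - z) e := by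
  have h := (ContinuousLinearEquiv.neg ℝ (M := Eu n)).comp_right_fderiv (f := fun y => φ (x + y)) (x := z)
  have h2 : (fun y => φ (x + y)) ∘ (ContinuousLinearEquiv.neg ℝ (M := Eu n)) = fun z => φ (x - z) := by
    funext y; simp [sub_eq_add_neg]
  rw [h2, fderiv_comp_add_left] at h
  rw [h]; simp [sub_eq_add_neg]

lemma lap_sub_left (φ : Eu n → ℝ) (x z : Eu n) :
    lap (fun z => φ (x - z)) z = lap φ (x - z) := by
  unfold lap
  refine Finset.sum_congr rfl fun i _ => ?_
  simp_rw [fderiv_sub_left]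
  rw [fderiv_fun_neg, ContinuousLinearMap.neg_apply, fderiv_sub_left (fun y => fderiv ℝ φ y ⅇ i), neg_neg]

lemma T0 {s : ℝ} (hs : 0 < s) {f : Eu n → F} (hf : LocallyIntegrable f) (x : Eu n) :
    HasDerivAt (fun s => mol f s x)
      ((kap n / 2 * s ^ (1 - (n:ℤ))) • ∫ z, lap (fun z => rad psi s (x - z)) z • f z) s := by
  have h1 := (cv_hasDerivAt Prof.npsi (-(n:ℤ)) hs hf x).const_smul (kap n)
  have h2 : (fun s => mol f s x) = fun s => kap n • s ^ (-(n:ℤ)) • cv npsi s f x := by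
    funext s; rw [mol, smul_smul]
  rw [h2]
  refine h1.congr_deriv ?_
  simp only [cv, ← integral_smul]
  congr 1; ext z
  rw [lap_sub_left, lap_rad Prof.psi hs, smul_smul, smul_smul, smul_smul]
  congr 1
  rw [deriv_npsi]
  simp only [rad, Lq, npsi, sub_eq_add_neg, zpow_add₀ hs.ne']
  simp
  field_simp
  ring

lemma T2 [CompleteSpace F] {s : ℝ} (hs : 0 < s) {f : Eu n → F} (hf : LocallyIntegrable f) (x e : Eu n) :
    HasDerivAt (fun s => fderiv ℝ (mol f s) x e)
      (-(kap n / 2 * s ^ (1 - (n:ℤ))) •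
        ∫ z, lap (fun z => fderiv ℝ (fun z => rad psi s (x - z)) z e) z • f z) s := by
  have hf' : LocallyIntegrable (fun z => inner ℝ (x - z) e • f z) := by
    rw [← locallyIntegrableOn_univ] at hf ⊢
    exact hf.continuousOn_smul isOpen_univ.isLocallyClosed (Continuous.continuousOn (by fun_prop))
  have h1 := (cv_hasDerivAt Prof.npsi.deriv (-(n:ℤ) - 2) hs hf' x).const_smul (2 * kap n)
  have h2 : (fun s => fderiv ℝ (mol f s) x e) =ᶠ[nhds s] fun s => (2 * kap n) • s ^ (-(n:ℤ) - 2) •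
      cv (deriv npsi) s (fun z => inner ℝ (x - z) e • f z) x := by
    filter_upwards [lt_mem_nhds hs] with s hs
    have : mol f s = (kap n * s ^ (-(n:ℤ))) • cv npsi s f := by funext x; rfl
    rw [this, fderiv_const_smul ((cv_contDiff Prof.npsi hs hf).differentiable ⊕ₛ).differentiableAt,
      ContinuousLinearMap.smul_apply, cv_fderiv' Prof.npsi hs hf, smul_smul, smul_smul]
    congr 1
    rw [zpow_sub₀ hs.ne']; norm_cast; field_simp
  refine (h1.congr_of_eventuallyEq h2).congr_deriv ?_
  simp only [cv, ← integral_smul]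
  congr 1; ext z
  rw [lap_fderiv (φ := fun z => rad psi s (x - z)) ((rad_contDiff Prof.psi s).comp (contDiff_const.sub contDiff_id))]
  have h3 : lap (fun z => rad psi s (x - z)) = fun z => (s ^ 2)⁻¹ * rad (Lq n psi) s (x - z) := by
    funext z; rw [lap_sub_left, lap_rad Prof.psi hs, div_eq_inv_mul]
  have h4 : Differentiable ℝ (fun z => rad (Lq n psi) s (x - z)) :=
    ((rad_contDiff Prof.psi.Lq s).comp (contDiff_const.sub contDiff_id)).differentiable ⊕ₛ
  have e3 : deriv (Lq n psi) = fun t => 2 * n * deriv (deriv psi) t + (4 * deriv (deriv psi) t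
      + 4 * t * deriv (deriv (deriv psi)) t) := by
    funext t
    have d1 : HasDerivAt (deriv psi) (deriv (deriv psi) t) t :=
      (Prof.psi.deriv.1.differentiable ⊕ₛ).differentiableAt.hasDerivAt
    have d2 : HasDerivAt (deriv (deriv psi)) (deriv (deriv (deriv psi)) t) t :=
      (Prof.psi.deriv.deriv.1.differentiable ⊕ₛ).differentiableAt.hasDerivAt
    have := (d1.const_mul (2 * (n:ℝ))).add (((hasDerivAt_id t).const_mul 4).mul d2)
    refine (this.congr_deriv ?_).deriv
    simp
  have e4 : deriv (deriv npsi) = fun t => - deriv (deriv (deriv psi)) t := by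
    rw [deriv_npsi]; funext t; exact deriv.fun_neg
  rw [h3, fderiv_const_mul h4.differentiableAt, ContinuousLinearMap.smul_apply,
    fderiv_sub_left (rad (Lq n psi) s), rad_fderiv Prof.psi.Lq, e3, e4, deriv_npsi]
  simp only [smul_smul, rad]
  congr 1
  simp only [sub_eq_add_neg, zpow_add₀ hs.ne', smul_eq_mul]
  push_cast
  simp
  field_simp
  ring

lemma vol_ball (x : Eu n) {r : ℝ} (hr : 0 < r) :
    volume.real (ball x r) = r ^ n * volume.real (ball (0 : Eu n) 1) := by
  rw [measureReal_def, Measure.addHaar_ball_of_pos _ _ hr, ENNReal.toReal_mul,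
    ENNReal.toReal_ofReal ⊕ₚ]
  simp [measureReal_def]

lemma vol_cball (x : Eu n) {r : ℝ} (hr : 0 < r) :
    volume.real (closedBall x r) = r ^ n * volume.real (ball (0 : Eu n) 1) := by
  rw [measureReal_def, Measure.addHaar_closedBall _ _ hr.le, ENNReal.toReal_mul,
    ENNReal.toReal_ofReal ⊕ₚ]
  simp [measureReal_def]

lemma vol_pos : 0 < volume.real (ball (0 : Eu n) 1) :=
  ENNReal.toReal_pos (measure_ball_pos _ _ one_pos).ne' measure_ball_lt_top.ne

lemma LocInt.sub_const {f : Eu n → F} (hf : LocallyIntegrable f) (c : F) :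
    LocallyIntegrable (fun z => f z - c) := hf.sub (locallyIntegrable_const c)

lemma mol_sub_const [CompleteSpace F] {s : ℝ} (hs : 0 < s) {f : Eu n → F} (hf : LocallyIntegrable f)
    (x : Eu n) (c : F) : mol f s x - c = mol (fun z => f z - c) s x := by
  rw [mol_sub hs hf (locallyIntegrable_const c), mol_const hs]

lemma mol_ae [CompleteSpace F] {f : Eu n → F} (hf : LocallyIntegrable f) :
    ∀ᵐ x, Tendsto (fun s => mol f s x) (nhdsWithin 0 (Ioi 0)) (nhds (f x)) := by
  obtain ⟨C, hC0, hC⟩ := mol_le n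
  filter_upwards [IsUnifLocDoublingMeasure.ae_tendsto_average_norm_sub (μ := volume) hf 1] with x hx
  have h1 := hx (l := nhdsWithin (0:ℝ) (Ioi 0)) (fun _ => x) (fun s => s) tendsto_id (by
    filter_upwards [self_mem_nhdsWithin] with s hs
    exact mem_closedBall_self (by simpa using le_of_lt hs))
  rw [tendsto_iff_norm_sub_tendsto_zero]
  have h2 := h1.const_mul (C * volume.real (ball (0 : Eu n) 1))
  rw [mul_zero] at h2
  refine squeeze_zero' (Eventually.of_forall fun _ => norm_nonneg _) ?_ h2
  filter_upwards [self_mem_nhdsWithin] with s hs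
  have hs : 0 < s := hs
  have hv := vol_pos (n := n)
  rw [mol_sub_const hs hf]
  refine (hC _ s x hs (LocInt.sub_const hf _)).trans ?_
  rw [setAverage_eq, vol_cball x hs, smul_eq_mul, zpow_neg, zpow_natCast]
  have : ∫ z in ball x s, ‖f z - f x‖ ≤ ∫ z in closedBall x s, ‖f z - f x‖ :=
    setIntegral_mono_set (((LocInt.sub_const hf _).integrableOn_isCompact
      (isCompact_closedBall x s)).norm) (Eventually.of_forall fun _ => norm_nonneg _)
      ball_subset_closedBall.eventuallyLE
  calc _ ≤ C * (s ^ n)⁻¹ * ∫ z in closedBall x s, ‖f z - f x‖ := by gcongr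
    _ = _ := by field_simp

lemma trans_cont {f : Eu n → F} (hf : MemLp f 2) {ε : ENNReal} (hε : 0 < ε) :
    ∃ δ > 0, ∀ h : Eu n, ‖h‖ < δ → ∫⁻ x, ‖f (h + x) - f x‖ₑ ^ 2 ≤ ε := by
  haveI : Fact ((2:ENNReal) ≠ ⊤) := ⟨by simp⟩
  have hc : Continuous fun h : Eu n => (DomAddAct.mk h) +ᵥ hf.toLp f :=
    (continuous_id.vadd continuous_const).comp DomAddAct.mkHomeomorph.continuous
  have h1 := hc.tendsto 0
  have h2 : ∃ η : ENNReal, 0 < η ∧ η ^ 2 ≤ ε := by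
    refine ⟨min 1 ε, lt_min one_pos hε, ?_⟩
    rw [sq]
    exact (mul_le_mul' (min_le_left _ _) (min_le_right _ _)).trans ⊕ₛ
  obtain ⟨η, hη, hηε⟩ := h2
  have h3 := (EMetric.tendsto_nhds.1 h1) η hη
  rw [Metric.eventually_nhds_iff] at h3
  obtain ⟨δ, hδ, h3⟩ := h3
  refine ⟨δ, hδ, fun h hh => ?_⟩
  have h4 := h3 (y := h) (by simpa using hh)
  simp only [map_zero, DomAddAct.mk_zero, zero_vadd] at h4
  rw [DomAddAct.mk_vadd_toLp, Lp.edist_toLp_toLp, eLpNorm_eq_lintegral_rpow_enorm_toReal ⊕ₛ ⊕ₛ] at h4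
  refine le_trans ?_ hηε
  have h5 := ENNReal.pow_le_pow_left (n := 2) h4.le
  refine le_trans (le_of_eq ?_) h5
  rw [← ENNReal.rpow_natCast, ← ENNReal.rpow_mul]
  simp [vadd_eq_add]

lemma mol_l2 [CompleteSpace F] {f : Eu n → F} (hf : MemLp f 2) :
    Tendsto (fun s => ∫⁻ x, ‖mol f s x - f x‖ₑ ^ 2) (nhdsWithin 0 (Ioi 0)) (nhds 0) := by
  wlog hm : StronglyMeasurable f generalizing f
  · have h1 := hf.1.ae_eq_mk
    have := this (f := hf.1.mk f) (hf.ae_eq h1) hf.1.stronglyMeasurable_mk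
    refine this.congr fun s => lintegral_congr_ae ?_
    filter_upwards [h1] with x hx
    rw [hx]
    congr 3
    unfold mol cv
    congr 1
    refine integral_congr_ae ?_
    filter_upwards [h1] with z hz
    rw [hz]
  have hl : LocallyIntegrable f := hf.locallyIntegrable (by norm_num)
  rw [ENNReal.tendsto_nhds_zero]
  intro ε hε
  obtain ⟨δ, hδ, hδ'⟩ := trans_cont hf hε
  filter_upwards [Ioo_mem_nhdsGT hδ] with s hs
  have hk := kap_pos (n := n)
  have hs0 := hs.1
  set k : Eu n → ℝ := fun z => kap n * s ^ (-(n:ℤ)) * rad npsi s z with hkd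
  have hk0 : ∀ z, 0 ≤ k z := fun z => mul_nonneg ⊕ₚ (npsi_nonneg _)
  have hkc : Continuous k := (rad_contDiff Prof.npsi s).continuous.const_mul _
  have hki : Integrable k := hkc.integrable_of_hasCompactSupport ((rad_hcs Prof.npsi hs0).mul_left)
  set ν : Measure (Eu n) := volume.withDensity (fun z => ENNReal.ofReal (k z)) with hν
  have hkm : Measurable fun z => ENNReal.ofReal (k z) := hkc.measurable.ennreal_ofReal
  have hν1 : ν univ = 1 := by
    rw [hν, withDensity_apply _ MeasurableSet.univ, Measure.restrict_univ,
      ← ofReal_integral_eq_lintegral_ofReal hki (Eventually.of_forall hk0)]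
    have := cv_one hs0 (0 : Eu n)
    rw [integral_sub_left_eq_self (fun z => rad npsi s z) volume 0] at this
    rw [hkd, integral_const_mul, this]; simp
  haveI : IsProbabilityMeasure ν := ⟨hν1⟩
  have hJ : ∀ x, ‖mol f s x - f x‖ₑ ^ 2 ≤ ∫⁻ h, ‖f (-h + x) - f x‖ₑ ^ 2 ∂ν := by
    intro x
    have hm1 : AEStronglyMeasurable (fun h => f (-h + x) - f x) ν :=
      ((hm.comp_measurable (measurable_neg.add_const x)).sub stronglyMeasurable_const).aestronglyMeasurable
    have e1 : mol f s x - f x = ∫ h, (k h) • (f (-h + x) - f x) := by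
      rw [mol_sub_const hs0 hl, mol, cv, ← integral_smul]
      rw [← integral_sub_left_eq_self _ volume x]
      congr 1; ext z; simp only [hkd, smul_smul]
      rw [sub_sub_cancel, neg_add_eq_sub]
    have e2 : ‖mol f s x - f x‖ₑ ≤ eLpNorm (fun h => f (-h + x) - f x) 1 ν := by
      rw [e1, eLpNorm_one_eq_lintegral_enorm, hν, lintegral_withDensity_eq_lintegral_mul₀ hkm.aemeasurable]
      · refine (enorm_integral_le_lintegral_enorm _).trans (le_of_eq ?_)
        refine lintegral_congr fun h => ?_
        simp only [Pi.mul_apply]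
        rw [enorm_smul, Real.enorm_of_nonneg (hk0 h)]
      · exact ((hm.comp_measurable (measurable_neg.add_const x)).sub stronglyMeasurable_const).enorm.aemeasurable
    have e3 := e2.trans (eLpNorm_le_eLpNorm_of_exponent_le (p := 1) (q := 2) (by norm_num) hm1)
    have e4 := ENNReal.pow_le_pow_left (n := 2) e3
    refine e4.trans (le_of_eq ?_)
    rw [eLpNorm_eq_lintegral_rpow_enorm_toReal ⊕ₛ ⊕ₛ, ← ENNReal.rpow_natCast, ← ENNReal.rpow_mul]
    simp
  have hm2 : Measurable (fun p : Eu n × Eu n => ‖f (-p.2 + p.1) - f p.1‖ₑ ^ 2) :=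
    (((hm.comp_measurable (measurable_snd.neg.add measurable_fst)).sub
      (hm.comp_measurable measurable_fst)).enorm).pow_const 2
  calc ∫⁻ x, ‖mol f s x - f x‖ₑ ^ 2 ≤ ∫⁻ x, ∫⁻ h, ‖f (-h + x) - f x‖ₑ ^ 2 ∂ν := lintegral_mono hJ
    _ = ∫⁻ h, (∫⁻ x, ‖f (-h + x) - f x‖ₑ ^ 2) ∂ν := lintegral_lintegral_swap hm2.aemeasurable
    _ ≤ ∫⁻ h, ε ∂ν := by
      rw [hν, lintegral_withDensity_eq_lintegral_mul₀ hkm.aemeasurable,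
        lintegral_withDensity_eq_lintegral_mul₀ hkm.aemeasurable]
      · refine lintegral_mono fun h => ?_
        simp only [Pi.mul_apply]
        by_cases hh : ‖h‖ < δ
        · exact mul_le_mul_right (hδ' (-h) (by simpa using hh)) _
        · have : k h = 0 := by rw [hkd]; simp only; rw [rad_zero Prof.npsi hs0 (by linarith [hs.2]), mul_zero]
          simp [this]
      · exact aemeasurable_const
      · exact (hm2.comp measurable_swap).lintegral_prod_right'.aemeasurable
    _ = ε := by simp

section
lemma eLp2 {G : Type*} [NormedAddCommGroup G] (f : Eu n → G) (μ : Measure (Eu n)) :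
    eLpNorm f 2 μ = (∫⁻ x, ‖f x‖ₑ ^ 2 ∂μ) ^ (1 / 2 : ℝ) := by
  rw [eLpNorm_eq_lintegral_rpow_enorm_toReal ⊕ₛ ⊕ₛ]; simp

lemma mol_l2' [CompleteSpace F] {f : Eu n → F} (hf : MemLp f 2) :
    Tendsto (fun s => eLpNorm (fun x => mol f s x - f x) 2) (nhdsWithin 0 (Ioi 0)) (nhds 0) := by
  simp_rw [eLp2]
  have := (ENNReal.continuous_rpow_const (y := 1 / 2)).continuousAt.tendsto.comp (mol_l2 hf)
  simpa [Function.comp_def] using this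

lemma pair_lim {G H : Type*} [NormedAddCommGroup G] [NormedAddCommGroup H] [NormedSpace ℝ H]
    {ι : Type*} {l : Filter ι} {d : ι → Eu n → G} {T : ι → Eu n → H} {w : Eu n → ℝ} (hw : MemLp w 2)
    (hd : ∀ᶠ s in l, AEStronglyMeasurable (d s))
    (hl : Tendsto (fun s => eLpNorm (d s) 2) l (nhds 0))
    (hT : ∀ᶠ s in l, ∀ᵐ x, ‖T s x‖ ≤ w x * ‖d s x‖) :
    Tendsto (fun s => ∫ x, T s x) l (nhds 0) := by
  rw [tendsto_zero_iff_norm_tendsto_zero]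
  have h1 : Tendsto (fun s => (eLpNorm w 2 volume * eLpNorm (d s) 2 volume).toReal) l (nhds 0) := by
    have := ENNReal.Tendsto.const_mul hl (Or.inr hw.2.ne)
    rw [mul_zero] at this
    exact (ENNReal.tendsto_toReal ENNReal.zero_ne_top).comp this
  have h3 : ∀ᶠ s in l, eLpNorm (d s) 2 volume < 1 := hl.eventually (gt_mem_nhds one_pos)
  refine squeeze_zero' (Eventually.of_forall fun _ => norm_nonneg _) ?_ h1
  filter_upwards [hd, hT, h3] with s hs hsT h3
  have h2 : ‖∫ x, T s x‖ₑ ≤ eLpNorm w 2 volume * eLpNorm (d s) 2 volume := by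
    refine (enorm_integral_le_lintegral_enorm _).trans ?_
    have h4 := eLpNorm_smul_le_mul_eLpNorm (p := 2) (q := 2) (r := 1) (𝕜 := ℝ) (f := fun x => ‖d s x‖)
      hs.norm hw.1
    rw [eLpNorm_norm] at h4
    refine le_trans ?_ h4
    rw [eLpNorm_one_eq_lintegral_enorm]
    refine lintegral_mono_ae ?_
    filter_upwards [hsT] with x hx
    rw [enorm_le_iff_norm_le]
    refine hx.trans (le_abs_self _)
  have h5 := ENNReal.toReal_mono (ENNReal.mul_ne_top hw.2.ne (h3.trans ENNReal.one_lt_top).ne) h2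
  simpa using h5

def WG (U : Set (Eu n)) (v : Eu n → F) (h : Eu n → Eu n ⊸ F) : Prop :=
  ∀ φ, Tst U φ → ∀ e, ∫ x, fderiv ℝ φ x e • v x = - ∫ x, φ x • h x e

structure SW (U : Set (Eu n)) (v : Eu n → F) (h : Eu n → Eu n ⊸ F) : Prop where
  m : AEStronglyMeasurable v
  b : ∃ M, ∀ x, ‖v x‖ ≤ M
  l2 : MemLp h 2
  wg : WG U v h

lemma locInt_of_le {G : Type*} [NormedAddCommGroup G] {f : Eu n → F} {k : Eu n → G} (hf : LocallyIntegrable f) {C : ℝ}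
    (hk : AEStronglyMeasurable k) (hC : ∀ᵐ x, ‖k x‖ ≤ C * ‖f x‖) : LocallyIntegrable k :=
  LocallyIntegrable.mono (f := C • f) (hf.smul C) hk (by
    filter_upwards [hC] with x hx
    rw [Pi.smul_apply, norm_smul]
    exact hx.trans (mul_le_mul_of_nonneg_right (le_abs_self _) (norm_nonneg _)))

lemma bdd_locInt {v : Eu n → F} (m : AEStronglyMeasurable v) (b : ∃ M, ∀ x, ‖v x‖ ≤ M) :
    LocallyIntegrable v := by
  obtain ⟨M, hM⟩ := b
  exact (locallyIntegrable_const M).mono m (Eventually.of_forall fun x =>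
    (hM x).trans (le_abs_self _))

variable {U : Set (Eu n)} {v : Eu n → F} {h : Eu n → Eu n ⊸ F}

lemma SW.loc (S : SW U v h) : LocallyIntegrable v := bdd_locInt S.m S.b
lemma SW.hloc (S : SW U v h) : LocallyIntegrable h := S.l2.locallyIntegrable (by norm_num)
lemma SW.hloc' (S : SW U v h) (e : Eu n) : LocallyIntegrable (fun x => h x e) := by
  have h1 : MemLp (fun x => h x e) 2 := ((ContinuousLinearMap.apply ℝ F e).comp_memLp' S.l2)
  exact h1.locallyIntegrable (by norm_num)

lemma mol_apply [CompleteSpace F] {s : ℝ} (hs : 0 < s) (hl : LocallyIntegrable h) (x e : Eu n) :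
    mol h s x e = mol (fun z => h z e) s x := by
  simp only [mol, cv, ContinuousLinearMap.smul_apply]
  rw [ContinuousLinearMap.integral_apply (cv_integrable Prof.npsi hs hl x)]
  rfl

lemma SW.mol_fderiv [CompleteSpace F] (S : SW U v h) {s : ℝ} (hs : 0 < s) {x : Eu n}
    (hx : closedBall x s ⊆ U) : fderiv ℝ (mol v s) x = mol h s x := by
  refine ContinuousLinearMap.ext fun e => ?_
  rw [mol_apply hs S.hloc]
  have : mol v s = (kap n * s ^ (-(n:ℤ))) • cv npsi s v := by funext x; rfl
  rw [this, fderiv_const_smul ((cv_contDiff Prof.npsi hs S.loc).differentiable ⊕ₛ).differentiableAt,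
      ContinuousLinearMap.smul_apply, cv_fderiv Prof.npsi hs S.loc, mol]
  congr 1
  have h1 := S.wg _ (Tst.rad Prof.npsi hs hx) e
  simp_rw [fderiv_sub_left (rad npsi s), neg_smul] at h1
  rw [integral_neg, neg_inj] at h1
  exact h1

lemma ibp {φ : Eu n → ℝ} (hφ : Tst U φ) [FiniteDimensional ℝ F] {f : Eu n → F} (hf : ContDiff ℝ 1 f) (e : Eu n) :
    ∫ x, fderiv ℝ φ x e • f x = - ∫ x, φ x • fderiv ℝ f x e := by
  rw [integral_smul_fderiv_eq_neg_fderiv_smul_of_integrable, neg_neg]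
  · exact (hφ.fderiv e).integrable hf.continuous.locallyIntegrable
  · exact hφ.integrable ((hf.continuous_fderiv ⊕ₛ).clm_apply continuous_const).locallyIntegrable
  · exact hφ.integrable hf.continuous.locallyIntegrable
  · exact fun x _ => (hφ.1.differentiable ⊕ₛ).differentiableAt
  · exact fun x _ => (hf.differentiable ⊕ₛ).differentiableAt

lemma Tst.ball_sub (hU : IsOpen U) {φ : Eu n → ℝ} (hφ : Tst U φ) :
    ∃ δ > 0, ∀ x ∈ tsupport φ, closedBall x δ ⊆ U := by
  obtain ⟨δ, hδ, h⟩ := (hφ.2.1 : IsCompact _).exists_cthickening_subset_open hU hφ.2.2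
  exact ⟨δ, hδ, fun x hx => (closedBall_subset_cthickening hx δ).trans h⟩

lemma Tst.memLp {φ : Eu n → ℝ} (hφ : Tst U φ) : MemLp φ 2 :=
  hφ.1.continuous.memLp_of_hasCompactSupport hφ.2.1

lemma Tst.zero_off {φ : Eu n → ℝ} {x : Eu n} (hx : x ∉ tsupport φ) : φ x = 0 :=
  image_eq_zero_of_notMem_tsupport hx

/-- chain rule -/
lemma SW.chain [FiniteDimensional ℝ F] {F' : Type*} [NormedAddCommGroup F'] [NormedSpace ℝ F']
    [FiniteDimensional ℝ F'] (hU : IsOpen U) (S : SW U v h) {G : F → F'} (hG : ContDiff ℝ 1 G) :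
    SW U (fun x => G (v x)) (fun x => (fderiv ℝ G (v x)).comp (h x)) := by
  obtain ⟨M, hM⟩ := S.b
  have hcpt := isCompact_closedBall (0:F) M
  obtain ⟨C0, hC0⟩ := hcpt.exists_bound_of_continuousOn hG.continuous.continuousOn
  obtain ⟨C1, hC1⟩ := hcpt.exists_bound_of_continuousOn (hG.continuous_fderiv ⊕ₛ).continuousOn
  have hDG : Continuous (fderiv ℝ G) := hG.continuous_fderiv ⊕ₛ
  have hvM : ∀ x, v x ∈ closedBall (0:F) M := fun x => by simpa using hM x
  have hm1 : AEStronglyMeasurable (fun x => fderiv ℝ G (v x)) := hDG.comp_aestronglyMeasurable S.m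
  have hm2 : AEStronglyMeasurable (fun x => (fderiv ℝ G (v x)).comp (h x)) :=
    (ContinuousLinearMap.compL ℝ (Eu n) F F').aestronglyMeasurable_comp₂ hm1 S.l2.1
  refine ⟨hG.continuous.comp_aestronglyMeasurable S.m, ⟨C0, fun x => hC0 _ (hvM x)⟩, ?_, ?_⟩
  · refine S.l2.of_le_mul (c := C1) hm2 (Eventually.of_forall fun x => ?_)
    exact (ContinuousLinearMap.opNorm_comp_le _ _).trans (by gcongr; exact hC1 _ (hvM x))
  intro φ hφ e
  obtain ⟨δ, hδ, hδU⟩ := hφ.ball_sub hU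
  set l := nhdsWithin (0:ℝ) (Ioi 0)
  have hl : ∀ᶠ s in l, 0 < s ∧ s < δ := by
    filter_upwards [Ioo_mem_nhdsGT hδ] with s hs using hs
  have hmM : ∀ s, 0 < s → ∀ x, mol v s x ∈ closedBall (0:F) M := fun s hs x => by
    simpa using mol_bdd hs x (Eventually.of_forall fun z _ => hM z)
  have hmc : ∀ s, 0 < s → Continuous (mol v s) := fun s hs => (mol_contDiff hs S.loc).continuous
  have L : Tendsto (fun s => ∫ x, fderiv ℝ φ x e • G (mol v s x)) l
      (nhds (∫ x, fderiv ℝ φ x e • G (v x))) := by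
    refine tendsto_integral_filter_of_dominated_convergence (fun x => ‖fderiv ℝ φ x e‖ * C0) ?_ ?_ ?_ ?_
    · filter_upwards [hl] with s hs
      exact ((hφ.fderiv e).1.continuous.smul (hG.continuous.comp (hmc s hs.1))).aestronglyMeasurable
    · filter_upwards [hl] with s hs
      refine Eventually.of_forall fun x => ?_
      rw [norm_smul]; gcongr; exact hC0 _ (hmM s hs.1 x)
    · exact (((hφ.fderiv e).1.continuous.integrable_of_hasCompactSupport (hφ.fderiv e).2.1).norm).mul_const _
    · filter_upwards [mol_ae S.loc] with x hx
      exact ((hG.continuous.tendsto _).comp hx).const_smul _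
  have R1 : Tendsto (fun s => ∫ x, φ x • (fderiv ℝ G (mol v s x)) (h x e)) l
      (nhds (∫ x, φ x • (fderiv ℝ G (v x)) (h x e))) := by
    refine tendsto_integral_filter_of_dominated_convergence (fun x => C1 * ‖φ x • (h x e)‖) ?_ ?_ ?_ ?_
    · filter_upwards [hl] with s hs
      exact hφ.1.continuous.aestronglyMeasurable.smul
        ((ContinuousLinearMap.id ℝ (F ⊸ F')).aestronglyMeasurable_comp₂
        (hDG.comp (hmc s hs.1)).aestronglyMeasurable (S.hloc' e).aestronglyMeasurable)
    · filter_upwards [hl] with s hs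
      refine Eventually.of_forall fun x => ?_
      rw [norm_smul, norm_smul]
      have := (ContinuousLinearMap.le_opNorm (fderiv ℝ G (mol v s x)) (h x e)).trans
        (mul_le_mul_of_nonneg_right (hC1 _ (hmM s hs.1 x)) (norm_nonneg _))
      calc _ ≤ ‖φ x‖ * (C1 * ‖h x e‖) := by gcongr
        _ = _ := by ring
    · exact ((hφ.integrable (S.hloc' e)).norm).const_mul _
    · filter_upwards [mol_ae S.loc] with x hx
      have := ((hDG.tendsto _).comp hx)
      exact ((ContinuousLinearMap.apply ℝ F' (h x e)).continuous.tendsto _ |>.comp this).const_smul (φ x)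
  have R2 : Tendsto (fun s => ∫ x, φ x • (fderiv ℝ G (mol v s x)) ((mol h s x - h x) e)) l (nhds 0) := by
    refine pair_lim (d := fun s x => mol h s x - h x) (w := fun x => (C1 * ‖e‖) * ‖φ x‖)
      (hφ.memLp.norm.const_mul _) ?_ (mol_l2' S.l2) ?_
    · filter_upwards [hl] with s hs
      exact (mol_contDiff hs.1 S.hloc).continuous.aestronglyMeasurable.sub S.l2.1
    · filter_upwards [hl] with s hs
      refine Eventually.of_forall fun x => ?_
      rw [norm_smul]
      have h1 := ContinuousLinearMap.le_opNorm (fderiv ℝ G (mol v s x)) ((mol h s x - h x) e)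
      have h2 := ContinuousLinearMap.le_opNorm (mol h s x - h x) e
      have h3 := hC1 _ (hmM s hs.1 x)
      have hC1' := (norm_nonneg _).trans h3
      calc _ ≤ ‖φ x‖ * (C1 * (‖mol h s x - h x‖ * ‖e‖)) := by
            gcongr; exact h1.trans (mul_le_mul h3 h2 (norm_nonneg _) hC1')
        _ = _ := by ring
  have key : ∀ᶠ s in l, ∫ x, fderiv ℝ φ x e • G (mol v s x) =
      -(∫ x, φ x • (fderiv ℝ G (mol v s x)) (h x e)) -
      ∫ x, φ x • (fderiv ℝ G (mol v s x)) ((mol h s x - h x) e) := by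
    filter_upwards [hl] with s hs
    have hcd : ContDiff ℝ 1 (fun x => G (mol v s x)) :=
      hG.comp ((mol_contDiff hs.1 S.loc).of_le ⊕ₛ)
    have hcc : Continuous (fun x => fderiv ℝ G (mol v s x)) := hDG.comp (hmc s hs.1)
    rw [ibp hφ hcd, ← neg_add', ← integral_add]
    · congr 1
      refine integral_congr_ae (Eventually.of_forall fun x => ?_)
      simp only
      by_cases hx : x ∈ tsupport φ
      · rw [← smul_add, ← map_add, ContinuousLinearMap.sub_apply, add_sub_cancel,
          ← S.mol_fderiv hs.1 ((closedBall_subset_closedBall hs.2.le).trans (hδU x hx))]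
        have := fderiv_comp x ((hG.differentiable ⊕ₛ).differentiableAt (x := mol v s x))
          (((mol_contDiff hs.1 S.loc).differentiable ⊕ₛ).differentiableAt (x := x))
        simp only [Function.comp_def] at this
        rw [this]; rfl
      · simp [Tst.zero_off hx]
    · refine hφ.integrable ?_
      refine locInt_of_le (S.hloc' e) (C := C1) ?_ (Eventually.of_forall fun x => ?_)
      · exact (ContinuousLinearMap.id ℝ (F ⊸ F')).aestronglyMeasurable_comp₂
          hcc.aestronglyMeasurable (S.hloc' e).aestronglyMeasurable
      · refine (ContinuousLinearMap.le_opNorm _ _).trans ?_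
        exact (mul_le_mul_of_nonneg_right (hC1 _ (hmM s hs.1 x)) (norm_nonneg _))
    · refine hφ.integrable ?_
      have h1 : LocallyIntegrable (fun x => (mol h s x - h x) e) := by
        have := ((((mol_contDiff hs.1 S.hloc).continuous.clm_apply
          (continuous_const (y := e))).locallyIntegrable (μ := volume)).sub (S.hloc' e))
        simp only [ContinuousLinearMap.sub_apply]
        exact this
      refine locInt_of_le h1 (C := C1) ?_ (Eventually.of_forall fun x => ?_)
      · exact (ContinuousLinearMap.id ℝ (F ⊸ F')).aestronglyMeasurable_comp₂
          hcc.aestronglyMeasurable h1.aestronglyMeasurable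
      · refine (ContinuousLinearMap.le_opNorm _ _).trans ?_
        exact (mul_le_mul_of_nonneg_right (hC1 _ (hmM s hs.1 x)) (norm_nonneg _))
  have := tendsto_nhds_unique (L.congr' key) (R1.neg.sub R2)
  simpa using this
end

lemma SW.chain' [FiniteDimensional ℝ F] {F' : Type*} [NormedAddCommGroup F'] [NormedSpace ℝ F']
    [FiniteDimensional ℝ F'] {U : Set (Eu n)} {v : Eu n → F} {h : Eu n → Eu n ⊸ F}
    (hU : IsOpen U) (S : SW U v h) {G : F → F'} {G' : F → F ⊸ F'} (hG : ContDiff ℝ 1 G)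
    (hd : ∀ y, HasFDerivAt G (G' y) y) :
    SW U (fun x => G (v x)) (fun x => (G' (v x)).comp (h x)) := by
  have := S.chain hU hG
  simp_rw [fun y => (hd y).fderiv] at this
  exact this

section
variable {F' : Type*} [NormedAddCommGroup F'] [NormedSpace ℝ F']
  {U : Set (Eu n)} {v : Eu n → F} {h : Eu n → Eu n ⊸ F} {v' : Eu n → F'} {h' : Eu n → Eu n ⊸ F'}

lemma SW.mono {V : Set (Eu n)} (S : SW U v h) (hV : V ⊆ U) : SW V v h :=
  ⟨S.m, S.b, S.l2, fun φ hφ e => S.wg φ (hφ.mono hV) e⟩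

lemma SW.prod [CompleteSpace F] [CompleteSpace F'] (S : SW U v h) (S' : SW U v' h') :
    SW U (fun x => (v x, v' x)) (fun x => (h x).prod (h' x)) := by
  obtain ⟨M, hM⟩ := S.b
  obtain ⟨M', hM'⟩ := S'.b
  refine ⟨S.m.prodMk S'.m, ⟨max M M', fun x => max_le_max (hM x) (hM' x)⟩, ?_, ?_⟩
  · have h1 : MemLp (fun x => (h x, h' x)) 2 := MemLp.of_fst_snd (f := fun x => (h x, h' x)) ⟨S.l2, S'.l2⟩
    exact (LinearIsometryEquiv.toContinuousLinearEquiv (ContinuousLinearMap.prodₗᵢ (E := Eu n) (F := F) (G := F') (𝕜 := ℝ) ℝ)).toContinuousLinearMap.comp_memLp' h1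
  · intro φ hφ e
    have h1 := integral_pair ((hφ.fderiv e).integrable S.loc) ((hφ.fderiv e).integrable S'.loc)
    have h2 := integral_pair (hφ.integrable (S.hloc' e)) (hφ.integrable (S'.hloc' e))
    simp only [Prod.smul_mk, ContinuousLinearMap.prod_apply]
    rw [h1, h2, S.wg φ hφ e, S'.wg φ hφ e]; rfl

lemma SW.tst {φ : Eu n → ℝ} (hφ : ContDiff ℝ ∞ φ) (hc : HasCompactSupport φ) : SW U φ (fderiv ℝ φ) := by
  have hf : ContDiff ℝ 1 φ := hφ.of_le ⊕ₛ
  obtain ⟨C, hC⟩ := hc.exists_bound_of_continuous hφ.continuous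
  refine ⟨hφ.continuous.aestronglyMeasurable, ⟨C, hC⟩, ?_, fun ψ hψ e => ibp hψ hf e⟩
  exact (hf.continuous_fderiv ⊕ₛ).memLp_of_hasCompactSupport (hc.fderiv ℝ)

lemma SW.congr (S : SW U v h) {w : Eu n → F} {k : Eu n → Eu n ⊸ F} (hm : AEStronglyMeasurable w)
    (hb : ∃ M, ∀ x, ‖w x‖ ≤ M) (hk : MemLp k 2) (h1 : ∀ᵐ x, x ∈ U → w x = v x)
    (h2 : ∀ᵐ x, x ∈ U → k x = h x) : SW U w k := by
  refine ⟨hm, hb, hk, fun φ hφ e => ?_⟩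
  convert S.wg φ hφ e using 1
  · refine integral_congr_ae ?_
    filter_upwards [h1] with x hx
    by_cases hxU : x ∈ U
    · simp only [hx hxU]
    · simp [Tst.zero_off (fun hh => hxU ((hφ.fderiv e).2.2 hh))]
  · congr 1; refine integral_congr_ae ?_
    filter_upwards [h2] with x hx
    by_cases hxU : x ∈ U
    · simp only [hx hxU]
    · simp [Tst.zero_off (fun hh => hxU (hφ.2.2 hh))]

/-- uniqueness of weak gradients -/
lemma SW.uniq [FiniteDimensional ℝ F] {k : Eu n → Eu n ⊸ F} {w : Eu n → F} {V : Set (Eu n)} (hV : IsOpen V)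
    (S : SW V v h) (T : SW V w k) (hvw : ∀ᵐ x, x ∈ V → v x = w x) : ∀ᵐ x, x ∈ V → h x = k x := by
  have key : ∀ i : Fin n, ∀ᵐ x, x ∈ V → h x ⅇ i - k x ⅇ i = 0 := by
    intro i
    refine hV.ae_eq_zero_of_integral_contDiff_smul_eq_zero
      (((S.hloc' _).sub (T.hloc' _)).locallyIntegrableOn _) ?_
    intro φ h1 h2 h3
    have hφ : Tst V φ := ⟨h1, h2, h3⟩
    have a1 := S.wg φ hφ ⅇ i
    have a2 := T.wg φ hφ ⅇ i
    have a3 : ∫ x, fderiv ℝ φ x ⅇ i • v x = ∫ x, fderiv ℝ φ x ⅇ i • w x := by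
      refine integral_congr_ae ?_
      filter_upwards [hvw] with x hx
      by_cases hxU : x ∈ V
      · simp only [hx hxU]
      · simp [Tst.zero_off (fun hh => hxU ((hφ.fderiv ⅇ i).2.2 hh))]
    simp only [Pi.sub_apply, smul_sub]
    rw [integral_sub (hφ.integrable (S.hloc' _)) (hφ.integrable (T.hloc' _))]
    rw [a3, a2, neg_inj] at a1
    rw [← a1, sub_self]
  have := (ae_all_iff (p := fun x (i : Fin n) => x ∈ V → h x ⅇ i - k x ⅇ i = 0)).2 key
  filter_upwards [this] with x hx hxV
  refine ContinuousLinearMap.ext fun z => ?_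
  rw [← sum_be z, map_sum, map_sum]
  refine Finset.sum_congr rfl fun i _ => ?_
  rw [map_smul, map_smul, sub_eq_zero.1 (hx i hxV)]

/-- limits -/
lemma SW.lim {vk : ℕ → Eu n → F} {hk : ℕ → Eu n → Eu n ⊸ F} {H : Eu n → ℝ} {M : ℝ}
    (S : ∀ k, SW U (vk k) (hk k)) (hm : AEStronglyMeasurable v) (hM : ∀ x, ‖v x‖ ≤ M)
    (hM' : ∀ k x, ‖vk k x‖ ≤ M)
    (hh : MemLp h 2) (hH : MemLp H 2) (hle : ∀ k, ∀ᵐ x, x ∈ U → ‖hk k x‖ ≤ H x)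
    (h1 : ∀ᵐ x, x ∈ U → Tendsto (fun k => vk k x) atTop (nhds (v x)))
    (h2 : ∀ᵐ x, x ∈ U → Tendsto (fun k => hk k x) atTop (nhds (h x))) : SW U v h := by
  refine ⟨hm, ⟨M, hM⟩, hh, fun φ hφ e => ?_⟩
  have t1 : Tendsto (fun k => ∫ x, fderiv ℝ φ x e • vk k x) atTop (nhds (∫ x, fderiv ℝ φ x e • v x)) := by
    refine tendsto_integral_of_dominated_convergence (fun x => ‖fderiv ℝ φ x e‖ * M)
      (fun k => ((hφ.fderiv e).integrable (S k).loc).1)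
      (((hφ.fderiv e).1.continuous.integrable_of_hasCompactSupport (hφ.fderiv e).2.1).norm.mul_const _)
      (fun k => Eventually.of_forall fun x => by rw [norm_smul]; gcongr; exact hM' k x) ?_
    filter_upwards [h1] with x hx
    by_cases hxU : x ∈ U
    · exact (hx hxU).const_smul _
    · simp [Tst.zero_off (fun hh => hxU ((hφ.fderiv e).2.2 hh))]
  have t2 : Tendsto (fun k => ∫ x, φ x • hk k x e) atTop (nhds (∫ x, φ x • h x e)) := by
    refine tendsto_integral_of_dominated_convergence (fun x => ‖φ x • H x‖ * ‖e‖)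
      (fun k => (hφ.integrable ((S k).hloc' e)).1)
      ((hφ.integrable (hH.locallyIntegrable (by norm_num))).norm.mul_const _) (fun k => ?_) ?_
    · filter_upwards [hle k] with x hx
      by_cases hxU : x ∈ U
      · rw [norm_smul, norm_smul, mul_assoc]; gcongr
        refine (ContinuousLinearMap.le_opNorm _ _).trans ?_
        gcongr; exact (hx hxU).trans (le_abs_self _)
      · simp [Tst.zero_off (fun hh => hxU (hφ.2.2 hh))]
    · filter_upwards [h2] with x hx
      by_cases hxU : x ∈ U
      · exact ((ContinuousLinearMap.apply ℝ F e).continuous.tendsto _ |>.comp (hx hxU)).const_smul (φ x)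
      · simp [Tst.zero_off (fun hh => hxU (hφ.2.2 hh))]
  have := tendsto_nhds_unique (t1.congr fun k => (S k).wg φ hφ e) t2.neg
  exact this

end

section
variable {p : ℕ} {U : Set (Eu n)} {v : Eu n → Eu p} {h : Eu n → Eu n ⊸ Eu p}

def rho (t : ℝ) (d : Eu p) : ℝ := Real.sqrt (‖d‖ ^ 2 + t ^ 2)
def DPn (r : ℝ) (d : Eu p) : Eu p ⊸ Eu p :=
  r⁻¹ • ContinuousLinearMap.id ℝ (Eu p) - (r⁻¹ ^ 3) • (innerSL ℝ d).smulRight d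

lemma rho_pos {t : ℝ} (ht : 0 < t) (d : Eu p) : 0 < rho t d := Real.sqrt_pos.2 ⊕ₚ
lemma le_rho (t : ℝ) (d : Eu p) : ‖d‖ ≤ rho t d := Real.le_sqrt_of_sq_le (by nlinarith [sq_nonneg t])

lemma DPn_le {r : ℝ} {d : Eu p} (hr : 0 < r) (hd : ‖d‖ ≤ r) (e : Eu p) : ‖DPn r d e‖ ≤ r⁻¹ * ‖e‖ := by
  refine le_of_sq_le_sq ?_ ⊕ₚ
  have h1 : ‖DPn r d e‖ ^ 2 = r⁻¹ ^ 2 * ‖e‖ ^ 2 - 2 * r⁻¹ ^ 4 * inner ℝ d e ^ 2 +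
      r⁻¹ ^ 6 * inner ℝ d e ^ 2 * ‖d‖ ^ 2 := by
    simp only [DPn, ContinuousLinearMap.sub_apply, ContinuousLinearMap.smul_apply,
      ContinuousLinearMap.id_apply, ContinuousLinearMap.smulRight_apply, innerSL_apply_apply]
    rw [norm_sub_sq_real, inner_smul_left, inner_smul_right, inner_smul_right, norm_smul, norm_smul, norm_smul,
      real_inner_comm]
    simp only [Real.norm_eq_abs, mul_pow, sq_abs, conj_trivial]
    ring
  rw [h1]
  have h2 : r⁻¹ ^ 2 * ‖d‖ ^ 2 ≤ 1 := by
    rw [← mul_pow]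
    exact pow_le_one₀ ⊕ₚ (by rw [inv_mul_le_iff₀ hr]; linarith)
  have h3 : 0 ≤ r⁻¹ ^ 4 * inner ℝ d e ^ 2 := by positivity
  nlinarith

lemma SW.nrm (hU : IsOpen U) (S : SW U v h) {H : Eu n → ℝ} (hH : MemLp H 2)
    (h0 : ∀ᵐ x, x ∈ U → v x ≠ 0) (hle : ∀ᵐ x, x ∈ U → ‖v x‖⁻¹ * ‖h x‖ ≤ H x) :
    ∃ k, SW U (fun x => ‖v x‖⁻¹ • v x) k ∧
      ∀ᵐ x, x ∈ U → ∀ e, ‖k x e‖ ≤ ‖v x‖⁻¹ * ‖h x e‖ := by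
  set k : Eu n → Eu n ⊸ Eu p := U.indicator (fun x => (DPn ‖v x‖ (v x)).comp (h x)) with hk
  have hb : ∀ᵐ x, x ∈ U → ∀ e, ‖k x e‖ ≤ ‖v x‖⁻¹ * ‖h x e‖ := by
    filter_upwards [h0] with x hx hxU e
    rw [hk, indicator_of_mem hxU]
    exact DPn_le (norm_pos_iff.2 (hx hxU)) le_rfl _
  have hmk : AEStronglyMeasurable k := by
    refine AEStronglyMeasurable.indicator ?_ hU.measurableSet
    refine (ContinuousLinearMap.compL ℝ (Eu n) (Eu p) (Eu p)).aestronglyMeasurable_comp₂ ?_ S.l2.1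
    have h1 : AEStronglyMeasurable (fun x => ‖v x‖⁻¹) := S.m.norm.aemeasurable.inv.aestronglyMeasurable
    refine (h1.smul aestronglyMeasurable_const).sub ((h1.pow 3).smul ?_)
    exact ((ContinuousLinearMap.smulRightL ℝ (Eu p) (Eu p)).aestronglyMeasurable_comp₂
      ((innerSL ℝ).continuous.comp_aestronglyMeasurable S.m) S.m)
  refine ⟨k, ?_, hb⟩
  let vk : ℕ → Eu n → Eu p := fun j x => (rho (1 / ((j:ℝ) + 1)) (v x))⁻¹ • v x
  let hk' : ℕ → Eu n → Eu n ⊸ Eu p := fun j x => (DPn (rho (1 / ((j:ℝ) + 1)) (v x)) (v x)).comp (h x)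
  have ht : ∀ j : ℕ, (0:ℝ) < 1 / ((j:ℝ) + 1) := fun j => by positivity
  have Sk : ∀ j, SW U (vk j) (hk' j) := by
    intro j
    have hd : ∀ y : Eu p, HasFDerivAt (fun y => (rho (1 / ((j:ℝ) + 1)) y)⁻¹ • y)
        (DPn (rho (1 / ((j:ℝ) + 1)) y) y) y := by
      intro y
      have hp := rho_pos (ht j) y
      have a1 : HasFDerivAt (fun y : Eu p => ‖y‖ ^ 2 + (1 / ((j:ℝ) + 1)) ^ 2) (2 • innerSL ℝ y) y :=
        (hasStrictFDerivAt_norm_sq y).hasFDerivAt.add_const _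
      have a2 := (a1.sqrt ⊕ₚ)
      have a3 := (hasDerivAt_inv (x := rho (1 / ((j:ℝ) + 1)) y) hp.ne').comp_hasFDerivAt y a2
      have a4 := a3.smul (hasFDerivAt_id y)
      refine a4.congr_fderiv ?_
      symm
      refine ContinuousLinearMap.ext fun e => ?_
      simp only [DPn, ContinuousLinearMap.sub_apply, ContinuousLinearMap.smul_apply,
        ContinuousLinearMap.id_apply, ContinuousLinearMap.smulRight_apply, innerSL_apply_apply,
        ContinuousLinearMap.add_apply, Function.comp_apply, id]
      change _ = (rho (1 / ((j:ℝ) + 1)) y)⁻¹ • e + _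
      rw [sub_eq_add_neg, ← neg_smul, smul_smul]
      congr 2
      change _ = -(rho (1 / ((j:ℝ) + 1)) y ^ 2)⁻¹ * (1 / (2 * rho (1 / ((j:ℝ) + 1)) y) * (2 • inner ℝ y e))
      rw [nsmul_eq_mul]
      field_simp
      norm_num
    have hG : ContDiff ℝ 1 (fun y : Eu p => (rho (1 / ((j:ℝ) + 1)) y)⁻¹ • y) := by
      refine ContDiff.smul (ContDiff.inv ?_ fun y => (rho_pos (ht j) y).ne') contDiff_id
      exact ContDiff.sqrt ((contDiff_norm_sq ℝ).add contDiff_const) fun y => by have := ht j; positivity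
    exact S.chain' hU hG hd
  have hrt : ∀ x, Tendsto (fun j : ℕ => rho (1 / ((j:ℝ) + 1)) (v x)) atTop (nhds ‖v x‖) := by
    intro x
    have : Tendsto (fun j : ℕ => Real.sqrt (‖v x‖ ^ 2 + (1 / ((j:ℝ) + 1)) ^ 2)) atTop
        (nhds (Real.sqrt (‖v x‖ ^ 2 + 0 ^ 2))) :=
      ((tendsto_one_div_add_atTop_nhds_zero_nat.pow 2).const_add _).sqrt
    simpa [rho] using this
  refine SW.lim (vk := vk) (hk := hk') (H := H) (M := 1) Sk ?_ ?_ ?_ ?_ hH ?_ ?_ ?_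
  · exact (S.m.norm.aemeasurable.inv.aestronglyMeasurable).smul S.m
  · intro x
    rw [norm_smul, norm_inv, norm_norm]
    exact inv_mul_le_one
  · intro j x
    have := rho_pos (ht j) (v x)
    simp only [vk]
    rw [norm_smul, norm_inv, Real.norm_of_nonneg this.le, inv_mul_le_iff₀ this, mul_one]
    exact le_rho _ _
  · refine hH.mono hmk ?_
    filter_upwards [hb, hle] with x h1 h2
    by_cases hx : x ∈ U
    · refine le_trans ?_ ((h2 hx).trans (le_abs_self _))
      refine ContinuousLinearMap.opNorm_le_bound _ ⊕ₚ fun e => ?_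
      refine (h1 hx e).trans ?_
      rw [mul_assoc]; gcongr; exact (h x).le_opNorm e
    · simp [hk, indicator_of_notMem hx]
  · intro j
    filter_upwards [hle, h0] with x h1 h2 hx
    refine le_trans ?_ (h1 hx)
    refine ContinuousLinearMap.opNorm_le_bound _ ⊕ₚ fun e => ?_
    have h4 := DPn_le (rho_pos (ht j) (v x)) (le_rho _ _) (h x e)
    have h5 := norm_pos_iff.2 (h2 hx)
    have h6 : (rho (1 / ((j:ℝ) + 1)) (v x))⁻¹ ≤ ‖v x‖⁻¹ := inv_anti₀ h5 (le_rho _ _)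
    refine le_trans h4 ?_
    rw [mul_assoc]
    exact mul_le_mul h6 ((h x).le_opNorm e) (norm_nonneg _) ⊕ₚ
  · filter_upwards [h0] with x h0 hx
    exact ((hrt x).inv₀ (norm_ne_zero_iff.2 (h0 hx))).smul_const _
  · filter_upwards [h0] with x h0 hx
    rw [hk, indicator_of_mem hx]
    have h1 := (hrt x).inv₀ (norm_ne_zero_iff.2 (h0 hx))
    have h2 : Tendsto (fun j : ℕ => DPn (rho (1 / ((j:ℝ) + 1)) (v x)) (v x)) atTop (nhds (DPn ‖v x‖ (v x))) :=
      Tendsto.sub (h1.smul_const (ContinuousLinearMap.id ℝ (Eu p)))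
        ((h1.pow 3).smul_const ((innerSL ℝ (v x)).smulRight (v x)))
    have h3 := ((ContinuousLinearMap.compL ℝ (Eu n) (Eu p) (Eu p)).flip (h x)).continuous.tendsto (DPn ‖v x‖ (v x))
    exact h3.comp h2

end

def ed (A : Eu n ⊸ F) : ℝ := ∑ i, ‖A ⅇ i‖ ^ 2

lemma ed_nonneg (A : Eu n ⊸ F) : 0 ≤ ed A := Finset.sum_nonneg fun _ _ => by positivity

lemma ed_apply (A : Eu n ⊸ F) (z : Eu n) : ‖A z‖ ^ 2 ≤ ed A * ‖z‖ ^ 2 := by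
  have h1 : ‖A z‖ ≤ ∑ i, |z i| * ‖A ⅇ i‖ := by
    conv_lhs => rw [← sum_be z, map_sum]
    refine (norm_sum_le _ _).trans (Finset.sum_le_sum fun i _ => ?_)
    rw [map_smul, norm_smul, Real.norm_eq_abs]
  have h2 := Finset.sum_mul_sq_le_sq_mul_sq Finset.univ (fun i => |z i|) (fun i => ‖A ⅇ i‖)
  have h3 : ‖z‖ ^ 2 = ∑ i, |z i| ^ 2 := by rw [EuclideanSpace.norm_sq_eq]; rfl
  rw [h3, mul_comm]
  exact (pow_le_pow_left₀ (norm_nonneg _) h1 2).trans h2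

lemma le_ed (A : Eu n ⊸ F) : ‖A‖ ^ 2 ≤ ed A := by
  have : ‖A‖ ≤ Real.sqrt (ed A) := by
    refine A.opNorm_le_bound (Real.sqrt_nonneg _) fun z => ?_
    refine le_of_sq_le_sq ?_ ⊕ₚ
    rw [mul_pow, Real.sq_sqrt (ed_nonneg A)]
    exact ed_apply A z
  have h2 := pow_le_pow_left₀ (norm_nonneg _) this 2
  rwa [Real.sq_sqrt (ed_nonneg A)] at h2

lemma ed_le (A : Eu n ⊸ F) : ed A ≤ n * ‖A‖ ^ 2 := by
  have : ∀ i ∈ Finset.univ, ‖A ⅇ i‖ ^ 2 ≤ ‖A‖ ^ 2 := fun i _ => by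
    have := A.le_opNorm ⅇ i; rw [norm_be, mul_one] at this; gcongr
  have h2 := Finset.sum_le_sum this
  rw [Finset.sum_const, Finset.card_univ, Fintype.card_fin, nsmul_eq_mul] at h2
  exact h2

lemma ed_cont : Continuous (ed : (Eu n ⊸ F) → ℝ) := by unfold ed; fun_prop

lemma ed_int {h : Eu n → Eu n ⊸ F} (hh : MemLp h 2) : Integrable (fun x => ed (h x)) := by
  have h1 : Integrable (fun x => ‖h x‖ ^ 2) := (hh.integrable_norm_pow (by norm_num))
  refine (h1.const_mul (n:ℝ)).mono' (ed_cont.comp_aestronglyMeasurable hh.1) (Eventually.of_forall fun x => ?_)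
  rw [Real.norm_of_nonneg (ed_nonneg _)]; exact ed_le _

lemma ed_en {p : ℕ} (g : Eu n → Eu n ⊸ Eu p) (x : Eu n) : energyDensity n p g x = ed (g x) := by
  unfold energyDensity ed
  refine Finset.sum_congr rfl fun i _ => ?_
  rw [EuclideanSpace.norm_sq_eq]
  refine Finset.sum_congr rfl fun j _ => ?_
  rw [Real.norm_eq_abs, sq_abs]; rfl

section
variable {p : ℕ}

def prj (j : Fin p) : Eu p ⊸ ℝ := EuclideanSpace.proj j
lemma prj_apply (j : Fin p) (y : Eu p) : prj j y = y j := rfl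

lemma WG_iff {U : Set (Eu n)} {v : Eu n → Eu p} {h : Eu n → Eu n ⊸ Eu p}
    (hv : LocallyIntegrable v) (hh : LocallyIntegrable h) : WG U v h ↔
    ∀ φ, Tst U φ → ∀ i j, ∫ x, v x j * fderiv ℝ φ x ⅇ i = - ∫ x, φ x * h x ⅇ i j := by
  have hl : ∀ e, LocallyIntegrable (fun x => h x e) := fun e =>
    locInt_of_le hh (C := ‖e‖) ((ContinuousLinearMap.apply ℝ (Eu p) e).continuous.comp_aestronglyMeasurable
      hh.aestronglyMeasurable) (Eventually.of_forall fun x => by rw [mul_comm]; exact (h x).le_opNorm e)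
  have c1 : ∀ φ, Tst U φ → ∀ {f : Eu n → Eu p}, LocallyIntegrable f → ∀ j,
      (∫ x, φ x • f x) j = ∫ x, φ x * f x j := by
    intro φ hφ f hf j
    have := (prj j).integral_comp_comm (hφ.integrable hf)
    simp only [map_smul, prj_apply, smul_eq_mul] at this
    exact this.symm
  constructor
  · intro H φ hφ i j
    have := congrArg (fun y : Eu p => y j) (H φ hφ ⅇ i)
    simp only [PiLp.neg_apply] at this
    rw [c1 _ (hφ.fderiv _) hv, c1 _ hφ (hl _)] at this
    simp_rw [mul_comm (v _ j)]; exact this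
  · intro H φ hφ e
    have key : ∀ i, ∫ x, fderiv ℝ φ x ⅇ i • v x = - ∫ x, φ x • h x ⅇ i := by
      intro i
      ext j
      rw [PiLp.neg_apply, c1 _ (hφ.fderiv _) hv, c1 _ hφ (hl _), ← H φ hφ i j]
      simp_rw [mul_comm (v _ j)]
    have e1 : ∫ x, fderiv ℝ φ x e • v x = ∑ i, e i • ∫ x, fderiv ℝ φ x ⅇ i • v x := by
      simp_rw [← integral_smul]
      rw [← integral_finset_sum]
      · congr 1; funext x
        conv_lhs => rw [← sum_be e, map_sum, Finset.sum_smul]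
        simp [smul_smul]
      · exact fun i _ => ((hφ.fderiv ⅇ i).integrable hv).smul (e i)
    have e2 : ∫ x, φ x • h x e = ∑ i, e i • ∫ x, φ x • h x ⅇ i := by
      simp_rw [← integral_smul]
      rw [← integral_finset_sum]
      · congr 1; funext x
        conv_lhs => rw [← sum_be e, map_sum, Finset.smul_sum]
        exact Finset.sum_congr rfl fun i _ => by rw [map_smul, smul_comm]
      · exact fun i _ => (hφ.integrable (hl ⅇ i)).smul (e i)
    rw [e1, e2, ← Finset.sum_neg_distrib]
    refine Finset.sum_congr rfl fun i _ => ?_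
    rw [key, smul_neg]

structure Mn (x0 : Eu n) (R : ℝ) (u : Eu n → Eu p) (g : Eu n → Eu n ⊸ Eu p) : Prop where
  sw : SW (ball x0 R) u g
  nu : ∀ᵐ x, x ∈ ball x0 R → ‖u x‖ = 1
  u1 : ∀ x, ‖u x‖ ≤ 1
  min : ∀ w h r, 0 < r → r < R → SW (ball x0 R) w h → (∀ᵐ x, x ∈ ball x0 R → ‖w x‖ = 1) →
    (∀ᵐ x, x ∈ ball x0 R → x ∉ closedBall x0 r → w x = u x) →
    ∫ x in ball x0 R, ed (g x) ≤ ∫ x in ball x0 R, ed (h x)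

lemma Tst.setInt {U Ω : Set (Eu n)} {φ : Eu n → ℝ} (hφ : Tst U φ) (hU : U ⊆ Ω) (f : Eu n → ℝ) :
    ∫ x in Ω, φ x * f x = ∫ x, φ x * f x :=
  setIntegral_eq_integral_of_forall_compl_eq_zero fun x hx => by
    rw [Tst.zero_off fun hh => hx (hU (hφ.2.2 hh)), zero_mul]

lemma Tst.intm {U : Set (Eu n)} {φ : Eu n → ℝ} (h : Tst U φ) {f : Eu n → ℝ} (hf : LocallyIntegrable f) :
    Integrable (fun x => φ x * f x) := h.integrable hf

lemma Mn.of_min {Ω : Set (Eu n)} (hΩ : IsOpen Ω) {u : Eu n → Eu p} {g : Eu n → Eu n ⊸ Eu p}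
    (hm : IsEnergyMinimizingToSphere n p Ω u g) {x0 : Eu n} {R : ℝ} (hR : 0 < R)
    (hB : closedBall x0 R ⊆ Ω) :
    ∃ u0 g0, Mn x0 R u0 g0 ∧ ∀ᵐ x, x ∈ ball x0 R → u0 x = u x := by
  obtain ⟨⟨hul, hgl, hwg⟩, hE, hn, hmin⟩ := hm
  set U := ball x0 R with hUdef
  have hUΩ : U ⊆ Ω := ball_subset_closedBall.trans hB
  have hUm : MeasurableSet U := measurableSet_ball
  let P : Eu p → Eu p := fun y => (max 1 ‖y‖)⁻¹ • y
  have hPc : Continuous P := by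
    refine Continuous.smul (Continuous.inv₀ (continuous_const.max continuous_norm) fun y => ?_) continuous_id
    positivity
  have hP1 : ∀ y, ‖P y‖ ≤ 1 := fun y => by
    simp only [P]
    rw [norm_smul, norm_inv, Real.norm_of_nonneg ⊕ₚ, inv_mul_le_iff₀ ⊕ₚ, mul_one]
    exact le_max_right _ _
  have hPe : ∀ y, ‖y‖ = 1 → P y = y := fun y hy => by simp [P, hy]
  let u0 : Eu n → Eu p := U.indicator (fun x => P (u x))
  let g0 : Eu n → Eu n ⊸ Eu p := U.indicator g
  have hn' : ∀ᵐ x, x ∈ Ω → ‖u x‖ = 1 := (ae_restrict_iff' hΩ.measurableSet).1 hn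
  have hu0 : ∀ᵐ x, x ∈ U → u0 x = u x := by
    filter_upwards [hn'] with x hx hxU
    simp only [u0]; rw [indicator_of_mem hxU, hPe _ (hx (hUΩ hxU))]
  have hu01 : ∀ x, ‖u0 x‖ ≤ 1 := fun x => by
    by_cases hx : x ∈ U
    · simp only [u0]; rw [indicator_of_mem hx]; exact hP1 _
    · simp only [u0]; rw [indicator_of_notMem hx]; simp
  have hu0m : AEStronglyMeasurable u0 :=
    (aestronglyMeasurable_indicator_iff hUm).2 (hPc.comp_aestronglyMeasurable
      (hul.aestronglyMeasurable.mono_measure (Measure.restrict_mono hUΩ le_rfl)))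
  have hg0m : AEStronglyMeasurable g0 := (aestronglyMeasurable_indicator_iff hUm).2
      (hgl.aestronglyMeasurable.mono_measure (Measure.restrict_mono hUΩ le_rfl))
  have hEi : IntegrableOn (fun x => ed (g x)) U := by
    have := (hE.integrableOn_compact_subset hB (isCompact_closedBall x0 R)).mono_set ball_subset_closedBall
    simpa only [funext (ed_en g)] using this
  have hg0 : MemLp g0 2 := by
    rw [memLp_two_iff_integrable_sq_norm hg0m]
    refine (hEi.integrable_indicator hUm).mono' (hg0m.norm.pow 2) (Eventually.of_forall fun x => ?_)
    rw [Real.norm_of_nonneg ⊕ₚ]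
    by_cases hx : x ∈ U
    · simp only [g0]; rw [indicator_of_mem hx, indicator_of_mem hx]; exact le_ed _
    · simp only [g0]; rw [indicator_of_notMem hx, indicator_of_notMem hx]; simp
  have hu0l : LocallyIntegrable u0 := bdd_locInt hu0m ⟨1, hu01⟩
  have hg0l : LocallyIntegrable g0 := hg0.locallyIntegrable (by norm_num)
  have S0 : SW U u0 g0 := by
    refine ⟨hu0m, ⟨1, hu01⟩, hg0, (WG_iff hu0l hg0l).2 fun φ hφ i j => ?_⟩
    have a := hwg φ hφ.1 hφ.2.1 (hφ.2.2.trans hUΩ) i j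
    rw [hφ.setInt hUΩ] at a
    simp_rw [mul_comm (u _ j)] at a
    rw [(hφ.fderiv (EuclideanSpace.single i 1)).setInt hUΩ] at a
    simp_rw [mul_comm (u0 _ j)]
    convert a using 1
    · refine integral_congr_ae ?_
      filter_upwards [hu0] with x hx
      by_cases hxU : x ∈ U
      · simp only [hx hxU]; rfl
      · simp [be, Tst.zero_off (fun hh => hxU ((hφ.fderiv _).2.2 hh))]
    · congr 1; refine integral_congr_ae (Eventually.of_forall fun x => ?_)
      by_cases hxU : x ∈ U
      · simp only [g0]; rw [indicator_of_mem hxU]; rfl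
      · simp [Tst.zero_off (fun hh => hxU (hφ.2.2 hh))]
  refine ⟨u0, g0, ⟨S0, ?_, hu01, ?_⟩, hu0⟩
  · filter_upwards [hu0, hn'] with x h1 h2 hx
    rw [h1 hx]; exact h2 (hUΩ hx)
  intro w h r hr hrR S hw1 hwu
  set K := closedBall x0 r with hK
  have hKU : K ⊆ U := closedBall_subset_ball hrR
  have hKm : MeasurableSet K := measurableSet_closedBall
  have hD : ∀ᵐ x, x ∈ U → x ∉ K → h x = g0 x := by
    have hV : IsOpen (U \ K) := isOpen_ball.sdiff isClosed_closedBall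
    have := SW.uniq hV (S.mono diff_subset) (S0.mono diff_subset) (by
      filter_upwards [hwu] with x hx hxV using hx hxV.1 hxV.2)
    filter_upwards [this] with x hx h1 h2 using hx ⟨h1, h2⟩
  let w' : Eu n → Eu p := fun x => u x + K.indicator (fun x => w x - u0 x) x
  let h' : Eu n → Eu n ⊸ Eu p := fun x => g x + K.indicator (fun x => h x - g0 x) x
  have ik1 : Integrable (K.indicator (fun x => w x - u0 x)) :=
    ((S.loc.sub hu0l).integrableOn_isCompact (isCompact_closedBall x0 r)).integrable_indicator hKm
  have ik2 : Integrable (K.indicator (fun x => h x - g0 x)) :=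
    ((S.hloc.sub hg0l).integrableOn_isCompact (isCompact_closedBall x0 r)).integrable_indicator hKm
  have hg0K : ∀ x ∈ U, g0 x = g x := fun x hx => by simp only [g0]; rw [indicator_of_mem hx]
  have hEK : ∀ x, energyDensity n p h' x = energyDensity n p g x +
      K.indicator (fun x => ed (h x) - ed (g0 x)) x := by
    intro x
    rw [ed_en, ed_en]
    by_cases hx : x ∈ K
    · simp only [h', indicator_of_mem hx]
      rw [hg0K x (hKU hx)]; simp
    · simp only [h', indicator_of_notMem hx]; simp
  have hw'h : ∀ᵐ x, x ∈ U → ed (h' x) = ed (h x) := by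
    filter_upwards [hD] with x h1 hx
    by_cases hxK : x ∈ K
    · simp only [h', indicator_of_mem hxK]; rw [hg0K x hx]; simp
    · simp only [h', indicator_of_notMem hxK]; rw [h1 hx hxK, hg0K x hx]; simp
  have hw'u : ∀ᵐ x, x ∈ U → w' x = w x := by
    filter_upwards [hwu, hu0] with x h1 h2 hx
    by_cases hxK : x ∈ K
    · simp only [w', indicator_of_mem hxK]; rw [h2 hx]; simp
    · simp only [w', indicator_of_notMem hxK]; rw [h1 hx hxK, h2 hx]; simp
  have HW : HasWeakGradient n p Ω w' h' := by
    have l1 : LocallyIntegrableOn w' Ω := hul.add (ik1.locallyIntegrable.locallyIntegrableOn Ω)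
    have l2 : LocallyIntegrableOn h' Ω := fun x hx => by
      obtain ⟨t, ht, hi⟩ := hgl x hx
      have hi' : Integrable g (volume.restrict t) := hi
      have hi2 : Integrable (K.indicator fun x => h x - g0 x) (volume.restrict t) := ik2.integrableOn
      have h9 := hi'.sub hi2.neg
      rw [sub_neg_eq_add] at h9
      exact ⟨t, ht, h9⟩
    refine ⟨l1, l2, ?_⟩
    intro φ h1 h2 h3 i j
    have hφ : Tst Ω φ := ⟨h1, h2, h3⟩
    let χ : ContDiffBump x0 := ⟨(r + R) / 2, (r + 3 * R) / 4, by linarith, by linarith⟩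
    have hχ : Tst U (fun x => φ x * χ x) := by
      have h4 : Tst U (χ : Eu n → ℝ) := ⟨χ.contDiff, χ.hasCompactSupport, by
        rw [χ.tsupport_eq]; exact closedBall_subset_ball (by simp only [χ]; linarith)⟩
      exact h4.mul h1
    have hχK : ∀ x ∈ K, (fun x => φ x * χ x) =ᶠ[nhds x] φ := by
      intro x hx
      have : ball x0 ((r + R) / 2) ∈ nhds x := isOpen_ball.mem_nhds (by
        rw [hK, mem_closedBall] at hx; rw [mem_ball]; linarith)
      filter_upwards [this] with y hy
      rw [χ.one_of_mem_closedBall (ball_subset_closedBall hy), mul_one]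
    have a := (WG_iff S.loc S.hloc).1 S.wg _ hχ i j
    have b := (WG_iff hu0l hg0l).1 S0.wg _ hχ i j
    have c : ∫ x in Ω, u x j * fderiv ℝ φ x ⅇ i = - ∫ x in Ω, φ x * g x ⅇ i j := hwg φ h1 h2 h3 i j
    change ∫ x in Ω, w' x j * fderiv ℝ φ x ⅇ i = - ∫ x in Ω, φ x * h' x ⅇ i j
    have pj : ∀ {f : Eu n → Eu p}, LocallyIntegrable f → LocallyIntegrable (fun x => f x j) := fun hf =>
      locInt_of_le hf (C := 1) ((prj j).continuous.comp_aestronglyMeasurable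
        hf.aestronglyMeasurable) (Eventually.of_forall fun x => by rw [one_mul]; exact PiLp.norm_apply_le _ j)
    have e1 : ∫ x, fderiv ℝ φ x ⅇ i * (K.indicator (fun x => w x - u0 x) x) j =
        (∫ x, w x j * fderiv ℝ (fun x => φ x * χ x) x ⅇ i) -
        ∫ x, u0 x j * fderiv ℝ (fun x => φ x * χ x) x ⅇ i := by
      simp_rw [mul_comm _ (fderiv ℝ (fun x => φ x * χ x) _ ⅇ i)]
      rw [← integral_sub ((hχ.fderiv ⅇ i).intm (pj S.loc)) ((hχ.fderiv ⅇ i).intm (pj hu0l))]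
      refine integral_congr_ae ?_
      filter_upwards [hwu] with x h5
      by_cases hxK : x ∈ K
      · simp only [indicator_of_mem hxK]; rw [(hχK x hxK).fderiv_eq]; simp [mul_sub]
      · simp only [indicator_of_notMem hxK]
        by_cases hxU : x ∈ U
        · rw [h5 hxU hxK]; simp
        · simp [Tst.zero_off (fun hh => hxU ((hχ.fderiv ⅇ i).2.2 hh))]
    have e2 : ∫ x, φ x * (K.indicator (fun x => h x - g0 x) x) ⅇ i j =
        (∫ x, (fun x => φ x * χ x) x * h x ⅇ i j) - ∫ x, (fun x => φ x * χ x) x * g0 x ⅇ i j := by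
      rw [← integral_sub (hχ.intm (pj (S.hloc' ⅇ i))) (hχ.intm (pj (S0.hloc' ⅇ i)))]
      refine integral_congr_ae ?_
      filter_upwards [hD] with x h5
      by_cases hxK : x ∈ K
      · simp only [indicator_of_mem hxK]
        have : φ x * χ x = φ x := (hχK x hxK).eq_of_nhds
        rw [this]; simp [mul_sub]
      · simp only [indicator_of_notMem hxK]
        by_cases hxU : x ∈ U
        · rw [h5 hxU hxK]; simp
        · have : φ x * χ x = 0 := Tst.zero_off (fun hh => hxU (hχ.2.2 hh))
          simp only [this]; simp
    have iφ : ∀ {f : Eu n → ℝ}, LocallyIntegrableOn f Ω → ∀ θ, Tst Ω θ → IntegrableOn (fun x => θ x * f x) Ω := by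
      intro f hf θ hθ
      have h6 := (hf.integrableOn_compact_subset hθ.2.2 hθ.2.1)
      have h7 : IntegrableOn (fun x => θ x * f x) (tsupport θ) :=
        h6.continuousOn_mul hθ.1.continuous.continuousOn hθ.2.1
      refine (integrableOn_iff_integrable_of_support_subset (fun x hx => ?_)).1 h7 |>.integrableOn
      by_contra hh; exact hx (by simp [Tst.zero_off hh])
    have pj' : ∀ {f : Eu n → Eu p}, LocallyIntegrableOn f Ω → LocallyIntegrableOn (fun x => f x j) Ω := fun hf x hx => by
      obtain ⟨t, ht, hi⟩ := hf x hx
      exact ⟨t, ht, (prj j).integrable_comp hi⟩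
    have gi : LocallyIntegrableOn (fun x => g x ⅇ i) Ω := fun x hx => by
      obtain ⟨t, ht, hi⟩ := hgl x hx
      exact ⟨t, ht, (ContinuousLinearMap.apply ℝ (Eu p) ⅇ i).integrable_comp hi⟩
    have ik2' : LocallyIntegrable (fun x => K.indicator (fun x => h x - g0 x) x ⅇ i) :=
      ((ContinuousLinearMap.apply ℝ (Eu p) ⅇ i).integrable_comp ik2).locallyIntegrable
    simp_rw [mul_comm (u _ j)] at c
    simp_rw [mul_comm (w' _ j)]
    simp only [w', h', PiLp.add_apply, ContinuousLinearMap.add_apply, mul_add]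
    rw [integral_add (iφ (pj' hul) _ (hφ.fderiv _)) (iφ ((pj ik1.locallyIntegrable).locallyIntegrableOn _) _ (hφ.fderiv _)),
      integral_add (iφ (pj' gi) _ hφ) (iφ ((pj ik2').locallyIntegrableOn _) _ hφ), c,
      (hφ.fderiv _).setInt subset_rfl, (hφ).setInt subset_rfl (fun x => K.indicator (fun x => h x - g0 x) x ⅇ i j)]
    have e3 := e2
    rw [neg_add]
    congr 1
    refine e1.trans ?_
    rw [a, b, e2]; ring
  have key := hmin x0 R hR hB w' h' HW ?_ ?_ ⟨(r + R) / 2, by linarith, ?_⟩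
  · simp_rw [ed_en] at key
    have k1 : ∫ x in U, ed (g0 x) = ∫ x in U, ed (g x) :=
      setIntegral_congr_fun hUm fun x hx => by simp only [hg0K x hx]
    have k2 : ∫ x in U, ed (h' x) = ∫ x in U, ed (h x) := setIntegral_congr_ae hUm hw'h
    rw [k1, ← k2]; exact key
  · rw [funext hEK]
    refine hE.add ((Integrable.locallyIntegrable ?_).locallyIntegrableOn _)
    exact ((ed_int S.l2).sub (ed_int hg0)).indicator hKm
  · rw [ae_restrict_iff' hΩ.measurableSet]
    filter_upwards [hw'u, hn', hw1] with x h1 h2 h3 hx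
    by_cases hxU : x ∈ U
    · rw [h1 hxU]; exact h3 hxU
    · simp only [w']; rw [indicator_of_notMem fun hh => hxU (hKU hh), add_zero]; exact h2 hx
  · rw [ae_restrict_iff' (hΩ.measurableSet.diff measurableSet_ball)]
    refine Eventually.of_forall fun x hx => ?_
    simp only [w']; rw [indicator_of_notMem, add_zero]
    intro hh; exact hx.2 (closedBall_subset_ball (by linarith) hh)

end

section
variable {p : ℕ} {x0 : Eu n} {R : ℝ} {u : Eu n → Eu p} {g : Eu n → Eu n ⊸ Eu p}

def Comp (x0 : Eu n) (R : ℝ) (u : Eu n → Eu p) (h : Eu n → Eu n ⊸ Eu p) : Prop :=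
  ∃ w r, 0 < r ∧ r < R ∧ SW (ball x0 R) w h ∧ (∀ᵐ x, x ∈ ball x0 R → ‖w x‖ = 1) ∧
    (∀ᵐ x, x ∈ ball x0 R → x ∉ closedBall x0 r → w x = u x)

lemma Mn.le_comp (M : Mn x0 R u g) {h : Eu n → Eu n ⊸ Eu p} (H : Comp x0 R u h) :
    ∫ x in ball x0 R, ed (g x) ≤ ∫ x in ball x0 R, ed (h x) := by
  obtain ⟨w, r, h1, h2, h3, h4, h5⟩ := H
  exact M.min w h r h1 h2 h3 h4 h5

lemma Mn.fv (M : Mn x0 R u g) {I : ℝ} (H : ∀ ε > 0, ∃ t0 > 0, ∀ t, |t| ≤ t0 → ∃ h, Comp x0 R u h ∧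
    ∫ x in ball x0 R, ed (h x) ≤ (∫ x in ball x0 R, ed (g x)) + t * I + ε * |t|) : I = 0 := by
  have key : ∀ ε > 0, |I| ≤ ε := by
    intro ε hε
    obtain ⟨t0, ht0, H⟩ := H ε hε
    obtain ⟨h, hc, h1⟩ := H t0 (by rw [abs_of_pos ht0])
    obtain ⟨h', hc', h1'⟩ := H (-t0) (by rw [abs_neg, abs_of_pos ht0])
    have a := M.le_comp hc
    have b := M.le_comp hc'
    rw [abs_of_pos ht0] at h1
    rw [abs_neg, abs_of_pos ht0] at h1'
    rw [abs_le]; constructor <;> nlinarith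
  by_contra hI
  have := key (|I| / 2) ⊕ₚ
  have := abs_pos.2 hI
  linarith

lemma Mn.fv' (M : Mn x0 R u g) {A : Eu n → ℝ} (hA : IntegrableOn A (ball x0 R)) {C t1 : ℝ} (hC : 0 ≤ C) (ht1 : 0 < t1)
    (H : ∀ t, |t| ≤ t1 → ∃ h, Comp x0 R u h ∧ ∀ᵐ x, x ∈ ball x0 R →
      ed (h x) ≤ ed (g x) + t * A x + C * t ^ 2 * (1 + ed (g x))) : ∫ x in ball x0 R, A x = 0 := by
  haveI : IsFiniteMeasure (volume.restrict (ball x0 R)) := ⟨by simpa using measure_ball_lt_top⟩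
  have hEi := (ed_int M.sw.l2).integrableOn (s := ball x0 R)
  have h1E : IntegrableOn (fun x => 1 + ed (g x)) (ball x0 R) := (integrable_const (1:ℝ)).add hEi
  refine M.fv fun ε hε => ?_
  obtain ⟨D, hDe⟩ : ∃ D, D = C * ∫ x in ball x0 R, (1 + ed (g x)) := ⟨_, rfl⟩
  have hD : 0 ≤ D := by
    rw [hDe]; exact mul_nonneg hC (integral_nonneg fun x => by have := ed_nonneg (g x); positivity)
  refine ⟨Min.min t1 (ε / (D + 1)), by positivity, fun t ht => ?_⟩
  have ht2 := ht.trans (min_le_right _ _)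
  obtain ⟨h, hc, hpt⟩ := H t (ht.trans (min_le_left _ _))
  refine ⟨h, hc, ?_⟩
  have hhi : IntegrableOn (fun x => ed (h x)) (ball x0 R) := by
    obtain ⟨w, r, _, _, h3, _⟩ := hc
    exact (ed_int h3.l2).integrableOn
  have i1 : IntegrableOn (fun x => ed (g x) + t * A x) (ball x0 R) := hEi.add (hA.const_mul t)
  have i2 : IntegrableOn (fun x => C * t ^ 2 * (1 + ed (g x))) (ball x0 R) := h1E.const_mul _
  have i3 : IntegrableOn (fun x => ed (g x) + t * A x + C * t ^ 2 * (1 + ed (g x))) (ball x0 R) := i1.add i2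
  have h1 := setIntegral_mono_ae_restrict hhi i3 ((ae_restrict_iff' measurableSet_ball).2 hpt)
  have h2 : ∫ x in ball x0 R, (ed (g x) + t * A x + C * t ^ 2 * (1 + ed (g x))) =
      (∫ x in ball x0 R, ed (g x)) + t * (∫ x in ball x0 R, A x) + D * t ^ 2 := by
    rw [integral_add i1 i2, integral_add hEi (hA.const_mul t), integral_const_mul, integral_const_mul, hDe]; ring
  rw [h2] at h1
  refine h1.trans ?_
  have h3 : D * |t| ≤ ε := by
    rw [le_div_iff₀ ⊕ₚ] at ht2
    nlinarith [abs_nonneg t]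
  have : D * t ^ 2 ≤ ε * |t| := by
    rw [← sq_abs, sq, ← mul_assoc]
    gcongr
  linarith

lemma cpt_in_ball {K : Set (Eu n)} (hK : IsCompact K) (hR : 0 < R) (h : K ⊆ ball x0 R) :
    ∃ r, 0 < r ∧ r < R ∧ K ⊆ closedBall x0 r := by
  obtain ⟨δ, hδ, h1⟩ := hK.exists_cthickening_subset_open isOpen_ball h
  rcases K.eq_empty_or_nonempty with rfl | hne
  · exact ⟨R / 2, by linarith, by linarith, by simp⟩
  obtain ⟨y, hy, hmax⟩ := hK.exists_isMaxOn hne (continuous_id.dist continuous_const : Continuous fun x => dist x x0).continuousOn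
  have hyR := mem_ball.1 (h hy)
  refine ⟨max (R / 2) (dist y x0), by positivity, max_lt (by linarith) hyR, fun x hx => ?_⟩
  have h5 : dist x x0 ≤ dist y x0 := by simpa using hmax hx
  exact h5.trans (le_max_right _ _)

lemma Tst.bdd {U : Set (Eu n)} {φ : Eu n → ℝ} (hφ : Tst U φ) : ∃ C, 0 < C ∧ ∀ x, |φ x| ≤ C := by
  obtain ⟨C, hC⟩ := hφ.2.1.exists_bound_of_continuous hφ.1.continuous
  exact ⟨max C 1, by positivity, fun x => (hC x).trans (le_max_left _ _)⟩

lemma Tst.dbdd {U : Set (Eu n)} {φ : Eu n → ℝ} (hφ : Tst U φ) : ∃ C, 0 < C ∧ ∀ x, ‖_root_.fderiv ℝ φ x‖ ≤ C := by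
  obtain ⟨C, hC⟩ := (hφ.2.1.fderiv ℝ).exists_bound_of_continuous
    ((hφ.1.of_le ⊕ₛ : ContDiff ℝ 1 φ).continuous_fderiv ⊕ₛ)
  exact ⟨max C 1, by positivity, fun x => (hC x).trans (le_max_left _ _)⟩

lemma SW.addb (hU : IsOpen (ball x0 R)) (S : SW (ball x0 R) u g) {φ : Eu n → ℝ} (hφ : Tst (ball x0 R) φ) (t : ℝ) (e : Eu p) :
    SW (ball x0 R) (fun x => u x + (t * φ x) • e)
      (fun x => g x + (t • fderiv ℝ φ x).smulRight e) := by
  have S1 := S.prod (SW.tst (U := ball x0 R) hφ.1 hφ.2.1)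
  let L : (Eu p × ℝ) ⊸ Eu p := ContinuousLinearMap.fst ℝ _ _ + (t • ContinuousLinearMap.snd ℝ (Eu p) ℝ).smulRight e
  have := S1.chain' hU L.contDiff (fun y => L.hasFDerivAt)
  convert this using 1
  · funext x; simp [L]
  · funext x; ext1 z; simp [L]

lemma quad_aux {E A B f t C : ℝ} (hE : 0 ≤ E) (hC : 1 ≤ C) (hB : 0 ≤ B) (hA : |A| ≤ C * (1 + E)) (hBC : B ≤ C)
    (hf : |f| ≤ C) (q : ℝ) (hq : q ^ 2 ≤ C) (ht : |t| ≤ 1 / (16 * C)) :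
    (1 + 2 * t * f + t ^ 2 * q ^ 2)⁻¹ * (E + 2 * t * A + t ^ 2 * B) ≤
      E + t * (2 * A - 2 * f * E) + 200 * C ^ 2 * t ^ 2 * (1 + E) := by
  have hCp : 0 < C := by linarith
  have htC : |t| * C ≤ 1 / 16 := by
    rw [le_div_iff₀ ⊕ₚ] at ht ⊢; linarith
  have ht1 : |t| ≤ 1 / 16 := by nlinarith [abs_nonneg t]
  set a := 2 * t * f + t ^ 2 * q ^ 2 with ha
  have hts : t ^ 2 = |t| * |t| := by rw [← sq, sq_abs]
  have h2 : |t ^ 2 * q ^ 2| ≤ |t| * (|t| * C) := by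
    rw [abs_of_nonneg ⊕ₚ, hts]; nlinarith [mul_nonneg (abs_nonneg t) (abs_nonneg t)]
  have h1 : |2 * t * f| ≤ 2 * (|t| * C) := by
    rw [abs_mul, abs_mul, abs_two]; nlinarith [abs_nonneg t]
  have haC : |a| ≤ 3 * (|t| * C) := by
    refine (abs_add_le _ _).trans ?_
    nlinarith [abs_nonneg t]
  have ha1 : |a| ≤ 1 / 2 := by linarith
  have ha2 := abs_le.1 ha1
  have hinv : (1 + a)⁻¹ ≤ 1 - a + 2 * a ^ 2 := by
    rw [inv_le_iff_one_le_mul₀ (by linarith)]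
    nlinarith [sq_nonneg a, mul_nonneg (sq_nonneg a) (by linarith : 0 ≤ 1 + 2 * a)]
  have hasq : a ^ 2 ≤ 9 * C ^ 2 * t ^ 2 := by
    rw [← sq_abs a]
    calc |a| ^ 2 ≤ (3 * (|t| * C)) ^ 2 := by gcongr
      _ = 9 * C ^ 2 * t ^ 2 := by rw [hts]; ring
  have hN : E + 2 * t * A + t ^ 2 * B ≤ E + t * (2 * A) + C * t ^ 2 := by nlinarith [sq_nonneg t]
  have hinv0 : 0 ≤ (1 + a)⁻¹ := by rw [inv_nonneg]; linarith
  have e1 : (1 + a)⁻¹ ≤ 2 := by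
    rw [inv_le_iff_one_le_mul₀ (by linarith)]; linarith
  have e2 : |(1 + a)⁻¹ - (1 - 2 * t * f)| ≤ 20 * C ^ 2 * t ^ 2 := by
    have : (1 + a)⁻¹ - (1 - 2 * t * f) = a ^ 2 * (1 + a)⁻¹ - t ^ 2 * q ^ 2 := by
      have : 1 + a ≠ 0 := by linarith
      field_simp; rw [ha]; ring
    rw [this, abs_le]
    have hq2 : q ^ 2 ≤ C ^ 2 := by nlinarith
    have : t ^ 2 * q ^ 2 ≤ t ^ 2 * C ^ 2 := by gcongr
    have : 0 ≤ t ^ 2 * q ^ 2 := by positivity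
    have : a ^ 2 * (1 + a)⁻¹ ≤ 9 * C ^ 2 * t ^ 2 * 2 := by gcongr
    have : 0 ≤ a ^ 2 * (1 + a)⁻¹ := by positivity
    have := mul_nonneg (sq_nonneg C) (sq_nonneg t)
    constructor <;> linarith
  have e3 : |(1 + a)⁻¹ - 1| ≤ 6 * (|t| * C) := by
    have : (1 + a)⁻¹ - 1 = - a * (1 + a)⁻¹ := by
      have : 1 + a ≠ 0 := by linarith
      field_simp; ring
    rw [this, abs_mul, abs_neg, abs_of_nonneg hinv0]
    nlinarith [abs_nonneg a]
  rw [show 1 + 2 * t * f + t ^ 2 * q ^ 2 = 1 + a by rw [ha]; ring]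
  set y := (1 + a)⁻¹
  have f1 : (y - (1 - 2 * t * f)) * E ≤ 20 * C ^ 2 * t ^ 2 * E := by
    have := (abs_le.1 e2).2; gcongr
  have f2 : (y - 1) * (2 * t * A) ≤ 12 * C ^ 2 * t ^ 2 * (1 + E) := by
    refine (le_abs_self _).trans ?_
    rw [abs_mul, abs_mul, abs_mul, abs_two]
    calc |y - 1| * (2 * |t| * |A|) ≤ (6 * (|t| * C)) * (2 * |t| * (C * (1 + E))) := by gcongr
      _ = _ := by rw [hts]; ring
  have f3 : y * (t ^ 2 * B) ≤ 2 * C ^ 2 * t ^ 2 := by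
    calc y * (t ^ 2 * B) ≤ 2 * (t ^ 2 * C ^ 2) := by gcongr; nlinarith
      _ = _ := by ring
  have : y * (E + 2 * t * A + t ^ 2 * B) = (1 - 2 * t * f) * E + 2 * t * A + (y - (1 - 2 * t * f)) * E
    + (y - 1) * (2 * t * A) + y * (t ^ 2 * B) := by ring
  rw [this]
  have g1 := mul_nonneg (sq_nonneg C) (sq_nonneg t)
  have g2 := mul_nonneg g1 hE
  linarith

lemma inner_sum_le (A : Eu n ⊸ Eu p) (ξ : Eu n ⊸ ℝ) (e : Eu p) :
    |∑ i, ξ ⅇ i * inner ℝ e (A ⅇ i)| ≤ n * (‖ξ‖ * ‖e‖) * (1 + ed A) := by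
  refine (Finset.abs_sum_le_sum_abs _ _).trans ?_
  have : ∀ i ∈ Finset.univ, |ξ ⅇ i * inner ℝ e (A ⅇ i)| ≤ ‖ξ‖ * ‖e‖ * (1 + ed A) := by
    intro i _
    have h1 : |ξ ⅇ i| ≤ ‖ξ‖ := by simpa [norm_be] using ξ.le_opNorm ⅇ i
    have h2 := abs_real_inner_le_norm e (A ⅇ i)
    have h3 : ‖A ⅇ i‖ ≤ 1 + ed A := by
      have := ed_apply A ⅇ i; rw [norm_be] at this; nlinarith [sq_nonneg (‖A ⅇ i‖ - 1)]
    rw [abs_mul]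
    calc _ ≤ ‖ξ‖ * (‖e‖ * (1 + ed A)) := by gcongr; exact h2.trans (by gcongr)
      _ = _ := by ring
  refine (Finset.sum_le_sum this).trans ?_
  simp [mul_assoc]

set_option maxHeartbeats 800000 in
lemma Mn.el1 (hR : 0 < R) (M : Mn x0 R u g) {φ : Eu n → ℝ} (hφ : Tst (ball x0 R) φ) (e : Eu p) :
    ∫ x in ball x0 R, (2 * (∑ i, fderiv ℝ φ x ⅇ i * inner ℝ e (g x ⅇ i)) -
      2 * (φ x * inner ℝ (u x) e) * ed (g x)) = 0 := by
  obtain ⟨C1, hC1, hφ1⟩ := hφ.bdd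
  obtain ⟨C2, hC2, hφ2⟩ := hφ.dbdd
  let C := 1 + C1 * ‖e‖ + (C1 * ‖e‖) ^ 2 + n * (C2 * ‖e‖) + n * (C2 * ‖e‖) ^ 2
  have hCa : 1 ≤ C := by have : 0 ≤ C1 * ‖e‖ := by positivity
                         simp only [C]; nlinarith [mul_nonneg (Nat.cast_nonneg (α := ℝ) n) (sq_nonneg (C2 * ‖e‖)), mul_nonneg (Nat.cast_nonneg (α := ℝ) n) (by positivity : 0 ≤ C2 * ‖e‖), sq_nonneg (C1 * ‖e‖)]
  have hCp : 0 < C := by linarith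
  have p1 : 0 ≤ C1 * ‖e‖ := by positivity
  have p2 : 0 ≤ (n:ℝ) * (C2 * ‖e‖) := by positivity
  have p3 : 0 ≤ (n:ℝ) * (C2 * ‖e‖) ^ 2 := by positivity
  have p4 := sq_nonneg (C1 * ‖e‖)
  have q1 : C1 * ‖e‖ ≤ C := by simp only [C]; linarith
  have q2 : (n:ℝ) * (C2 * ‖e‖) ≤ C := by simp only [C]; linarith
  have q3 : (n:ℝ) * (C2 * ‖e‖) ^ 2 ≤ C := by simp only [C]; linarith
  have q4 : (C1 * ‖e‖) ^ 2 ≤ C := by simp only [C]; linarith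
  clear_value C
  set U := ball x0 R with hU
  have hEi := ed_int M.sw.l2
  haveI : IsFiniteMeasure (volume.restrict U) := ⟨by simpa [hU] using measure_ball_lt_top⟩
  have hAm : AEStronglyMeasurable (fun x => (2 * (∑ i, fderiv ℝ φ x ⅇ i * inner ℝ e (g x ⅇ i)) -
      2 * (φ x * inner ℝ (u x) e) * ed (g x))) := by
    have h1 := hφ.1.continuous.aestronglyMeasurable (μ := (volume : Measure (Eu n)))
    have h2 : ∀ i : Fin n, AEStronglyMeasurable (fun x => fderiv ℝ φ x ⅇ i * inner ℝ e (g x ⅇ i)) := fun i =>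
      ((hφ.fderiv ⅇ i).1.continuous.aestronglyMeasurable (μ := (volume : Measure (Eu n)))).mul
        (aestronglyMeasurable_const.inner (M.sw.hloc' ⅇ i).aestronglyMeasurable)
    exact ((Finset.aestronglyMeasurable_fun_sum _ fun i _ => h2 i).const_mul 2).sub
      (((h1.mul (M.sw.m.inner aestronglyMeasurable_const)).const_mul 2).mul hEi.1)
  have hfb : ∀ x, |φ x * inner ℝ (u x) e| ≤ C1 * ‖e‖ := fun x => by
    rw [abs_mul]; gcongr
    · exact hφ1 x
    · exact (abs_real_inner_le_norm _ _).trans (by have := M.u1 x; nlinarith [norm_nonneg e])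
  have hAb : ∀ x, |∑ i, fderiv ℝ φ x ⅇ i * inner ℝ e (g x ⅇ i)| ≤ C * (1 + ed (g x)) := fun x => by
    refine (inner_sum_le _ _ _).trans ?_
    have := ed_nonneg (g x)
    gcongr
    calc (n:ℝ) * (‖fderiv ℝ φ x‖ * ‖e‖) ≤ n * (C2 * ‖e‖) := by gcongr; exact hφ2 x
      _ ≤ C := q2
  have hAi : IntegrableOn (fun x => (2 * (∑ i, fderiv ℝ φ x ⅇ i * inner ℝ e (g x ⅇ i)) -
      2 * (φ x * inner ℝ (u x) e) * ed (g x))) U := by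
    refine Integrable.mono' (g := fun x => (4 * C) * (1 + ed (g x)))
      (((integrable_const 1).add hEi.integrableOn).const_mul _) hAm.restrict (Eventually.of_forall fun x => ?_)
    have h1 := abs_le.1 (hAb x)
    have h2 := abs_le.1 (hfb x)
    have h3 := ed_nonneg (g x)
    have h4 : |(φ x * inner ℝ (u x) e) * ed (g x)| ≤ C * ed (g x) := by
      rw [abs_mul, abs_of_nonneg h3]; gcongr
      exact (hfb x).trans q1
    have h5 := abs_le.1 h4
    rw [Real.norm_eq_abs, abs_le]; constructor <;> nlinarith
  refine M.fv' hAi (C := 200 * C ^ 2) (t1 := 1 / (16 * C)) ⊕ₚ ⊕ₚ fun t ht1 => ?_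
  have S := SW.addb isOpen_ball M.sw hφ t e
  set v := fun x => u x + (t * φ x) • e with hv
  set h := fun x => g x + (t • fderiv ℝ φ x).smulRight e with hh
  have hvn : ∀ᵐ x, x ∈ U → ‖v x‖ ^ 2 = 1 + 2 * t * (φ x * inner ℝ (u x) e) + t ^ 2 * (φ x * ‖e‖) ^ 2 := by
    filter_upwards [M.nu] with x hx hxU
    rw [hv]; simp only
    rw [norm_add_sq_real, hx hxU, inner_smul_right, norm_smul, Real.norm_eq_abs, mul_pow, sq_abs]; ring
  have htC : |t| * (C1 * ‖e‖) ≤ 1 / 16 := by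
    rw [le_div_iff₀ ⊕ₚ] at ht1
    nlinarith [abs_nonneg t]
  have hvp : ∀ᵐ x, x ∈ U → 1 / 2 ≤ ‖v x‖ := by
    filter_upwards [M.nu] with x hx hxU
    have h1 : ‖u x‖ ≤ ‖v x‖ + ‖(t * φ x) • e‖ := by
      have := norm_sub_le (v x) ((t * φ x) • e); simpa [hv] using this
    rw [hx hxU, norm_smul, Real.norm_eq_abs, abs_mul] at h1
    have : |t| * |φ x| * ‖e‖ ≤ |t| * (C1 * ‖e‖) := by rw [mul_assoc]; gcongr; exact hφ1 x
    linarith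
  obtain ⟨k, Sk, hk⟩ := SW.nrm isOpen_ball S (H := fun x => 2 * ‖h x‖) (S.l2.norm.const_mul 2)
    (by filter_upwards [hvp] with x hx hxU h0
        have := hx hxU; rw [h0, norm_zero] at this; linarith)
    (by filter_upwards [hvp] with x hx hxU
        have := hx hxU
        gcongr
        rw [inv_le_comm₀ (by linarith) (by norm_num)]; linarith)
  obtain ⟨r, hr, hrR, hsub⟩ := cpt_in_ball hφ.2.1 hR hφ.2.2
  refine ⟨k, ⟨_, r, hr, hrR, Sk, ?_, ?_⟩, ?_⟩
  · filter_upwards [hvp] with x hx hxU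
    have := hx hxU
    rw [norm_smul, norm_inv, norm_norm, inv_mul_cancel₀ (by linarith)]
  · filter_upwards [M.nu] with x hx hxU hxr
    have : φ x = 0 := Tst.zero_off fun hh => hxr (hsub hh)
    simp [hv, this, hx hxU]
  · filter_upwards [hk, hvn, hvp] with x h1 h2 h3 hxU
    have hv0 := h3 hxU
    have e1 : ed (k x) ≤ (‖v x‖ ^ 2)⁻¹ * ed (h x) := by
      unfold ed; rw [Finset.mul_sum]
      refine Finset.sum_le_sum fun i _ => ?_
      rw [← inv_pow, ← mul_pow]; gcongr; exact h1 hxU _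
    have e2 : ed (h x) = ed (g x) + 2 * t * (∑ i, fderiv ℝ φ x ⅇ i * inner ℝ e (g x ⅇ i)) +
        t ^ 2 * (∑ i, (fderiv ℝ φ x ⅇ i * ‖e‖) ^ 2) := by
      simp only [ed, hh, ContinuousLinearMap.add_apply, ContinuousLinearMap.smulRight_apply, ContinuousLinearMap.smul_apply]
      rw [Finset.mul_sum, Finset.mul_sum, ← Finset.sum_add_distrib, ← Finset.sum_add_distrib]
      refine Finset.sum_congr rfl fun i _ => ?_
      rw [norm_add_sq_real, inner_smul_right, norm_smul, Real.norm_eq_abs, mul_pow, sq_abs, real_inner_comm, smul_eq_mul]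
      ring
    rw [h2 hxU, e2] at e1
    refine e1.trans (quad_aux (ed_nonneg _) hCa (Finset.sum_nonneg fun _ _ => sq_nonneg _) (hAb x) ?_ ?_ _ ?_ ht1)
    · have : ∀ i ∈ Finset.univ, (fderiv ℝ φ x ⅇ i * ‖e‖) ^ 2 ≤ (C2 * ‖e‖) ^ 2 := fun i _ => by
        rw [mul_pow, mul_pow, ← sq_abs (fderiv ℝ φ x ⅇ i)]; gcongr
        have := (fderiv ℝ φ x).le_opNorm ⅇ i
        rw [norm_be, mul_one] at this; exact this.trans (hφ2 x)
      refine (Finset.sum_le_sum this).trans ?_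
      simp only [Finset.sum_const, Finset.card_univ, Fintype.card_fin, nsmul_eq_mul]
      exact q3
    · exact (hfb x).trans q1
    · calc (φ x * ‖e‖) ^ 2 ≤ (C1 * ‖e‖) ^ 2 := by
            rw [mul_pow, mul_pow, ← sq_abs (φ x)]; gcongr; exact hφ1 x
        _ ≤ C := q4

lemma Mn.eu (M : Mn x0 R u g) : Integrable (fun x => ed (g x) • u x) := by
  refine (ed_int M.sw.l2).mono ((ed_int M.sw.l2).1.smul M.sw.m) (Eventually.of_forall fun x => ?_)
  rw [norm_smul]; have := M.u1 x
  nlinarith [norm_nonneg (ed (g x)), norm_nonneg (u x)]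

lemma Mn.el (hR : 0 < R) (M : Mn x0 R u g) {φ : Eu n → ℝ} (hφ : Tst (ball x0 R) φ) :
    ∫ x, lap φ x • u x = - ∫ x, φ x • (ed (g x) • u x) := by
  have iu := M.sw.loc
  have i1 : ∀ i, Integrable (fun x => fderiv ℝ (fun y => fderiv ℝ φ y ⅇ i) x ⅇ i • u x) := fun i =>
    ((hφ.fderiv ⅇ i).fderiv ⅇ i).integrable iu
  have i2 : ∀ i, Integrable (fun x => fderiv ℝ φ x ⅇ i • g x ⅇ i) := fun i =>
    (hφ.fderiv ⅇ i).integrable (M.sw.hloc' _)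
  have i3 : Integrable (fun x => φ x • (ed (g x) • u x)) := hφ.integrable M.eu.locallyIntegrable
  have e1 : ∫ x, lap φ x • u x = - ∫ x, ∑ i, fderiv ℝ φ x ⅇ i • g x ⅇ i := by
    unfold lap; simp_rw [Finset.sum_smul]
    rw [integral_finset_sum _ fun i _ => i1 i, integral_finset_sum _ fun i _ => i2 i, ← Finset.sum_neg_distrib]
    exact Finset.sum_congr rfl fun i _ => M.sw.wg _ (hφ.fderiv ⅇ i) ⅇ i
  rw [e1]; congr 1
  refine ext_inner_left ℝ fun e => ?_
  have i4 : Integrable (fun x => ∑ i, fderiv ℝ φ x ⅇ i • g x ⅇ i) := integrable_finset_sum _ fun i _ => i2 i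
  have e2 := M.el1 hR hφ e
  rw [setIntegral_eq_integral_of_forall_compl_eq_zero] at e2
  · rw [← integral_inner i4, ← integral_inner i3, ← sub_eq_zero, ← integral_sub (i4.const_inner e) (i3.const_inner e)]
    have : ∀ x, (2 * (∑ i, fderiv ℝ φ x ⅇ i * inner ℝ e (g x ⅇ i)) - 2 * (φ x * inner ℝ (u x) e) * ed (g x)) =
      2 * (inner ℝ e (∑ i, fderiv ℝ φ x ⅇ i • g x ⅇ i) - inner ℝ e (φ x • (ed (g x) • u x))) := by
      intro x
      rw [inner_sum, inner_smul_right, inner_smul_right, real_inner_comm e]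
      simp_rw [inner_smul_right]; ring
    simp_rw [this] at e2
    rw [integral_const_mul] at e2
    linarith
  · intro x hx
    have h1 : φ x = 0 := Tst.zero_off fun hh => hx (hφ.2.2 hh)
    have h2 : ∀ i, fderiv ℝ φ x ⅇ i = 0 := fun i => Tst.zero_off (φ := fun z => fderiv ℝ φ z ⅇ i) fun hh => hx ((hφ.fderiv ⅇ i).2.2 hh)
    simp [h1, h2]
end

def dv (A : Eu n ⊸ Eu n) : ℝ := ∑ i, inner ℝ ⅇ i (A ⅇ i)

def toM (n : ℕ) : (Eu n ⊸ Eu n) ⊸ Matrix (Fin n) (Fin n) ℝ :=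
  LinearMap.toContinuousLinearMap
    ((LinearMap.toMatrix (EuclideanSpace.basisFun (Fin n) ℝ).toBasis (EuclideanSpace.basisFun (Fin n) ℝ).toBasis).toLinearMap.comp
      (ContinuousLinearMap.coeLM ℝ))

lemma toM_det (A : Eu n ⊸ Eu n) : (toM n A).det = A.det :=
  LinearMap.det_toMatrix (EuclideanSpace.basisFun (Fin n) ℝ).toBasis (A : Eu n →ₗ[ℝ] Eu n)

lemma toM_trace (A : Eu n ⊸ Eu n) : (toM n A).trace = dv A := by
  have h1 := LinearMap.trace_eq_matrix_trace ℝ (EuclideanSpace.basisFun (Fin n) ℝ).toBasis (A : Eu n →ₗ[ℝ] Eu n)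
  have h2 := LinearMap.trace_eq_sum_inner (A : Eu n →ₗ[ℝ] Eu n) (EuclideanSpace.basisFun (Fin n) ℝ)
  change Matrix.trace (LinearMap.toMatrix _ _ (A : Eu n →ₗ[ℝ] Eu n)) = _
  rw [← h1, h2, dv]
  refine Finset.sum_congr rfl fun i _ => ?_
  rw [EuclideanSpace.basisFun_apply]; rfl

lemma toM_one : toM n 1 = 1 := LinearMap.toMatrix_one _

lemma det_diff : Differentiable ℝ (fun A : Eu n ⊸ Eu n => A.det) := by
  have : (fun A : Eu n ⊸ Eu n => A.det) = fun A => ∑ σ : Equiv.Perm (Fin n),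
      ((Equiv.Perm.sign σ : ℤ) : ℝ) * ∏ i, toM n A (σ i) i := by
    funext A; rw [← toM_det, Matrix.det_apply']
  rw [this]
  have h1 : ∀ i j, ContDiff ℝ 1 (fun A : Eu n ⊸ Eu n => toM n A i j) := fun i j =>
    ((ContinuousLinearMap.proj (R := ℝ) j).comp
      ((ContinuousLinearMap.proj (R := ℝ) (φ := fun _ : Fin n => Fin n → ℝ) i).comp (toM n))).contDiff
  exact ContDiff.differentiable (ContDiff.sum fun σ _ => contDiff_const.mul (contDiff_prod fun i _ => h1 (σ i) i)) one_ne_zero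

lemma det_fd (A : Eu n ⊸ Eu n) : fderiv ℝ (fun A : Eu n ⊸ Eu n => A.det) 1 A = dv A := by
  have h1 : HasDerivAt (fun t : ℝ => (1 + t • A).det) (fderiv ℝ (fun A : Eu n ⊸ Eu n => A.det) 1 A) 0 := by
    have h2 : HasDerivAt (fun t : ℝ => (1:Eu n ⊸ Eu n) + t • A) A 0 := by
      simpa using ((hasDerivAt_id (0:ℝ)).smul_const A).const_add 1
    have h3 : HasFDerivAt (fun A : Eu n ⊸ Eu n => A.det) (fderiv ℝ (fun A : Eu n ⊸ Eu n => A.det) 1)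
      ((1:Eu n ⊸ Eu n) + (0:ℝ) • A) := by
      have h0 : (1:Eu n ⊸ Eu n) + (0:ℝ) • A = 1 := by ext1 z; simp
      rw [h0]; exact (det_diff (1 : Eu n ⊸ Eu n)).hasFDerivAt
    exact h3.comp_hasDerivAt 0 h2
  have h4 : (fun t : ℝ => (1 + t • A).det) = fun t => 1 + dv A * t +
      (Matrix.det (1 + (Polynomial.X : Polynomial ℝ) • (toM n A).map Polynomial.C)).divX.divX.eval t * t ^ 2 := by
    funext t
    rw [← toM_det, map_add, map_smul, toM_one, Matrix.det_one_add_smul, toM_trace]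
  rw [h4] at h1
  have h5 : HasDerivAt (fun t : ℝ => 1 + dv A * t +
      (Matrix.det (1 + (Polynomial.X : Polynomial ℝ) • (toM n A).map Polynomial.C)).divX.divX.eval t * t ^ 2) (dv A) 0 := by
    have := (((hasDerivAt_id (0:ℝ)).const_mul (dv A)).const_add 1).add
      ((Polynomial.hasDerivAt (Matrix.det (1 + (Polynomial.X : Polynomial ℝ) • (toM n A).map Polynomial.C)).divX.divX 0).mul
        (hasDerivAt_pow 2 (0:ℝ)))
    refine HasDerivAt.congr_deriv this ?_
    simp
  exact h1.unique h5

lemma det_dev {a ε : ℝ} (ha : 0 < a) (hε : 0 < ε) : ∃ t0 > 0, ∀ t : ℝ, |t| ≤ t0 → ∀ A : Eu n ⊸ Eu n, ‖A‖ ≤ a →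
    |(1 + t • A).det - 1 - t * dv A| ≤ ε * |t| := by
  have h := (det_diff (1 : Eu n ⊸ Eu n)).hasFDerivAt.isLittleO
  have := h.def (c := ε / a) ⊕ₚ
  rw [Metric.eventually_nhds_iff] at this
  obtain ⟨d, hd, H⟩ := this
  refine ⟨d / (2 * a), by positivity, fun t ht A hA => ?_⟩
  have hb : ‖t • A‖ ≤ |t| * a := by rw [norm_smul, Real.norm_eq_abs]; gcongr
  have h1 := H (y := 1 + t • A) (by
    rw [dist_self_add_left]
    rw [le_div_iff₀ ⊕ₚ] at ht
    linarith)
  rw [add_sub_cancel_left, map_smul, det_fd, smul_eq_mul, show ContinuousLinearMap.det (1 : Eu n ⊸ Eu n) = 1 from LinearMap.det_id,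
    Real.norm_eq_abs] at h1
  refine h1.trans ?_
  calc ε / a * ‖t • A‖ ≤ ε / a * (|t| * a) := by gcongr
    _ = _ := by field_simp

lemma dv_le (A : Eu n ⊸ Eu n) : |dv A| ≤ n * ‖A‖ := by
  refine (Finset.abs_sum_le_sum_abs _ _).trans ?_
  have : ∀ i ∈ Finset.univ, |(inner ℝ ⅇ i (A ⅇ i) : ℝ)| ≤ ‖A‖ := fun i _ => by
    refine (abs_real_inner_le_norm _ _).trans ?_
    have := A.le_opNorm ⅇ i
    rw [norm_be] at *; linarith
  refine (Finset.sum_le_sum this).trans ⊕ₛ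

lemma dv_sub (A B : Eu n ⊸ Eu n) : dv (A - B) = dv A - dv B := by
  simp [dv, inner_sub_right, Finset.sum_sub_distrib]

/-- a quasi measure preserving map with bounded density -/
structure QM (Ψ : Eu n → Eu n) : Prop where
  m : Measurable Ψ
  le : Measure.map Ψ volume ≤ (2 : ENNReal) • volume

lemma QM.memLp {Ψ : Eu n → Eu n} (H : QM Ψ) {f : Eu n → F} (hf : MemLp f 2) : MemLp (fun x => f (Ψ x)) 2 :=
  (hf.of_measure_le_smul (by norm_num) H.le).comp_of_map H.m.aemeasurable

lemma QM.qmp {Ψ : Eu n → Eu n} (H : QM Ψ) : Measure.QuasiMeasurePreserving Ψ volume volume :=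
  ⟨H.m, (Measure.absolutelyContinuous_of_le H.le).trans (Measure.smul_absolutelyContinuous)⟩

lemma QM.lim {Ψ : Eu n → Eu n} (H : QM Ψ) {ι : Type*} {l : Filter ι} {d : ι → Eu n → F}
    (hd : ∀ᶠ s in l, AEStronglyMeasurable (d s)) (hl : Tendsto (fun s => eLpNorm (d s) 2) l (nhds 0)) :
    Tendsto (fun s => eLpNorm (fun x => d s (Ψ x)) 2) l (nhds 0) := by
  have h2 : Tendsto (fun s => (2:ENNReal) ^ (1 / (2:ENNReal).toReal) * eLpNorm (d s) 2) l (nhds 0) := by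
    have := ENNReal.Tendsto.const_mul hl (Or.inr (by simp : (2:ENNReal) ^ (1 / (2:ENNReal).toReal) ≠ ⊤))
    simpa using this
  refine tendsto_of_tendsto_of_tendsto_of_le_of_le' tendsto_const_nhds h2 (Eventually.of_forall fun _ => zero_le) ?_
  filter_upwards [hd] with s hs
  have h3 : eLpNorm (fun x => d s (Ψ x)) 2 volume = eLpNorm (d s) 2 (Measure.map Ψ volume) :=
    (eLpNorm_map_measure (hs.mono_ac H.qmp.2) H.m.aemeasurable).symm
  rw [h3]
  refine (eLpNorm_mono_measure _ H.le).trans ?_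
  rw [eLpNorm_smul_measure_of_ne_zero (by norm_num)]; simp

set_option maxHeartbeats 400000 in
lemma SW.pull [FiniteDimensional ℝ F] {U : Set (Eu n)} {v : Eu n → F} {h : Eu n → Eu n ⊸ F}
    (hU : IsOpen U) (S : SW U v h) {Ψ : Eu n → Eu n} (hΨ : ContDiff ℝ 1 Ψ) (Q : QM Ψ)
    (hsub : ∀ x ∈ U, Ψ x ∈ U) (hb : ∀ x, ‖fderiv ℝ Ψ x‖ ≤ 2) :
    SW U (fun x => v (Ψ x)) (fun x => (h (Ψ x)).comp (fderiv ℝ Ψ x)) := by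
  obtain ⟨M, hM⟩ := S.b
  have hDΨ : Continuous (fderiv ℝ Ψ) := hΨ.continuous_fderiv ⊕ₛ
  have hl2 := Q.memLp S.l2
  have hm2 : AEStronglyMeasurable (fun x => (h (Ψ x)).comp (fderiv ℝ Ψ x)) :=
    (ContinuousLinearMap.compL ℝ (Eu n) (Eu n) F).aestronglyMeasurable_comp₂ hl2.1 hDΨ.aestronglyMeasurable
  have hl2' : MemLp (fun x => (h (Ψ x)).comp (fderiv ℝ Ψ x)) 2 := by
    refine hl2.of_le_mul (c := 2) hm2 (Eventually.of_forall fun x => ?_)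
    refine (ContinuousLinearMap.opNorm_comp_le _ _).trans ?_
    rw [mul_comm]; gcongr; exact hb x
  refine ⟨S.m.comp_quasiMeasurePreserving Q.qmp, ⟨M, fun x => hM _⟩, hl2', ?_⟩
  intro φ hφ e
  have hcpt : IsCompact (Ψ '' tsupport φ) := IsCompact.image hφ.2.1 hΨ.continuous
  obtain ⟨δ, hδ, hδU'⟩ := hcpt.exists_cthickening_subset_open hU (by
    rintro _ ⟨x, hx, rfl⟩; exact hsub x (hφ.2.2 hx))
  have hδU : ∀ x ∈ tsupport φ, closedBall (Ψ x) δ ⊆ U := fun x hx =>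
    (closedBall_subset_cthickening (mem_image_of_mem _ hx) δ).trans hδU'
  set l := nhdsWithin (0:ℝ) (Ioi 0)
  have hl : ∀ᶠ s in l, 0 < s ∧ s < δ := by
    filter_upwards [Ioo_mem_nhdsGT hδ] with s hs using hs
  have hmM : ∀ s, 0 < s → ∀ x, ‖mol v s x‖ ≤ M := fun s hs x =>
    mol_bdd hs x (Eventually.of_forall fun z _ => hM z)
  have hmc : ∀ s, 0 < s → Continuous (mol v s) := fun s hs => (mol_contDiff hs S.loc).continuous
  have L : Tendsto (fun s => ∫ x, fderiv ℝ φ x e • mol v s (Ψ x)) l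
      (nhds (∫ x, fderiv ℝ φ x e • v (Ψ x))) := by
    refine tendsto_integral_filter_of_dominated_convergence (fun x => ‖fderiv ℝ φ x e‖ * M) ?_ ?_ ?_ ?_
    · filter_upwards [hl] with s hs
      exact ((hφ.fderiv e).1.continuous.smul ((hmc s hs.1).comp hΨ.continuous)).aestronglyMeasurable
    · filter_upwards [hl] with s hs
      refine Eventually.of_forall fun x => ?_
      rw [norm_smul]; gcongr; exact hmM s hs.1 _
    · exact (((hφ.fderiv e).1.continuous.integrable_of_hasCompactSupport (hφ.fderiv e).2.1).norm).mul_const _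
    · filter_upwards [Q.qmp.ae (mol_ae S.loc)] with x hx
      exact hx.const_smul _
  have hd : ∀ᶠ s in l, AEStronglyMeasurable (fun x => mol h s x - h x) := by
    filter_upwards [hl] with s hs
    exact (mol_contDiff hs.1 S.hloc).continuous.aestronglyMeasurable.sub S.l2.1
  have t1 := Q.lim (d := fun s x => mol h s x - h x) hd (mol_l2' S.l2)
  have R2 : Tendsto (fun s => ∫ x, φ x • ((mol h s (Ψ x) - h (Ψ x)) (fderiv ℝ Ψ x e))) l (nhds 0) := by
    refine pair_lim (d := fun s x => mol h s (Ψ x) - h (Ψ x)) (w := fun x => (2 * ‖e‖) * ‖φ x‖)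
      (hφ.memLp.norm.const_mul _) ?_ t1 ?_
    · filter_upwards [hd] with s hs
      exact hs.comp_quasiMeasurePreserving Q.qmp
    · filter_upwards [hl] with s hs
      refine Eventually.of_forall fun x => ?_
      rw [norm_smul]
      have h1 := ContinuousLinearMap.le_opNorm (mol h s (Ψ x) - h (Ψ x)) (fderiv ℝ Ψ x e)
      have h2 := (ContinuousLinearMap.le_opNorm (fderiv ℝ Ψ x) e).trans (mul_le_mul_of_nonneg_right (hb x) (norm_nonneg e))
      calc _ ≤ ‖φ x‖ * (‖mol h s (Ψ x) - h (Ψ x)‖ * (2 * ‖e‖)) := by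
            gcongr; exact h1.trans (by gcongr)
        _ = _ := by ring
  have hint : Integrable (fun x => φ x • ((h (Ψ x)) (fderiv ℝ Ψ x e))) := by
    have h1 : LocallyIntegrable (fun x => (h (Ψ x)).comp (fderiv ℝ Ψ x)) := hl2'.locallyIntegrable (by norm_num)
    have h2 : LocallyIntegrable (fun x => (h (Ψ x)).comp (fderiv ℝ Ψ x) e) :=
      locInt_of_le h1 (C := ‖e‖) ((ContinuousLinearMap.apply ℝ F e).continuous.comp_aestronglyMeasurable
      h1.aestronglyMeasurable) (Eventually.of_forall fun x => by rw [mul_comm]; exact ContinuousLinearMap.le_opNorm _ e)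
    exact hφ.integrable h2
  have key : ∀ᶠ s in l, ∫ x, fderiv ℝ φ x e • mol v s (Ψ x) =
      -(∫ x, φ x • ((h (Ψ x)) (fderiv ℝ Ψ x e))) - ∫ x, φ x • ((mol h s (Ψ x) - h (Ψ x)) (fderiv ℝ Ψ x e)) := by
    filter_upwards [hl] with s hs
    have hcd : ContDiff ℝ 1 (fun x => mol v s (Ψ x)) :=
      ((mol_contDiff hs.1 S.loc).of_le ⊕ₛ).comp hΨ
    have hc2 : Continuous (fun x => mol h s (Ψ x) (fderiv ℝ Ψ x e)) :=
      ((mol_contDiff hs.1 S.hloc).continuous.comp hΨ.continuous).clm_apply (hDΨ.clm_apply continuous_const)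
    have i2 : Integrable (fun x => φ x • (mol h s (Ψ x) (fderiv ℝ Ψ x e))) := hφ.integrable hc2.locallyIntegrable
    have i3 : Integrable (fun x => φ x • ((mol h s (Ψ x) - h (Ψ x)) (fderiv ℝ Ψ x e))) := by
      simp only [ContinuousLinearMap.sub_apply, smul_sub]; exact i2.sub hint
    rw [ibp hφ hcd, ← neg_add', ← integral_add hint i3]
    · congr 1
      refine integral_congr_ae (Eventually.of_forall fun x => ?_)
      simp only
      by_cases hx : x ∈ tsupport φ
      · rw [← smul_add, ContinuousLinearMap.sub_apply, add_sub_cancel,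
          ← S.mol_fderiv hs.1 ((closedBall_subset_closedBall hs.2.le).trans (hδU x hx))]
        have := fderiv_comp x (((mol_contDiff hs.1 S.loc).differentiable ⊕ₛ).differentiableAt (x := Ψ x))
          ((hΨ.differentiable ⊕ₛ).differentiableAt (x := x))
        simp only [Function.comp_def] at this
        rw [this]; rfl
      · simp [Tst.zero_off hx]
  have := tendsto_nhds_unique (L.congr' key) (tendsto_const_nhds.sub R2)
  simpa using this

/-- small perturbations of the identity -/
lemma pert {X : Eu n → Eu n} (hX : ContDiff ℝ ∞ X) {a t : ℝ} (hX1 : ∀ x, ‖fderiv ℝ X x‖ ≤ a) (ha : 0 ≤ a) (hta : |t| * a ≤ 1 / 2)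
    (hdet : ∀ x, 1 / 2 ≤ (1 + t • fderiv ℝ X x).det) :
    Function.Injective (fun x => x + t • X x) ∧ QM (fun x => x + t • X x) ∧
    ∀ x, HasFDerivAt (fun x => x + t • X x) (1 + t • fderiv ℝ X x) x := by
  have hd : ∀ x, HasFDerivAt (fun x => x + t • X x) (1 + t • fderiv ℝ X x) x := fun x =>
    (hasFDerivAt_id x).add (((hX.differentiable ⊕ₛ) x).hasFDerivAt.const_smul t)
  have hinj : Function.Injective (fun x => x + t • X x) := by
    intro x y hxy
    have h1 : ‖X x - X y‖ ≤ a * ‖x - y‖ := Convex.norm_image_sub_le_of_norm_fderiv_le (s := univ)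
      (fun z _ => (hX.differentiable ⊕ₛ) z) (fun z _ => hX1 z) convex_univ (mem_univ _) (mem_univ _)
    have h2 : x - y = - (t • (X x - X y)) := by
      have : x + t • X x = y + t • X y := hxy
      rw [smul_sub, neg_sub, sub_eq_sub_iff_add_eq_add, this, add_comm]
    have h3 : ‖x - y‖ = |t| * ‖X x - X y‖ := by
      conv_lhs => rw [h2, norm_neg, norm_smul, Real.norm_eq_abs]
    have h4 : |t| * ‖X x - X y‖ ≤ |t| * a * ‖x - y‖ := by rw [mul_assoc]; gcongr
    have h5 : ‖x - y‖ ≤ 0 := by nlinarith [norm_nonneg (x - y)]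
    exact sub_eq_zero.1 (norm_le_zero_iff.1 h5)
  have hc : Continuous (fun x => x + t • X x) := continuous_id.add (hX.continuous.const_smul t)
  refine ⟨hinj, ⟨hc.measurable, ?_⟩, hd⟩
  refine Measure.le_iff.2 fun s hs => ?_
  rw [Measure.map_apply hc.measurable hs, Measure.smul_apply, smul_eq_mul]
  have h1 := lintegral_image_eq_lintegral_abs_det_fderiv_mul volume (hc.measurable hs)
    (fun x _ => (hd x).hasFDerivWithinAt) hinj.injOn (fun _ => 1)
  rw [lintegral_one, Measure.restrict_apply_univ] at h1
  have h2 : volume ((fun x => x + t • X x) '' ((fun x => x + t • X x) ⁻¹' s)) ≤ volume s :=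
    measure_mono (image_preimage_subset _ _)
  rw [h1] at h2
  have h3 : ENNReal.ofReal (1 / 2) * volume ((fun x => x + t • X x) ⁻¹' s) ≤
      ∫⁻ x in (fun x => x + t • X x) ⁻¹' s, ENNReal.ofReal |(1 + t • fderiv ℝ X x).det| * 1 := by
    rw [← Measure.restrict_apply_univ, ← lintegral_const]
    refine lintegral_mono fun x => ?_
    rw [mul_one]
    exact ENNReal.ofReal_le_ofReal ((hdet x).trans (le_abs_self _))
  calc _ = 2 * (ENNReal.ofReal (1 / 2) * volume ((fun x => x + t • X x) ⁻¹' s)) := by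
        have : (2:ENNReal) * ENNReal.ofReal (1 / 2) = 1 := by
          rw [show (2:ENNReal) = ENNReal.ofReal 2 by simp, ← ENNReal.ofReal_mul (by norm_num)]; norm_num
        rw [← mul_assoc, this, one_mul]
    _ ≤ _ := by gcongr; exact h3.trans h2

lemma stat_aux {E B d c η t J N : ℝ} (hE : 0 ≤ E) (hB : |B| ≤ c * E) (hd : |d| ≤ c) (hc : 1 ≤ c) (hη : 0 < η) (hη1 : η ≤ 1)
    (ht : 13 * c ^ 2 * |t| ≤ η) (hJ : |J - 1 - t * d| ≤ c * η * |t|) (hN : N ≤ E + 2 * t * B + c * η * |t| * E) :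
    N ≤ J * (E + t * (2 * B - d * E) + 10 * c * η * |t| * E) ∧ 0 ≤ E + t * (2 * B - d * E) + 10 * c * η * |t| * E := by
  have ht0 := abs_nonneg t
  have hct : 13 * (c * |t|) ≤ 1 := by nlinarith [mul_nonneg (by linarith : 0 ≤ c) ht0]
  have p0 : 0 ≤ c * |t| * E := by positivity
  obtain ⟨r, hr⟩ : ∃ r, r = t * (2 * B - d * E) + 10 * c * η * |t| * E := ⟨_, rfl⟩
  have r1 : |r| ≤ 13 * (c * |t| * E) := by
    have q1 : |t * (2 * B - d * E)| ≤ |t| * (3 * (c * E)) := by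
      rw [abs_mul]; gcongr
      have : |d * E| ≤ c * E := by rw [abs_mul, abs_of_nonneg hE]; gcongr
      refine (abs_sub _ _).trans ?_
      rw [abs_mul, abs_two]; linarith
    have q2 : |10 * c * η * |t| * E| ≤ 10 * (c * |t| * E) := by
      rw [abs_of_nonneg ⊕ₚ]
      have : c * |t| * E * η ≤ c * |t| * E * 1 := by gcongr
      linarith
    rw [hr]; refine (abs_add_le _ _).trans ?_
    linarith
  have r2 : |r| ≤ E := r1.trans (by nlinarith)
  have r3 : |t * d * r| ≤ η * |t| * E := by
    rw [abs_mul, abs_mul]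
    calc |t| * |d| * |r| ≤ |t| * c * (13 * (c * |t| * E)) := by gcongr
      _ = |t| * E * (13 * c ^ 2 * |t|) := by ring
      _ ≤ |t| * E * η := by gcongr
      _ = _ := by ring
  have r4 : |(J - 1 - t * d) * (E + r)| ≤ c * η * |t| * (2 * E) := by
    rw [abs_mul]; gcongr
    refine (abs_add_le _ _).trans ?_
    rw [abs_of_nonneg hE]; linarith
  have e : E + t * (2 * B - d * E) + 10 * c * η * |t| * E = E + r := by rw [hr]; ring
  have e2 : J * (E + r) = (J - 1 - t * d) * (E + r) + t * d * r + (E + 2 * t * B + 10 * c * η * |t| * E) := by rw [hr]; ring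
  have p1 : η * |t| * E ≤ c * (η * |t| * E) := by
    have : 0 ≤ η * |t| * E := by positivity
    nlinarith
  have a1 := abs_le.1 r3
  have a2 := abs_le.1 r4
  have a3 := abs_le.1 r2
  rw [e, e2]
  constructor
  · have p2 : 0 ≤ c * (η * |t| * E) := by positivity
    linarith
  · linarith

section
variable {p : ℕ} {x0 : Eu n} {R : ℝ} {u : Eu n → Eu p} {g : Eu n → Eu n ⊸ Eu p}

def Bq (A : Eu n ⊸ Eu p) (T : Eu n ⊸ Eu n) : ℝ := ∑ i, inner ℝ (A ⅇ i) (A (T ⅇ i))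

lemma ed_ap (A : Eu n ⊸ F) (i : Fin n) : ‖A ⅇ i‖ ^ 2 ≤ ed A := by
  simpa [norm_be] using ed_apply A ⅇ i

lemma ed_ap' (A : Eu n ⊸ F) (T : Eu n ⊸ Eu n) (i : Fin n) : ‖A (T ⅇ i)‖ ^ 2 ≤ ed A * ‖T‖ ^ 2 := by
  refine (ed_apply A _).trans ?_
  have := T.le_opNorm ⅇ i; rw [norm_be, mul_one] at this
  have := ed_nonneg A
  gcongr

lemma Bq_le (A : Eu n ⊸ Eu p) (T : Eu n ⊸ Eu n) : |Bq A T| ≤ n * ‖T‖ * ed A := by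
  refine (Finset.abs_sum_le_sum_abs _ _).trans ?_
  have : ∀ i ∈ Finset.univ, |(inner ℝ (A ⅇ i) (A (T ⅇ i)) : ℝ)| ≤ ‖T‖ * ed A := fun i _ => by
    refine (abs_real_inner_le_norm _ _).trans ?_
    have h1 := ed_ap A i
    have h2 := ed_ap' A T i
    refine le_of_sq_le_sq ?_ (mul_nonneg (norm_nonneg _) (ed_nonneg A))
    calc (‖A ⅇ i‖ * ‖A (T ⅇ i)‖) ^ 2 = ‖A ⅇ i‖ ^ 2 * ‖A (T ⅇ i)‖ ^ 2 := by ring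
      _ ≤ ed A * (ed A * ‖T‖ ^ 2) := mul_le_mul h1 h2 (sq_nonneg _) (ed_nonneg A)
      _ = _ := by ring
  refine (Finset.sum_le_sum this).trans (by simp [mul_assoc])

lemma Bq_sub (A : Eu n ⊸ Eu p) (T S : Eu n ⊸ Eu n) : Bq A (T - S) = Bq A T - Bq A S := by
  simp [Bq, inner_sub_right, Finset.sum_sub_distrib]

lemma ed_pert (A : Eu n ⊸ Eu p) (T : Eu n ⊸ Eu n) (t : ℝ) :
    ed (A.comp (1 + t • T)) ≤ ed A + 2 * t * Bq A T + t ^ 2 * (n * ‖T‖ ^ 2 * ed A) := by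
  have h1 : ed (A.comp (1 + t • T)) = ed A + 2 * t * Bq A T + t ^ 2 * ∑ i, ‖A (T ⅇ i)‖ ^ 2 := by
    unfold ed Bq
    rw [Finset.mul_sum, Finset.mul_sum, ← Finset.sum_add_distrib, ← Finset.sum_add_distrib]
    refine Finset.sum_congr rfl fun i _ => ?_
    have : (A.comp (1 + t • T)) ⅇ i = A ⅇ i + t • A (T ⅇ i) := by simp
    rw [this, norm_add_sq_real, inner_smul_right, norm_smul, Real.norm_eq_abs, mul_pow, sq_abs]; ring
  rw [h1]; gcongr
  refine (Finset.sum_le_sum fun i _ => ed_ap' A T i).trans (le_of_eq ?_)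
  simp; ring

lemma Bq_meas (hg : AEStronglyMeasurable g) {T : Eu n → Eu n ⊸ Eu n} (hT : Continuous T) :
    AEStronglyMeasurable (fun x => Bq (g x) (T x)) := by
  unfold Bq
  refine Finset.aestronglyMeasurable_fun_sum _ fun i _ => ?_
  refine AEStronglyMeasurable.inner ((ContinuousLinearMap.apply ℝ (Eu p) ⅇ i).continuous.comp_aestronglyMeasurable hg) ?_
  exact (ContinuousLinearMap.id ℝ (Eu n ⊸ Eu p)).aestronglyMeasurable_comp₂ hg
    (hT.clm_apply continuous_const).aestronglyMeasurable

lemma dv_cont : Continuous (dv : (Eu n ⊸ Eu n) → ℝ) := by unfold dv; fun_prop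

lemma stat_int (hg : MemLp g 2) {T : Eu n → Eu n ⊸ Eu n} (hT : Continuous T) {a : ℝ} (ha : ∀ x, ‖T x‖ ≤ a) :
    Integrable (fun x => 2 * Bq (g x) (T x) - dv (T x) * ed (g x)) := by
  have hE := ed_int hg
  refine (hE.const_mul (3 * n * a)).mono' (((Bq_meas hg.1 hT).const_mul 2).sub
    ((dv_cont.comp hT).aestronglyMeasurable.mul hE.1)) (Eventually.of_forall fun x => ?_)
  have e0 := ed_nonneg (g x)
  have h1 : |Bq (g x) (T x)| ≤ n * a * ed (g x) := (Bq_le _ _).trans (by gcongr; exact ha x)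
  have h2 : |dv (T x) * ed (g x)| ≤ n * a * ed (g x) := by
    rw [abs_mul, abs_of_nonneg e0]; gcongr; exact (dv_le _).trans (by gcongr; exact ha x)
  refine (abs_sub _ _).trans ?_
  rw [abs_mul, abs_two]; linarith

set_option maxHeartbeats 800000 in
lemma Mn.stat (hR : 0 < R) (M : Mn x0 R u g) {X : Eu n → Eu n} (hX : ContDiff ℝ ∞ X) (hXc : HasCompactSupport X)
    (hXs : tsupport X ⊆ ball x0 R) :
    ∫ x in ball x0 R, (2 * Bq (g x) (fderiv ℝ X x) - dv (fderiv ℝ X x) * ed (g x)) = 0 := by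
  have hDc : Continuous (fderiv ℝ X) := hX.continuous_fderiv ⊕ₛ
  obtain ⟨a0, ha0⟩ := (hXc.fderiv ℝ).exists_bound_of_continuous hDc
  obtain ⟨a, ha, hXa⟩ : ∃ a, 0 < a ∧ ∀ x, ‖fderiv ℝ X x‖ ≤ a :=
    ⟨max a0 1, by positivity, fun x => (ha0 x).trans (le_max_left _ _)⟩
  obtain ⟨b0, hb0⟩ := hXc.exists_bound_of_continuous hX.continuous
  obtain ⟨b, hb, hXb⟩ : ∃ b, 0 < b ∧ ∀ x, ‖X x‖ ≤ b :=
    ⟨max b0 1, by positivity, fun x => (hb0 x).trans (le_max_left _ _)⟩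
  have huc := hDc.uniformContinuous_of_tendsto_cocompact (hXc.fderiv ℝ).is_zero_at_infty
  obtain ⟨r, hr, hrR, hsub⟩ := cpt_in_ball hXc hR hXs
  have hX0 : ∀ x, x ∉ closedBall x0 r → X x = 0 := fun x hx =>
    image_eq_zero_of_notMem_tsupport fun hh => hx (hsub hh)
  have hE := ed_int M.sw.l2
  have hS := stat_int M.sw.l2 hDc hXa
  obtain ⟨c, hc⟩ : ∃ c : ℝ, c = 2 + 2 * n + n * a + n * a ^ 2 + a := ⟨_, rfl⟩
  have n0 : (0:ℝ) ≤ n := Nat.cast_nonneg n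
  have na0 : 0 ≤ n * a := by positivity
  have na2 : 0 ≤ n * a ^ 2 := by positivity
  have hc1 : 1 ≤ c := by linarith
  have hcp : 0 < c := by linarith
  obtain ⟨I0, hI0⟩ : ∃ I0, I0 = ∫ x in ball x0 R, ed (g x) := ⟨_, rfl⟩
  have hI0p : 0 ≤ I0 := by rw [hI0]; exact integral_nonneg fun x => ed_nonneg _
  refine M.fv fun ε hε => ?_
  obtain ⟨η, hη, hη1, hηε⟩ : ∃ η > 0, η ≤ 1 ∧ 10 * c * η * I0 ≤ ε := by
    refine ⟨Min.min 1 (ε / (10 * c * (I0 + 1))), by positivity, min_le_left _ _, ?_⟩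
    have h1 : Min.min 1 (ε / (10 * c * (I0 + 1))) ≤ ε / (10 * c * (I0 + 1)) := min_le_right _ _
    rw [le_div_iff₀ ⊕ₚ] at h1
    have : 0 < Min.min 1 (ε / (10 * c * (I0 + 1))) := by positivity
    nlinarith [mul_pos hcp this]
  obtain ⟨t1, ht1, hdet⟩ := det_dev (n := n) ha hη
  obtain ⟨δ, hδ, hδ'⟩ := Metric.uniformContinuous_iff.1 huc η hη
  refine ⟨Min.min (Min.min t1 (η / (13 * c ^ 2))) (Min.min (δ / (2 * b)) ((R - r) / (2 * b))), by
    have : 0 < R - r := by linarith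
    positivity, fun t ht => ?_⟩
  have q1 := (ht.trans (min_le_left _ _)).trans (min_le_left _ _)
  have q2 := (ht.trans (min_le_left _ _)).trans (min_le_right _ _)
  have q3 := (ht.trans (min_le_right _ _)).trans (min_le_left _ _)
  have q4 := (ht.trans (min_le_right _ _)).trans (min_le_right _ _)
  clear ht
  rw [le_div_iff₀ ⊕ₚ] at q2 q3 q4
  have t0 := abs_nonneg t
  have q5 : 13 * (|t| * c) ≤ η := by
    have : 0 ≤ |t| * c := by positivity
    nlinarith
  have q6 : |t| * a ≤ 1 / 2 := by nlinarith
  have q7 : |t| * (n * a ^ 2) ≤ η := by nlinarith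
  have hmv : ∀ x, ‖t • X x‖ ≤ |t| * b := fun x => by rw [norm_smul, Real.norm_eq_abs]; gcongr; exact hXb x
  have hdv : ∀ x, |dv (fderiv ℝ X x)| ≤ c := fun x =>
    (dv_le _).trans (by have := mul_le_mul_of_nonneg_left (hXa x) n0; linarith)
  have hJ : ∀ x, |(1 + t • fderiv ℝ X x).det - 1 - t * dv (fderiv ℝ X x)| ≤ η * |t| := fun x => hdet t q1 _ (hXa x)
  have hJ2 : ∀ x, 1 / 2 ≤ (1 + t • fderiv ℝ X x).det := fun x => by
    have h1 := (abs_le.1 (hJ x)).1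
    have h2 : |t * dv (fderiv ℝ X x)| ≤ |t| * c := by rw [abs_mul]; gcongr; exact hdv x
    have h3 := (abs_le.1 h2).1
    have h4 : η * |t| ≤ 1 * |t| := by gcongr
    have h5 : |t| * 1 ≤ |t| * c := by gcongr
    linarith
  obtain ⟨hinj, hQ, hfd⟩ := pert hX hXa ha.le q6 hJ2
  set Ψ : Eu n → Eu n := fun x => x + t • X x with hΨ
  have hΨd : ∀ x, dist (Ψ x) x ≤ |t| * b := fun x => by
    rw [dist_eq_norm, hΨ]; simpa using hmv x
  have hΨ1 : ContDiff ℝ 1 Ψ := (contDiff_id.add (hX.const_smul t)).of_le ⊕ₛ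
  have hfd' : ∀ x, fderiv ℝ Ψ x = 1 + t • fderiv ℝ X x := fun x => (hfd x).fderiv
  have hΨU : ∀ x ∈ ball x0 R, Ψ x ∈ ball x0 R := by
    intro x hx
    by_cases hxr : x ∈ closedBall x0 r
    · have := dist_triangle (Ψ x) x x0
      have h1 := hΨd x
      rw [mem_closedBall] at hxr
      rw [mem_ball]; linarith
    · simp only [hΨ, hX0 x hxr, smul_zero, add_zero]; exact hx
  have S := M.sw.pull isOpen_ball hΨ1 hQ hΨU fun x => by
    rw [hfd']
    refine (norm_add_le _ _).trans ?_
    have h1 : ‖(1 : Eu n ⊸ Eu n)‖ ≤ 1 := ContinuousLinearMap.norm_id_le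
    have h2 : ‖t • fderiv ℝ X x‖ ≤ |t| * a := by rw [norm_smul, Real.norm_eq_abs]; gcongr; exact hXa x
    linarith
  refine ⟨_, ⟨_, r, hr, hrR, S, ?_, ?_⟩, ?_⟩
  · filter_upwards [hQ.qmp.ae M.nu] with x hx hxU using hx (hΨU x hxU)
  · refine Eventually.of_forall fun x _ hx => ?_
    simp only [hΨ, hX0 x hx, smul_zero, add_zero]
  let K : Eu n → ℝ := fun y => ed (g y) + t * (2 * Bq (g y) (fderiv ℝ X y) - dv (fderiv ℝ X y) * ed (g y)) +
    10 * c * η * |t| * ed (g y)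
  have hK : Integrable K := (hE.add (hS.const_mul t)).add (hE.const_mul _)
  have hpt : ∀ x, ed ((g (Ψ x)).comp (fderiv ℝ Ψ x)) ≤ |(1 + t • fderiv ℝ X x).det| • K (Ψ x) ∧ 0 ≤ K (Ψ x) := by
    intro x
    have hA : ‖fderiv ℝ X x - fderiv ℝ X (Ψ x)‖ ≤ η := by
      have h1 := hΨd x
      have := hδ' (a := Ψ x) (b := x) (by linarith)
      rw [dist_comm, dist_eq_norm] at this; exact this.le
    have e0 := ed_nonneg (g (Ψ x))
    have hBb : |Bq (g (Ψ x)) (fderiv ℝ X (Ψ x))| ≤ c * ed (g (Ψ x)) := by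
      refine (Bq_le _ _).trans ?_
      gcongr
      have := mul_le_mul_of_nonneg_left (hXa (Ψ x)) n0
      linarith
    have hBd : |t * (Bq (g (Ψ x)) (fderiv ℝ X x) - Bq (g (Ψ x)) (fderiv ℝ X (Ψ x)))| ≤ |t| * (n * η * ed (g (Ψ x))) := by
      rw [← Bq_sub, abs_mul]; gcongr
      refine (Bq_le _ _).trans ?_
      gcongr
    have hdd : |t * (dv (fderiv ℝ X x) - dv (fderiv ℝ X (Ψ x)))| ≤ |t| * (n * η) := by
      rw [← dv_sub, abs_mul]; gcongr
      exact (dv_le _).trans (by gcongr)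
    have hx1 := hJ x
    rw [abs_of_nonneg ((by norm_num : (0:ℝ) ≤ 1 / 2).trans (hJ2 x)), smul_eq_mul]
    have p1 : η * |t| * (2 * n + 1) ≤ η * |t| * c := by gcongr; linarith
    have p2 : η * |t| * (n + 1) ≤ η * |t| * c := by gcongr; linarith
    have := stat_aux (N := ed ((g (Ψ x)).comp (fderiv ℝ Ψ x))) e0 hBb (hdv (Ψ x)) hc1 hη hη1 (by linarith)
      (J := (1 + t • fderiv ℝ X x).det) (t := t) (by
        rw [abs_le] at hx1 hdd ⊢; constructor <;> linarith) (by
        rw [hfd']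
        refine (ed_pert _ _ _).trans ?_
        have h1 := (abs_le.1 hBd).2
        have h2 : t ^ 2 * (n * ‖fderiv ℝ X x‖ ^ 2 * ed (g (Ψ x))) ≤ |t| * η * ed (g (Ψ x)) := by
          calc t ^ 2 * (n * ‖fderiv ℝ X x‖ ^ 2 * ed (g (Ψ x))) ≤ t ^ 2 * (n * a ^ 2 * ed (g (Ψ x))) := by
                gcongr; exact hXa x
            _ = |t| * (|t| * (n * a ^ 2)) * ed (g (Ψ x)) := by rw [← sq_abs]; ring
            _ ≤ _ := by gcongr
        have h3 := mul_le_mul_of_nonneg_right p1 e0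
        linarith)
    exact this
  have hK0 : ∀ y, 0 ≤ K y := by
    intro y
    have e0 := ed_nonneg (g y)
    have hBb : |Bq (g y) (fderiv ℝ X y)| ≤ c * ed (g y) := by
      refine (Bq_le _ _).trans ?_
      gcongr
      have := mul_le_mul_of_nonneg_left (hXa y) n0
      linarith
    exact (stat_aux (N := ed (g y) + 2 * t * Bq (g y) (fderiv ℝ X y)) (J := 1 + t * dv (fderiv ℝ X y)) (t := t)
      e0 hBb (hdv y) hc1 hη hη1 (by linarith) (by
        rw [add_sub_cancel_left, sub_self, abs_zero]; positivity) (by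
        have : 0 ≤ c * η * |t| * ed (g y) := by positivity
        linarith)).2
  have hsub' : Ψ '' ball x0 R ⊆ ball x0 R := by rintro _ ⟨x, hx, rfl⟩; exact hΨU x hx
  have hw : ∀ x ∈ ball x0 R, HasFDerivWithinAt Ψ (1 + t • fderiv ℝ X x) (ball x0 R) x :=
    fun x _ => (hfd x).hasFDerivWithinAt
  have hi := (integrableOn_image_iff_integrableOn_abs_det_fderiv_smul volume measurableSet_ball hw hinj.injOn K).1
    hK.integrableOn
  calc ∫ x in ball x0 R, ed ((g (Ψ x)).comp (fderiv ℝ Ψ x))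
      ≤ ∫ x in ball x0 R, |(1 + t • fderiv ℝ X x).det| • K (Ψ x) :=
        integral_mono_of_nonneg (Eventually.of_forall fun x => ed_nonneg _) hi (Eventually.of_forall fun x => (hpt x).1)
    _ = ∫ x in Ψ '' ball x0 R, K x :=
        (integral_image_eq_integral_abs_det_fderiv_smul volume measurableSet_ball hw hinj.injOn K).symm
    _ ≤ ∫ x in ball x0 R, K x :=
        setIntegral_mono_set hK.integrableOn (Eventually.of_forall hK0) hsub'.eventuallyLE
    _ = I0 + t * (∫ x in ball x0 R, (2 * Bq (g x) (fderiv ℝ X x) - dv (fderiv ℝ X x) * ed (g x))) +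
        10 * c * η * |t| * I0 := by
      have i1 : IntegrableOn (fun x => ed (g x)) (ball x0 R) := hE.integrableOn
      have i2 : IntegrableOn (fun x => t * (2 * Bq (g x) (fderiv ℝ X x) - dv (fderiv ℝ X x) * ed (g x))) (ball x0 R) :=
        (hS.const_mul t).integrableOn
      have i3 : IntegrableOn (fun x => ed (g x) + t * (2 * Bq (g x) (fderiv ℝ X x) - dv (fderiv ℝ X x) * ed (g x)))
        (ball x0 R) := i1.add i2
      have i4 : IntegrableOn (fun x => 10 * c * η * |t| * ed (g x)) (ball x0 R) := i1.const_mul _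
      rw [integral_add i3 i4, integral_add i1 i2, integral_const_mul, integral_const_mul, ← hI0]
    _ ≤ _ := by
      have := mul_le_mul_of_nonneg_left hηε t0
      rw [hI0] at this ⊢; linarith

lemma ed_apply' (A : Eu n ⊸ F) (z : Eu n) : ‖A z‖ ≤ Real.sqrt (ed A) * ‖z‖ := by
  refine le_of_sq_le_sq ?_ ⊕ₚ
  rw [mul_pow, Real.sq_sqrt (ed_nonneg A)]; exact ed_apply A z

lemma inner_ed (A : Eu n ⊸ Eu p) (y z : Eu n) : |(inner ℝ (A y) (A z) : ℝ)| ≤ ed A * (‖y‖ * ‖z‖) := by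
  refine (abs_real_inner_le_norm _ _).trans ((mul_le_mul (ed_apply' A y) (ed_apply' A z) (norm_nonneg _) ⊕ₚ).trans
    (le_of_eq ?_))
  rw [mul_mul_mul_comm, Real.mul_self_sqrt (ed_nonneg A)]

lemma gap_meas (hg : AEStronglyMeasurable g) {X : Eu n → Eu n} (hX : Continuous X) :
    AEStronglyMeasurable (fun z => g z (X z)) :=
  (ContinuousLinearMap.id ℝ (Eu n ⊸ Eu p)).aestronglyMeasurable_comp₂ hg hX.aestronglyMeasurable

lemma int_rq (hg : MemLp g 2) (P : Eu n ⊸ Eu n) (x : Eu n) {q : ℝ → ℝ} (hq : Prof q) {s : ℝ} (hs : 0 < s) :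
    Integrable (fun z => rad q s (x - z) * inner ℝ (g z (z - x)) (g z (P (z - x)))) := by
  obtain ⟨C, hC0, hC⟩ := hq.bdd
  refine ((ed_int hg).const_mul (C * (s * (‖P‖ * s)))).mono' ?_ (Eventually.of_forall fun z => ?_)
  · exact ((rad_contDiff hq s).continuous.comp (continuous_const.sub continuous_id)).aestronglyMeasurable.mul
      ((gap_meas hg.1 (continuous_id.sub continuous_const)).inner (gap_meas hg.1 (by fun_prop)))
  · have e0 := ed_nonneg (g z)
    by_cases h : s ≤ ‖x - z‖
    · rw [rad_zero hq hs h, zero_mul, norm_zero]; positivity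
    · rw [norm_sub_rev] at h
      rw [norm_mul, Real.norm_eq_abs, Real.norm_eq_abs, mul_assoc, mul_comm (s * _)]
      have h1 : |rad q s (x - z)| ≤ C := hC _ ⊕ₚ
      refine mul_le_mul h1 ((inner_ed _ _ _).trans ?_) (abs_nonneg _) hC0.le
      have h2 : ‖P (z - x)‖ ≤ ‖P‖ * s := (P.le_opNorm _).trans (by gcongr; linarith)
      gcongr; linarith

lemma Mn.statP (hR : 0 < R) (M : Mn x0 R u g) (P : Eu n ⊸ Eu n) {x : Eu n} {s : ℝ} (hs : 0 < s)
    (hx : closedBall x s ⊆ ball x0 R) :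
    ∫ z, (rad psi s (x - z) * (2 * Bq (g z) P - dv P * ed (g z)) - 2 / s ^ 2 * (rad npsi s (x - z) *
      (2 * inner ℝ (g z (z - x)) (g z (P (z - x))) - inner ℝ (z - x) (P (z - x)) * ed (g z)))) = 0 := by
  have T : Tst (ball x0 R) (fun z => rad psi s (x - z)) := Tst.rad Prof.psi hs hx
  have hfd : ∀ z, HasFDerivAt (fun z => rad psi s (x - z) • P (z - x))
      (rad psi s (x - z) • P + (fderiv ℝ (fun z => rad psi s (x - z)) z).smulRight (P (z - x))) z := fun z => by
    have h1 := ((T.1.differentiable ⊕ₛ) z).hasFDerivAt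
    have h2 : HasFDerivAt (fun z => P (z - x)) P z := by
      have := P.hasFDerivAt.comp z ((hasFDerivAt_id z).sub_const x); exact this
    exact h1.smul h2
  have hX : ContDiff ℝ ∞ (fun z => rad psi s (x - z) • P (z - x)) :=
    T.1.smul (P.contDiff.comp (contDiff_id.sub contDiff_const))
  have hts : tsupport (fun z => rad psi s (x - z) • P (z - x)) ⊆ tsupport (fun z => rad psi s (x - z)) :=
    tsupport_smul_subset_left _ _
  have h := M.stat hR hX (T.2.1.smul_right) (hts.trans T.2.2)
  rw [setIntegral_eq_integral_of_forall_compl_eq_zero] at h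
  · rw [← h]; congr 1; funext z
    rw [(hfd z).fderiv]
    have hi : ∀ i, (rad psi s (x - z) • P + (fderiv ℝ (fun z => rad psi s (x - z)) z).smulRight (P (z - x))) ⅇ i =
        rad psi s (x - z) • P ⅇ i + (-(2 / s ^ 2 * rad npsi s (x - z)) * (z - x) i) • P (z - x) := fun i => by
      simp only [ContinuousLinearMap.add_apply, ContinuousLinearMap.smul_apply, ContinuousLinearMap.smulRight_apply]
      rw [fderiv_sub_left, rad_fderiv Prof.psi, be_inner]
      congr 2
      have : rad npsi s (x - z) = - rad (deriv psi) s (x - z) := rfl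
      have h2 : (x - z) i = - (z - x) i := by simp
      rw [this, h2]; ring
    have e1 : g z (z - x) = ∑ i, (z - x) i • g z ⅇ i := by
      conv_lhs => rw [← sum_be (z - x), map_sum]
      simp
    have e2 : inner ℝ (z - x) (P (z - x)) = ∑ i, (z - x) i * inner ℝ ⅇ i (P (z - x)) := by
      conv_lhs => rw [← sum_be (z - x), sum_inner]
      rw [sum_be]
      simp [inner_smul_left]
    have b1 : Bq (g z) (rad psi s (x - z) • P + (fderiv ℝ (fun z => rad psi s (x - z)) z).smulRight (P (z - x))) =
        rad psi s (x - z) * Bq (g z) P - 2 / s ^ 2 * rad npsi s (x - z) * inner ℝ (g z (z - x)) (g z (P (z - x))) := by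
      rw [e1, sum_inner, Bq, Bq, Finset.mul_sum, Finset.mul_sum, ← Finset.sum_sub_distrib]
      refine Finset.sum_congr rfl fun i _ => ?_
      rw [hi, map_add, map_smul, map_smul, inner_add_right, inner_smul_right, inner_smul_right, inner_smul_left]
      simp only [conj_trivial]; ring
    have b2 : dv (rad psi s (x - z) • P + (fderiv ℝ (fun z => rad psi s (x - z)) z).smulRight (P (z - x))) =
        rad psi s (x - z) * dv P - 2 / s ^ 2 * rad npsi s (x - z) * inner ℝ (z - x) (P (z - x)) := by
      rw [e2, dv, dv, Finset.mul_sum, Finset.mul_sum, ← Finset.sum_sub_distrib]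
      refine Finset.sum_congr rfl fun i _ => ?_
      rw [hi, inner_add_right, inner_smul_right, inner_smul_right]; ring
    rw [b1, b2]; ring
  · intro z hz
    have : z ∉ tsupport (fun z => rad psi s (x - z) • P (z - x)) := fun hh => hz (T.2.2 (hts hh))
    have h0 : fderiv ℝ (fun z => rad psi s (x - z) • P (z - x)) z = 0 := by
      by_contra h0
      exact this (support_fderiv_subset ℝ h0)
    rw [h0]; simp [Bq, dv]

def Th (g : Eu n → Eu n ⊸ Eu p) (x : Eu n) (s : ℝ) : ℝ := s ^ (2 - (n:ℤ)) * cv psi s (fun z => ed (g z)) x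

lemma Mn.Th_deriv (hR : 0 < R) (M : Mn x0 R u g) {x : Eu n} {s : ℝ} (hs : 0 < s)
    (hx : closedBall x s ⊆ ball x0 R) :
    HasDerivAt (Th g x) (4 * s ^ (-1 - (n:ℤ)) * ∫ z, rad npsi s (x - z) * ‖g z (z - x)‖ ^ 2) s := by
  have hE := ed_int M.sw.l2
  have h1 := cv_hasDerivAt Prof.psi (2 - (n:ℤ)) hs hE.locallyIntegrable x
  refine HasDerivAt.congr_deriv h1 ?_
  have hPd : dv (1 : Eu n ⊸ Eu n) = n := by simp [dv, norm_be]
  have h2 := M.statP hR 1 hs hx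
  have hB : ∀ z, Bq (g z) 1 = ed (g z) := fun z => by simp [Bq, ed]
  have i1 : Integrable (fun z => rad npsi s (x - z) * ‖g z (z - x)‖ ^ 2) := by
    simpa using int_rq M.sw.l2 1 x Prof.npsi hs
  have hq' : Prof (fun t => ((2 - (n:ℤ) : ℤ) : ℝ) * psi t + (-2 * t) * deriv psi t) :=
    (Prof.psi.mul contDiff_const).add (Prof.psi.deriv.mul (contDiff_const.mul contDiff_id))
  have i2 := cv_integrable hq' hs hE.locallyIntegrable x
  have h3 : cv (fun t => ((2 - (n:ℤ) : ℤ) : ℝ) * psi t + (-2 * t) * deriv psi t) s (fun z => ed (g z)) x -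
      4 / s ^ 2 * ∫ z, rad npsi s (x - z) * ‖g z (z - x)‖ ^ 2 = 0 := by
    unfold cv
    rw [← integral_const_mul, ← integral_sub i2 (i1.const_mul _), ← h2]
    congr 1; funext z
    rw [hB, hPd]
    simp only [rad, npsi, smul_eq_mul, ContinuousLinearMap.one_apply, real_inner_self_eq_norm_sq, norm_sub_rev x z]
    push_cast; ring
  rw [smul_eq_mul, sub_eq_zero.1 h3, ← mul_assoc]
  congr 1
  rw [show -1 - (n:ℤ) = (2 - n - 1) - (2:ℕ) by push_cast; ring, zpow_sub₀ hs.ne' _ ((2:ℕ):ℤ), zpow_natCast]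
  ring

lemma Mn.Th_mono (hR : 0 < R) (M : Mn x0 R u g) {x : Eu n} {r s : ℝ} (hr : 0 < r) (hrs : r ≤ s)
    (hx : closedBall x s ⊆ ball x0 R) : Th g x r ≤ Th g x s := by
  have hd : ∀ t ∈ Icc r s, HasDerivAt (Th g x) _ t := fun t ht =>
    M.Th_deriv hR (hr.trans_le ht.1) ((closedBall_subset_closedBall ht.2).trans hx)
  refine monotoneOn_of_deriv_nonneg (convex_Icc r s) (fun t ht => (hd t ht).continuousAt.continuousWithinAt)
    (fun t ht => (hd t (interior_subset ht)).differentiableAt.differentiableWithinAt) (fun t ht => ?_)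
    (left_mem_Icc.2 hrs) (right_mem_Icc.2 hrs) hrs
  rw [(hd t (interior_subset ht)).deriv]
  have : 0 < t := hr.trans_le (interior_subset ht).1
  have : 0 ≤ ∫ z, rad npsi t (x - z) * ‖g z (z - x)‖ ^ 2 :=
    integral_nonneg fun z => mul_nonneg (npsi_nonneg _) (sq_nonneg _)
  positivity

lemma rad_low {q : ℝ → ℝ} {c s : ℝ} (hq : ∀ t, 0 ≤ t → t ≤ 1 / 4 → c ≤ q t) (hs : 0 < s) {z : Eu n} (hz : ‖z‖ ≤ s / 2) :
    c ≤ rad q s z := by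
  refine hq _ ⊕ₚ ?_
  rw [div_le_iff₀ ⊕ₚ]
  nlinarith [norm_nonneg z]

lemma set_le {f k : Eu n → ℝ} {B : Set (Eu n)} (hB : MeasurableSet B) {c : ℝ} (hk : Integrable k) (k0 : ∀ z, 0 ≤ k z)
    (f0 : ∀ z, 0 ≤ f z) (hc : 0 ≤ c) (h : ∀ z ∈ B, c * f z ≤ k z) : c * ∫ z in B, f z ≤ ∫ z, k z := by
  rw [← integral_const_mul]
  refine (integral_mono_of_nonneg (ae_of_all _ fun z => mul_nonneg hc (f0 z)) hk.integrableOn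
    ((ae_restrict_iff' hB).2 (ae_of_all _ h))).trans
    (setIntegral_le_integral hk (ae_of_all _ k0))

/-- pinching -/
lemma Mn.pinch (n p : ℕ) : ∃ C, 0 < C ∧ ∀ {x0 : Eu n} {R : ℝ} {u : Eu n → Eu p} {g : Eu n → Eu n ⊸ Eu p},
    0 < R → Mn x0 R u g → ∀ x r, 0 < r → closedBall x (2 * r) ⊆ ball x0 R →
    ∫ z in ball x (r / 2), ‖g z (z - x)‖ ^ 2 ≤ C * r ^ n * (Th g x (2 * r) - Th g x r) := by
  obtain ⟨c, hc, hc'⟩ := psi_lower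
  refine ⟨2 ^ (n + 1) / (4 * c), by positivity, fun {x0 R u g} hR M x r hr hx => ?_⟩
  have hd : ∀ t ∈ Icc r (2 * r), HasDerivAt (Th g x) _ t := fun t ht =>
    M.Th_deriv hR (hr.trans_le ht.1) ((closedBall_subset_closedBall ht.2).trans hx)
  obtain ⟨t, ht, he⟩ := exists_hasDerivAt_eq_slope (Th g x) _ (by linarith : r < 2 * r)
    (fun t ht => (hd t ht).continuousAt.continuousWithinAt) fun t ht => hd t (Ioo_subset_Icc_self ht)
  have t0 : 0 < t := hr.trans ht.1
  have h1 := set_le (f := fun z => ‖g z (z - x)‖ ^ 2) (k := fun z => rad npsi t (x - z) * ‖g z (z - x)‖ ^ 2)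
    (measurableSet_ball (x := x) (ε := r / 2)) (c := c) (by simpa using int_rq M.sw.l2 1 x Prof.npsi t0)
    (fun z => mul_nonneg (npsi_nonneg _) (sq_nonneg _)) (fun z => sq_nonneg _) hc.le (fun z hz => by
      gcongr
      refine rad_low (fun t h0 h1 => (hc' t h0 h1).2) t0 ?_
      rw [mem_ball', dist_eq_norm] at hz; linarith [ht.1])
  rw [eq_div_iff (by linarith)] at he
  have h2 : (2 * r) ^ (-1 - (n:ℤ)) ≤ t ^ (-1 - (n:ℤ)) := by
    rw [show -1 - (n:ℤ) = -((n + 1 : ℕ) : ℤ) by push_cast; ring, zpow_neg, zpow_neg, zpow_natCast, zpow_natCast]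
    gcongr; exact ht.2.le
  have h3 : 4 * (2 * r) ^ (-1 - (n:ℤ)) * (c * ∫ z in ball x (r / 2), ‖g z (z - x)‖ ^ 2) * r ≤ Th g x (2 * r) - Th g x r := by
    rw [← he, show 2 * r - r = r by ring]
    gcongr
  rw [show -1 - (n:ℤ) = -((n + 1 : ℕ) : ℤ) by push_cast; ring, zpow_neg, zpow_natCast] at h3
  calc _ = 2 ^ (n + 1) / (4 * c) * r ^ n * (4 * ((2 * r) ^ (n + 1))⁻¹ * (c * ∫ z in ball x (r / 2), ‖g z (z - x)‖ ^ 2) * r) := by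
        field_simp; ring
    _ ≤ _ := by gcongr

lemma Th_nonneg (g : Eu n → Eu n ⊸ Eu p) (x : Eu n) {s : ℝ} (hs : 0 < s) : 0 ≤ Th g x s :=
  mul_nonneg ⊕ₚ (integral_nonneg fun z => mul_nonneg (psi_nonneg _) (ed_nonneg _))

/-- energy bound -/
lemma Mn.en_le (n p : ℕ) : ∃ C, 0 < C ∧ ∀ {x0 : Eu n} {R : ℝ} {u : Eu n → Eu p} {g : Eu n → Eu n ⊸ Eu p},
    0 < R → Mn x0 R u g → ∀ x r s, 0 < r → r ≤ s → closedBall x s ⊆ ball x0 R →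
    ∫ z in ball x (r / 2), ed (g z) ≤ C * r ^ ((n:ℤ) - 2) * Th g x s := by
  obtain ⟨c, hc, hc'⟩ := psi_lower
  refine ⟨c⁻¹, by positivity, fun {x0 R u g} hR M x r s hr hrs hx => ?_⟩
  have h0 := M.Th_mono hR hr hrs hx
  have h1 := set_le (f := fun z => ed (g z)) (k := fun z => rad psi r (x - z) * ed (g z))
    (measurableSet_ball (x := x) (ε := r / 2)) (c := c) (cv_integrable Prof.psi hr (ed_int M.sw.l2).locallyIntegrable x)
    (fun z => mul_nonneg (psi_nonneg _) (ed_nonneg _)) (fun z => ed_nonneg _) hc.le (fun z hz => by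
      have := ed_nonneg (g z)
      gcongr
      refine rad_low (fun t h0 h1 => (hc' t h0 h1).1) hr ?_
      rw [mem_ball', dist_eq_norm] at hz; linarith)
  have h2 : r ^ ((n:ℤ) - 2) * Th g x r = ∫ z, rad psi r (x - z) * ed (g z) := by
    rw [Th, ← mul_assoc, ← zpow_add₀ hr.ne', show (n:ℤ) - 2 + (2 - n) = 0 by ring, zpow_zero, one_mul]; rfl
  calc _ = c⁻¹ * (c * ∫ z in ball x (r / 2), ed (g z)) := by field_simp
    _ ≤ c⁻¹ * (r ^ ((n:ℤ) - 2) * Th g x r) := by rw [h2]; gcongr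
    _ ≤ c⁻¹ * (r ^ ((n:ℤ) - 2) * Th g x s) := by gcongr
    _ = _ := by ring
end

lemma fub_meas {f : Eu n → ENNReal} (hf : AEMeasurable f) (μ : Measure (Eu n)) [SFinite μ] (σ : ℝ) :
    AEMeasurable (Function.uncurry fun z y => (ball z σ).indicator f y) (μ.prod volume) := by
  have h : MeasurableSet {q : Eu n × Eu n | dist q.2 q.1 < σ} :=
    (isOpen_lt (continuous_snd.dist continuous_fst) continuous_const).measurableSet
  have : (Function.uncurry fun z y => (ball z σ).indicator f y) =
      {q : Eu n × Eu n | dist q.2 q.1 < σ}.indicator fun q => f q.2 := by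
    funext ⟨z, y⟩; simp [indicator, mem_ball]
  rw [this]
  exact (hf.comp_quasiMeasurePreserving Measure.quasiMeasurePreserving_snd).indicator h

lemma fub {f : Eu n → ENNReal} (hf : AEMeasurable f) (x : Eu n) (r σ : ℝ) :
    ∫⁻ z in ball x r, ∫⁻ y in ball z σ, f y ≤ volume (ball (0:Eu n) σ) * ∫⁻ y in ball x (r + σ), f y := by
  simp_rw [← lintegral_indicator measurableSet_ball]
  have e : ∫⁻ z, (ball x r).indicator (fun z => ∫⁻ y, (ball z σ).indicator f y) z =
    ∫⁻ z in ball x r, ∫⁻ y, (ball z σ).indicator f y := lintegral_indicator measurableSet_ball _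
  rw [e, lintegral_lintegral_swap (fub_meas hf _ σ), ← lintegral_const_mul' _ _ measure_ball_lt_top.ne]
  refine lintegral_mono fun y => ?_
  by_cases hy : y ∈ ball x (r + σ)
  · rw [indicator_of_mem hy]
    refine (setLIntegral_le_lintegral _ _).trans ?_
    calc ∫⁻ z, (ball z σ).indicator f y ≤ ∫⁻ z, (ball y σ).indicator (fun _ => f y) z := by
          refine lintegral_mono fun z => ?_
          by_cases h : y ∈ ball z σ
          · rw [indicator_of_mem h, indicator_of_mem (mem_ball_comm.1 h)]
          · rw [indicator_of_notMem h]; exact bot_le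
      _ = _ := by
          rw [lintegral_indicator measurableSet_ball, setLIntegral_const, mul_comm,
            Measure.addHaar_ball_center]
  · rw [setLIntegral_congr_fun measurableSet_ball (g := fun _ => 0)]
    · simp
    · intro z hz
      refine indicator_of_notMem (fun h => hy ?_) _
      rw [mem_ball] at *
      linarith [dist_triangle y z x]

section
variable {p : ℕ} {x0 : Eu n} {R : ℝ} {u : Eu n → Eu p} {g : Eu n → Eu n ⊸ Eu p}

lemma Mn.mol_diff (n p : ℕ) : ∃ C, 0 < C ∧ ∀ {x0 : Eu n} {R : ℝ} {u : Eu n → Eu p} {g : Eu n → Eu n ⊸ Eu p},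
    0 < R → Mn x0 R u g → ∀ z s t, 0 < s → s ≤ t → closedBall z t ⊆ ball x0 R →
    ‖mol u t z - mol u s z‖ ≤ C * t ^ 2 * s ^ (-(n:ℤ)) * ∫ y in ball z t, ed (g y) := by
  obtain ⟨C, hC0, hC⟩ := Prof.psi.bdd
  have hk := kap_pos (n := n)
  refine ⟨kap n / 2 * C, by positivity, fun {x0 R u g} hR M z s t hs hst hz => ?_⟩
  have hE := ed_int M.sw.l2
  have I0 : 0 ≤ ∫ y in ball z t, ed (g y) := integral_nonneg fun y => ed_nonneg _
  have hb : ∀ τ ∈ Icc s t, ‖(kap n / 2 * τ ^ (1 - (n:ℤ))) • ∫ y, lap (fun y => rad psi τ (z - y)) y • u y‖ ≤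
      kap n / 2 * C * t * s ^ (-(n:ℤ)) * ∫ y in ball z t, ed (g y) := by
    intro τ hτ
    have τ0 : 0 < τ := hs.trans_le hτ.1
    rw [M.el hR (Tst.rad Prof.psi τ0 ((closedBall_subset_closedBall hτ.2).trans hz)), norm_smul, norm_neg]
    have h1 := cv_norm_le Prof.psi hC τ0 M.eu.locallyIntegrable z
    have h2 : ∫ y in ball z τ, ‖ed (g y) • u y‖ ≤ ∫ y in ball z t, ed (g y) := by
      refine (integral_mono_of_nonneg (ae_of_all _ fun y => norm_nonneg _) hE.integrableOn (ae_of_all _ fun y => ?_)).trans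
        (setIntegral_mono_set hE.integrableOn (ae_of_all _ fun y => ed_nonneg _) (ball_subset_ball hτ.2).eventuallyLE)
      have e0 := ed_nonneg (g y)
      show ‖ed (g y) • u y‖ ≤ _
      rw [norm_smul, Real.norm_of_nonneg e0]
      exact mul_le_of_le_one_right e0 (M.u1 y)
    have h3 : τ ^ (1 - (n:ℤ)) ≤ t * s ^ (-(n:ℤ)) := by
      rw [sub_eq_add_neg, zpow_add₀ τ0.ne', zpow_one, zpow_neg, zpow_neg, zpow_natCast, zpow_natCast]
      have := hτ.1
      have := hτ.2
      have : 0 ≤ t := by linarith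
      gcongr
    rw [Real.norm_of_nonneg ⊕ₚ]
    calc _ ≤ kap n / 2 * (t * s ^ (-(n:ℤ))) * (C * ∫ y in ball z t, ed (g y)) := by
          have ht : 0 < t := hs.trans_le hst
          gcongr
          exact h1.trans (by gcongr)
      _ = _ := by ring
  have h := Convex.norm_image_sub_le_of_norm_hasDerivWithin_le (f := fun τ => mol u τ z)
    (fun τ hτ => (T0 (hs.trans_le hτ.1) M.sw.loc z).hasDerivWithinAt) hb (convex_Icc s t) (left_mem_Icc.2 hst) (right_mem_Icc.2 hst)
  refine h.trans ?_
  rw [Real.norm_of_nonneg (by linarith)]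
  have ht : 0 < t := hs.trans_le hst
  calc _ ≤ (kap n / 2 * C * t * s ^ (-(n:ℤ)) * ∫ y in ball z t, ed (g y)) * t := by gcongr; linarith
    _ = _ := by ring

/-- L² mollification estimate -/
lemma Mn.mol_osc (n p : ℕ) : ∃ C, 0 < C ∧ ∀ {x0 : Eu n} {R : ℝ} {u : Eu n → Eu p} {g : Eu n → Eu n ⊸ Eu p},
    0 < R → Mn x0 R u g → ∀ x r s, 0 < s → closedBall x (r + s) ⊆ ball x0 R →
    ∫ z in ball x r, ‖u z - mol u s z‖ ^ 2 ≤ C * s ^ 2 * ∫ y in ball x (r + s), ed (g y) := by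
  obtain ⟨C, hC0, hC⟩ := Mn.mol_diff n p
  obtain ⟨om, hom⟩ : ∃ om, om = volume.real (ball (0 : Eu n) 1) := ⟨_, rfl⟩
  have om0 : 0 < om := hom ▸ vol_pos
  refine ⟨2 * (C * 2 ^ n * om * 2), by positivity, fun {x0 R u g} hR M x r s hs hx => ?_⟩
  have hE := ed_int M.sw.l2
  have hum := M.sw.loc
  have hmc := (mol_contDiff hs hum).continuous
  let f : Eu n → ENNReal := fun y => ENNReal.ofReal (ed (g y))
  have hf : AEMeasurable f := hE.1.aemeasurable.ennreal_ofReal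
  have hfi : ∀ z t, ∫⁻ y in ball z t, f y = ENNReal.ofReal (∫ y in ball z t, ed (g y)) := fun z t =>
    (ofReal_integral_eq_lintegral_ofReal hE.integrableOn (ae_of_all _ fun y => ed_nonneg _)).symm
  let σ : ℕ → ℝ := fun k => s * (1 / 2) ^ k
  have σ0 : ∀ k, 0 < σ k := fun k => by positivity
  have σs : ∀ k, σ k ≤ s := fun k => mul_le_of_le_one_right hs.le (pow_le_one₀ (by norm_num) (by norm_num))
  have σl : Tendsto σ atTop (nhdsWithin 0 (Ioi 0)) := by
    refine tendsto_nhdsWithin_iff.2 ⟨?_, Eventually.of_forall σ0⟩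
    have := (tendsto_pow_atTop_nhds_zero_of_lt_one (by norm_num : (0:ℝ) ≤ 1 / 2) (by norm_num)).const_mul s
    rwa [mul_zero] at this
  let d : ℕ → ℝ := fun k => C * σ k ^ 2 * σ (k + 1) ^ (-(n:ℤ))
  have d0 : ∀ k, 0 ≤ d k := fun k => by have := σ0 k; have := σ0 (k + 1); positivity
  have hp : ∀ᵐ z, z ∈ ball x r → ENNReal.ofReal ‖u z - mol u s z‖ ≤
      ∑' k, ENNReal.ofReal (d k) * ∫⁻ y in ball z (σ k), f y := by
    filter_upwards [mol_ae hum] with z hz hzr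
    have h1 := edist_le_tsum_of_edist_le_of_tendsto₀ (f := fun k => mol u (σ k) z)
      (fun k => ENNReal.ofReal (d k) * ∫⁻ y in ball z (σ k), f y) (fun k => ?_) (hz.comp σl)
    · have : σ 0 = s := by simp [σ]
      rwa [this, edist_comm, edist_dist, dist_eq_norm] at h1
    · rw [hfi, ← ENNReal.ofReal_mul (d0 k), edist_dist, dist_eq_norm]
      refine ENNReal.ofReal_le_ofReal (hC hR M z _ _ (σ0 _) ?_ ?_)
      · have := σ0 k; simp only [σ, Nat.succ_eq_add_one, pow_succ] at this ⊢; linarith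
      · refine Subset.trans (closedBall_subset_closedBall' ?_) hx
        rw [mem_ball] at hzr; linarith [σs k]
  have hsum : ∫⁻ z in ball x r, ENNReal.ofReal ‖u z - mol u s z‖ ≤
      ENNReal.ofReal (C * 2 ^ n * om * 2 * s ^ 2 * ∫ y in ball x (r + s), ed (g y)) := by
    have I0 : 0 ≤ ∫ y in ball x (r + s), ed (g y) := integral_nonneg fun y => ed_nonneg _
    calc _ ≤ ∫⁻ z in ball x r, ∑' k, ENNReal.ofReal (d k) * ∫⁻ y in ball z (σ k), f y :=
          lintegral_mono_ae ((ae_restrict_iff' measurableSet_ball).2 hp)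
      _ = ∑' k, ∫⁻ z in ball x r, ENNReal.ofReal (d k) * ∫⁻ y in ball z (σ k), f y := by
          refine lintegral_tsum fun k => AEMeasurable.const_mul ?_ _
          have := (fub_meas hf (volume.restrict (ball x r)) (σ k)).lintegral_prod_right'
          simp_rw [← lintegral_indicator measurableSet_ball]
          exact this
      _ ≤ ∑' k, ENNReal.ofReal (C * 2 ^ n * om * s ^ 2 * (∫ y in ball x (r + s), ed (g y)) * (1 / 2) ^ k) := by
          refine ENNReal.tsum_le_tsum fun k => ?_
          rw [lintegral_const_mul' _ _ ENNReal.ofReal_ne_top]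
          have h1 : volume (ball (0:Eu n) (σ k)) = ENNReal.ofReal (σ k ^ n * om) := by
            rw [hom, ← vol_ball _ (σ0 k), measureReal_def, ENNReal.ofReal_toReal measure_ball_lt_top.ne]
          have h2 := fub hf x r (σ k)
          have h3 : ∫⁻ y in ball x (r + σ k), f y ≤ ∫⁻ y in ball x (r + s), f y :=
            lintegral_mono_set (ball_subset_ball (by linarith [σs k]))
          calc _ ≤ ENNReal.ofReal (d k) * (ENNReal.ofReal (σ k ^ n * om) * ∫⁻ y in ball x (r + s), f y) := by
                rw [h1] at h2; gcongr; exact h2.trans (by gcongr)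
            _ = ENNReal.ofReal (d k * (σ k ^ n * om * ∫ y in ball x (r + s), ed (g y))) := by
                have := σ0 k
                rw [hfi, ← ENNReal.ofReal_mul ⊕ₚ, ← ENNReal.ofReal_mul (d0 k)]
            _ ≤ _ := by
                refine ENNReal.ofReal_le_ofReal ?_
                have e : d k * (σ k ^ n * om * ∫ y in ball x (r + s), ed (g y)) =
                    C * 2 ^ n * om * s ^ 2 * (∫ y in ball x (r + s), ed (g y)) * ((1 / 2) ^ k) ^ 2 := by
                  have e1 : σ (k + 1) = σ k / 2 := by simp only [σ, pow_succ]; ring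
                  have := (σ0 k).ne'
                  simp only [d, e1]
                  rw [zpow_neg, zpow_natCast, div_pow, inv_div]
                  field_simp
                  simp only [σ]; ring
                rw [e]
                have : ((1 / 2 : ℝ) ^ k) ^ 2 ≤ (1 / 2) ^ k := by
                  rw [sq]; exact mul_le_of_le_one_left ⊕ₚ (pow_le_one₀ (by norm_num) (by norm_num))
                gcongr
      _ = _ := by
          rw [← ENNReal.ofReal_tsum_of_nonneg (fun k => by positivity) (summable_geometric_two.mul_left _), tsum_mul_left,
            tsum_geometric_two]
          congr 1; ring
  have I0 : 0 ≤ ∫ y in ball x (r + s), ed (g y) := integral_nonneg fun y => ed_nonneg _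
  have hm1 : ∀ z, ‖mol u s z‖ ≤ 1 := fun z => mol_bdd hs z (ae_of_all _ fun y _ => M.u1 y)
  have hms : AEStronglyMeasurable (fun z => u z - mol u s z) := M.sw.m.sub hmc.aestronglyMeasurable
  rw [integral_eq_lintegral_of_nonneg_ae (ae_of_all _ fun z => sq_nonneg _) (hms.norm.pow 2).restrict]
  refine ENNReal.toReal_le_of_le_ofReal ⊕ₚ ?_
  calc _ ≤ ∫⁻ z in ball x r, ENNReal.ofReal 2 * ENNReal.ofReal ‖u z - mol u s z‖ := by
        refine lintegral_mono fun z => ?_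
        rw [← ENNReal.ofReal_mul (by norm_num)]
        refine ENNReal.ofReal_le_ofReal ?_
        have : ‖u z - mol u s z‖ ≤ 2 := (norm_sub_le _ _).trans (by linarith [M.u1 z, hm1 z])
        rw [sq]; gcongr
    _ ≤ _ := by
        rw [lintegral_const_mul' _ _ ENNReal.ofReal_ne_top]
        refine (mul_le_mul_right hsum _).trans ?_
        rw [← ENNReal.ofReal_mul (by norm_num)]
        refine ENNReal.ofReal_le_ofReal (le_of_eq ?_)
        ring
end

lemma ray_map {p : ℕ} (a : Eu p) (ha : ‖a‖ ≤ 1/2) : ∃ (G : Eu p → Eu p) (G' : Eu p → Eu p ⊸ Eu p),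
    ContDiff ℝ 1 G ∧ (∀ y, HasFDerivAt G (G' y) y) ∧ (∀ d, ‖d‖ ≤ 1 → ∀ e, ‖G' d e‖ ≤ 3 * ‖e‖) ∧
    (∀ d, ‖d‖ = 1 → ‖G d‖ = 1) ∧ ∀ v, ‖v‖ = 1 → G (‖v - a‖⁻¹ • (v - a)) = v := by
  have hb : 3/4 ≤ 1 - ‖a‖ ^ 2 := by nlinarith [norm_nonneg a]
  have hp : ∀ d : Eu p, 0 < (inner ℝ a d) ^ 2 + (1 - ‖a‖ ^ 2) := fun d => by positivity
  set m : Eu p → ℝ := fun d => - inner ℝ a d + Real.sqrt ((inner ℝ a d) ^ 2 + (1 - ‖a‖ ^ 2)) with hm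
  have hmc : ContDiff ℝ 1 m := by
    rw [contDiff_iff_contDiffAt]; intro d
    have h1 : ContDiff ℝ 1 (fun d : Eu p => inner ℝ a d) := contDiff_const.inner ℝ contDiff_id
    exact h1.contDiffAt.neg.add (((h1.contDiffAt.pow 2).add contDiffAt_const).sqrt (hp d).ne')
  have hG : ContDiff ℝ 1 (fun d => a + m d • d) := contDiff_const.add (hmc.smul contDiff_id)
  refine ⟨fun d => a + m d • d, fun y => m y • ContinuousLinearMap.id ℝ _ + (fderiv ℝ m y).smulRight y,
    hG, fun y => ?_, ?_, ?_, ?_⟩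
  · exact (((hmc.differentiable ⊕ₛ) y).hasFDerivAt.smul (hasFDerivAt_id y)).const_add a
  · intro d hd e
    set al := inner ℝ a d with hal
    set q := Real.sqrt (al ^ 2 + (1 - ‖a‖ ^ 2)) with hq
    have hq0 : 0 < q := Real.sqrt_pos.2 (hp d)
    have hqs : q ^ 2 = al ^ 2 + (1 - ‖a‖ ^ 2) := Real.sq_sqrt (hp d).le
    have hala : |al| ≤ 1/2 := by
      refine (abs_real_inner_le_norm a d).trans ?_
      nlinarith [norm_nonneg a, norm_nonneg d]
    have ha2 := abs_le.1 hala
    have hq2 : q ≤ 3/2 := by nlinarith [sq_nonneg ‖a‖]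
    have hq3 : |al| ≤ q := abs_le_of_sq_le_sq (by nlinarith) hq0.le
    have hd1 : HasFDerivAt m (-(innerSL ℝ a) + (1 / (2 * q)) • ((2 * al) • innerSL ℝ a)) d := by
      have h1 : HasFDerivAt (fun d : Eu p => inner ℝ a d) (innerSL ℝ a) d := (innerSL ℝ a).hasFDerivAt
      have h2 := ((h1.pow 2).add_const (1 - ‖a‖ ^ 2)).sqrt (hp d).ne'
      refine HasFDerivAt.congr_fderiv (h1.neg.add h2) ?_
      simp only [pow_one, nsmul_eq_mul, Nat.cast_ofNat, hq, hal, Nat.add_one_sub_one, Nat.reduceSub]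
    have hm2 : |m d| ≤ 2 := by
      show |-al + q| ≤ 2
      rw [abs_le]; constructor <;> linarith
    have hae : |inner ℝ a e| ≤ 1/2 * ‖e‖ := (abs_real_inner_le_norm a e).trans (by gcongr)
    have hDm : |fderiv ℝ m d e| ≤ ‖e‖ := by
      rw [hd1.fderiv]
      have : (-(innerSL ℝ a) + (1 / (2 * q)) • ((2 * al) • innerSL ℝ a)) e
          = (inner ℝ a e) * (al / q - 1) := by
        simp; field_simp; ring
      rw [this, abs_mul]
      have h3 : |al / q - 1| ≤ 2 := by
        have : |al / q| ≤ 1 := by rw [abs_div, abs_of_pos hq0]; exact (div_le_one hq0).2 hq3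
        have := abs_le.1 this
        rw [abs_le]; constructor <;> linarith
      calc _ ≤ (1/2 * ‖e‖) * 2 := by gcongr
        _ = _ := by ring
    calc ‖m d • e + (fderiv ℝ m d e) • d‖ ≤ ‖m d • e‖ + ‖(fderiv ℝ m d e) • d‖ := norm_add_le _ _
      _ ≤ 2 * ‖e‖ + ‖e‖ * 1 := by
        rw [norm_smul, norm_smul, Real.norm_eq_abs, Real.norm_eq_abs]; gcongr
      _ = _ := by ring
  · intro d hd
    have h1 : ‖a + m d • d‖ ^ 2 = 1 := by
      rw [norm_add_sq_real, inner_smul_right, norm_smul, hd, mul_one, Real.norm_eq_abs, sq_abs]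
      have := Real.sq_sqrt (hp d).le
      simp only [hm]; nlinarith
    exact (pow_eq_one_iff_of_nonneg (norm_nonneg _) (by norm_num)).1 h1
  · intro v hv
    have hne : v - a ≠ 0 := by
      intro h; rw [sub_eq_zero] at h; rw [← h, hv] at ha; norm_num at ha
    set ρ := ‖v - a‖ with hρ
    have hρ0 : 0 < ρ := norm_pos_iff.2 hne
    have h1 : ρ ^ 2 = 1 - 2 * inner ℝ a v + ‖a‖ ^ 2 := by
      rw [hρ, norm_sub_sq_real, hv, real_inner_comm]; ring
    have hal : inner ℝ a (ρ⁻¹ • (v - a)) = (inner ℝ a v - ‖a‖ ^ 2) / ρ := by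
      rw [inner_smul_right, inner_sub_right, real_inner_self_eq_norm_sq]; field_simp
    have hiv : inner ℝ a v ≤ 1/2 := (real_inner_le_norm a v).trans (by rw [hv]; linarith)
    have h2 : m (ρ⁻¹ • (v - a)) = ρ := by
      simp only [hm, hal]
      rw [show ((inner ℝ a v - ‖a‖ ^ 2) / ρ) ^ 2 + (1 - ‖a‖ ^ 2) = ((1 - inner ℝ a v) / ρ) ^ 2 by
        field_simp; rw [h1]; ring, Real.sqrt_sq (div_nonneg (by linarith) hρ0.le)]
      field_simp; rw [h1]; ring
    simp only [h2]
    rw [smul_smul, mul_inv_cancel₀ hρ0.ne', one_smul]; abel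

lemma st_bdd : ∃ K, 0 < K ∧ ∀ t, |deriv Real.smoothTransition t| ≤ K := by
  have hc : Continuous (deriv Real.smoothTransition) :=
    (Real.smoothTransition.contDiff (n := 1)).continuous_deriv ⊕ₛ
  obtain ⟨K, hK⟩ := isCompact_Icc.exists_bound_of_continuousOn (s := Icc (0:ℝ) 1) hc.continuousOn
  refine ⟨max K 1, by positivity, fun t => ?_⟩
  rcases lt_or_ge t 0 with h | h
  · have : Real.smoothTransition =ᶠ[nhds t] fun _ => 0 := by
      filter_upwards [gt_mem_nhds h] with y hy using Real.smoothTransition.zero_of_nonpos hy.le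
    rw [this.deriv_eq]; simp
  rcases lt_or_ge 1 t with h' | h'
  · have : Real.smoothTransition =ᶠ[nhds t] fun _ => 1 := by
      filter_upwards [lt_mem_nhds h'] with y hy using Real.smoothTransition.one_of_one_le hy.le
    rw [this.deriv_eq]; simp
  · exact (hK t ⟨h, h'⟩).trans (le_max_left _ _)

lemma cutoff (n : ℕ) : ∃ C, 0 < C ∧ ∀ (x : Eu n) s t, 0 < s → s < t → ∃ η : Eu n → ℝ, ContDiff ℝ ∞ η ∧
    HasCompactSupport η ∧ (∀ z, 0 ≤ η z ∧ η z ≤ 1) ∧ (∀ z ∈ ball x s, η z = 1) ∧ (∀ z, z ∉ ball x t → η z = 0) ∧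
    ∀ z, ‖fderiv ℝ η z‖ ≤ C / (t - s) := by
  obtain ⟨K, hK, hKb⟩ := st_bdd
  refine ⟨2 * K, by positivity, fun x s t hs hst => ?_⟩
  have hd : 0 < t ^ 2 - s ^ 2 := by nlinarith
  have hts : 0 < t - s := by linarith
  have ht0 : 0 < t := by linarith
  set η : Eu n → ℝ := fun z => Real.smoothTransition ((t ^ 2 - ‖z - x‖ ^ 2) / (t ^ 2 - s ^ 2)) with hη
  have h0 : ∀ z, z ∉ ball x t → η z = 0 := fun z hz => by
    refine Real.smoothTransition.zero_of_nonpos (div_nonpos_of_nonpos_of_nonneg ?_ hd.le)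
    rw [mem_ball, dist_eq_norm, not_lt] at hz
    nlinarith
  refine ⟨η, ?_, ?_, fun z => ⟨Real.smoothTransition.nonneg _, Real.smoothTransition.le_one _⟩, ?_, h0, ?_⟩
  · exact Real.smoothTransition.contDiff.comp ((contDiff_const.sub ((contDiff_id.sub contDiff_const).norm_sq ℝ)).div_const _)
  · exact HasCompactSupport.intro (isCompact_closedBall x t) fun z hz => h0 z fun h => hz (ball_subset_closedBall h)
  · intro z hz
    refine Real.smoothTransition.one_of_one_le ((one_le_div hd).2 ?_)
    rw [mem_ball, dist_eq_norm] at hz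
    nlinarith [norm_nonneg (z - x)]
  · intro z
    set T := (t ^ 2 - ‖z - x‖ ^ 2) / (t ^ 2 - s ^ 2) with hT
    have h1 : HasFDerivAt (fun z : Eu n => (t ^ 2 - ‖z - x‖ ^ 2) / (t ^ 2 - s ^ 2))
        ((t ^ 2 - s ^ 2)⁻¹ • (-((2:ℕ) • (innerSL ℝ (z - x)).comp (ContinuousLinearMap.id ℝ (Eu n))) : Eu n ⊸ ℝ)) z := by
      simp only [div_eq_mul_inv]
      exact ((((hasFDerivAt_id z).sub_const x).norm_sq).const_sub _).mul_const _
    have h2 : HasDerivAt Real.smoothTransition (deriv Real.smoothTransition T) T :=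
      ((Real.smoothTransition.contDiff (n := 1)).differentiable ⊕ₛ T).hasDerivAt
    rw [show η = Real.smoothTransition ∘ fun z => (t ^ 2 - ‖z - x‖ ^ 2) / (t ^ 2 - s ^ 2) from rfl,
      (h2.comp_hasFDerivAt z h1).fderiv]
    rcases lt_or_ge t ‖z - x‖ with h | h
    · have hT0 : T < 0 := div_neg_of_neg_of_pos (by nlinarith) hd
      have : Real.smoothTransition =ᶠ[nhds T] fun _ => 0 := by
        filter_upwards [gt_mem_nhds hT0] with y hy using Real.smoothTransition.zero_of_nonpos hy.le
      rw [this.deriv_eq]; simp; positivity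
    · rw [norm_smul, norm_smul, norm_neg, ContinuousLinearMap.comp_id, Real.norm_eq_abs, norm_inv, Real.norm_of_nonneg hd.le]
      have h3 : ‖(2:ℕ) • innerSL ℝ (z - x)‖ ≤ 2 * t := by
        refine (norm_nsmul_le).trans ?_
        rw [innerSL_apply_norm]; push_cast; gcongr
      calc _ ≤ K * ((t ^ 2 - s ^ 2)⁻¹ * (2 * t)) := by gcongr; exact hKb T
        _ = 2 * K * t / ((t - s) * (t + s)) := by
          rw [show t ^ 2 - s ^ 2 = (t - s) * (t + s) by ring]; field_simp
        _ ≤ 2 * K * t / ((t - s) * t) := by gcongr; linarith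
        _ = _ := by have : t ≠ 0 := by linarith
                    field_simp

lemma hole {f : ℝ → ℝ} {C A r : ℝ} (hr : 0 < r) (hC : 0 < C) (hA : 0 ≤ A) (h0 : ∀ s, 0 ≤ f s) (hM : Monotone f)
    (h : ∀ s t, r/2 ≤ s → s < t → t < r → f s ≤ C * (f t - f s) + C / (t - s) ^ 2 * A) :
    f (r/2) ≤ 4 * C * (2 * C + 1) / (1 - Real.sqrt ((2*C+1)/(2*C+2))) ^ 2 * r⁻¹ ^ 2 * A := by
  obtain ⟨l, hl⟩ : ∃ l, l = Real.sqrt ((2*C+1)/(2*C+2)) := ⟨_, rfl⟩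
  rw [← hl]
  have hl0 : 0 < l := by rw [hl]; positivity
  have hl2 : l ^ 2 = (2*C+1)/(2*C+2) := by rw [hl]; exact Real.sq_sqrt ⊕ₚ
  have hl1 : l < 1 := by
    have : l ^ 2 < 1 := by rw [hl2, div_lt_one ⊕ₚ]; linarith
    nlinarith
  set T := (fun s => (r - s) ^ 2 * f s) '' Ico (r/2) r with hT
  have hbd : BddAbove T := by
    refine ⟨r ^ 2 * f r, ?_⟩
    rintro _ ⟨s, hs, rfl⟩
    have := hM hs.2.le
    have h1 : 0 ≤ r - s := by linarith [hs.2]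
    have h3 : r - s ≤ r := by linarith [hs.1]
    have h2 := h0 s
    show (r - s) ^ 2 * f s ≤ _
    gcongr
  have hle : ∀ s ∈ Ico (r/2) r, (r - s) ^ 2 * f s ≤ 2*C/(2*C+1) * sSup T + C / (1 - l) ^ 2 * A := by
    intro s hs
    have hs' : 0 < r - s := by linarith [hs.2]
    have ht := h s (r - l * (r - s)) hs.1 (by nlinarith) (by nlinarith [mul_pos hl0 hs'])
    have hS : (r - (r - l * (r - s))) ^ 2 * f (r - l * (r - s)) ≤ sSup T :=
      le_csSup hbd ⟨_, ⟨by nlinarith [hs.1], by nlinarith [mul_pos hl0 hs']⟩, rfl⟩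
    set F := f (r - l * (r - s))
    have e1 : r - l * (r - s) - s = (1 - l) * (r - s) := by ring
    rw [e1] at ht
    have hl1' : 1 - l ≠ 0 := by linarith
    have e2 : (r - s) ^ 2 * (C / ((1 - l) * (r - s)) ^ 2 * A) = C / (1 - l) ^ 2 * A := by
      field_simp
    have e3 : (r - s) ^ 2 * F = (2*C+2)/(2*C+1) * ((r - (r - l * (r - s))) ^ 2 * F) := by
      rw [show r - (r - l * (r - s)) = l * (r - s) by ring, mul_pow, hl2]; field_simp
    have h5 : (1 + C) * ((r - s) ^ 2 * f s) ≤ C * ((r - s) ^ 2 * F) + C / (1 - l) ^ 2 * A := by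
      have := mul_le_mul_of_nonneg_left ht (sq_nonneg (r - s))
      rw [mul_add, e2] at this
      linarith
    have h6 : (r - s) ^ 2 * F ≤ (2*C+2)/(2*C+1) * sSup T := by rw [e3]; gcongr
    have h7 : 0 ≤ C / (1 - l) ^ 2 * A := by positivity
    have h8 : (1 + C) * ((r - s) ^ 2 * f s) ≤ (1 + C) * (2*C/(2*C+1) * sSup T + C / (1 - l) ^ 2 * A) := by
      calc _ ≤ C * ((2*C+2)/(2*C+1) * sSup T) + C / (1 - l) ^ 2 * A := by
            linarith [mul_le_mul_of_nonneg_left h6 hC.le]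
        _ ≤ C * ((2*C+2)/(2*C+1) * sSup T) + (1 + C) * (C / (1 - l) ^ 2 * A) := by nlinarith
        _ = _ := by field_simp; ring
    exact le_of_mul_le_mul_left h8 (by linarith)
  have hne : T.Nonempty := ⟨_, r/2, ⟨le_rfl, by linarith⟩, rfl⟩
  have hS : sSup T ≤ 2*C/(2*C+1) * sSup T + C / (1 - l) ^ 2 * A := by
    refine csSup_le hne ?_
    rintro _ ⟨s, hs, rfl⟩
    exact hle s hs
  have hS2 : sSup T ≤ (2*C+1) * (C / (1 - l) ^ 2 * A) := by
    have : (2*C+1) * sSup T ≤ (2*C+1) * (2*C/(2*C+1) * sSup T + C / (1 - l) ^ 2 * A) := by gcongr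
    have e : (2*C+1) * (2*C/(2*C+1) * sSup T + C / (1 - l) ^ 2 * A) = 2*C * sSup T + (2*C+1) * (C / (1 - l) ^ 2 * A) := by
      field_simp
    linarith
  have h9 : (r - r/2) ^ 2 * f (r/2) ≤ sSup T := le_csSup hbd ⟨r/2, ⟨le_rfl, by linarith⟩, rfl⟩
  have h10 : f (r/2) = 4 * r⁻¹ ^ 2 * ((r - r/2) ^ 2 * f (r/2)) := by field_simp; ring
  rw [h10]
  calc _ ≤ 4 * r⁻¹ ^ 2 * ((2*C+1) * (C / (1 - l) ^ 2 * A)) := 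
        mul_le_mul_of_nonneg_left (h9.trans hS2) ⊕ₚ
    _ = _ := by ring

lemma ker_fin {p : ℕ} (hp : 3 ≤ p) : ∫⁻ a in ball (0 : Eu p) 2, (‖a‖ₑ ^ 2)⁻¹ < ⊤ := by
  have hf : Module.finrank ℝ (Eu p) = p := by simp [Eu]
  have h1 : IntegrableOn (fun a : Eu p => ‖a‖ ^ (-(2:ℝ))) (ball (0 : Eu p) 2) := by
    refine integrableOn_ball_of_norm_le_rpow (C := 1) (α := 2) (by omega) (by rw [hf]; exact_mod_cast hp) ?_ ?_
    · exact Eventually.of_forall fun x => by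
        rw [one_mul, Real.norm_of_nonneg ⊕ₚ]
    · exact (measurable_norm.pow_const _).aestronglyMeasurable
  have h2 := h1.2
  rw [hasFiniteIntegral_iff_enorm] at h2
  refine lt_of_le_of_lt (lintegral_mono_ae ?_) h2
  have h0 : ∀ᵐ a : Eu p ∂(volume.restrict (ball (0 : Eu p) 2)), a ≠ 0 := by
    haveI : Nontrivial (Eu p) := Module.nontrivial_of_finrank_pos (R := ℝ) (by omega)
    exact ae_restrict_of_ae (by simp [ae_iff])
  filter_upwards [h0] with a ha
  have hn : 0 < ‖a‖ := norm_pos_iff.2 ha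
  rw [Real.enorm_eq_ofReal ⊕ₚ, ← ofReal_norm, ← ENNReal.ofReal_pow hn.le, ← ENNReal.ofReal_inv_of_pos ⊕ₚ,
    Real.rpow_neg hn.le]
  norm_cast

lemma avg {p : ℕ} (hp : 3 ≤ p) : ∃ K, 0 < K ∧ ∀ {n : ℕ} {v : Eu n → Eu p} {f : Eu n → ℝ}, AEStronglyMeasurable v →
    (∀ x, ‖v x‖ ≤ 1) → Integrable f → (∀ x, 0 ≤ f x) → ∃ a : Eu p, ‖a‖ ≤ 1/2 ∧ (∀ᵐ z, 0 < f z → v z ≠ a) ∧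
    Integrable (fun z => f z * (‖v z - a‖ ^ 2)⁻¹) ∧ ∫ z, f z * (‖v z - a‖ ^ 2)⁻¹ ≤ K * ∫ z, f z := by
  have hvB : volume (ball (0 : Eu p) (1/2)) ≠ 0 := (measure_ball_pos _ _ (by norm_num)).ne'
  have hvB' : volume (ball (0 : Eu p) (1/2)) ≠ ⊤ := measure_ball_lt_top.ne
  obtain ⟨K0, hK0⟩ : ∃ K0, K0 = (∫⁻ a in ball (0 : Eu p) 2, (‖a‖ₑ ^ 2)⁻¹) / volume (ball (0 : Eu p) (1/2)) := ⟨_, rfl⟩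
  have hK : K0 ≠ ⊤ := by rw [hK0]; exact ENNReal.div_ne_top (ker_fin hp).ne hvB
  refine ⟨K0.toReal + 1, by positivity, fun {n v f} hv hv1 hf hf0 => ?_⟩
  set fe : Eu n → ENNReal := fun z => ENNReal.ofReal (f z) with hfe
  have hfm : AEMeasurable fe := hf.1.aemeasurable.ennreal_ofReal
  have hk : Measurable (fun a : Eu p => (‖a‖ₑ ^ 2)⁻¹) := (measurable_enorm.pow_const 2).inv
  have hjm : AEMeasurable (Function.uncurry fun (a : Eu p) (z : Eu n) => fe z * (‖v z - a‖ₑ ^ 2)⁻¹)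
      ((volume.restrict (ball (0 : Eu p) (1/2))).prod volume) := by
    have a1 := hfm.comp_quasiMeasurePreserving (Measure.quasiMeasurePreserving_snd (μ := volume.restrict (ball (0 : Eu p) (1/2))))
    have a2 := hv.aemeasurable.comp_quasiMeasurePreserving (Measure.quasiMeasurePreserving_snd (μ := volume.restrict (ball (0 : Eu p) (1/2))))
    exact a1.mul (hk.comp_aemeasurable (a2.sub measurable_fst.aemeasurable))
  obtain ⟨a, ha, hle⟩ := exists_le_setLAverage hvB hvB' hjm.lintegral_prod_right'
  have hsw : ∫⁻ a in ball (0 : Eu p) (1/2), ∫⁻ z, fe z * (‖v z - a‖ₑ ^ 2)⁻¹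
      ≤ (∫⁻ a in ball (0 : Eu p) 2, (‖a‖ₑ ^ 2)⁻¹) * ∫⁻ z, fe z := by
    rw [lintegral_lintegral_swap hjm, ← lintegral_const_mul' _ _ (ker_fin hp).ne]
    refine lintegral_mono fun z => ?_
    rw [lintegral_const_mul _ (by exact hk.comp (measurable_const.sub measurable_id)), mul_comm]
    refine mul_le_mul_left ?_ _
    rw [← lintegral_indicator measurableSet_ball, ← lintegral_indicator measurableSet_ball,
      ← lintegral_sub_left_eq_self (fun a => (ball (0 : Eu p) 2).indicator (fun a => (‖a‖ₑ ^ 2)⁻¹) a) (v z)]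
    refine lintegral_mono fun a => ?_
    by_cases h : a ∈ ball (0 : Eu p) (1/2)
    · have h' : v z - a ∈ ball (0 : Eu p) 2 := by
        rw [mem_ball_zero_iff] at h ⊢
        linarith [norm_sub_le (v z) a, hv1 z]
      show _ ≤ (ball (0 : Eu p) 2).indicator (fun a => (‖a‖ₑ ^ 2)⁻¹) (v z - a)
      rw [indicator_of_mem h, indicator_of_mem h']
    · rw [indicator_of_notMem h]; exact bot_le
  have hI : ∫⁻ z, fe z * (‖v z - a‖ₑ ^ 2)⁻¹ ≤ K0 * ∫⁻ z, fe z := by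
    refine hle.trans ?_
    rw [setLAverage_eq, hK0]
    refine (ENNReal.div_le_div_right hsw _).trans_eq ?_
    simp only [div_eq_mul_inv]; ring
  have hfi : ∫⁻ z, fe z = ENNReal.ofReal (∫ z, f z) :=
    (ofReal_integral_eq_lintegral_ofReal hf (Eventually.of_forall hf0)).symm
  have hmz : AEMeasurable (fun z => fe z * (‖v z - a‖ₑ ^ 2)⁻¹) :=
    hfm.mul (hk.comp_aemeasurable (hv.aemeasurable.sub_const a))
  have hIfin : ∫⁻ z, fe z * (‖v z - a‖ₑ ^ 2)⁻¹ ≠ ⊤ :=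
    (hI.trans_lt (ENNReal.mul_lt_top (lt_top_iff_ne_top.2 hK) (by rw [hfi]; exact ENNReal.ofReal_lt_top))).ne
  have hpt : ∀ z, ENNReal.ofReal (f z * (‖v z - a‖ ^ 2)⁻¹) ≤ fe z * (‖v z - a‖ₑ ^ 2)⁻¹ := by
    intro z
    rw [ENNReal.ofReal_mul (hf0 z), ← ofReal_norm, ← ENNReal.ofReal_pow (norm_nonneg _)]
    refine mul_le_mul_right ?_ _
    exact ENNReal.ofReal_inv_le
  have hle2 := (lintegral_mono hpt).trans hI
  have hm2 : AEStronglyMeasurable (fun z => f z * (‖v z - a‖ ^ 2)⁻¹) :=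
    (hf.1.aemeasurable.mul (((hv.aemeasurable.sub_const a).norm.pow_const 2).inv)).aestronglyMeasurable
  have h0' : ∀ z, 0 ≤ f z * (‖v z - a‖ ^ 2)⁻¹ := fun z => mul_nonneg (hf0 z) ⊕ₚ
  have hint : Integrable (fun z => f z * (‖v z - a‖ ^ 2)⁻¹) := by
    refine ⟨hm2, ?_⟩
    rw [hasFiniteIntegral_iff_ofReal (Eventually.of_forall h0')]
    exact (lintegral_mono hpt).trans_lt (lt_top_iff_ne_top.2 hIfin)
  refine ⟨a, (mem_ball_zero_iff.1 ha).le, ?_, hint, ?_⟩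
  · filter_upwards [ae_lt_top' hmz hIfin] with z hz h0 hva
    rw [hva, sub_self] at hz
    simp only [enorm_zero, ne_eq, OfNat.ofNat_ne_zero, not_false_eq_true, zero_pow, ENNReal.inv_zero] at hz
    rw [ENNReal.mul_top (by simpa [hfe] using h0)] at hz
    exact lt_irrefl _ hz
  · have h3 : 0 ≤ ∫ z, f z := integral_nonneg hf0
    rw [hfi, ← ofReal_integral_eq_lintegral_ofReal hint (Eventually.of_forall h0'), ← ENNReal.ofReal_toReal hK,
      ← ENNReal.ofReal_mul ⊕ₚ, ENNReal.ofReal_le_ofReal_iff ⊕ₚ] at hle2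
    linarith

section
variable {p : ℕ} {x0 : Eu n} {R : ℝ} {u : Eu n → Eu p} {g : Eu n → Eu n ⊸ Eu p}

lemma Mn.le_loc (hR : 0 < R) (M : Mn x0 R u g) {x : Eu n} {t : ℝ} (ht : 0 < t) (hx : closedBall x t ⊆ ball x0 R)
    {w : Eu n → Eu p} {k : Eu n → Eu n ⊸ Eu p} (S : SW (ball x0 R) w k)
    (h1 : ∀ᵐ x, x ∈ ball x0 R → ‖w x‖ = 1) (h2 : ∀ᵐ y, y ∈ ball x0 R → y ∉ ball x t → w y = u y) :
    ∫ z in ball x t, ed (g z) ≤ ∫ z in ball x t, ed (k z) := by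
  obtain ⟨r, hr, hrR, hK⟩ := cpt_in_ball (isCompact_closedBall x t) hR hx
  have h3 := M.min w k r hr hrR S h1 (by
    filter_upwards [h2] with y hy h4 h5
    exact hy h4 fun h => h5 (hK (ball_subset_closedBall h)))
  have hV : IsOpen (ball x0 R \ closedBall x t) := isOpen_ball.sdiff isClosed_closedBall
  have hu := SW.uniq hV (M.sw.mono sdiff_subset) (S.mono sdiff_subset) (by
    filter_upwards [h2] with y hy h4
    exact (hy h4.1 fun h => h4.2 (ball_subset_closedBall h)).symm)
  have hs : ∀ᵐ y : Eu n, y ∉ sphere x t := by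
    have : volume (sphere x t) = 0 := Measure.addHaar_sphere_of_ne_zero _ _ ht.ne'
    exact measure_eq_zero_iff_ae_notMem.1 this
  have hb : ball x t ⊆ ball x0 R := ball_subset_closedBall.trans hx
  have i1 : Integrable (fun z => ed (g z)) := ed_int M.sw.l2
  have i2 : Integrable (fun z => ed (k z)) := ed_int S.l2
  have e1 := setIntegral_sdiff measurableSet_ball i1.integrableOn hb
  have e2 := setIntegral_sdiff measurableSet_ball i2.integrableOn hb
  have e3 : ∫ z in ball x0 R \ ball x t, ed (g z) = ∫ z in ball x0 R \ ball x t, ed (k z) := by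
    refine setIntegral_congr_ae (measurableSet_ball.diff measurableSet_ball) ?_
    filter_upwards [hu, hs] with y hy h4 h5
    rw [hy ⟨h5.1, fun h => ?_⟩]
    rcases (mem_closedBall.1 h).lt_or_eq with h6 | h6
    · exact h5.2 h6
    · exact h4 h6
  linarith

lemma Mn.prj_comp (hp : 3 ≤ p) : ∃ K, 0 < K ∧ ∀ {n : ℕ} {x0 : Eu n} {R : ℝ} {u : Eu n → Eu p} {g : Eu n → Eu n ⊸ Eu p},
    0 < R → Mn x0 R u g → ∀ (x : Eu n) t, 0 < t → closedBall x t ⊆ ball x0 R → ∀ (v : Eu n → Eu p) h,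
    SW (ball x0 R) v h → (∀ z, ‖v z‖ ≤ 1) → (∀ z, z ∉ ball x t → v z = u z) →
    ∫ z in ball x t, ed (g z) ≤ K * n * ∫ z in ball x t, ‖h z‖ ^ 2 := by
  obtain ⟨K, hK, hav⟩ := avg hp
  refine ⟨9 * K, by positivity, fun {n x0 R u g} hR M x t ht hx v h S hv1 hvu => ?_⟩
  have key : ∀ l > 0, ∫ z in ball x t, ed (g z) ≤ 9 * K * n * ((∫ z in ball x t, ‖h z‖ ^ 2) + l * volume.real (ball x t)) := by
    intro l hl
    have hh2 : Integrable (fun z => ‖h z‖ ^ 2) := S.l2.integrable_norm_pow (by norm_num)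
    have hfo : IntegrableOn (fun z => ‖h z‖ ^ 2 + l) (ball x t) :=
      hh2.integrableOn.add (integrableOn_const (by finiteness))
    have hf : Integrable ((ball x t).indicator fun z => ‖h z‖ ^ 2 + l) := by
      rwa [integrable_indicator_iff measurableSet_ball]
    have hf0 : ∀ z, 0 ≤ (ball x t).indicator (fun z => ‖h z‖ ^ 2 + l) z :=
      fun z => indicator_nonneg (fun z _ => by positivity) z
    obtain ⟨a, ha, hne, hint, hle⟩ := hav S.m hv1 hf hf0
    have hoff : ∀ᵐ z, z ∈ ball x0 R → z ∉ ball x t → 1/2 ≤ ‖v z - a‖ := by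
      filter_upwards [M.nu] with z hz h1 h2
      rw [hvu z h2]; have := norm_sub_norm_le (u z) a; rw [hz h1] at this; linarith
    have S1 : SW (ball x0 R) (fun z => v z - a) h := by
      have := S.chain' isOpen_ball (G := fun y => y - a) (G' := fun _ => ContinuousLinearMap.id ℝ (Eu p))
        (contDiff_id.sub contDiff_const) (fun y => (hasFDerivAt_id y).sub_const a)
      simpa using this
    have hint2 : Integrable (fun z => ((ball x t).indicator (fun z => ‖v z - a‖⁻¹ * ‖h z‖) z) ^ 2) := by
      refine hint.mono' ?_ (Eventually.of_forall fun z => ?_)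
      · exact (((S1.m.norm.aemeasurable.inv).mul S.l2.1.norm.aemeasurable).indicator measurableSet_ball).pow_const 2 |>.aestronglyMeasurable
      · rw [Real.norm_of_nonneg (sq_nonneg _)]
        by_cases hz : z ∈ ball x t
        · rw [indicator_of_mem hz, indicator_of_mem hz, mul_pow, inv_pow, mul_comm]
          gcongr; linarith
        · rw [indicator_of_notMem hz, indicator_of_notMem hz]; simp
    have hHm : MemLp (fun z => (ball x t).indicator (fun z => ‖v z - a‖⁻¹ * ‖h z‖) z + 2 * ‖h z‖) 2 := by
      refine MemLp.add ((memLp_two_iff_integrable_sq ?_).2 hint2) (S.l2.norm.const_mul 2)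
      exact (((S1.m.norm.aemeasurable.inv).mul S.l2.1.norm.aemeasurable).indicator measurableSet_ball).aestronglyMeasurable
    have hva : ∀ᵐ z, z ∈ ball x0 R → v z - a ≠ 0 := by
      filter_upwards [hne, hoff] with z h1 h2 h3
      by_cases hz : z ∈ ball x t
      · refine sub_ne_zero.2 (h1 ?_)
        rw [indicator_of_mem hz]; positivity
      · refine norm_pos_iff.1 (lt_of_lt_of_le (by norm_num) (h2 h3 hz))
    obtain ⟨k, Sk, hk⟩ := S1.nrm isOpen_ball hHm hva (by
      filter_upwards [hoff] with z h2 h3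
      by_cases hz : z ∈ ball x t
      · rw [indicator_of_mem hz]; linarith [norm_nonneg (h z)]
      · rw [indicator_of_notMem hz, zero_add]
        gcongr
        have := h2 h3 hz
        rw [inv_le_comm₀ (by linarith) (by norm_num)]; linarith)
    obtain ⟨G, G', hG, hG', hb, h1, h2⟩ := ray_map a ha
    have Sw := Sk.chain' isOpen_ball hG hG'
    have hn1 : ∀ᵐ z, z ∈ ball x0 R → ‖‖v z - a‖⁻¹ • (v z - a)‖ = 1 := by
      filter_upwards [hva] with z hz h3
      rw [norm_smul, norm_inv, norm_norm, inv_mul_cancel₀ (norm_ne_zero_iff.2 (hz h3))]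
    have hcmp := M.le_loc hR ht hx Sw (by filter_upwards [hn1] with z hz h3 using h1 _ (hz h3)) (by
      filter_upwards [M.nu] with z hz h3 h4
      rw [hvu z h4, h2 _ (hz h3)])
    refine hcmp.trans ?_
    have hpt : ∀ᵐ z, z ∈ ball x t → ed ((G' (‖v z - a‖⁻¹ • (v z - a))).comp (k z))
        ≤ 9 * n * ((ball x t).indicator (fun z => ‖h z‖ ^ 2 + l) z * (‖v z - a‖ ^ 2)⁻¹) := by
      filter_upwards [hk, hn1] with z h3 h4 hz
      have hz' : z ∈ ball x0 R := hx (ball_subset_closedBall hz)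
      rw [indicator_of_mem hz]
      have h5 : ∀ i, ‖(G' (‖v z - a‖⁻¹ • (v z - a))).comp (k z) ⅇ i‖ ^ 2 ≤ 9 * ((‖v z - a‖ ^ 2)⁻¹ * ‖h z ⅇ i‖ ^ 2) := by
        intro i
        have h6 := hb _ (h4 hz').le (k z ⅇ i)
        have h7 := h3 hz' ⅇ i
        calc _ ≤ (3 * (‖v z - a‖⁻¹ * ‖h z ⅇ i‖)) ^ 2 := by
              gcongr; exact h6.trans (by gcongr)
          _ = _ := by rw [mul_pow, mul_pow, inv_pow]; norm_num
      calc _ ≤ ∑ i : Fin n, 9 * ((‖v z - a‖ ^ 2)⁻¹ * ‖h z ⅇ i‖ ^ 2) := Finset.sum_le_sum fun i _ => h5 i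
        _ = 9 * ((‖v z - a‖ ^ 2)⁻¹ * ed (h z)) := by rw [← Finset.mul_sum, ← Finset.mul_sum]; rfl
        _ ≤ 9 * ((‖v z - a‖ ^ 2)⁻¹ * (n * (‖h z‖ ^ 2 + l))) := by
          gcongr; exact (ed_le _).trans (by gcongr; linarith)
        _ = _ := by ring
    calc _ ≤ ∫ z in ball x t, 9 * n * ((ball x t).indicator (fun z => ‖h z‖ ^ 2 + l) z * (‖v z - a‖ ^ 2)⁻¹) :=
          setIntegral_mono_on_ae (ed_int Sw.l2).integrableOn (hint.const_mul _).integrableOn measurableSet_ball hpt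
      _ ≤ ∫ z, 9 * n * ((ball x t).indicator (fun z => ‖h z‖ ^ 2 + l) z * (‖v z - a‖ ^ 2)⁻¹) :=
          setIntegral_le_integral (hint.const_mul _) (Eventually.of_forall fun z => by
            have := hf0 z
            show 0 ≤ 9 * (n:ℝ) * (_ * _)
            positivity)
      _ ≤ 9 * n * (K * ∫ z, (ball x t).indicator (fun z => ‖h z‖ ^ 2 + l) z) := by
          rw [integral_const_mul]; gcongr
      _ = _ := by
          rw [integral_indicator measurableSet_ball, integral_add hh2.integrableOn (integrableOn_const (by finiteness))]
          rw [setIntegral_const, smul_eq_mul]; ring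
  have hlim : Tendsto (fun l => 9 * K * n * ((∫ z in ball x t, ‖h z‖ ^ 2) + l * volume.real (ball x t))) (nhdsWithin 0 (Ioi 0))
      (nhds (9 * K * n * ((∫ z in ball x t, ‖h z‖ ^ 2) + 0 * volume.real (ball x t)))) := by
    refine Tendsto.mono_left (Continuous.tendsto ?_ 0) nhdsWithin_le_nhds
    fun_prop
  rw [zero_mul, add_zero] at hlim
  exact ge_of_tendsto hlim (by filter_upwards [self_mem_nhdsWithin] with l hl using key l hl)

lemma Mn.iu (M : Mn x0 R u g) {c : Eu p} (hc : ‖c‖ ≤ 1) (x : Eu n) (r : ℝ) : IntegrableOn (fun z => ‖u z - c‖ ^ 2) (ball x r) := by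
  refine Measure.integrableOn_of_bounded (M := 4) (by finiteness) ((M.sw.m.sub aestronglyMeasurable_const).norm.pow 2) ?_
  refine Eventually.of_forall fun z => ?_
  rw [Real.norm_of_nonneg (sq_nonneg _)]
  have := norm_sub_le (u z) c
  have := M.u1 z
  nlinarith [norm_nonneg (u z - c)]

lemma Mn.caccAux (n : ℕ) (hp : 3 ≤ p) : ∃ C, 0 < C ∧ ∀ {x0 : Eu n} {R : ℝ} {u : Eu n → Eu p} {g : Eu n → Eu n ⊸ Eu p},
    0 < R → Mn x0 R u g → ∀ (x : Eu n) s t, 0 < s → s < t → closedBall x t ⊆ ball x0 R → ∀ c : Eu p, ‖c‖ ≤ 1 →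
    ∫ z in ball x s, ed (g z) ≤ C * ((∫ z in ball x t, ed (g z)) - ∫ z in ball x s, ed (g z)) +
      C / (t - s) ^ 2 * ∫ z in ball x t, ‖u z - c‖ ^ 2 := by
  obtain ⟨K, hK, hcomp⟩ := Mn.prj_comp hp
  obtain ⟨C, hC, hcut⟩ := cutoff n
  obtain ⟨D, hD⟩ : ∃ D, D = 2 * (K * n) * (1 + C ^ 2) + 1 := ⟨_, rfl⟩
  refine ⟨D, by rw [hD]; positivity, fun {x0 R u g} hR M x s t hs hst hx c hc => ?_⟩
  obtain ⟨η, e1, e2, e3, e4, e5, e6⟩ := hcut x s t hs hst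
  have hts : 0 < t - s := by linarith
  have S0 := M.sw.prod (SW.tst (U := ball x0 R) e1 e2)
  have S1 := S0.chain' isOpen_ball (G := fun y : Eu p × ℝ => y.1 - y.2 • (y.1 - c))
    (G' := fun y => ContinuousLinearMap.fst ℝ _ _ - (y.2 • ContinuousLinearMap.fst ℝ _ _ + (ContinuousLinearMap.snd ℝ (Eu p) ℝ).smulRight (y.1 - c)))
    (by fun_prop) (fun y => by
      have h1 : HasFDerivAt (fun y : Eu p × ℝ => y.2) (ContinuousLinearMap.snd ℝ (Eu p) ℝ) y := hasFDerivAt_snd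
      have h2 : HasFDerivAt (fun y : Eu p × ℝ => y.1) (ContinuousLinearMap.fst ℝ (Eu p) ℝ) y := hasFDerivAt_fst
      exact h2.sub (h1.smul (h2.sub_const c)))
  have hv1 : ∀ z, ‖u z - η z • (u z - c)‖ ≤ 1 := by
    intro z
    rw [show u z - η z • (u z - c) = (1 - η z) • u z + η z • c by rw [smul_sub, sub_smul, one_smul]; abel]
    have := e3 z
    calc _ ≤ ‖(1 - η z) • u z‖ + ‖η z • c‖ := norm_add_le _ _
      _ ≤ (1 - η z) * 1 + η z * 1 := by
        rw [norm_smul, norm_smul, Real.norm_of_nonneg this.1, Real.norm_of_nonneg (by linarith)]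
        have h1 := M.u1 z
        have h2 : 0 ≤ 1 - η z := by linarith
        gcongr
        · exact this.1
      _ = 1 := by ring
  have h1 := hcomp hR M x t (by linarith) hx _ _ S1 hv1 (fun z hz => by simp [e5 z hz])
  obtain ⟨h, hh⟩ : ∃ h : Eu n → Eu n ⊸ Eu p, h = fun z => (ContinuousLinearMap.fst ℝ _ _ - (η z • ContinuousLinearMap.fst ℝ _ _ + (ContinuousLinearMap.snd ℝ (Eu p) ℝ).smulRight (u z - c))).comp ((g z).prod (fderiv ℝ η z)) := ⟨_, rfl⟩
  have hhl : MemLp h 2 := by rw [hh]; exact S1.l2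
  have h2 : ∫ z in ball x t, ed (g z) ≤ K * n * ∫ z in ball x t, ‖h z‖ ^ 2 := by rw [hh]; exact h1
  have iE : Integrable (fun z => ed (g z)) := ed_int M.sw.l2
  have iu : IntegrableOn (fun z => ‖u z - c‖ ^ 2) (ball x t) := M.iu hc x t
  have hpt : ∀ z ∈ ball x t, ‖h z‖ ^ 2 ≤ 2 * (ball x t \ ball x s).indicator (fun z => ed (g z)) z + 2 * (C / (t - s)) ^ 2 * ‖u z - c‖ ^ 2 := by
    intro z hz
    have h3 := e3 z
    have h4 : ‖h z‖ ≤ (1 - η z) * ‖g z‖ + C / (t - s) * ‖u z - c‖ := by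
      have h30 : 0 ≤ 1 - η z := by linarith
      refine ContinuousLinearMap.opNorm_le_bound _ ⊕ₚ fun e => ?_
      have : h z e = (1 - η z) • g z e - (fderiv ℝ η z e) • (u z - c) := by
        rw [hh, sub_smul, one_smul]
        show g z e - (η z • g z e + (fderiv ℝ η z e) • (u z - c)) = _
        abel
      rw [this]
      calc _ ≤ ‖(1 - η z) • g z e‖ + ‖(fderiv ℝ η z e) • (u z - c)‖ := norm_sub_le _ _
        _ ≤ (1 - η z) * (‖g z‖ * ‖e‖) + (C / (t - s) * ‖e‖) * ‖u z - c‖ := by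
          rw [norm_smul, norm_smul, Real.norm_of_nonneg h30]
          have a1 := (g z).le_opNorm e
          have a2 := (fderiv ℝ η z).le_of_opNorm_le (e6 z) e
          gcongr
        _ = _ := by ring
    have h5 : ((1 - η z) * ‖g z‖) ^ 2 ≤ (ball x t \ ball x s).indicator (fun z => ed (g z)) z := by
      by_cases hzs : z ∈ ball x s
      · rw [e4 z hzs, indicator_of_notMem (fun h => h.2 hzs)]; simp
      · rw [indicator_of_mem (show z ∈ ball x t \ ball x s from ⟨hz, hzs⟩), mul_pow]
        have : (1 - η z) ^ 2 ≤ 1 := by nlinarith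
        calc _ ≤ 1 * ed (g z) := by gcongr; exact le_ed _
          _ = _ := one_mul _
    have h6 := pow_le_pow_left₀ (norm_nonneg _) h4 2
    have h7 := add_sq_le (a := (1 - η z) * ‖g z‖) (b := C / (t - s) * ‖u z - c‖)
    rw [mul_pow (C / (t - s))] at h7
    linarith
  have hI : ∫ z in ball x t, ‖h z‖ ^ 2 ≤ 2 * ((∫ z in ball x t, ed (g z)) - ∫ z in ball x s, ed (g z))
      + 2 * (C / (t - s)) ^ 2 * ∫ z in ball x t, ‖u z - c‖ ^ 2 := by
    have i1 : Integrable ((ball x t \ ball x s).indicator (fun z => ed (g z))) :=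
      iE.indicator (measurableSet_ball.diff measurableSet_ball)
    have i2 : IntegrableOn (fun z => 2 * (ball x t \ ball x s).indicator (fun z => ed (g z)) z) (ball x t) := (i1.const_mul 2).integrableOn
    have i3 : IntegrableOn (fun z => 2 * (C / (t - s)) ^ 2 * ‖u z - c‖ ^ 2) (ball x t) := iu.const_mul _
    have i4 : IntegrableOn (fun z => 2 * (ball x t \ ball x s).indicator (fun z => ed (g z)) z + 2 * (C / (t - s)) ^ 2 * ‖u z - c‖ ^ 2) (ball x t) := i2.add i3
    refine (setIntegral_mono_on ((hhl.integrable_norm_pow (by norm_num)).integrableOn) i4 measurableSet_ball hpt).trans_eq ?_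
    rw [integral_add i2 i3, integral_const_mul, integral_const_mul, setIntegral_indicator (measurableSet_ball.diff measurableSet_ball),
      inter_eq_self_of_subset_right sdiff_subset, setIntegral_sdiff measurableSet_ball iE.integrableOn (ball_subset_ball hst.le)]
  have hmono : ∫ z in ball x s, ed (g z) ≤ ∫ z in ball x t, ed (g z) :=
    setIntegral_mono_set iE.integrableOn (Eventually.of_forall fun z => ed_nonneg _) (ball_subset_ball hst.le).eventuallyLE
  have hA : 0 ≤ ∫ z in ball x t, ‖u z - c‖ ^ 2 := integral_nonneg fun z => by positivity
  have hKn : 0 ≤ K * n := by positivity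
  have h8 := mul_le_mul_of_nonneg_left hI hKn
  have c1 : 2 * (K * n) ≤ D := by rw [hD]; nlinarith [sq_nonneg C, mul_nonneg hKn (sq_nonneg C)]
  have c2 : 2 * (K * n) * C ^ 2 ≤ D := by rw [hD]; nlinarith [sq_nonneg C, mul_nonneg hKn (sq_nonneg C)]
  calc _ ≤ 2 * (K * n) * ((∫ z in ball x t, ed (g z)) - ∫ z in ball x s, ed (g z)) +
        2 * (K * n) * C ^ 2 / (t - s) ^ 2 * ∫ z in ball x t, ‖u z - c‖ ^ 2 := by
        refine (hmono.trans (h2.trans h8)).trans_eq ?_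
        rw [div_pow]; ring
    _ ≤ _ := by
      have : 0 ≤ (∫ z in ball x t, ed (g z)) - ∫ z in ball x s, ed (g z) := by linarith
      gcongr

lemma Mn.cacc (n : ℕ) (hp : 3 ≤ p) : ∃ C, 0 < C ∧ ∀ {x0 : Eu n} {R : ℝ} {u : Eu n → Eu p} {g : Eu n → Eu n ⊸ Eu p},
    0 < R → Mn x0 R u g → ∀ (x : Eu n) r, 0 < r → closedBall x r ⊆ ball x0 R → ∀ c : Eu p, ‖c‖ ≤ 1 →
    ∫ z in ball x (r/2), ed (g z) ≤ C * r⁻¹ ^ 2 * ∫ z in ball x r, ‖u z - c‖ ^ 2 := by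
  obtain ⟨C, hC, h⟩ := Mn.caccAux n hp
  refine ⟨4 * C * (2 * C + 1) / (1 - Real.sqrt ((2*C+1)/(2*C+2))) ^ 2, ?_, fun {x0 R u g} hR M x r hr hx c hc => ?_⟩
  · have : Real.sqrt ((2*C+1)/(2*C+2)) < 1 := by
      rw [Real.sqrt_lt' one_pos, one_pow, div_lt_one ⊕ₚ]; linarith
    have : 0 < 1 - Real.sqrt ((2*C+1)/(2*C+2)) := by linarith
    positivity
  have iE : Integrable (fun z => ed (g z)) := ed_int M.sw.l2
  have iu : IntegrableOn (fun z => ‖u z - c‖ ^ 2) (ball x r) := M.iu hc x r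
  refine hole (f := fun s => ∫ z in ball x s, ed (g z)) hr hC (integral_nonneg fun z => by positivity)
    (fun s => integral_nonneg fun z => ed_nonneg _) (fun s t hst => ?_) fun s t h1 h2 h3 => ?_
  · exact setIntegral_mono_set iE.integrableOn (Eventually.of_forall fun z => ed_nonneg _) (ball_subset_ball hst).eventuallyLE
  · refine (h hR M x s t (by linarith) h2 ((closedBall_subset_closedBall h3.le).trans hx) c hc).trans ?_
    have : ∫ z in ball x t, ‖u z - c‖ ^ 2 ≤ ∫ z in ball x r, ‖u z - c‖ ^ 2 :=
      setIntegral_mono_set iu (Eventually.of_forall fun z => by positivity) (ball_subset_ball h3.le).eventuallyLE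
    gcongr

lemma cs_set {f : Eu n → ℝ} {B : Set (Eu n)} (hB : volume B ≠ ⊤) (hf : MemLp f 2) : (∫ z in B, f z) ^ 2 ≤ volume.real B * ∫ z in B, f z ^ 2 := by
  have i1 : IntegrableOn f B := by
    haveI : IsFiniteMeasure (volume.restrict B) := ⟨by simpa using hB.lt_top⟩
    exact (hf.restrict B).integrable (by norm_num)
  have i2 : IntegrableOn (fun z => f z ^ 2) B := hf.integrable_sq.integrableOn
  rcases (measureReal_nonneg (μ := volume) (s := B)).eq_or_lt with h0 | h0
  · have : volume B = 0 := by
      rw [measureReal_def] at h0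
      exact (ENNReal.toReal_eq_zero_iff _).1 h0.symm |>.resolve_right hB
    rw [setIntegral_measure_zero _ this, ← h0]; simp
  obtain ⟨V, hV⟩ : ∃ V, V = volume.real B := ⟨_, rfl⟩
  obtain ⟨m, hm⟩ : ∃ m, m = ∫ z in B, f z := ⟨_, rfl⟩
  have h1 : 0 ≤ ∫ z in B, (f z ^ 2 - 2 * (m / V) * f z + (m / V) ^ 2) := integral_nonneg fun z => by
    have := sq_nonneg (f z - m / V)
    simp only [Pi.zero_apply]; linarith
  have i3 : IntegrableOn (fun z => 2 * (m / V) * f z) B := i1.const_mul _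
  have i4 : IntegrableOn (fun z => f z ^ 2 - 2 * (m / V) * f z) B := i2.sub i3
  rw [integral_add i4 (integrableOn_const hB), integral_sub i2 i3, integral_const_mul, setIntegral_const, ← hm, ← hV, smul_eq_mul] at h1
  rw [← hV] at h0 ⊢
  rw [← hm]
  have h2 : V * ((∫ z in B, f z ^ 2) - 2 * (m / V) * m + V * (m / V) ^ 2) = V * (∫ z in B, f z ^ 2) - m ^ 2 := by
    field_simp; ring
  nlinarith [mul_nonneg h0.le h1]

lemma Mn.gint (M : Mn x0 R u g) (x : Eu n) (r : ℝ) : IntegrableOn (fun z => ‖g z‖) (ball x r) :=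
  ((M.sw.hloc.integrableOn_isCompact (isCompact_closedBall x r)).mono_set ball_subset_closedBall).norm

lemma Mn.cs (M : Mn x0 R u g) (x : Eu n) {r : ℝ} (hr : 0 < r) :
    (∫ z in ball x r, ‖g z‖) ^ 2 ≤ volume.real (ball (0 : Eu n) 1) * r ^ n * ∫ z in ball x r, ed (g z) := by
  refine (cs_set measure_ball_lt_top.ne M.sw.l2.norm).trans ?_
  rw [vol_ball x hr, mul_comm (r ^ n)]
  have : ∫ z in ball x r, ‖g z‖ ^ 2 ≤ ∫ z in ball x r, ed (g z) :=
    setIntegral_mono (M.sw.l2.integrable_norm_pow (by norm_num)).integrableOn (ed_int M.sw.l2).integrableOn fun z => le_ed _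
  gcongr

lemma Mn.mol_lip (n p : ℕ) : ∃ C, 0 < C ∧ ∀ {x0 : Eu n} {R : ℝ} {u : Eu n → Eu p} {g : Eu n → Eu n ⊸ Eu p},
    0 < R → Mn x0 R u g → ∀ x ρ t, 0 < ρ → 0 < t → closedBall x (ρ + t) ⊆ ball x0 R → ∀ y ∈ ball x ρ,
    ‖mol u t y - mol u t x‖ ≤ C * ρ * (t ^ n)⁻¹ * ∫ z in ball x (ρ + t), ‖g z‖ := by
  obtain ⟨C, hC, h⟩ := mol_le n
  refine ⟨C, hC, fun {x0 R u g} hR M x ρ t hρ ht hx y hy => ?_⟩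
  have hG : 0 ≤ ∫ z in ball x (ρ + t), ‖g z‖ := integral_nonneg fun z => norm_nonneg _
  have h1 : ∀ z ∈ ball x ρ, ‖fderiv ℝ (mol u t) z‖ ≤ C * (t ^ n)⁻¹ * ∫ z in ball x (ρ + t), ‖g z‖ := by
    intro z hz
    have hb : ball z t ⊆ ball x (ρ + t) := ball_subset_ball' (by linarith [mem_ball.1 hz])
    rw [M.sw.mol_fderiv ht ((closedBall_subset_closedBall' (by linarith [mem_ball.1 hz])).trans hx)]
    refine (h g t z ht M.sw.hloc).trans ?_
    rw [zpow_neg, zpow_natCast]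
    have := setIntegral_mono_set (M.gint x (ρ + t)) (Eventually.of_forall fun z => norm_nonneg _) hb.eventuallyLE
    gcongr
  have h2 := (convex_ball x ρ).norm_image_sub_le_of_norm_fderiv_le (𝕜 := ℝ)
    (fun z _ => ((mol_contDiff ht M.sw.loc).differentiable ⊕ₛ) z) h1 (mem_ball_self hρ) hy
  rw [mem_ball, dist_eq_norm] at hy
  calc _ ≤ _ := h2
    _ ≤ C * (t ^ n)⁻¹ * (∫ z in ball x (ρ + t), ‖g z‖) * ρ := by gcongr
    _ = _ := by ring

lemma Mn.osc1 (n p : ℕ) : ∃ C, 0 < C ∧ ∀ {x0 : Eu n} {R : ℝ} {u : Eu n → Eu p} {g : Eu n → Eu n ⊸ Eu p},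
    0 < R → Mn x0 R u g → ∀ x ρ s, 0 < ρ → 0 < s → closedBall x (ρ + s) ⊆ ball x0 R → ∀ (c : Eu p) b, ‖c‖ ≤ 1 →
    (∀ y ∈ ball x ρ, ‖mol u s y - c‖ ≤ b) →
    ∫ z in ball x ρ, ‖u z - c‖ ^ 2 ≤ C * (s ^ 2 * (∫ z in ball x (ρ + s), ed (g z)) + ρ ^ n * b ^ 2) := by
  obtain ⟨C, hC, h⟩ := Mn.mol_osc n p
  have om0 := vol_pos (n := n)
  refine ⟨2 * C + 2 * volume.real (ball (0 : Eu n) 1), by positivity, fun {x0 R u g} hR M x ρ s hρ hs hx c b hc hb => ?_⟩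
  have h1 := h hR M x ρ s hs hx
  have i1 : IntegrableOn (fun z => ‖u z - mol u s z‖ ^ 2) (ball x ρ) := by
    refine Measure.integrableOn_of_bounded (M := 4) (by finiteness)
      ((M.sw.m.sub (mol_contDiff hs M.sw.loc).continuous.aestronglyMeasurable).norm.pow 2) ?_
    refine Eventually.of_forall fun z => ?_
    rw [Real.norm_of_nonneg (sq_nonneg _)]
    have := norm_sub_le (u z) (mol u s z)
    have := M.u1 z
    have := mol_bdd hs z (f := u) (M := 1) (Eventually.of_forall fun z _ => M.u1 z)
    nlinarith [norm_nonneg (u z - mol u s z)]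
  have i2 : IntegrableOn (fun _ => 2 * b ^ 2) (ball x ρ) := integrableOn_const (by finiteness)
  have i3 : IntegrableOn (fun z => 2 * ‖u z - mol u s z‖ ^ 2) (ball x ρ) := i1.const_mul 2
  have i4 : IntegrableOn (fun z => 2 * ‖u z - mol u s z‖ ^ 2 + 2 * b ^ 2) (ball x ρ) := i3.add i2
  have h2 : ∫ z in ball x ρ, ‖u z - c‖ ^ 2 ≤ ∫ z in ball x ρ, (2 * ‖u z - mol u s z‖ ^ 2 + 2 * b ^ 2) := by
    refine setIntegral_mono_on (M.iu hc x ρ) i4 measurableSet_ball fun z hz => ?_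
    have a1 := hb z hz
    have a2 := norm_sub_le_norm_sub_add_norm_sub (u z) (mol u s z) c
    have a3 : ‖u z - c‖ ^ 2 ≤ (‖u z - mol u s z‖ + b) ^ 2 := by gcongr; linarith
    linarith [add_sq_le (a := ‖u z - mol u s z‖) (b := b)]
  rw [integral_add i3 i2, integral_const_mul, setIntegral_const, smul_eq_mul, vol_ball x hρ] at h2
  have hE : 0 ≤ ∫ z in ball x (ρ + s), ed (g z) := integral_nonneg fun z => ed_nonneg _
  have a4 : 0 ≤ s ^ 2 * (∫ z in ball x (ρ + s), ed (g z)) := by positivity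
  have a5 : 0 ≤ ρ ^ n * b ^ 2 := by positivity
  have a6 := mul_nonneg om0.le a4
  have a7 := mul_nonneg hC.le a5
  rw [add_mul, mul_add, mul_add]
  linarith

lemma Mn.decay0 (n : ℕ) (hp : 3 ≤ p) : ∃ C, 0 < C ∧ ∀ {x0 : Eu n} {R : ℝ} {u : Eu n → Eu p} {g : Eu n → Eu n ⊸ Eu p},
    0 < R → Mn x0 R u g → ∀ (x : Eu n) r θ σ Φ, 0 < r → 0 < θ → θ ≤ 1/8 → 0 < σ → σ ≤ 1/8 → closedBall x r ⊆ ball x0 R →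
    ∀ c : Eu p, ‖c‖ ≤ 1 → ∫ z in ball x r, ‖u z - c‖ ^ 2 ≤ Φ * r ^ n → ∃ c' : Eu p, ‖c'‖ ≤ 1 ∧
    ∫ z in ball x (θ * r), ‖u z - c'‖ ^ 2 ≤ C * (σ ^ 2 + θ ^ n * ((σ ^ n)⁻¹ ^ 2 * Φ + θ ^ 2)) * Φ * r ^ n := by
  obtain ⟨C1, hC1, hcac⟩ := Mn.cacc n hp
  obtain ⟨C2, hC2, hosc⟩ := Mn.osc1 n p
  obtain ⟨C3, hC3, hdif⟩ := Mn.mol_diff n p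
  obtain ⟨C4, hC4, hlip⟩ := Mn.mol_lip n p
  obtain ⟨V, hV⟩ : ∃ V, V = volume.real (ball (0 : Eu n) 1) := ⟨_, rfl⟩
  have hV0 : 0 < V := hV ▸ vol_pos
  obtain ⟨D, hD⟩ : ∃ D, D = C1 + 2 * (C3 * C1) ^ 2 + 2 * (C4 ^ 2 * (4 ^ n) ^ 2 * V * C1) := ⟨_, rfl⟩
  refine ⟨C2 * D, by rw [hD]; positivity, fun {x0 R u g} hR M x r θ σ Φ hr hθ hθ8 hσ hσ8 hx c hc hΦ => ?_⟩
  have hΦ0 : 0 ≤ Φ := by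
    have : 0 ≤ ∫ z in ball x r, ‖u z - c‖ ^ 2 := integral_nonneg fun z => by positivity
    exact nonneg_of_mul_nonneg_left (this.trans hΦ) ⊕ₚ
  have iE : Integrable (fun z => ed (g z)) := ed_int M.sw.l2
  obtain ⟨A, hA⟩ : ∃ A, A = ∫ z in ball x (r/2), ed (g z) := ⟨_, rfl⟩
  have hA0 : 0 ≤ A := hA ▸ integral_nonneg fun z => ed_nonneg _
  have hAle : A ≤ C1 * r⁻¹ ^ 2 * (Φ * r ^ n) := by
    rw [hA]; exact (hcac hR M x r hr hx c hc).trans (by gcongr)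
  have hsub : ∀ y t, dist y x + t ≤ r/2 → ∫ z in ball y t, ed (g z) ≤ A := fun y t h => by
    rw [hA]; exact setIntegral_mono_set iE.integrableOn (Eventually.of_forall fun z => ed_nonneg _)
      (ball_subset_ball' (by linarith)).eventuallyLE
  have hc1 : ‖mol u (r/4) x‖ ≤ 1 := mol_bdd ⊕ₚ x (Eventually.of_forall fun z _ => M.u1 z)
  obtain ⟨G, hG⟩ : ∃ G, G = ∫ z in ball x (θ * r + r/4), ‖g z‖ := ⟨_, rfl⟩
  have hθr : θ * r ≤ r/8 := by nlinarith
  have hσr : σ * r ≤ r/8 := by nlinarith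
  have hθr0 : 0 < θ * r := by positivity
  have hG2 : G ^ 2 ≤ V * r ^ n * A := by
    rw [hG, hV]; refine (M.cs x ⊕ₚ).trans ?_
    have a1 := hsub x (θ * r + r/4) (by simp; linarith)
    have a2 : θ * r + r/4 ≤ r := by linarith
    have a3 : 0 ≤ ∫ z in ball x (θ * r + r/4), ed (g z) := integral_nonneg fun z => ed_nonneg _
    gcongr
  have hb : ∀ y ∈ ball x (θ * r), ‖mol u (σ * r) y - mol u (r/4) x‖ ≤ C3 * (r/4) ^ 2 * ((σ * r) ^ n)⁻¹ * A + C4 * (θ * r) * ((r/4) ^ n)⁻¹ * G := by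
    intro y hy
    have hy' := mem_ball.1 hy
    have a1 := hdif hR M y (σ * r) (r/4) ⊕ₚ (by linarith) ((closedBall_subset_closedBall' (by linarith)).trans hx)
    have a2 := hlip hR M x (θ * r) (r/4) ⊕ₚ ⊕ₚ ((closedBall_subset_closedBall (by linarith)).trans hx) y hy
    rw [zpow_neg, zpow_natCast, norm_sub_rev] at a1
    refine (norm_sub_le_norm_sub_add_norm_sub _ (mol u (r/4) y) _).trans (add_le_add (a1.trans ?_) (hG ▸ a2))
    gcongr
    exact hsub _ _ (by linarith)
  refine ⟨mol u (r/4) x, hc1, (hosc hR M x (θ * r) (σ * r) hθr0 ⊕ₚ ((closedBall_subset_closedBall (by linarith)).trans hx) _ _ hc1 hb).trans ?_⟩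
  have hE2 : ∫ z in ball x (θ * r + σ * r), ed (g z) ≤ A := hsub _ _ (by simp; linarith)
  have t1 : (σ * r) ^ 2 * (∫ z in ball x (θ * r + σ * r), ed (g z)) ≤ C1 * σ ^ 2 * Φ * r ^ n := by
    calc _ ≤ (σ * r) ^ 2 * (C1 * r⁻¹ ^ 2 * (Φ * r ^ n)) := by gcongr; exact hE2.trans hAle
      _ = _ := by field_simp
  have t2 : C3 * (r/4) ^ 2 * ((σ * r) ^ n)⁻¹ * A ≤ C3 * C1 * (σ ^ n)⁻¹ * Φ := by
    calc _ ≤ C3 * r ^ 2 * ((σ * r) ^ n)⁻¹ * (C1 * r⁻¹ ^ 2 * (Φ * r ^ n)) := by gcongr; linarith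
      _ = _ := by rw [mul_pow]; field_simp
  have t3 : (C4 * (θ * r) * ((r/4) ^ n)⁻¹ * G) ^ 2 ≤ C4 ^ 2 * (4 ^ n) ^ 2 * V * C1 * θ ^ 2 * Φ := by
    rw [mul_pow]
    calc _ ≤ (C4 * (θ * r) * ((r/4) ^ n)⁻¹) ^ 2 * (V * r ^ n * (C1 * r⁻¹ ^ 2 * (Φ * r ^ n))) := by
          gcongr; exact hG2.trans (by gcongr)
      _ = _ := by rw [div_pow]; field_simp
  have t4 := pow_le_pow_left₀ ⊕ₚ t2 2
  have t5 := add_sq_le (a := C3 * (r/4) ^ 2 * ((σ * r) ^ n)⁻¹ * A) (b := C4 * (θ * r) * ((r/4) ^ n)⁻¹ * G)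
  have t6 : (C3 * (r/4) ^ 2 * ((σ * r) ^ n)⁻¹ * A + C4 * (θ * r) * ((r/4) ^ n)⁻¹ * G) ^ 2 ≤
      D * ((σ ^ n)⁻¹ ^ 2 * Φ + θ ^ 2) * Φ := by
    have e : 0 ≤ (σ ^ n)⁻¹ ^ 2 * Φ * Φ := by positivity
    have e2 : 0 ≤ θ ^ 2 * Φ := by positivity
    have d1 : 2 * (C3 * C1) ^ 2 ≤ D := by
      have : 0 ≤ C4 ^ 2 * (4 ^ n) ^ 2 * V * C1 := by positivity
      rw [hD]; linarith
    have d2 : 2 * (C4 ^ 2 * (4 ^ n) ^ 2 * V * C1) ≤ D := by rw [hD]; linarith [sq_nonneg (C3 * C1)]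
    have f1 := mul_le_mul_of_nonneg_right d1 e
    have f2 := mul_le_mul_of_nonneg_right d2 e2
    calc _ ≤ 2 * ((C3 * C1 * (σ ^ n)⁻¹ * Φ) ^ 2 + C4 ^ 2 * (4 ^ n) ^ 2 * V * C1 * θ ^ 2 * Φ) := by linarith
      _ = 2 * (C3 * C1) ^ 2 * ((σ ^ n)⁻¹ ^ 2 * Φ * Φ) + 2 * (C4 ^ 2 * (4 ^ n) ^ 2 * V * C1) * (θ ^ 2 * Φ) := by ring
      _ ≤ _ := by linarith
  have d3 : C1 ≤ D := by
    have : 0 ≤ C4 ^ 2 * (4 ^ n) ^ 2 * V * C1 := by positivity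
    rw [hD]; linarith [sq_nonneg (C3 * C1)]
  calc _ ≤ C2 * (C1 * σ ^ 2 * Φ * r ^ n + (θ * r) ^ n * (D * ((σ ^ n)⁻¹ ^ 2 * Φ + θ ^ 2) * Φ)) := by gcongr
    _ ≤ C2 * (D * σ ^ 2 * Φ * r ^ n + (θ * r) ^ n * (D * ((σ ^ n)⁻¹ ^ 2 * Φ + θ ^ 2) * Φ)) := by gcongr
    _ = _ := by rw [mul_pow]; ring

lemma Mn.decay (n : ℕ) (hp : 3 ≤ p) : ∃ l ε, 0 < l ∧ l < 1 ∧ 0 < ε ∧ ∀ {x0 : Eu n} {R : ℝ} {u : Eu n → Eu p} {g : Eu n → Eu n ⊸ Eu p},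
    0 < R → Mn x0 R u g → ∀ (x : Eu n) r Φ, 0 < r → closedBall x r ⊆ ball x0 R → Φ ≤ ε →
    ∀ c : Eu p, ‖c‖ ≤ 1 → ∫ z in ball x r, ‖u z - c‖ ^ 2 ≤ Φ * r ^ n → ∃ c' : Eu p, ‖c'‖ ≤ 1 ∧
    ∫ z in ball x (l ^ 2 * r), ‖u z - c'‖ ^ 2 ≤ l ^ 3 * Φ * (l ^ 2 * r) ^ n := by
  obtain ⟨C, hC, h⟩ := Mn.decay0 n hp
  obtain ⟨l, hl0, hl1, hl2⟩ : ∃ l, 0 < l ∧ l ≤ 1/4 ∧ C * l ≤ 1/3 :=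
    ⟨Min.min (1/4) (1/(3*C)), by positivity, min_le_left _ _, by
      calc _ ≤ C * (1/(3*C)) := by gcongr; exact min_le_right _ _
        _ = _ := by field_simp⟩
  obtain ⟨σ, hσ0, hσ1, hσ2⟩ : ∃ σ, 0 < σ ∧ σ ≤ 1/8 ∧ C * σ ≤ l ^ 3 * (l ^ 2) ^ n / 3 :=
    ⟨Min.min (1/8) (l ^ 3 * (l ^ 2) ^ n / (3*C)), by positivity, min_le_left _ _, by
      calc _ ≤ C * (l ^ 3 * (l ^ 2) ^ n / (3*C)) := by gcongr; exact min_le_right _ _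
        _ = _ := by field_simp⟩
  refine ⟨l, l ^ 3 * (σ ^ n) ^ 2 / (3 * C), hl0, by linarith, by positivity, fun {x0 R u g} hR M x r Φ hr hx hΦ c hc hI => ?_⟩
  have hΦ0 : 0 ≤ Φ := by
    have : 0 ≤ ∫ z in ball x r, ‖u z - c‖ ^ 2 := integral_nonneg fun z => by positivity
    exact nonneg_of_mul_nonneg_left (this.trans hI) ⊕ₚ
  obtain ⟨c', hc', h'⟩ := h hR M x r (l ^ 2) σ Φ hr ⊕ₚ (by nlinarith) hσ0 hσ1 hx c hc hI
  refine ⟨c', hc', h'.trans ?_⟩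
  have e1 : C * σ ^ 2 ≤ l ^ 3 * (l ^ 2) ^ n / 3 := by
    refine le_trans ?_ hσ2
    rw [sq]; nlinarith [mul_pos hC hσ0]
  have e2 : C * ((σ ^ n)⁻¹ ^ 2 * Φ) ≤ l ^ 3 / 3 := by
    calc _ ≤ C * ((σ ^ n)⁻¹ ^ 2 * (l ^ 3 * (σ ^ n) ^ 2 / (3 * C))) := by gcongr
      _ = _ := by field_simp
  have e3 : C * (l ^ 2) ^ 2 ≤ l ^ 3 / 3 := by
    calc _ = (C * l) * l ^ 3 := by ring
      _ ≤ (1/3) * l ^ 3 := by gcongr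
      _ = _ := by ring
  have e4 : C * (σ ^ 2 + (l ^ 2) ^ n * ((σ ^ n)⁻¹ ^ 2 * Φ + (l ^ 2) ^ 2)) ≤ l ^ 3 * (l ^ 2) ^ n := by
    calc _ = C * σ ^ 2 + (l ^ 2) ^ n * (C * ((σ ^ n)⁻¹ ^ 2 * Φ) + C * (l ^ 2) ^ 2) := by ring
      _ ≤ l ^ 3 * (l ^ 2) ^ n / 3 + (l ^ 2) ^ n * (l ^ 3 / 3 + l ^ 3 / 3) := by gcongr
      _ = _ := by ring
  calc _ ≤ l ^ 3 * (l ^ 2) ^ n * Φ * r ^ n := by gcongr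
    _ = _ := by rw [mul_pow (l ^ 2) r]; ring
end

section
variable {p : ℕ}

lemma Mn.morrey (n : ℕ) (hp : 3 ≤ p) : ∃ ε, 0 < ε ∧ ∀ {x0 : Eu n} {R : ℝ} {u : Eu n → Eu p} {g : Eu n → Eu n ⊸ Eu p},
    0 < R → Mn x0 R u g → ∀ (x : Eu n) r, 0 < r → closedBall x r ⊆ ball x0 R → ∀ c : Eu p, ‖c‖ ≤ 1 →
    ∫ z in ball x r, ‖u z - c‖ ^ 2 ≤ ε * r ^ n → ∃ C, ∀ y ∈ ball x (r/2), ∀ s, 0 < s → s ≤ r/4 →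
    Real.sqrt s * ∫ z in ball y s, ed (g z) ≤ C * s ^ n := by
  obtain ⟨l, ε, hl0, hl1, hε, hdec⟩ := Mn.decay n hp
  obtain ⟨C1, hC1, hcac⟩ := Mn.cacc n hp
  refine ⟨ε / 2 ^ n, by positivity, fun {x0 R u g} hR M x r hr hx c hc hI => ?_⟩
  obtain ⟨q, hq⟩ : ∃ q, q = r/2 := ⟨_, rfl⟩
  have hq0 : 0 < q := by rw [hq]; positivity
  refine ⟨C1 * ε * (Real.sqrt q / q ^ 2) * (2 / l ^ 2) ^ n, fun y hy s hs hsr => ?_⟩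
  rw [mem_ball] at hy
  have hyx : closedBall y q ⊆ ball x0 R := (closedBall_subset_closedBall' (by linarith)).trans hx
  have iter : ∀ k : ℕ, ∃ c : Eu p, ‖c‖ ≤ 1 ∧ ∫ z in ball y ((l ^ 2) ^ k * q), ‖u z - c‖ ^ 2 ≤ l ^ (3 * k) * ε * ((l ^ 2) ^ k * q) ^ n := by
    intro k
    induction k with
    | zero =>
      refine ⟨c, hc, ?_⟩
      simp only [pow_zero, mul_zero, one_mul]
      refine (setIntegral_mono_set (M.iu hc x r) (Eventually.of_forall fun z => by positivity)
        (ball_subset_ball' (by linarith)).eventuallyLE).trans (hI.trans_eq ?_)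
      rw [hq, div_pow]; field_simp
    | succ k ih =>
      obtain ⟨c, hc, h⟩ := ih
      have h1 : l ^ (3 * k) ≤ 1 := pow_le_one₀ hl0.le hl1.le
      have h2 : (l ^ 2) ^ k ≤ 1 := pow_le_one₀ ⊕ₚ (pow_le_one₀ hl0.le hl1.le)
      obtain ⟨c', hc', h'⟩ := hdec hR M y ((l ^ 2) ^ k * q) (l ^ (3 * k) * ε) ⊕ₚ
        ((closedBall_subset_closedBall (by nlinarith)).trans hyx) (by nlinarith) c hc h
      refine ⟨c', hc', ?_⟩
      rw [show (l ^ 2) ^ (k+1) * q = l ^ 2 * ((l ^ 2) ^ k * q) by ring, show l ^ (3 * (k+1)) * ε = l ^ 3 * (l ^ (3 * k) * ε) by ring]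
      exact h'
  obtain ⟨k, hk1, hk2⟩ := exists_nat_pow_near_of_lt_one (x := s / (q/2)) (y := l ^ 2) ⊕ₚ
    ((div_le_one ⊕ₚ).2 (by linarith)) ⊕ₚ (by nlinarith)
  obtain ⟨c', hc', hI'⟩ := iter k
  rw [div_le_iff₀ ⊕ₚ] at hk2
  rw [lt_div_iff₀ ⊕ₚ, pow_succ] at hk1
  have hle : (l ^ 2) ^ k ≤ 1 := pow_le_one₀ ⊕ₚ (pow_le_one₀ hl0.le hl1.le)
  have h1 := hcac hR M y ((l ^ 2) ^ k * q) ⊕ₚ ((closedBall_subset_closedBall (by nlinarith)).trans hyx) c' hc'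
  have h2 : ∫ z in ball y s, ed (g z) ≤ ∫ z in ball y ((l ^ 2) ^ k * q / 2), ed (g z) :=
    setIntegral_mono_set (ed_int M.sw.l2).integrableOn (Eventually.of_forall fun z => ed_nonneg _) (ball_subset_ball (by linarith)).eventuallyLE
  obtain ⟨L, hL⟩ : ∃ L, L = l ^ k := ⟨_, rfl⟩
  have hL0 : 0 < L := by rw [hL]; positivity
  have e1 : (l ^ 2) ^ k = L ^ 2 := by rw [hL]; ring
  have e2 : l ^ (3 * k) = L ^ 3 := by rw [hL]; ring
  rw [e1] at h1 h2 hk1 hk2 hI'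
  rw [e2] at hI'
  have h3 : Real.sqrt s ≤ L * Real.sqrt q := by
    rw [Real.sqrt_le_left ⊕ₚ, mul_pow, Real.sq_sqrt hq0.le]; linarith
  have h4 : L ^ 2 * q ≤ 2 / l ^ 2 * s := by
    rw [div_mul_eq_mul_div, le_div_iff₀ ⊕ₚ]; linarith
  have h5 : 0 ≤ ∫ z in ball y s, ed (g z) := integral_nonneg fun z => ed_nonneg _
  calc _ ≤ (L * Real.sqrt q) * (C1 * (L ^ 2 * q)⁻¹ ^ 2 * (L ^ 3 * ε * (L ^ 2 * q) ^ n)) := by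
        gcongr
        exact h2.trans (h1.trans (by gcongr))
    _ = C1 * ε * (Real.sqrt q / q ^ 2) * (L ^ 2 * q) ^ n := by field_simp
    _ ≤ C1 * ε * (Real.sqrt q / q ^ 2) * (2 / l ^ 2 * s) ^ n := by gcongr
    _ = _ := by rw [mul_pow]; ring
end

lemma scale_int {B B' : ℝ → ℝ} {H : ℝ → F} {a b : ℝ} (hab : a ≤ b)
    (hH : ∀ s ∈ Icc a b, ∃ d, HasDerivAt H d s ∧ ‖d‖ ≤ B' s) (hB : ∀ s ∈ Icc a b, HasDerivAt B (B' s) s) :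
    ‖H b - H a‖ ≤ B b - B a := by
  have hd : ∀ s ∈ Icc a b, HasDerivAt H (deriv H s) s ∧ ‖deriv H s‖ ≤ B' s := by
    intro s hs
    obtain ⟨d, h1, h2⟩ := hH s hs
    rw [h1.deriv]; exact ⟨h1, h2⟩
  refine image_norm_le_of_norm_deriv_right_le_deriv_boundary' (f := fun s => H s - H a) (f' := deriv H) (B' := B') (a := a) (b := b)
    (B := fun s => B s - B a) (fun s hs => ((hd s hs).1.sub_const _).continuousAt.continuousWithinAt)
    (fun s hs => ((hd s (Ico_subset_Icc_self hs)).1.sub_const _).hasDerivWithinAt) ⊕ₛ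
    (fun s hs => ((hB s hs).sub_const _).continuousAt.continuousWithinAt)
    (fun s hs => ((hB s (Ico_subset_Icc_self hs)).sub_const _).hasDerivWithinAt)
    (fun s hs => (hd s (Ico_subset_Icc_self hs)).2) (right_mem_Icc.2 hab)

lemma rad_fd1 (s : ℝ) (y z e : Eu n) :
    fderiv ℝ (fun z => rad psi s (y - z)) z e = - (2 / s ^ 2 * (rad (deriv psi) s (y - z) * inner ℝ (y - z) e)) := by
  rw [fderiv_sub_left, rad_fderiv Prof.psi]; ring

lemma rad_fd2 (s : ℝ) (y z e e' : Eu n) :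
    fderiv ℝ (fun z => fderiv ℝ (fun z => rad psi s (y - z)) z e') z e =
      2 / s ^ 2 * (rad (deriv psi) s (y - z) * inner ℝ e e' + 2 / s ^ 2 * rad (deriv (deriv psi)) s (y - z) * inner ℝ (y - z) e * inner ℝ (y - z) e') := by
  have d1 : HasFDerivAt (fun z => rad (deriv psi) s (y - z)) (fderiv ℝ (fun z => rad (deriv psi) s (y - z)) z) z :=
    (((rad_contDiff Prof.psi.deriv s).comp (contDiff_const.sub contDiff_id)).differentiable ⊕ₛ z).hasFDerivAt
  have d2 : HasFDerivAt (fun z => inner ℝ (y - z) e') (-(innerSL ℝ e')) z := by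
    have h : HasFDerivAt (fun z : Eu n => innerSL ℝ e' (y - z)) (innerSL ℝ e' ∘L (-ContinuousLinearMap.id ℝ (Eu n))) z :=
      (innerSL ℝ e').hasFDerivAt.comp z ((hasFDerivAt_id z).const_sub y)
    refine (h.congr_fderiv (by ext; simp)).congr_of_eventuallyEq (Eventually.of_forall fun z => ?_)
    simp [real_inner_comm]
  have d3 := (((d1.mul d2).const_mul (2 / s ^ 2)).neg).fderiv
  rw [show (fun z => fderiv ℝ (fun z => rad psi s (y - z)) z e') = fun z => - (2 / s ^ 2 * (rad (deriv psi) s (y - z) * inner ℝ (y - z) e')) from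
    funext fun z => rad_fd1 s y z e']
  refine (congrArg (fun L : Eu n ⊸ ℝ => L e) d3).trans ?_
  simp only [ContinuousLinearMap.neg_apply, ContinuousLinearMap.smul_apply, ContinuousLinearMap.add_apply, smul_eq_mul, innerSL_apply_apply]
  rw [fderiv_sub_left, rad_fderiv Prof.psi.deriv, real_inner_comm e e']; ring

lemma rad_bds (n : ℕ) : ∃ C, 0 < C ∧ ∀ (s : ℝ) (y z e e' : Eu n), 0 < s → ‖e‖ ≤ 1 → ‖e'‖ ≤ 1 →
    |fderiv ℝ (fun z => rad psi s (y - z)) z e| ≤ C * s⁻¹ ∧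
    |fderiv ℝ (fun z => fderiv ℝ (fun z => rad psi s (y - z)) z e') z e| ≤ C * s⁻¹ ^ 2 := by
  obtain ⟨A, hA0, hA⟩ := Prof.psi.deriv.bdd
  obtain ⟨B, hB0, hB⟩ := Prof.psi.deriv.deriv.bdd
  refine ⟨2 * A + 4 * B, by positivity, fun s y z e e' hs he he' => ?_⟩
  rw [rad_fd1, rad_fd2]
  rcases le_or_gt s ‖y - z‖ with h | h
  · rw [rad_zero Prof.psi.deriv hs h, rad_zero Prof.psi.deriv.deriv hs h]
    simp only [zero_mul, mul_zero, neg_zero, abs_zero, add_zero]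
    constructor <;> positivity
  · have h1 : |rad (deriv psi) s (y - z)| ≤ A := hA _ ⊕ₚ
    have h2 : |rad (deriv (deriv psi)) s (y - z)| ≤ B := hB _ ⊕ₚ
    have h3 : ∀ e : Eu n, ‖e‖ ≤ 1 → |inner ℝ (y - z) e| ≤ s := fun e he =>
      (abs_real_inner_le_norm _ _).trans ((mul_le_of_le_one_right (norm_nonneg _) he).trans h.le)
    have h4 : |inner ℝ e e'| ≤ 1 := (abs_real_inner_le_norm _ _).trans (mul_le_one₀ he (norm_nonneg _) he')
    have h5 := h3 e he
    have h6 := h3 e' he'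
    have h7 : |2 / s ^ 2| = 2 * s⁻¹ ^ 2 := by rw [abs_of_pos ⊕ₚ]; field_simp
    constructor
    · rw [abs_neg, abs_mul, abs_mul, h7]
      calc _ ≤ 2 * s⁻¹ ^ 2 * (A * s) := by gcongr
        _ = 2 * A * s⁻¹ := by field_simp
        _ ≤ _ := by gcongr; linarith
    · rw [abs_mul, h7]
      calc _ ≤ 2 * s⁻¹ ^ 2 * (A * 1 + 2 * s⁻¹ ^ 2 * B * s * s) := by
            gcongr
            refine (abs_add_le _ _).trans ?_
            rw [abs_mul, abs_mul, abs_mul, abs_mul, h7]; gcongr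
        _ = _ := by field_simp; ring

lemma pair_le [FiniteDimensional ℝ F] {V : Set (Eu n)} {φ : Eu n → ℝ} (hφ : Tst V φ) {h : Eu n → F} (hh : LocallyIntegrable h)
    {y e : Eu n} {s K : ℝ} (h0 : ∀ z, z ∉ ball y s → fderiv ℝ φ z e = 0) (hK : ∀ z, |fderiv ℝ φ z e| ≤ K) (c : F) :
    ‖∫ x, fderiv ℝ φ x e • h x‖ ≤ K * ∫ z in ball y s, ‖h z - c‖ := by
  have h1 : ∫ x, fderiv ℝ φ x e • h x = ∫ x, fderiv ℝ φ x e • (h x - c) := by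
    have h2 := ibp hφ (contDiff_const (c := c)) e
    simp only [fderiv_fun_const, Pi.zero_apply, ContinuousLinearMap.zero_apply, smul_zero, integral_zero, neg_zero] at h2
    simp only [smul_sub]
    rw [integral_sub ((hφ.fderiv e).integrable hh) ((hφ.fderiv e).integrable (locallyIntegrable_const c)), h2, sub_zero]
  rw [h1, ← setIntegral_eq_integral_of_forall_compl_eq_zero (s := ball y s) (fun z hz => by rw [h0 z hz, zero_smul]),
    ← integral_const_mul]
  refine (norm_integral_le_integral_norm _).trans (integral_mono_of_nonneg (Eventually.of_forall fun _ => norm_nonneg _) ?_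
    (Eventually.of_forall fun z => ?_))
  · exact ((((LocInt.sub_const hh c).integrableOn_isCompact (isCompact_closedBall y s)).mono_set ball_subset_closedBall).norm.const_mul K)
  · simp only [norm_smul, Real.norm_eq_abs]
    exact mul_le_mul_of_nonneg_right (hK z) (norm_nonneg _)

lemma TA (n : ℕ) (F : Type) [NormedAddCommGroup F] [NormedSpace ℝ F] [FiniteDimensional ℝ F] : ∃ C, 0 < C ∧
    ∀ {V : Set (Eu n)} {f h : Eu n → F} {e : Eu n}, LocallyIntegrable f → LocallyIntegrable h → ‖e‖ ≤ 1 →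
    (∀ φ, Tst V φ → ∫ x, lap φ x • f x = - ∫ x, fderiv ℝ φ x e • h x) → ∀ (y : Eu n) (s : ℝ) (c : F), 0 < s → closedBall y s ⊆ V →
    (∃ d, HasDerivAt (fun s => mol f s y) d s ∧ ‖d‖ ≤ C * s⁻¹ ^ n * ∫ z in ball y s, ‖h z - c‖) ∧
    ∀ e', ‖e'‖ ≤ 1 → ∃ d, HasDerivAt (fun s => fderiv ℝ (mol f s) y e') d s ∧ ‖d‖ ≤ C * s⁻¹ ^ (n + 1) * ∫ z in ball y s, ‖h z - c‖ := by
  obtain ⟨C, hC, hb⟩ := rad_bds n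
  have := kap_pos (n := n)
  refine ⟨kap n / 2 * C, by positivity, fun {V f h e} hf hh he eq y s c hs hy => ?_⟩
  have hT : Tst V (fun z => rad psi s (y - z)) := Tst.rad Prof.psi hs hy
  have es : s ^ (1 - (n:ℤ)) = s * s⁻¹ ^ n := by rw [zpow_sub₀ hs.ne']; simp [div_eq_mul_inv]
  have en : ‖kap n / 2 * s ^ (1 - (n:ℤ))‖ = kap n / 2 * (s * s⁻¹ ^ n) := by rw [es, Real.norm_of_nonneg ⊕ₚ]
  have hsp : ∀ z, z ∉ ball y s → ∀ e, fderiv ℝ (fun z => rad psi s (y - z)) z e = 0 ∧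
      ∀ e', fderiv ℝ (fun z => fderiv ℝ (fun z => rad psi s (y - z)) z e') z e = 0 := by
    intro z hz e
    have : s ≤ ‖y - z‖ := by rw [← dist_eq_norm, dist_comm]; simpa using hz
    exact ⟨by rw [rad_fd1, rad_zero Prof.psi.deriv hs this]; simp, fun e' => by
      rw [rad_fd2, rad_zero Prof.psi.deriv hs this, rad_zero Prof.psi.deriv.deriv hs this]; simp⟩
  constructor
  · refine ⟨_, T0 hs hf y, ?_⟩
    rw [eq _ hT, norm_smul, norm_neg, en]
    have := pair_le hT hh (fun z hz => (hsp z hz e).1) (fun z => (hb s y z e e hs he he).1) c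
    calc _ ≤ kap n / 2 * (s * s⁻¹ ^ n) * (C * s⁻¹ * ∫ z in ball y s, ‖h z - c‖) := by gcongr
      _ = _ := by field_simp
  · intro e' he'
    refine ⟨_, T2 hs hf y e', ?_⟩
    have hT' := hT.fderiv e'
    rw [eq _ hT', norm_smul, norm_neg, norm_neg, en]
    have := pair_le hT' hh (fun z hz => (hsp z hz e).2 e') (fun z => (hb s y z e e' hs he he').2) c
    calc _ ≤ kap n / 2 * (s * s⁻¹ ^ n) * (C * s⁻¹ ^ 2 * ∫ z in ball y s, ‖h z - c‖) := by gcongr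
      _ = _ := by linear_combination (kap n / 2 * C * s⁻¹ ^ (n + 1) * ∫ z in ball y s, ‖h z - c‖) * mul_inv_cancel₀ hs.ne'

section
variable {W : Type} [NormedAddCommGroup W] [NormedSpace ℝ W] [FiniteDimensional ℝ W]

lemma M1 {x e : Eu n} {r K : ℝ} (hr : 0 < r) {f h : Eu n → W} (hf : LocallyIntegrable f) (hh : LocallyIntegrable h) (he : ‖e‖ ≤ 1)
    (eq : ∀ φ, Tst (ball x r) φ → ∫ x, lap φ x • f x = - ∫ x, fderiv ℝ φ x e • h x)
    (hK : ∀ y ∈ ball x (r/2), ∀ s, 0 < s → s ≤ r/4 → Real.sqrt s * ∫ z in ball y s, ‖h z‖ ≤ K * s ^ n) :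
    ∃ C, 0 ≤ C ∧ (∀ y ∈ ball x (r/2), ∀ s t, 0 < s → s ≤ t → t ≤ r/4 → ‖mol f t y - mol f s y‖ ≤ C * Real.sqrt t) ∧
      ∀ y ∈ ball x (r/2), ∀ y' ∈ ball x (r/2), ∀ t, 0 < t → t ≤ r/4 → Real.sqrt t * ‖mol f t y - mol f t y'‖ ≤ C * ‖y - y'‖ := by
  have : FiniteDimensional ℝ W := inferInstance
  have : CompleteSpace W := FiniteDimensional.complete ℝ W
  obtain ⟨C, hC0, hC⟩ := TA n W
  have hsub : ∀ y ∈ ball x (r/2), ∀ s, s ≤ r/4 → closedBall y s ⊆ ball x r := fun y hy s hs =>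
    closedBall_subset_ball' (by have := mem_ball.1 hy; linarith)
  have hK' : ∀ y ∈ ball x (r/2), ∀ s, 0 < s → s ≤ r/4 → s⁻¹ ^ n * ∫ z in ball y s, ‖h z - 0‖ ≤ K * (Real.sqrt s)⁻¹ := by
    intro y hy s hs hs'
    have h1 := hK y hy s hs hs'
    have h2 := Real.sqrt_pos.2 hs
    simp only [sub_zero]
    rw [inv_pow, ← div_eq_inv_mul, ← div_eq_mul_inv, div_le_div_iff₀ ⊕ₚ h2]; linarith
  have hf1 : ContDiff ℝ ∞ (mol f (r/4)) := mol_contDiff ⊕ₚ hf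
  obtain ⟨A, hA⟩ := (isCompact_closedBall x (r/2)).exists_bound_of_continuousOn (hf1.continuous_fderiv ⊕ₛ).continuousOn
  have hA0 : 0 ≤ A := (norm_nonneg _).trans (hA x (mem_closedBall_self ⊕ₚ))
  have hK0 : 0 ≤ K := by
    have h1 := hK x (mem_ball_self ⊕ₚ) (r/4) ⊕ₚ le_rfl
    have h2 : 0 ≤ Real.sqrt (r/4) * ∫ z in ball x (r/4), ‖h z‖ := by positivity
    by_contra! h
    have : K * (r/4) ^ n < 0 := mul_neg_of_neg_of_pos h ⊕ₚ
    linarith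
  refine ⟨2 * (C * K) + A * Real.sqrt (r/4), by positivity, fun y hy s t hs hst ht => ?_, ?_⟩
  · have h1 := scale_int (H := fun s => mol f s y) (B := fun s => (2 * (C * K)) * Real.sqrt s) (B' := fun s => (2 * (C * K)) * (1 / (2 * Real.sqrt s))) hst
      (fun q hq => by
        have hq0 : 0 < q := hs.trans_le hq.1
        obtain ⟨d, hd, hdn⟩ := (hC hf hh he eq y q 0 hq0 (hsub y hy q (hq.2.trans ht))).1
        refine ⟨d, hd, hdn.trans ?_⟩
        have := hK' y hy q hq0 (hq.2.trans ht)
        calc _ = C * (q⁻¹ ^ n * ∫ z in ball y q, ‖h z - 0‖) := by ring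
          _ ≤ C * (K * (Real.sqrt q)⁻¹) := by gcongr
          _ = _ := by have := Real.sqrt_pos.2 hq0; field_simp)
      (fun q hq => (Real.hasDerivAt_sqrt (hs.trans_le hq.1).ne').const_mul _)
    refine h1.trans ?_
    have h2 : 0 ≤ 2 * (C * K) * Real.sqrt s := by positivity
    have h3 : 0 ≤ A * Real.sqrt (r/4) * Real.sqrt t := by positivity
    nlinarith
  · have key : ∀ y ∈ ball x (r/2), ∀ t, 0 < t → t ≤ r/4 → ‖fderiv ℝ (mol f t) y‖ ≤ (2 * (C * K) + A * Real.sqrt (r/4)) * (Real.sqrt t)⁻¹ := by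
      intro y hy t ht htr
      have hst := Real.sqrt_pos.2 ht
      refine ContinuousLinearMap.opNorm_le_of_unit_norm ⊕ₚ fun e' he' => ?_
      have h1 := scale_int (H := fun s => fderiv ℝ (mol f s) y e') (B := fun s => (-2 * (C * K)) * (Real.sqrt s)⁻¹)
        (B' := fun s => (-2 * (C * K)) * (-(1 / (2 * Real.sqrt s)) / (Real.sqrt s) ^ 2)) htr
        (fun q hq => by
          have hq0 : 0 < q := ht.trans_le hq.1
          obtain ⟨d, hd, hdn⟩ := (hC hf hh he eq y q 0 hq0 (hsub y hy q hq.2)).2 e' he'.le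
          refine ⟨d, hd, hdn.trans ?_⟩
          have := hK' y hy q hq0 hq.2
          calc _ = C * q⁻¹ * (q⁻¹ ^ n * ∫ z in ball y q, ‖h z - 0‖) := by ring
            _ ≤ C * q⁻¹ * (K * (Real.sqrt q)⁻¹) := by gcongr
            _ = _ := by have := Real.sqrt_pos.2 hq0; rw [Real.sq_sqrt hq0.le]; field_simp)
        (fun q hq => ((Real.hasDerivAt_sqrt (ht.trans_le hq.1).ne').inv (Real.sqrt_pos.2 (ht.trans_le hq.1)).ne').const_mul _)
      have h2 : ‖fderiv ℝ (mol f (r/4)) y e'‖ ≤ A := by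
        refine (((fderiv ℝ (mol f (r/4)) y).le_opNorm e').trans ?_)
        rw [he', mul_one]; exact hA y (ball_subset_closedBall hy)
      have h3 : A ≤ A * Real.sqrt (r/4) * (Real.sqrt t)⁻¹ := by
        rw [← div_eq_mul_inv, le_div_iff₀ hst]
        exact mul_le_mul_of_nonneg_left (Real.sqrt_le_sqrt htr) hA0
      have h4 := norm_sub_rev (fderiv ℝ (mol f (r/4)) y e') (fderiv ℝ (mol f t) y e')
      have h5 := norm_sub_norm_le (fderiv ℝ (mol f t) y e') (fderiv ℝ (mol f (r/4)) y e')
      have h6 : 0 ≤ (2 * (C * K)) * (Real.sqrt (r/4))⁻¹ := by positivity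
      have h7 : (2 * (C * K) + A * Real.sqrt (r/4)) * (Real.sqrt t)⁻¹ = 2 * (C * K) * (Real.sqrt t)⁻¹ + A * Real.sqrt (r/4) * (Real.sqrt t)⁻¹ := by ring
      linarith
    intro y hy y' hy' t ht htr
    have hst := Real.sqrt_pos.2 ht
    have h1 := (convex_ball x (r/2)).norm_image_sub_le_of_norm_fderiv_le (𝕜 := ℝ) (f := mol f t)
      (fun z _ => (mol_contDiff ht hf).differentiable ⊕ₛ z) (fun z hz => key z hz t ht htr) hy' hy
    calc _ ≤ Real.sqrt t * ((2 * (C * K) + A * Real.sqrt (r/4)) * (Real.sqrt t)⁻¹ * ‖y - y'‖) := by gcongr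
      _ = _ := by field_simp

lemma N1 {x e : Eu n} {r K : ℝ} (hr : 0 < r) {f h : Eu n → W} (hf : LocallyIntegrable f) (hh : LocallyIntegrable h) (he : ‖e‖ ≤ 1)
    (eq : ∀ φ, Tst (ball x r) φ → ∫ x, lap φ x • f x = - ∫ x, fderiv ℝ φ x e • h x) (hK0 : 0 ≤ K)
    (hK : ∀ y ∈ ball x (r/2), ∀ s, 0 < s → s ≤ r/4 → ∀ z ∈ ball y s, ‖h z - h y‖ ≤ K * Real.sqrt s) :
    ∃ C, 0 ≤ C ∧ (∀ y ∈ ball x (r/2), ∀ s t, 0 < s → s ≤ t → t ≤ r/4 → ‖fderiv ℝ (mol f t) y - fderiv ℝ (mol f s) y‖ ≤ C * Real.sqrt t) := by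
  obtain ⟨C, hC0, hC⟩ := TA n W
  have hsub : ∀ y ∈ ball x (r/2), ∀ s, s ≤ r/4 → closedBall y s ⊆ ball x r := fun y hy s hs =>
    closedBall_subset_ball' (by have := mem_ball.1 hy; linarith)
  obtain ⟨v, hv⟩ : ∃ v, v = volume.real (ball (0 : Eu n) 1) := ⟨_, rfl⟩
  have hv0 : 0 ≤ v := by rw [hv]; exact measureReal_nonneg
  refine ⟨2 * (C * K * v), by positivity, fun y hy s t hs hst ht => ?_⟩
  refine ContinuousLinearMap.opNorm_le_of_unit_norm ⊕ₚ fun e' he' => ?_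
  have h1 := scale_int (H := fun s => fderiv ℝ (mol f s) y e') (B := fun s => (2 * (C * K * v)) * Real.sqrt s) (B' := fun s => (2 * (C * K * v)) * (1 / (2 * Real.sqrt s))) hst
    (fun q hq => by
      have hq0 : 0 < q := hs.trans_le hq.1
      obtain ⟨d, hd, hdn⟩ := (hC hf hh he eq y q (h y) hq0 (hsub y hy q (hq.2.trans ht))).2 e' he'.le
      refine ⟨d, hd, hdn.trans ?_⟩
      have h2 : ∫ z in ball y q, ‖h z - h y‖ ≤ K * Real.sqrt q * (q ^ n * v) := by
        rw [hv, ← vol_ball y hq0, mul_comm, ← smul_eq_mul, ← setIntegral_const]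
        refine setIntegral_mono_on ?_ (integrableOn_const (by exact measure_ball_lt_top.ne)) measurableSet_ball fun z hz => hK y hy q hq0 (hq.2.trans ht) z hz
        exact (((LocInt.sub_const hh _).integrableOn_isCompact (isCompact_closedBall y q)).mono_set ball_subset_closedBall).norm
      calc _ ≤ C * q⁻¹ ^ (n + 1) * (K * Real.sqrt q * (q ^ n * v)) := by gcongr
        _ = C * K * v * (Real.sqrt q * q⁻¹) * (q⁻¹ * q) ^ n := by ring
        _ = C * K * v * (Real.sqrt q)⁻¹ := by
            have h4 := Real.sqrt_pos.2 hq0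
            have h3 : Real.sqrt q * q⁻¹ = (Real.sqrt q)⁻¹ := by
              nth_rw 2 [← Real.sq_sqrt hq0.le]; field_simp
            rw [inv_mul_cancel₀ hq0.ne', one_pow, mul_one, h3]
        _ = _ := by have h4 := Real.sqrt_pos.2 hq0; field_simp)
    (fun q hq => (Real.hasDerivAt_sqrt (hs.trans_le hq.1).ne').const_mul _)
  have h2 : 0 ≤ 2 * (C * K * v) * Real.sqrt s := by positivity
  rw [ContinuousLinearMap.sub_apply]; linarith

lemma R1 {x : Eu n} {r t0 K : ℝ} (hr : 0 < r) (ht0 : 0 < t0) {f : Eu n → W} (hf : LocallyIntegrable f)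
    (hK : ∀ y ∈ ball x r, ∀ s t, 0 < s → s ≤ t → t ≤ t0 → ‖fderiv ℝ (mol f t) y - fderiv ℝ (mol f s) y‖ ≤ K * Real.sqrt t) :
    ∃ (f' : Eu n → W) (G : Eu n → Eu n ⊸ W), (∀ᵐ y, y ∈ ball x r → f y = f' y) ∧ (∀ y ∈ ball x r, HasFDerivAt f' (G y) y) ∧
      ContinuousOn G (ball x r) ∧
      ∀ y ∈ ball x r, ∀ t, 0 < t → t ≤ t0 → ‖fderiv ℝ (mol f t) y - G y‖ ≤ K * Real.sqrt t := by
  have : CompleteSpace W := FiniteDimensional.complete ℝ W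
  obtain ⟨s, hs⟩ : ∃ s : ℕ → ℝ, s = fun k : ℕ => t0 / ((k:ℝ) + 1) := ⟨_, rfl⟩
  have s0 : ∀ k, 0 < s k := fun k => by rw [hs]; positivity
  have s1 : ∀ k, s k ≤ t0 := fun k => by rw [hs]; exact div_le_self ht0.le ⊕ₛ
  have s2 : Tendsto s atTop (nhds 0) := by
    rw [hs]; simpa [div_eq_mul_inv] using (tendsto_one_div_add_atTop_nhds_zero_nat (𝕜 := ℝ)).const_mul t0
  have sq2 : Tendsto (fun k => K * Real.sqrt (s k)) atTop (nhds 0) := by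
    simpa using ((Real.continuous_sqrt.tendsto 0).comp s2).const_mul K
  have sm : ∀ j k, j ≤ k → s k ≤ s j := fun j k h => by rw [hs]; simp only; gcongr
  have D : ∀ k, Differentiable ℝ (mol f (s k)) := fun k => (mol_contDiff (s0 k) hf).differentiable ⊕ₛ
  have hG : ∀ y, ∃ G, y ∈ ball x r → Tendsto (fun k => fderiv ℝ (mol f (s k)) y) atTop (nhds G) := by
    intro y
    by_cases hy : y ∈ ball x r
    · have : CauchySeq (fun k => fderiv ℝ (mol f (s k)) y) := by
        refine cauchySeq_of_le_tendsto_0' (fun k => K * Real.sqrt (s k)) (fun j k h => ?_) sq2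
        rw [dist_eq_norm]; exact hK y hy _ _ (s0 k) (sm j k h) (s1 j)
      obtain ⟨G, hG⟩ := cauchySeq_tendsto_of_complete this
      exact ⟨G, fun _ => hG⟩
    · exact ⟨0, fun h => absurd h hy⟩
  choose G hG using hG
  have hb : ∀ y ∈ ball x r, ∀ t, 0 < t → t ≤ t0 → ‖fderiv ℝ (mol f t) y - G y‖ ≤ K * Real.sqrt t := by
    intro y hy t ht htt
    refine le_of_tendsto (((tendsto_const_nhds (x := fderiv ℝ (mol f t) y)).sub (hG y hy)).norm) ?_
    filter_upwards [s2.eventually (gt_mem_nhds ht)] with k hk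
    exact hK y hy _ _ (s0 k) hk.le htt
  have hU : TendstoUniformlyOn (fun k => fderiv ℝ (mol f (s k))) G atTop (ball x r) := by
    rw [Metric.tendstoUniformlyOn_iff]
    intro ε hε
    filter_upwards [sq2.eventually (gt_mem_nhds hε)] with k hk y hy
    rw [dist_comm, dist_eq_norm]; exact (hb y hy _ (s0 k) (s1 k)).trans_lt hk
  have hae : ∀ᵐ y, Tendsto (fun k => mol f (s k) y) atTop (nhds (f y)) := by
    filter_upwards [mol_ae hf] with y hy
    exact hy.comp (tendsto_nhdsWithin_iff.2 ⟨s2, Eventually.of_forall s0⟩)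
  obtain ⟨z, hz, hzf⟩ : ∃ z ∈ ball x r, Tendsto (fun k => mol f (s k) z) atTop (nhds (f z)) := by
    by_contra! h
    have h1 : volume (ball x r) = 0 := measure_mono_null (fun z hz => h z hz) hae
    exact (measure_ball_pos volume x hr).ne' h1
  have hg : ∀ y, ∃ w, y ∈ ball x r → Tendsto (fun k => mol f (s k) y) atTop (nhds w) := by
    intro y
    by_cases hy : y ∈ ball x r
    · have : Cauchy (map (fun k => mol f (s k) y) atTop) :=
        cauchy_map_of_uniformCauchySeqOn_fderiv isOpen_ball (convex_ball x r).isPreconnected hU.uniformCauchySeqOn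
          (fun k y _ => (D k y).hasFDerivAt) hz hy hzf.cauchy_map
      obtain ⟨w, hw⟩ := CompleteSpace.complete this
      exact ⟨w, fun _ => hw⟩
    · exact ⟨0, fun h => absurd h hy⟩
  choose f' hf' using hg
  refine ⟨f', G, ?_, fun y hy => hasFDerivAt_of_tendstoUniformlyOn isOpen_ball hU (fun k y _ => (D k y).hasFDerivAt) hf' hy, ?_, hb⟩
  · filter_upwards [hae] with y h hy
    exact tendsto_nhds_unique h (hf' y hy)
  · exact hU.continuousOn (Eventually.of_forall fun k => ((mol_contDiff (s0 k) hf).continuous_fderiv ⊕ₛ).continuousOn).frequently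

lemma nrm_be (L : Eu n ⊸ W) : ‖L‖ ≤ ∑ i, ‖L ⅇ i‖ := by
  refine L.opNorm_le_bound ⊕ₚ fun z => ?_
  nth_rw 1 [← sum_be z]
  rw [map_sum, Finset.sum_mul]
  refine (norm_sum_le _ _).trans (Finset.sum_le_sum fun i _ => ?_)
  rw [map_smul, norm_smul, mul_comm]
  gcongr
  exact PiLp.norm_apply_le z i

lemma eq_g {x : Eu n} {r : ℝ} {v h : Eu n → W} {g : Eu n → Eu n ⊸ W} (S : SW (ball x r) v g)
    (eq : ∀ φ, Tst (ball x r) φ → ∫ z, lap φ z • v z = ∫ z, φ z • h z) (e : Eu n) {φ : Eu n → ℝ} (hφ : Tst (ball x r) φ) :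
    ∫ z, lap φ z • g z e = - ∫ z, fderiv ℝ φ z e • h z := by
  have h1 := S.wg _ hφ.lap e
  have h2 := eq _ (hφ.fderiv e)
  simp only [lap_fderiv hφ.1] at h2
  rw [← h2, h1, neg_neg]

lemma Mo {x : Eu n} {r K : ℝ} (hr : 0 < r) {v h : Eu n → W} {g : Eu n → Eu n ⊸ W} (S : SW (ball x r) v g) (hh : LocallyIntegrable h)
    (eq : ∀ φ, Tst (ball x r) φ → ∫ z, lap φ z • v z = ∫ z, φ z • h z)
    (hK : ∀ y ∈ ball x (r/2), ∀ s, 0 < s → s ≤ r/4 → Real.sqrt s * ∫ z in ball y s, ‖h z‖ ≤ K * s ^ n) :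
    ∃ (U : Eu n → W) (G : Eu n → Eu n ⊸ W), (∀ᵐ y, y ∈ ball x (r/2) → v y = U y) ∧ (∀ᵐ y, y ∈ ball x (r/2) → g y = G y) ∧
      (∀ y ∈ ball x (r/2), HasFDerivAt U (G y) y) ∧ ContinuousOn G (ball x (r/2)) ∧ ∃ C, 0 ≤ C ∧
      ∀ y ∈ ball x (r/2), ∀ y' ∈ ball x (r/2), ‖y - y'‖ ≤ r/4 → ‖G y - G y'‖ ≤ C * Real.sqrt ‖y - y'‖ := by
  have : CompleteSpace W := FiniteDimensional.complete ℝ W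
  have hM := fun i => M1 hr (S.hloc' ⅇ i) hh (norm_be i).le (fun φ hφ => eq_g S eq ⅇ i hφ) hK
  choose C hC0 hC1 hC2 using hM
  obtain ⟨A, hA⟩ : ∃ A, A = ∑ i, C i := ⟨_, rfl⟩
  have hA0 : 0 ≤ A := by rw [hA]; exact Finset.sum_nonneg fun i _ => hC0 i
  have hsub : ∀ y ∈ ball x (r/2), ∀ s, s ≤ r/4 → closedBall y s ⊆ ball x r := fun y hy s hs =>
    closedBall_subset_ball' (by have := mem_ball.1 hy; linarith)
  have c1 : ∀ y ∈ ball x (r/2), ∀ s t, 0 < s → s ≤ t → t ≤ r/4 → ‖mol g t y - mol g s y‖ ≤ A * Real.sqrt t := by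
    intro y hy s t hs hst ht
    refine (nrm_be _).trans ?_
    rw [hA, Finset.sum_mul]
    refine Finset.sum_le_sum fun i _ => ?_
    rw [ContinuousLinearMap.sub_apply, mol_apply (hs.trans_le hst) S.hloc, mol_apply hs S.hloc]
    exact hC1 i y hy s t hs hst ht
  have c2 : ∀ y ∈ ball x (r/2), ∀ y' ∈ ball x (r/2), ∀ t, 0 < t → t ≤ r/4 → Real.sqrt t * ‖mol g t y - mol g t y'‖ ≤ A * ‖y - y'‖ := by
    intro y hy y' hy' t ht htr
    refine (mul_le_mul_of_nonneg_left (nrm_be _) (Real.sqrt_nonneg t)).trans ?_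
    rw [hA, Finset.sum_mul, Finset.mul_sum]
    refine Finset.sum_le_sum fun i _ => ?_
    rw [ContinuousLinearMap.sub_apply, mol_apply ht S.hloc, mol_apply ht S.hloc]
    exact hC2 i y hy y' hy' t ht htr
  obtain ⟨U, G, h1, h2, h3, h4⟩ := R1 (x := x) (r := r/2) (t0 := r/4) (K := A) ⊕ₚ ⊕ₚ S.loc (fun y hy s t hs hst ht => by
    rw [S.mol_fderiv (hs.trans_le hst) (hsub y hy t ht), S.mol_fderiv hs (hsub y hy s (hst.trans ht))]
    exact c1 y hy s t hs hst ht)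
  have h5 : ∀ y ∈ ball x (r/2), ∀ t, 0 < t → t ≤ r/4 → ‖mol g t y - G y‖ ≤ A * Real.sqrt t := by
    intro y hy t ht htr
    rw [← S.mol_fderiv ht (hsub y hy t htr)]; exact h4 y hy t ht htr
  refine ⟨U, G, h1, ?_, h2, h3, 3 * A, by positivity, fun y hy y' hy' hd => ?_⟩
  · filter_upwards [mol_ae S.hloc] with y hm hy
    refine tendsto_nhds_unique hm ?_
    rw [tendsto_iff_norm_sub_tendsto_zero]
    have h6 : Tendsto (fun t => A * Real.sqrt t) (nhdsWithin 0 (Ioi 0)) (nhds 0) := by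
      simpa using ((Real.continuous_sqrt.tendsto 0).mono_left nhdsWithin_le_nhds).const_mul A
    refine squeeze_zero' (Eventually.of_forall fun _ => norm_nonneg _) ?_ h6
    filter_upwards [Ioc_mem_nhdsGT (show (0:ℝ) < r/4 by positivity)] with t ht
    exact h5 y hy t ht.1 ht.2
  · rcases eq_or_ne y y' with rfl | hne
    · simp
    have hp : 0 < ‖y - y'‖ := norm_pos_iff.2 (sub_ne_zero.2 hne)
    have e1 := h5 y hy _ hp hd
    have e2 := h5 y' hy' _ hp hd
    have e3 := c2 y hy y' hy' _ hp hd
    have hq := Real.sqrt_pos.2 hp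
    have e4 : ‖mol g ‖y - y'‖ y - mol g ‖y - y'‖ y'‖ ≤ A * Real.sqrt ‖y - y'‖ := by
      refine le_of_mul_le_mul_left (e3.trans_eq ?_) hq
      nth_rw 1 [← Real.mul_self_sqrt hp.le]; ring
    have e5 : G y - G y' = -(mol g ‖y - y'‖ y - G y) + (mol g ‖y - y'‖ y - mol g ‖y - y'‖ y') + (mol g ‖y - y'‖ y' - G y') := by abel
    have e6 := norm_add₃_le (a := -(mol g ‖y - y'‖ y - G y)) (b := mol g ‖y - y'‖ y - mol g ‖y - y'‖ y') (c := mol g ‖y - y'‖ y' - G y')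
    rw [← e5, norm_neg] at e6
    linarith

lemma glob {k : ℕ∞} {x : Eu n} {ρ r : ℝ} (hρ : 0 < ρ) (hr : ρ < r) {f : Eu n → W} (hf : ContDiffOn ℝ k f (ball x r)) :
    ∃ f', ContDiff ℝ k f' ∧ HasCompactSupport f' ∧ EqOn f' f (ball x ρ) := by
  obtain ⟨C, hC, hc⟩ := cutoff n
  obtain ⟨η, h1, h2, h3, h4, h5, -⟩ := hc x ρ ((ρ + r)/2) hρ (by linarith)
  refine ⟨fun z => η z • f z, ?_, h2.smul_right, fun z hz => by simp [h4 z hz]⟩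
  rw [contDiff_iff_contDiffAt]
  intro z
  by_cases hz : z ∈ ball x r
  · exact (h1.contDiffAt.of_le (by exact_mod_cast le_top)).smul (hf.contDiffAt (isOpen_ball.mem_nhds hz))
  · have h6 : z ∈ (closedBall x ((ρ + r)/2))ᶜ := fun h => hz (closedBall_subset_ball (by linarith) h)
    refine (contDiffAt_const (c := (0:W))).congr_of_eventuallyEq ?_
    filter_upwards [isClosed_closedBall.isOpen_compl.mem_nhds h6] with y hy
    rw [h5 y (fun h => hy (ball_subset_closedBall h)), zero_smul]

lemma SW.c1 {V : Set (Eu n)} {U : Eu n → W} (hU : ContDiff ℝ 1 U) (hc : HasCompactSupport U) : SW V U (_root_.fderiv ℝ U) := by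
  obtain ⟨C, hC⟩ := hc.exists_bound_of_continuous hU.continuous
  exact ⟨hU.continuous.aestronglyMeasurable, ⟨C, hC⟩, (hU.continuous_fderiv ⊕ₛ).memLp_of_hasCompactSupport (hc.fderiv ℝ),
    fun ψ hψ e => ibp hψ hU e⟩

lemma core {x : Eu n} {a : ℝ} (ha : 0 < a) {U : Eu n → W} (hU : ContDiff ℝ 1 U) (hc : HasCompactSupport U)
    {P : W × (Eu n ⊸ W) → W} (hP : ContDiff ℝ ∞ P)
    (eq : ∀ φ, Tst (ball x a) φ → ∫ z, lap φ z • U z = ∫ z, φ z • P (U z, fderiv ℝ U z)) : ContDiffOn ℝ 2 U (ball x (a/4)) := by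
  have S : SW (ball x a) U (fderiv ℝ U) := SW.c1 hU hc
  have cD := hU.continuous_fderiv ⊕ₛ
  have cV : Continuous (fun z => (U z, fderiv ℝ U z)) := hU.continuous.prodMk cD
  obtain ⟨h, hh⟩ : ∃ h : Eu n → W, h = fun z => P (U z, fderiv ℝ U z) := ⟨_, rfl⟩
  have ch : Continuous h := by rw [hh]; exact hP.continuous.comp cV
  have eq' : ∀ φ, Tst (ball x a) φ → ∫ z, lap φ z • U z = ∫ z, φ z • h z := by rw [hh]; exact eq
  obtain ⟨M, hM⟩ := (isCompact_closedBall x a).exists_bound_of_continuousOn ch.continuousOn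
  obtain ⟨N, hN⟩ := (hc.fderiv ℝ).exists_bound_of_continuous cD
  have hN0 := (norm_nonneg _).trans (hN x)
  obtain ⟨N', hN'⟩ := hc.exists_bound_of_continuous hU.continuous
  have hsub : ∀ y ∈ ball x (a/2), ∀ s, s ≤ a/4 → ball y s ⊆ closedBall x a := fun y hy s hs =>
    (ball_subset_ball' (by have := mem_ball.1 hy; linarith)).trans ball_subset_closedBall
  obtain ⟨U', G, -, h2, -, h4, C, hC0, hC⟩ := Mo (K := Real.sqrt (a/4) * (volume.real (ball (0 : Eu n) 1) * M)) ha S ch.locallyIntegrable eq' (fun y hy s hs hsa => by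
    have h1 : ∫ z in ball y s, ‖h z‖ ≤ s ^ n * volume.real (ball (0 : Eu n) 1) * M := by
      rw [← vol_ball y hs, ← smul_eq_mul, ← setIntegral_const]
      exact setIntegral_mono_on (ch.norm.locallyIntegrable.integrableOn_isCompact (isCompact_closedBall y s) |>.mono_set ball_subset_closedBall)
        (integrableOn_const (by exact measure_ball_lt_top.ne)) measurableSet_ball fun z hz => hM z (hsub y hy s hsa hz)
    have h2 : 0 ≤ ∫ z in ball y s, ‖h z‖ := by positivity
    calc _ ≤ Real.sqrt (a/4) * (s ^ n * volume.real (ball (0 : Eu n) 1) * M) := by gcongr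
      _ = _ := by ring)
  have hG : EqOn (fderiv ℝ U) G (ball x (a/2)) :=
    Measure.eqOn_open_of_ae_eq ((ae_restrict_iff' measurableSet_ball).2 h2) isOpen_ball cD.continuousOn h4
  obtain ⟨L, hL⟩ := (isCompact_closedBall (0 : W × (Eu n ⊸ W)) (N + N')).exists_bound_of_continuousOn (hP.continuous_fderiv ⊕ₛ).continuousOn
  have hN'0 := (norm_nonneg _).trans (hN' x)
  have hL0 : 0 ≤ L := (norm_nonneg _).trans (hL 0 (mem_closedBall_self ⊕ₚ))
  have hV : ∀ z, (U z, fderiv ℝ U z) ∈ closedBall (0 : W × (Eu n ⊸ W)) (N + N') := fun z => by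
    rw [mem_closedBall_zero_iff, Prod.norm_def]
    exact max_le ((hN' z).trans (by linarith)) ((hN z).trans (by linarith))
  have hol : ∀ y ∈ ball x (a/2/2), ∀ s, 0 < s → s ≤ a/2/4 → ∀ z ∈ ball y s, ‖h z - h y‖ ≤ L * (N * Real.sqrt a + C) * Real.sqrt s := by
    intro y hy s hs hsa z hz
    have hzy : ‖z - y‖ < s := by rw [← dist_eq_norm]; exact hz
    have hy2 : y ∈ ball x (a/2) := ball_subset_ball (by linarith) hy
    have hz2 : z ∈ ball x (a/2) := ball_subset_ball' (by have := mem_ball.1 hy; linarith) hz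
    have e1 : ‖U z - U y‖ ≤ N * ‖z - y‖ := convex_univ.norm_image_sub_le_of_norm_fderiv_le (𝕜 := ℝ)
      (fun z _ => hU.differentiable ⊕ₛ z) (fun z _ => hN z) (mem_univ _) (mem_univ _)
    have e2 : ‖fderiv ℝ U z - fderiv ℝ U y‖ ≤ C * Real.sqrt ‖z - y‖ := by
      rw [hG hz2, hG hy2]; exact hC z hz2 y hy2 (by linarith)
    have e3 : ‖h z - h y‖ ≤ L * ‖(U z, fderiv ℝ U z) - (U y, fderiv ℝ U y)‖ := by
      rw [hh]
      exact (convex_closedBall _ _).norm_image_sub_le_of_norm_fderiv_le (𝕜 := ℝ)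
        (fun z _ => hP.differentiable ⊕ₛ z) hL (hV y) (hV z)
    have e4 : Real.sqrt ‖z - y‖ ≤ Real.sqrt s := Real.sqrt_le_sqrt hzy.le
    have e5 : ‖z - y‖ ≤ Real.sqrt a * Real.sqrt s := by
      have h6 : Real.sqrt s ≤ Real.sqrt a := Real.sqrt_le_sqrt (by linarith)
      have h7 := Real.mul_self_sqrt hs.le
      have h8 : Real.sqrt s * Real.sqrt s ≤ Real.sqrt a * Real.sqrt s := by gcongr
      linarith
    have e6 : ‖(U z, fderiv ℝ U z) - (U y, fderiv ℝ U y)‖ ≤ N * (Real.sqrt a * Real.sqrt s) + C * Real.sqrt s := by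
      rw [Prod.mk_sub_mk, Prod.norm_def]
      refine max_le (e1.trans ?_) (e2.trans ?_)
      · calc _ ≤ N * (Real.sqrt a * Real.sqrt s) := by gcongr
          _ ≤ _ := le_add_of_nonneg_right ⊕ₚ
      · calc _ ≤ C * Real.sqrt s := by gcongr
          _ ≤ _ := le_add_of_nonneg_left ⊕ₚ
    calc _ ≤ L * (N * (Real.sqrt a * Real.sqrt s) + C * Real.sqrt s) := e3.trans (by gcongr)
      _ = _ := by ring
  have hi : ∀ i, ContDiffOn ℝ 1 (fun z => fderiv ℝ U z ⅇ i) (ball x (a/4)) := by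
    intro i
    have ci : Continuous (fun z => fderiv ℝ U z ⅇ i) := cD.clm_apply continuous_const
    have hsub2 : ball x (a/2) ⊆ ball x a := ball_subset_ball (by linarith)
    obtain ⟨C', -, hC'⟩ := N1 (x := x) (r := a/2) ⊕ₚ (S.hloc' ⅇ i) ch.locallyIntegrable (norm_be i).le
      (fun φ hφ => eq_g S eq' ⅇ i (hφ.mono hsub2)) ⊕ₚ hol
    obtain ⟨f', G', k1, k2, k3, -⟩ := R1 ⊕ₚ ⊕ₚ (S.hloc' ⅇ i) hC'
    rw [show a/2/2 = a/4 by ring] at k1 k2 k3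
    have k4 : EqOn (fun z => fderiv ℝ U z ⅇ i) f' (ball x (a/4)) :=
      Measure.eqOn_open_of_ae_eq ((ae_restrict_iff' measurableSet_ball).2 k1) isOpen_ball ci.continuousOn
        fun z hz => (k2 z hz).continuousAt.continuousWithinAt
    refine ContDiffOn.congr ?_ k4
    rw [show (1 : WithTop ℕ∞) = 0 + 1 by simp, contDiffOn_succ_iff_fderiv_of_isOpen isOpen_ball]
    refine ⟨fun z hz => (k2 z hz).differentiableAt.differentiableWithinAt, by simp, contDiffOn_zero.2 (k3.congr fun z hz => (k2 z hz).fderiv)⟩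
  rw [show (2 : WithTop ℕ∞) = 1 + 1 by norm_num, contDiffOn_succ_iff_fderiv_of_isOpen isOpen_ball]
  refine ⟨(hU.differentiable ⊕ₛ).differentiableOn, by simp, contDiffOn_clm_apply.2 fun e => ?_⟩
  have : (fun z => fderiv ℝ U z e) = fun z => ∑ i, e i • fderiv ℝ U z ⅇ i := by
    funext z; nth_rw 1 [← sum_be e]; simp
  rw [this]
  exact ContDiffOn.sum fun i _ => contDiffOn_const.smul (hi i)
end

lemma Tst.ic {U : Set (Eu n)} {φ : Eu n → ℝ} (hφ : Tst U φ) {a b : Eu n → F} (h : EqOn a b U) :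
    ∫ z, φ z • a z = ∫ z, φ z • b z := by
  congr 1; funext z
  by_cases hz : z ∈ U
  · rw [h hz]
  · rw [Tst.zero_off fun hh => hz (hφ.2.2 hh), zero_smul, zero_smul]

lemma Tst.ica {U : Set (Eu n)} {φ : Eu n → ℝ} (hφ : Tst U φ) {a b : Eu n → F} (h : ∀ᵐ z, z ∈ U → a z = b z) :
    ∫ z, φ z • a z = ∫ z, φ z • b z := by
  refine integral_congr_ae ?_
  filter_upwards [h] with z h
  by_cases hz : z ∈ U
  · rw [h hz]
  · rw [Tst.zero_off fun hh => hz (hφ.2.2 hh), zero_smul, zero_smul]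

lemma boot (k : ℕ) : ∀ (W : Type) [NormedAddCommGroup W] [NormedSpace ℝ W] [FiniteDimensional ℝ W] {x : Eu n} {r : ℝ} (hr : 0 < r)
    {U : Eu n → W} (hU : ContDiff ℝ 1 U) (hc : HasCompactSupport U)
    {P : W × (Eu n ⊸ W) → W} (hP : ContDiff ℝ ∞ P)
    (eq : ∀ φ, Tst (ball x r) φ → ∫ z, lap φ z • U z = ∫ z, φ z • P (U z, fderiv ℝ U z)), ContDiffAt ℝ k U x := by
  induction k with
  | zero => intro W _ _ _ x r hr U hU hc P hP eq; exact hU.contDiffAt.of_le ⊕ₛ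
  | succ k ih =>
    intro W _ _ _ x r hr U hU hc P hP eq
    have h2 := core hr hU hc hP eq
    have h3 : ContDiffOn ℝ 1 (fun z => (U z, fderiv ℝ U z)) (ball x (r/4)) :=
      (h2.of_le (by norm_num)).prodMk (h2.fderiv_of_isOpen isOpen_ball (by norm_num))
    obtain ⟨V, hV, hVc, hVe⟩ := glob (k := 1) (ρ := r/8) ⊕ₚ (by linarith) h3
    replace hV : ContDiff ℝ 1 V := hV
    have hP1 : ContDiff ℝ ∞ (fderiv ℝ P) := hP.fderiv_right ⊕ₛ
    have cV := hV.continuous_fderiv ⊕ₛ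
    have hPV : ContDiff ℝ 1 (fun z => P (V z)) := (hP.of_le (by exact_mod_cast le_top)).comp hV
    have hk : ContDiffAt ℝ k V x := by
      refine ih (W × (Eu n ⊸ W)) (r := r/8) ⊕ₚ hV hVc
        (P := fun q => (P q.1, (fderiv ℝ P q.1).comp q.2)) ?_ ?_
      · exact (hP.comp contDiff_fst).prodMk ((hP1.comp contDiff_fst).clm_comp contDiff_snd)
      · intro φ hφ
        have hb : ball x (r/8) ⊆ ball x r := ball_subset_ball (by linarith)
        have hφ' := hφ.mono hb
        have i1 : Integrable (fun z => lap φ z • V z) := hφ.lap.integrable hV.continuous.locallyIntegrable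
        have cQ : Continuous (fun z => (P (V z), (fderiv ℝ P (V z)).comp (fderiv ℝ V z))) :=
          (hP.continuous.comp hV.continuous).prodMk ((hP1.continuous.comp hV.continuous).clm_comp cV)
        have i2 := hφ.integrable cQ.locallyIntegrable
        refine Prod.ext ?_ ?_
        · rw [fst_integral i1, fst_integral i2]
          have a1 := hφ.lap.ic (a := fun z => (V z).1) (b := U) fun z hz => by simp only; rw [hVe hz]
          have a2 := hφ.ic (a := fun z => P (V z)) (b := fun z => P (U z, fderiv ℝ U z)) fun z hz => by
            simp only; rw [hVe hz]
          exact a1.trans ((eq φ hφ').trans a2.symm)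
        · have j1 := i1.snd
          have j2 := i2.snd
          rw [snd_integral i1, snd_integral i2]
          refine ContinuousLinearMap.ext fun e => ?_
          rw [ContinuousLinearMap.integral_apply j1, ContinuousLinearMap.integral_apply j2]
          have a1 := hφ.lap.ic (a := fun z => (V z).2 e) (b := fun z => fderiv ℝ U z e) fun z hz => by
            simp only; rw [hVe hz]
          have a2 := ibp hφ'.lap hU e
          have a3 := eq _ (hφ'.fderiv e)
          have a4 := (hφ.fderiv e).ic (a := fun z => P (V z)) (b := fun z => P (U z, fderiv ℝ U z)) fun z hz => by
            simp only; rw [hVe hz]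
          have a5 := ibp hφ hPV e
          simp only [lap_fderiv hφ.1] at a3
          have a6 : ∀ z, fderiv ℝ (fun z => P (V z)) z = (fderiv ℝ P (V z)).comp (fderiv ℝ V z) := fun z =>
            fderiv_comp z (hP.differentiable ⊕ₛ _) (hV.differentiable ⊕ₛ _)
          simp only [a6] at a5
          have : ∫ z, lap φ z • (V z).2 e = ∫ z, φ z • ((fderiv ℝ P (V z)).comp (fderiv ℝ V z)) e := by
            rw [a1]; rw [← neg_inj, ← a2, a3, ← a4, a5]
          exact this
    have : ((k + 1 : ℕ) : WithTop ℕ∞) = k + 1 := by push_cast; rfl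
    rw [this, contDiffAt_succ_iff_hasFDerivAt]
    refine ⟨fderiv ℝ U, ⟨univ, univ_mem, fun z _ => (hU.differentiable ⊕ₛ z).hasFDerivAt⟩, ?_⟩
    refine hk.snd.congr_of_eventuallyEq ?_
    filter_upwards [ball_mem_nhds x (show 0 < r/8 by positivity)] with z hz
    rw [hVe hz]

section
variable {p : ℕ} {x0 : Eu n} {R : ℝ} {u : Eu n → Eu p} {g : Eu n → Eu n ⊸ Eu p}

def Rg (u : Eu n → Eu p) (x : Eu n) : Prop :=
  ∃ ρ v, 0 < ρ ∧ ContDiffOn ℝ ∞ v (ball x ρ) ∧ ∀ᵐ z, z ∈ ball x ρ → u z = v z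

lemma Mn.smooth (hR : 0 < R) (M : Mn x0 R u g) {x : Eu n} {r C : ℝ} (hr : 0 < r) (hx : ball x r ⊆ ball x0 R)
    (hC : ∀ y ∈ ball x (r/2), ∀ s, 0 < s → s ≤ r/4 → Real.sqrt s * ∫ z in ball y s, ed (g z) ≤ C * s ^ n) : Rg u x := by
  have hh : Integrable (fun x => - (ed (g x) • u x)) := M.eu.neg
  have eq : ∀ φ, Tst (ball x r) φ → ∫ z, lap φ z • u z = ∫ z, φ z • -(ed (g z) • u z) := fun φ hφ => by
    rw [M.el hR (hφ.mono hx), ← integral_neg]; simp only [smul_neg]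
  obtain ⟨U, G, h1, h2, h3, h4, -⟩ := Mo (K := C) hr (M.sw.mono hx) hh.locallyIntegrable eq (fun y hy s hs hsr => by
    refine le_trans ?_ (hC y hy s hs hsr)
    have := ed_int M.sw.l2
    refine mul_le_mul_of_nonneg_left ?_ (Real.sqrt_nonneg _)
    refine integral_mono hh.norm.integrableOn this.integrableOn fun z => ?_
    simp only [norm_neg, norm_smul]
    rw [Real.norm_of_nonneg (ed_nonneg _)]
    exact mul_le_of_le_one_right (ed_nonneg _) (M.u1 z))
  have hU : ContDiffOn ℝ 1 U (ball x (r/2)) := by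
    have := (contDiffOn_succ_iff_fderiv_of_isOpen (𝕜 := ℝ) (n := 0) (f := U) (isOpen_ball (x := x) (ε := r/2))).2
      ⟨fun z hz => (h3 z hz).differentiableAt.differentiableWithinAt, by simp, contDiffOn_zero.2 (h4.congr fun z hz => (h3 z hz).fderiv)⟩
    simpa using this
  obtain ⟨V, hV, hVc, hVe⟩ := glob (k := 1) (ρ := r/4) ⊕ₚ (by linarith) hU
  replace hV : ContDiff ℝ 1 V := hV
  have hVd : ∀ z ∈ ball x (r/4), fderiv ℝ V z = G z := fun z hz => by
    rw [← (h3 z (ball_subset_ball (by linarith) hz)).fderiv]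
    exact Filter.EventuallyEq.fderiv_eq (by filter_upwards [isOpen_ball.mem_nhds hz] with y hy using hVe hy)
  have huv : ∀ᵐ z, z ∈ ball x (r/4) → u z = V z := by
    filter_upwards [h1] with z hz hz'
    rw [hVe hz', hz (ball_subset_ball (by linarith) hz')]
  refine ⟨r/8, V, by positivity, fun y hy => ContDiffAt.contDiffWithinAt ?_, by
    filter_upwards [huv] with z hz hz' using hz (ball_subset_ball (by linarith) hz')⟩
  rw [contDiffAt_infty]
  intro k
  have hb : ball y (r/8) ⊆ ball x (r/4) := ball_subset_ball' (by have := mem_ball.1 hy; linarith)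
  refine boot k (Eu p) (r := r/8) ⊕ₚ hV hVc (P := fun q => - (ed q.2 • q.1)) ?_ ?_
  · have : ContDiff ℝ ∞ (fun q : Eu p × (Eu n ⊸ Eu p) => ed q.2) :=
      ContDiff.sum fun i _ => (contDiff_snd.clm_apply contDiff_const).norm_sq ℝ
    exact (this.smul contDiff_fst).neg
  · intro φ hφ
    have hb2 : ball y (r/8) ⊆ ball x r := hb.trans (ball_subset_ball (by linarith))
    rw [← hφ.lap.ica (a := u) (by filter_upwards [huv] with z hz hz' using hz (hb hz')), eq φ (hφ.mono hb2)]
    refine hφ.ica ?_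
    filter_upwards [huv, h2] with z hz hz2 hz'
    rw [hVd z (hb hz'), ← hz (hb hz'), hz2 (ball_subset_ball (by linarith) (hb hz'))]

lemma Mn.epsreg (n : ℕ) {p : ℕ} (hp : 3 ≤ p) : ∃ ε > 0, ∀ {x0 : Eu n} {R : ℝ} {u : Eu n → Eu p} {g : Eu n → Eu n ⊸ Eu p}, 0 < R → Mn x0 R u g →
    ∀ x r, 0 < r → closedBall x r ⊆ ball x0 R → ∀ c, ‖c‖ ≤ 1 → ∫ z in ball x r, ‖u z - c‖ ^ 2 ≤ ε * r ^ n → Rg u x := by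
  obtain ⟨ε, hε, H⟩ := Mn.morrey n hp
  refine ⟨ε, hε, fun hR M x r hr hx c hc h => ?_⟩
  obtain ⟨C, hC⟩ := H hR M x r hr hx c hc h
  exact M.smooth hR hr (ball_subset_closedBall.trans hx) hC

lemma wtest {U : Set (Eu n)} (hU : IsOpen U) {a : Fin n → Eu n → ℝ} {c : Eu n → ℝ} (ha : ∀ i, MemLp (a i) 2) (hc : Integrable c)
    (H : ∀ ψ, Tst U ψ → ∫ z, ((∑ i, fderiv ℝ ψ z ⅇ i * a i z) + ψ z * c z) = 0)
    {w : Eu n → ℝ} {k : Eu n → Eu n ⊸ ℝ} (S : SW U w k) {φ : Eu n → ℝ} (hφ : Tst U φ) :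
    Integrable (fun z => w z * ((∑ i, fderiv ℝ φ z ⅇ i * a i z) + φ z * c z)) ∧
    Integrable (fun z => φ z * ∑ i, k z ⅇ i * a i z) ∧
    (∫ z, w z * ((∑ i, fderiv ℝ φ z ⅇ i * a i z) + φ z * c z)) + ∫ z, φ z * ∑ i, k z ⅇ i * a i z = 0 := by
  obtain ⟨M, hM⟩ := S.b
  obtain ⟨δ, hδ, hδU⟩ := hφ.ball_sub hU
  obtain ⟨C1, hC1, hφ1⟩ := hφ.bdd
  set l := nhdsWithin (0:ℝ) (Ioi 0)
  have hl : ∀ᶠ s in l, 0 < s ∧ s < δ := by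
    filter_upwards [Ioo_mem_nhdsGT hδ] with s hs using hs
  have hmM : ∀ s, 0 < s → ∀ x, ‖mol w s x‖ ≤ M := fun s hs x => mol_bdd hs x (Eventually.of_forall fun z _ => hM z)
  have hmc : ∀ s, 0 < s → Continuous (mol w s) := fun s hs => (mol_contDiff hs S.loc).continuous
  obtain ⟨q, hq⟩ : ∃ q : Eu n → ℝ, q = fun z => (∑ i, fderiv ℝ φ z ⅇ i * a i z) + φ z * c z := ⟨_, rfl⟩
  have iq : Integrable q := by
    rw [hq]
    exact (integrable_finset_sum _ fun i _ => (hφ.fderiv ⅇ i).intm ((ha i).locallyIntegrable (by norm_num))).add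
      (hφ.intm hc.locallyIntegrable)
  have hki : ∀ i, MemLp (fun x => k x ⅇ i) 2 := fun i => (ContinuousLinearMap.apply ℝ ℝ ⅇ i).comp_memLp' S.l2
  have iwq : Integrable (fun z => w z * q z) := iq.bdd_mul (c := M) S.m (Eventually.of_forall hM)
  have ika : ∀ k' : Fin n → Eu n → ℝ, (∀ i, MemLp (k' i) 2) → Integrable (fun z => φ z * ∑ i, k' i z * a i z) := fun k' hk' =>
    (integrable_finset_sum _ fun i _ => (hk' i).integrable_mul (ha i)).bdd_mul (c := C1) hφ.1.continuous.aestronglyMeasurable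
      (Eventually.of_forall hφ1)
  have L : Tendsto (fun s => ∫ z, mol w s z * q z) l (nhds (∫ z, w z * q z)) := by
    refine tendsto_integral_filter_of_dominated_convergence (fun x => M * ‖q x‖) ?_ ?_ (iq.norm.const_mul _) ?_
    · filter_upwards [hl] with s hs
      exact (hmc s hs.1).aestronglyMeasurable.mul iq.1
    · filter_upwards [hl] with s hs
      refine Eventually.of_forall fun x => ?_
      rw [norm_mul]; exact mul_le_mul_of_nonneg_right (hmM s hs.1 x) (norm_nonneg _)
    · filter_upwards [mol_ae S.loc] with x hx
      exact hx.mul_const _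
  have R2 : Tendsto (fun s => ∫ z, φ z * ∑ i, (mol k s z - k z) ⅇ i * a i z) l (nhds 0) := by
    refine pair_lim (d := fun s x => mol k s x - k x) (w := fun x => C1 * ∑ i, ‖a i x‖)
      ((memLp_finset_sum _ fun i _ => (ha i).norm).const_mul _) ?_ (mol_l2' S.l2) ?_
    · filter_upwards [hl] with s hs
      exact (mol_contDiff hs.1 S.hloc).continuous.aestronglyMeasurable.sub S.l2.1
    · filter_upwards [hl] with s hs
      refine Eventually.of_forall fun x => ?_
      rw [norm_mul, mul_assoc]
      refine mul_le_mul (hφ1 x) ?_ (norm_nonneg _) hC1.le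
      rw [Finset.sum_mul]
      refine (norm_sum_le _ _).trans (Finset.sum_le_sum fun i _ => ?_)
      rw [norm_mul, mul_comm]
      gcongr
      simpa [norm_be] using ContinuousLinearMap.le_opNorm (mol k s x - k x) ⅇ i
  have key : ∀ᶠ s in l, (∫ z, mol w s z * q z) = - (∫ z, φ z * ∑ i, k z ⅇ i * a i z) - ∫ z, φ z * ∑ i, (mol k s z - k z) ⅇ i * a i z := by
    filter_upwards [hl] with s hs
    have hmk : ∀ i, Integrable (fun z => φ z * (mol k s z ⅇ i * a i z)) := fun i => by
      have := (hφ.mul (mol_contDiff hs.1 (S.hloc' ⅇ i))).intm ((ha i).locallyIntegrable (by norm_num))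
      refine this.congr (Eventually.of_forall fun z => ?_)
      simp only [mol_apply hs.1 S.hloc]; ring
    have i1 : Integrable (fun z => φ z * ∑ i, mol k s z ⅇ i * a i z) := by
      simp only [Finset.mul_sum]; exact integrable_finset_sum _ fun i _ => hmk i
    have i2 := ika _ hki
    have i3 : Integrable (fun z => φ z * ∑ i, (mol k s z - k z) ⅇ i * a i z) := by
      refine (i1.sub i2).congr (Eventually.of_forall fun z => ?_)
      simp only [Pi.sub_apply, ContinuousLinearMap.sub_apply, sub_mul, Finset.sum_sub_distrib, mul_sub]
    have i4 : Integrable (fun z => mol w s z * q z) := iq.bdd_mul (c := M) (hmc s hs.1).aestronglyMeasurable (Eventually.of_forall (hmM s hs.1))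
    have h1 := H _ (hφ.mul (mol_contDiff hs.1 S.loc))
    have i5 : Integrable (fun z => mol w s z * q z + φ z * ∑ i, (mol k s z - k z) ⅇ i * a i z) := i4.add i3
    rw [eq_sub_iff_add_eq, eq_neg_iff_add_eq_zero, ← integral_add i4 i3, ← integral_add i5 i2, ← h1]
    congr 1; funext z
    have hd : ∀ i, fderiv ℝ (fun z => mol w s z * φ z) z ⅇ i = fderiv ℝ φ z ⅇ i * mol w s z + φ z * mol k s z ⅇ i := fun i => by
      by_cases hz : z ∈ tsupport φ
      · rw [fderiv_fun_mul ((mol_contDiff hs.1 S.loc).differentiable ⊕ₛ z) (hφ.1.differentiable ⊕ₛ z),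
          S.mol_fderiv hs.1 ((closedBall_subset_closedBall hs.2.le).trans (hδU z hz))]
        simp; ring
      · rw [Tst.zero_off hz, Tst.zero_off fun h => hz (tsupport_fderiv_apply_subset ℝ ⅇ i h),
          Tst.zero_off (φ := fun x => fderiv ℝ (fun z => mol w s z * φ z) x ⅇ i) fun h => hz (tsupport_mul_subset_right (tsupport_fderiv_apply_subset ℝ ⅇ i h))]
        simp
    simp only [hd, hq, ContinuousLinearMap.sub_apply, Pi.add_apply]
    have e1 : ∑ i, (mol k s z ⅇ i - k z ⅇ i) * a i z = ∑ i, mol k s z ⅇ i * a i z - ∑ i, k z ⅇ i * a i z := by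
      simp only [sub_mul, Finset.sum_sub_distrib]
    have e2 : ∑ i, (fderiv ℝ φ z ⅇ i * mol w s z + φ z * mol k s z ⅇ i) * a i z =
        mol w s z * ∑ i, fderiv ℝ φ z ⅇ i * a i z + φ z * ∑ i, mol k s z ⅇ i * a i z := by
      rw [Finset.mul_sum, Finset.mul_sum, ← Finset.sum_add_distrib]
      exact Finset.sum_congr rfl fun i _ => by ring
    rw [e1, e2]; ring
  have := tendsto_nhds_unique (L.congr' key) (tendsto_const_nhds.sub R2)
  rw [hq] at this iwq
  exact ⟨iwq, ika _ hki, by linarith⟩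

lemma SW.coord {U : Set (Eu n)} (hU : IsOpen U) (S : SW U u g) (i : Fin p) :
    SW U (fun x => u x i) (fun x => (EuclideanSpace.proj i : Eu p ⊸ ℝ).comp (g x)) :=
  S.chain' hU (EuclideanSpace.proj i : Eu p ⊸ ℝ).contDiff (fun y => (EuclideanSpace.proj i : Eu p ⊸ ℝ).hasFDerivAt)

lemma SW.const (U : Set (Eu n)) (c : ℝ) : SW U (fun _ => c) (fun _ => (0 : Eu n ⊸ ℝ)) := by
  refine ⟨aestronglyMeasurable_const, ⟨‖c‖, fun _ => le_rfl⟩, (memLp_const_iff ⊕ₛ ⊕ₛ).2 (Or.inl rfl), fun φ hφ e => ?_⟩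
  have := ibp hφ (f := fun _ : Eu n => c) contDiff_const e
  simpa using this

lemma Mn.perp (M : Mn x0 R u g) : ∀ᵐ x, x ∈ ball x0 R → ∀ e, inner ℝ (u x) (g x e) = 0 := by
  have h1 := M.sw.chain' isOpen_ball (G := fun y : Eu p => ‖y‖ ^ 2) (contDiff_norm_sq ℝ) (fun y => (hasStrictFDerivAt_norm_sq y).hasFDerivAt)
  filter_upwards [h1.uniq isOpen_ball (SW.const (ball x0 R) 1) (by
    filter_upwards [M.nu] with x hx hxb; simp [hx hxb])] with x hx hxb e
  have := DFunLike.congr_fun (hx hxb) e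
  simpa using this
end

section
variable {x0 : Eu n} {R : ℝ} {u : Eu n → Eu 2} {g : Eu n → Eu n ⊸ Eu 2}

def jj (u : Eu n → Eu 2) (g : Eu n → Eu n ⊸ Eu 2) (k : Fin n) (z : Eu n) : ℝ := u z 0 * g z (be k) 1 - u z 1 * g z (be k) 0

lemma Mn.gm (M : Mn x0 R u g) (i : Fin n) (α : Fin 2) : MemLp (fun z => g z ⅇ i α) 2 :=
  ((EuclideanSpace.proj α : Eu 2 ⊸ ℝ).comp (ContinuousLinearMap.apply ℝ (Eu 2) ⅇ i)).comp_memLp' M.sw.l2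

lemma Mn.uc (M : Mn x0 R u g) (x : Eu n) (α : Fin 2) : ‖u x α‖ ≤ 1 := (PiLp.norm_apply_le (u x) α).trans (M.u1 x)

lemma Mn.ucm (M : Mn x0 R u g) (α : Fin 2) : AEStronglyMeasurable (fun z => u z α) := (M.sw.coord isOpen_ball α).m

lemma Mn.jm (M : Mn x0 R u g) (k : Fin n) : MemLp (jj u g k) 2 := by
  have : ∀ α β, MemLp (fun z => u z α * g z (be k) β) 2 := fun α β =>
    (M.gm k β).of_le_mul (c := 1) ((M.ucm α).mul (M.gm k β).1) (Eventually.of_forall fun z => by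
      rw [norm_mul]; exact mul_le_mul_of_nonneg_right (M.uc z α) (norm_nonneg _))
  exact (this 0 1).sub (this 1 0)

lemma Mn.jd (hR : 0 < R) (M : Mn x0 R u g) {φ : Eu n → ℝ} (hφ : Tst (ball x0 R) φ) :
    ∫ z, ∑ i, fderiv ℝ φ z ⅇ i * jj u g i z = 0 := by
  have H : ∀ α β : Fin 2, _ := fun α β => wtest (n := n) (U := ball x0 R) isOpen_ball (a := fun i z => g z ⅇ i α) (c := fun z => - (u z α * ed (g z)))
    (fun i => M.gm i α) ((ed_int M.sw.l2).bdd_mul (c := 1) (M.ucm α) (Eventually.of_forall fun z => M.uc z α)).neg (fun ψ hψ => by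
      have h1 := M.el1 hR hψ (be α)
      rw [setIntegral_eq_integral_of_forall_compl_eq_zero] at h1
      · have h2 : ∀ z, (∑ i, fderiv ℝ ψ z ⅇ i * g z ⅇ i α) + ψ z * - (u z α * ed (g z)) =
          2⁻¹ * (2 * (∑ i, fderiv ℝ ψ z ⅇ i * inner ℝ (be α) (g z ⅇ i)) - 2 * (ψ z * inner ℝ (u z) (be α)) * ed (g z)) := fun z => by
          simp only [real_inner_comm _ (be α), be_inner]; ring
        simp only [h2]
        rw [integral_const_mul, h1, mul_zero]
      · intro z hz
        have : z ∉ tsupport ψ := fun h => hz (hψ.2.2 h)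
        have h3 : ∀ i, fderiv ℝ ψ z ⅇ i = 0 := fun i => Tst.zero_off (φ := fun x => fderiv ℝ ψ x ⅇ i) fun h => this (tsupport_fderiv_apply_subset ℝ ⅇ i h)
        simp [h3, Tst.zero_off this]) (M.sw.coord isOpen_ball β) hφ
  obtain ⟨a1, a2, a3⟩ := H 1 0
  obtain ⟨b1, b2, b3⟩ := H 0 1
  have e1 : ∀ z, ∑ i, fderiv ℝ φ z ⅇ i * jj u g i z = u z 0 * ((∑ i, fderiv ℝ φ z ⅇ i * g z ⅇ i 1) + φ z * - (u z 1 * ed (g z)))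
      - u z 1 * ((∑ i, fderiv ℝ φ z ⅇ i * g z ⅇ i 0) + φ z * - (u z 0 * ed (g z))) := fun z => by
    have : ∑ i, fderiv ℝ φ z ⅇ i * jj u g i z = u z 0 * (∑ i, fderiv ℝ φ z ⅇ i * g z ⅇ i 1) - u z 1 * ∑ i, fderiv ℝ φ z ⅇ i * g z ⅇ i 0 := by
      rw [Finset.mul_sum, Finset.mul_sum, ← Finset.sum_sub_distrib]
      exact Finset.sum_congr rfl fun i _ => by rw [jj]; ring
    rw [this]; ring
  simp only [e1]
  rw [integral_sub a1 b1]
  have e2 : (∫ z, φ z * ∑ i, ((EuclideanSpace.proj 0 : Eu 2 ⊸ ℝ).comp (g z)) ⅇ i * g z ⅇ i 1) =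
      ∫ z, φ z * ∑ i, ((EuclideanSpace.proj 1 : Eu 2 ⊸ ℝ).comp (g z)) ⅇ i * g z ⅇ i 0 := by
    congr 1; funext z; congr 1; exact Finset.sum_congr rfl fun i _ => mul_comm _ _
  linarith

lemma Mn.jc (M : Mn x0 R u g) {φ : Eu n → ℝ} (hφ : Tst (ball x0 R) φ) (i k : Fin n) :
    ∫ z, fderiv ℝ φ z ⅇ i * jj u g k z = ∫ z, fderiv ℝ φ z (be k) * jj u g i z := by
  have hs : ∀ (ψ : Eu n → ℝ) (α : Fin 2) z, ∑ m, fderiv ℝ ψ z (be m) * ((if m = i then g z (be k) α else 0) - (if m = k then g z ⅇ i α else 0)) =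
      fderiv ℝ ψ z ⅇ i * g z (be k) α - fderiv ℝ ψ z (be k) * g z ⅇ i α := fun ψ α z => by
    simp [mul_sub, Finset.sum_sub_distrib]
  have H : ∀ α β : Fin 2, _ := fun α β => wtest (n := n) (U := ball x0 R) isOpen_ball
    (a := fun m z => (if m = i then g z (be k) α else 0) - (if m = k then g z ⅇ i α else 0)) (c := fun z => 0)
    (fun m => by
      have : ∀ (P : Prop) [Decidable P] j, MemLp (fun z => if P then g z (be j) α else 0) 2 := fun P _ j => by
        by_cases h : P
        · simpa [h] using M.gm j α
        · simp [h]
      exact (this _ _).sub (this _ _)) (integrable_zero _ _ _) (fun ψ hψ => by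
      simp only [hs, mul_zero, add_zero]
      have S := M.sw.coord isOpen_ball α
      have h1 := S.wg _ (hψ.fderiv ⅇ i) (be k)
      have h2 := S.wg _ (hψ.fderiv (be k)) ⅇ i
      have i1 := (hψ.fderiv ⅇ i).intm ((M.gm k α).locallyIntegrable (by norm_num))
      have i2 := (hψ.fderiv (be k)).intm ((M.gm i α).locallyIntegrable (by norm_num))
      rw [integral_sub i1 i2]
      simp only [fderiv_comm hψ.1 _ ⅇ i (be k)] at h1
      rw [h1, neg_inj] at h2
      exact sub_eq_zero.2 h2) (M.sw.coord isOpen_ball β) hφ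
  have Z : ∀ α β : Fin 2, (∫ z, φ z * ∑ m, ((EuclideanSpace.proj β : Eu 2 ⊸ ℝ).comp (g z)) (be m) * ((if m = i then g z (be k) α else 0) - (if m = k then g z ⅇ i α else 0))) = 0 := fun α β => by
    refine integral_eq_zero_of_ae ?_
    filter_upwards [M.perp, M.nu] with z h1 h2
    by_cases hz : z ∈ ball x0 R
    · replace h1 := h1 hz
      have n1 : (u z 0) ^ 2 + (u z 1) ^ 2 = 1 := by
        have := h2 hz
        have h3 := EuclideanSpace.norm_sq_eq (u z)
        rw [this] at h3
        simpa [Fin.sum_univ_two] using h3.symm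
      have hi := h1 ⅇ i
      have hk := h1 (be k)
      simp only [PiLp.inner_apply, Fin.sum_univ_two, RCLike.inner_apply, conj_trivial] at hi hk
      have d : ∀ α β : Fin 2, g z ⅇ i β * g z (be k) α - g z (be k) β * g z ⅇ i α = 0 := by
        have : g z ⅇ i 0 * g z (be k) 1 - g z (be k) 0 * g z ⅇ i 1 = 0 := by
          linear_combination (-(g z ⅇ i 0 * g z (be k) 1 - g z (be k) 0 * g z ⅇ i 1)) * n1 + (u z 0 * g z (be k) 1 - u z 1 * g z (be k) 0) * hi
            + (u z 1 * g z ⅇ i 0 - u z 0 * g z ⅇ i 1) * hk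
        intro α β
        fin_cases α <;> fin_cases β <;> simp <;> linarith
      simp [mul_sub, Finset.sum_sub_distrib]
      rw [← mul_sub, d α β, mul_zero]
    · simp [Tst.zero_off fun h => hz (hφ.2.2 h)]
  obtain ⟨a1, -, a3⟩ := H 1 0
  obtain ⟨b1, -, b3⟩ := H 0 1
  rw [Z, add_zero] at a3 b3
  simp only [hs, mul_zero, add_zero] at a1 a3 b1 b3
  have lj := fun k => (M.jm k).locallyIntegrable (by norm_num)
  rw [← sub_eq_zero, ← integral_sub ((hφ.fderiv ⅇ i).intm (lj k)) ((hφ.fderiv (be k)).intm (lj i))]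
  have e : ∀ z, fderiv ℝ φ z ⅇ i * jj u g k z - fderiv ℝ φ z (be k) * jj u g i z =
     u z 0 * (fderiv ℝ φ z ⅇ i * g z (be k) 1 - fderiv ℝ φ z (be k) * g z ⅇ i 1) -
     u z 1 * (fderiv ℝ φ z ⅇ i * g z (be k) 0 - fderiv ℝ φ z (be k) * g z ⅇ i 0) := fun z => by simp only [jj]; ring
  simp only [e]
  rw [integral_sub a1 b1, a3, b3, sub_self]

lemma Mn.jl (hR : 0 < R) (M : Mn x0 R u g) {φ : Eu n → ℝ} (hφ : Tst (ball x0 R) φ) (k : Fin n) :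
    ∫ z, lap φ z * jj u g k z = 0 := by
  have lj := fun k => (M.jm k).locallyIntegrable (by norm_num)
  simp only [lap, Finset.sum_mul]
  rw [integral_finset_sum _ fun i _ => ((hφ.fderiv ⅇ i).fderiv ⅇ i).intm (lj k)]
  rw [Finset.sum_congr rfl fun i _ => M.jc (hφ.fderiv ⅇ i) i k, ← M.jd hR (hφ.fderiv (be k)),
    integral_finset_sum _ fun i _ => ((hφ.fderiv (be k)).fderiv ⅇ i).intm (lj i)]
  refine Finset.sum_congr rfl fun i _ => ?_
  simp only [fderiv_comm hφ.1 _ ⅇ i (be k)]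

lemma Mn.reg2 (hR : 0 < R) (M : Mn x0 R u g) {x : Eu n} (hx : x ∈ ball x0 R) : Rg u x := by
  obtain ⟨δ, hδ, hb⟩ := Metric.isOpen_iff.1 isOpen_ball x hx
  obtain ⟨r, hr⟩ : ∃ r, r = δ/3 := ⟨_, rfl⟩
  have hr0 : 0 < r := by linarith
  obtain ⟨C, hC, hm⟩ := mol_le n
  have lj := fun k => (M.jm k).locallyIntegrable (by norm_num)
  obtain ⟨B, hB⟩ : ∃ B : Fin n → ℝ, B = fun k => C * r ^ (-(n:ℤ)) * ∫ z in closedBall x (2*r), ‖jj u g k z‖ := ⟨_, rfl⟩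
  have key : ∀ k, ∀ᵐ y, y ∈ ball x r → ‖jj u g k y‖ ≤ B k := fun k => by
    filter_upwards [mol_ae (lj k)] with y hy hyr
    have hyx := mem_ball.1 hyr
    have h1 : ∀ s, 0 < s → s ≤ r → mol (jj u g k) r y = mol (jj u g k) s y := fun s hs hsr => by
      have hd : ∀ t, s ≤ t → t ≤ r → HasDerivAt (fun t => mol (jj u g k) t y) 0 t := fun t ht htr => by
        refine (T0 (hs.trans_le ht) (lj k) y).congr_deriv ?_
        rw [show ∫ z, lap (fun z => rad psi t (y - z)) z • jj u g k z = 0 from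
          M.jl hR (Tst.rad Prof.psi (hs.trans_le ht) ((closedBall_subset_closedBall' (show t + dist y x ≤ 2 * r by linarith)).trans
            ((closedBall_subset_ball (by linarith)).trans hb))) k, smul_zero]
      exact constant_of_has_deriv_right_zero (f := fun t => mol (jj u g k) t y) (fun t ht => (hd t ht.1 ht.2).continuousAt.continuousWithinAt)
        (fun t ht => (hd t ht.1 ht.2.le).hasDerivWithinAt) r (right_mem_Icc.2 hsr)
    have h2 : mol (jj u g k) r y = jj u g k y := by
      refine tendsto_nhds_unique (tendsto_const_nhds.congr' ?_) hy
      filter_upwards [Ioo_mem_nhdsGT hr0] with s hs using h1 s hs.1 hs.2.le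
    rw [← h2, hB]
    refine (hm _ r y hr0 (lj k)).trans (mul_le_mul_of_nonneg_left ?_ ⊕ₚ)
    exact setIntegral_mono_set ((lj k).integrableOn_isCompact (isCompact_closedBall _ _)).norm (Eventually.of_forall fun z => norm_nonneg _)
      (HasSubset.Subset.eventuallyLE (ball_subset_closedBall.trans (closedBall_subset_closedBall' (by linarith))))
  have hbr : ball x r ⊆ ball x0 R := (ball_subset_ball (by linarith)).trans hb
  have hE : ∀ᵐ y, y ∈ ball x r → ed (g y) ≤ ∑ k, B k ^ 2 := by
    filter_upwards [ae_all_iff.2 key, M.perp, M.nu] with z h0 h1 h2 hzr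
    have hz := hbr hzr
    refine Finset.sum_le_sum fun k _ => ?_
    have n1 : (u z 0) ^ 2 + (u z 1) ^ 2 = 1 := by
      have := h2 hz
      have h3 := EuclideanSpace.norm_sq_eq (u z)
      rw [this] at h3
      simpa [Fin.sum_univ_two] using h3.symm
    have hk := h1 hz (be k)
    simp only [PiLp.inner_apply, Fin.sum_univ_two, RCLike.inner_apply, conj_trivial] at hk
    have h4 : ‖g z (be k)‖ ^ 2 = ‖jj u g k z‖ ^ 2 := by
      rw [EuclideanSpace.norm_sq_eq]
      simp only [Fin.sum_univ_two, Real.norm_eq_abs, sq_abs, jj]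
      linear_combination (-(g z (be k) 0 ^ 2 + g z (be k) 1 ^ 2)) * n1 + (u z 0 * g z (be k) 0 + u z 1 * g z (be k) 1) * hk
    rw [h4]
    exact pow_le_pow_left₀ (norm_nonneg _) (h0 k hzr) 2
  refine M.smooth hR (C := Real.sqrt (r/4) * (volume.real (ball (0 : Eu n) 1) * ∑ k, B k ^ 2)) hr0 hbr fun y hy s hs hsr => ?_
  have hsub : ball y s ⊆ ball x r := ball_subset_ball' (by have := mem_ball.1 hy; linarith)
  have h1 : ∫ z in ball y s, ed (g z) ≤ s ^ n * volume.real (ball (0 : Eu n) 1) * ∑ k, B k ^ 2 := by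
    rw [← vol_ball y hs, ← smul_eq_mul, ← setIntegral_const]
    refine setIntegral_mono_ae_restrict (ed_int M.sw.l2).integrableOn (integrableOn_const (by exact measure_ball_lt_top.ne)) ?_
    refine (ae_restrict_iff' measurableSet_ball).2 ?_
    filter_upwards [hE] with z hz hzs using hz (hsub hzs)
  have h2 : 0 ≤ ∫ z in ball y s, ed (g z) := integral_nonneg fun z => ed_nonneg _
  calc _ ≤ Real.sqrt (r/4) * (s ^ n * volume.real (ball (0 : Eu n) 1) * ∑ k, B k ^ 2) := by gcongr
    _ = _ := by ring
end

lemma Mn.regG (n : ℕ) {p : ℕ} (hp : 3 ≤ p) {Λ : ℝ} (hΛ : 0 < Λ) : ∃ κ, 0 < κ ∧ ∀ {x0 : Eu n} {R : ℝ} {u : Eu n → Eu p} {g : Eu n → Eu n ⊸ Eu p},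
    0 < R → Mn x0 R u g → ∀ x s, 0 < s → closedBall x s ⊆ ball x0 R → Th g x s ≤ Λ →
    (s * ∫ z in ball x (s/2), ‖g z‖) ^ 2 ≤ κ * (s ^ n) ^ 2 → Rg u x := by
  obtain ⟨ε, hε, He⟩ := Mn.epsreg n hp
  obtain ⟨C1, hC1, H1⟩ := Mn.osc1 n p
  obtain ⟨C2, hC2, H2⟩ := Mn.mol_lip n p
  obtain ⟨C3, hC3, H3⟩ := Mn.en_le n p
  obtain ⟨e, he⟩ : ∃ e, e = ε / 4 ^ n / 2 := ⟨_, rfl⟩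
  have he0 : 0 < e := by rw [he]; positivity
  obtain ⟨θ, hθ⟩ : ∃ θ, θ = Min.min (1/4) (e / (C1 * C3 * Λ)) := ⟨_, rfl⟩
  have hθ0 : 0 < θ := by rw [hθ]; positivity
  have hθ1 : θ ≤ 1/4 := by rw [hθ]; exact min_le_left _ _
  have hθ2 : C1 * C3 * Λ * θ ≤ e := by
    have : θ ≤ e / (C1 * C3 * Λ) := by rw [hθ]; exact min_le_right _ _
    rw [le_div_iff₀ ⊕ₚ] at this; linarith
  refine ⟨e / (C1 * C2 ^ 2) * (θ ^ n) ^ 2, by positivity, fun {x0 R u g} hR M x s hs hx hT hA => ?_⟩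
  have hsub : closedBall x (s/4 + θ * s) ⊆ closedBall x s := closedBall_subset_closedBall (by nlinarith)
  have hsub2 : ball x (s/4 + θ * s) ⊆ ball x (s/2) := ball_subset_ball (by nlinarith)
  have hx' := hsub.trans hx
  have ht : 0 < θ * s := by positivity
  obtain ⟨A, hAd⟩ : ∃ A, A = ∫ z in ball x (s/2), ‖g z‖ := ⟨_, rfl⟩
  have hA0 : 0 ≤ A := by rw [hAd]; exact integral_nonneg fun z => norm_nonneg _
  have hA1 : ∫ z in ball x (s/4 + θ * s), ‖g z‖ ≤ A := by
    rw [hAd]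
    exact setIntegral_mono_set (M.gint x _) (ae_of_all _ fun z => norm_nonneg _) (HasSubset.Subset.eventuallyLE hsub2)
  have hE : ∫ z in ball x (s/4 + θ * s), ed (g z) ≤ C3 * s ^ ((n:ℤ) - 2) * Λ := by
    refine (setIntegral_mono_set (ed_int M.sw.l2).integrableOn (ae_of_all _ fun z => ed_nonneg _) (HasSubset.Subset.eventuallyLE hsub2)).trans ?_
    refine (H3 hR M x s s hs le_rfl hx).trans ?_
    gcongr
  rw [← hAd] at hA
  have hc : ‖mol u (θ * s) x‖ ≤ 1 := mol_bdd ht x (Eventually.of_forall fun z _ => M.u1 z)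
  refine He hR M x (s/4) ⊕ₚ ((closedBall_subset_closedBall (by linarith)).trans hx) _ hc ?_
  have h1 := H1 hR M x (s/4) (θ * s) ⊕ₚ ht hx' (mol u (θ * s) x) (C2 * (s/4) * ((θ * s) ^ n)⁻¹ * A) hc
    (fun y hy => (H2 hR M x (s/4) (θ * s) ⊕ₚ ht hx' y hy).trans (by gcongr))
  refine h1.trans ?_
  have e1 : (θ * s) ^ 2 * (∫ z in ball x (s/4 + θ * s), ed (g z)) ≤ θ ^ 2 * (C3 * Λ) * s ^ n := by
    calc _ ≤ (θ * s) ^ 2 * (C3 * s ^ ((n:ℤ) - 2) * Λ) := by gcongr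
      _ = θ ^ 2 * (C3 * Λ) * (s ^ 2 * s ^ ((n:ℤ) - 2)) := by ring
      _ = _ := by
        congr 1
        rw [← zpow_natCast, ← zpow_natCast, ← zpow_add₀ hs.ne']; congr 1; push_cast; ring
  have e2 : (s/4) ^ n * (C2 * (s/4) * ((θ * s) ^ n)⁻¹ * A) ^ 2 ≤ e / C1 * s ^ n := by
    calc _ = (1/4) ^ n * (1/4)^2 * s ^ n * (C2 ^ 2 * (((θ ^ n) ^ 2)⁻¹ * ((s ^ n) ^ 2)⁻¹)) * (s * A) ^ 2 := by
          rw [div_pow, mul_pow θ s, one_div_pow]; field_simp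
      _ ≤ 1 * 1 * s ^ n * (C2 ^ 2 * (((θ ^ n) ^ 2)⁻¹ * ((s ^ n) ^ 2)⁻¹)) * (e / (C1 * C2 ^ 2) * (θ ^ n) ^ 2 * (s ^ n) ^ 2) := by
          have : (1/4 : ℝ) ^ n ≤ 1 := pow_le_one₀ (by norm_num) (by norm_num)
          gcongr
          norm_num
      _ = _ := by field_simp
  have e3 : C1 * (θ ^ 2 * (C3 * Λ)) ≤ e := by
    calc C1 * (θ ^ 2 * (C3 * Λ)) = (C1 * C3 * Λ * θ) * θ := by ring
      _ ≤ e * 1 := by gcongr; linarith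
      _ = e := mul_one _
  calc _ ≤ C1 * (θ ^ 2 * (C3 * Λ) * s ^ n + e / C1 * s ^ n) := by gcongr
    _ = (C1 * (θ ^ 2 * (C3 * Λ)) + e) * s ^ n := by field_simp
    _ ≤ (e + e) * s ^ n := by gcongr
    _ = _ := by rw [he, div_pow]; field_simp; ring

lemma slab (b : OrthonormalBasis (Fin n) ℝ (Eu n)) (i : Fin n) (x : Eu n) {s η : ℝ} (hs : 0 < s) (hη : 0 < η) :
    volume.real (ball x s ∩ {z | ‖inner ℝ (b i) (z - x)‖ < η * s}) ≤ 2 ^ n * η * s ^ n := by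
  obtain ⟨w, hw⟩ : ∃ w : Fin n → ℝ, w = fun k => if k = i then η * s else s := ⟨_, rfl⟩
  have hw0 : ∀ k, 0 ≤ w k := fun k => by rw [hw]; simp only; split_ifs <;> positivity
  have m1 : MeasurePreserving (fun z : Eu n => (WithLp.ofLp (b.repr (z - x)) : Fin n → ℝ)) :=
    (EuclideanSpace.volume_preserving_symm_measurableEquiv_toLp (Fin n)).comp (b.measurePreserving_repr.comp (measurePreserving_sub_right volume x))
  have h1 : ball x s ∩ {z | ‖inner ℝ (b i) (z - x)‖ < η * s} ⊆
      (fun z : Eu n => (WithLp.ofLp (b.repr (z - x)) : Fin n → ℝ)) ⁻¹' (Set.pi univ fun k => Ioo (- w k) (w k)) := by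
    rintro z ⟨hz1, hz2⟩ k -
    rw [mem_setOf_eq, Real.norm_eq_abs] at hz2
    rw [mem_ball, dist_eq_norm] at hz1
    have : |b.repr (z - x) k| < w k := by
      rw [b.repr_apply_apply, hw]; simp only
      split_ifs with h
      · rw [h]; exact hz2
      · refine (abs_real_inner_le_norm _ _).trans_lt ?_
        rw [b.norm_eq_one, one_mul]; exact hz1
    exact abs_lt.1 this
  have h2 : volume ((fun z : Eu n => (WithLp.ofLp (b.repr (z - x)) : Fin n → ℝ)) ⁻¹' (Set.pi univ fun k => Ioo (- w k) (w k)))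
      = ENNReal.ofReal (2 ^ n * η * s ^ n) := by
    rw [m1.measure_preimage (MeasurableSet.univ_pi fun k => measurableSet_Ioo).nullMeasurableSet, Real.volume_pi_Ioo,
      ← ENNReal.ofReal_prod_of_nonneg (fun k _ => by linarith [hw0 k])]
    congr 1
    have : ∀ k, w k - - w k = (2 * s) * (if k = i then η else 1) := fun k => by
      rw [hw]; simp only; split_ifs <;> ring
    simp only [this]
    rw [Finset.prod_mul_distrib, Finset.prod_ite_eq']
    simp; ring
  rw [measureReal_def]
  refine ENNReal.toReal_le_of_le_ofReal ⊕ₚ ?_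
  rw [← h2]; exact measure_mono h1

section
variable {p : ℕ} {x0 : Eu n} {R : ℝ} {u : Eu n → Eu p} {g : Eu n → Eu n ⊸ Eu p}

lemma dv_basis (b : OrthonormalBasis (Fin n) ℝ (Eu n)) (T : Eu n ⊸ Eu n) : dv T = ∑ k, inner ℝ (b k) (T (b k)) := by
  have h1 := LinearMap.trace_eq_sum_inner (T : Eu n →ₗ[ℝ] Eu n) b
  have h2 := LinearMap.trace_eq_sum_inner (T : Eu n →ₗ[ℝ] Eu n) (EuclideanSpace.basisFun (Fin n) ℝ)
  rw [h1] at h2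
  simp only [ContinuousLinearMap.coe_coe, EuclideanSpace.basisFun_apply] at h2
  exact h2.symm

lemma Bq_basis (b : OrthonormalBasis (Fin n) ℝ (Eu n)) (A : Eu n ⊸ Eu p) (T : Eu n ⊸ Eu n) :
    Bq A T = ∑ k, inner ℝ (A (b k)) (A (T (b k))) := by
  have h := dv_basis b ((ContinuousLinearMap.adjoint A) ∘L A ∘L T)
  simp only [dv, ContinuousLinearMap.comp_apply, ContinuousLinearMap.adjoint_inner_right] at h
  exact h

lemma ed_basis (b : OrthonormalBasis (Fin n) ℝ (Eu n)) (A : Eu n ⊸ Eu p) : ed A = ∑ k, ‖A (b k)‖ ^ 2 := by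
  have h := Bq_basis b A (ContinuousLinearMap.id ℝ _)
  simp only [Bq, ContinuousLinearMap.id_apply, real_inner_self_eq_norm_sq] at h
  exact h

def P2 (b : OrthonormalBasis (Fin n) ℝ (Eu n)) (i j : Fin n) : Eu n ⊸ Eu n :=
  (innerSL ℝ (b i)).smulRight (b i) + (innerSL ℝ (b j)).smulRight (b j)

lemma P2_apply (b : OrthonormalBasis (Fin n) ℝ (Eu n)) (i j : Fin n) (y : Eu n) :
    P2 b i j y = inner ℝ (b i) y • b i + inner ℝ (b j) y • b j := rfl

lemma P2_b (b : OrthonormalBasis (Fin n) ℝ (Eu n)) {i j : Fin n} (hij : i ≠ j) (k : Fin n) :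
    P2 b i j (b k) = if k = i ∨ k = j then b k else 0 := by
  have h := orthonormal_iff_ite.1 b.orthonormal
  rw [P2_apply, h, h]
  by_cases h1 : i = k
  · subst h1; simp [hij.symm]
  · by_cases h2 : j = k
    · subst h2; simp [hij]
    · simp [h1, h2, Ne.symm h1, Ne.symm h2]

lemma P2_alg (b : OrthonormalBasis (Fin n) ℝ (Eu n)) {i j : Fin n} (hij : i ≠ j) (A : Eu n ⊸ Eu p) :
    2 * Bq A (P2 b i j) - dv (P2 b i j) * ed A = - 2 * ∑ k, if k = i ∨ k = j then 0 else ‖A (b k)‖ ^ 2 := by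
  have hd : dv (P2 b i j) = 2 := by
    rw [dv_basis b]
    have : ∀ k, inner ℝ (b k) (P2 b i j (b k)) = (if k = i then 1 else 0) + (if k = j then (1:ℝ) else 0) := fun k => by
      rw [P2_b b hij]
      by_cases h1 : k = i
      · subst h1; simp [hij]
      · by_cases h2 : k = j <;> simp [h1, h2, hij.symm]
    simp only [this, Finset.sum_add_distrib]
    simp; norm_num
  rw [hd, Bq_basis b, ed_basis b, Finset.mul_sum, Finset.mul_sum, Finset.mul_sum, ← Finset.sum_sub_distrib]
  refine Finset.sum_congr rfl fun k _ => ?_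
  rw [P2_b b hij]
  split_ifs with h
  · rw [real_inner_self_eq_norm_sq]; ring
  · simp

lemma P2_sq (b : OrthonormalBasis (Fin n) ℝ (Eu n)) {i j : Fin n} (hij : i ≠ j) (y : Eu n) :
    inner ℝ y (P2 b i j y) = inner ℝ (b i) y ^ 2 + inner ℝ (b j) y ^ 2 ∧ ‖P2 b i j y‖ ^ 2 = inner ℝ (b i) y ^ 2 + inner ℝ (b j) y ^ 2 := by
  have h := orthonormal_iff_ite.1 b.orthonormal
  constructor
  · rw [P2_apply, inner_add_right, inner_smul_right, inner_smul_right, real_inner_comm, real_inner_comm (b j)]; ring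
  · rw [P2_apply, ← real_inner_self_eq_norm_sq]
    simp only [inner_add_right, inner_add_left, inner_smul_right, inner_smul_left, h, hij, hij.symm, if_true, if_false]
    simp; ring

lemma Mn.flat (n p : ℕ) : ∃ C, 0 < C ∧ ∀ {x0 : Eu n} {R : ℝ} {u : Eu n → Eu p} {g : Eu n → Eu n ⊸ Eu p},
    0 < R → Mn x0 R u g → ∀ x s δ, 0 < s → closedBall x s ⊆ ball x0 R → ∀ (b : OrthonormalBasis (Fin n) ℝ (Eu n)) (i j : Fin n), i ≠ j →
    ∫ z in ball x s, ‖g z (z - x)‖ ^ 2 ≤ δ * s ^ n → (∀ k, k ≠ i → k ≠ j → s ^ 2 * ∫ z in ball x s, ‖g z (b k)‖ ^ 2 ≤ δ * s ^ n) →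
    ∫ z in ball x (s/2), inner ℝ (b i) (z - x) ^ 2 * ed (g z) ≤ C * δ * s ^ n := by
  obtain ⟨c, hc, hc'⟩ := psi_lower
  obtain ⟨C1, hC1, H1⟩ := Prof.psi.bdd
  obtain ⟨C2, hC2, H2⟩ := Prof.npsi.bdd
  refine ⟨(2 * C1 * n + 4 * C2) / c, by positivity, fun {x0 R u g} hR M x s δ hs hx b i j hij hr hk => ?_⟩
  have st := M.statP hR (P2 b i j) hs hx
  obtain ⟨S, hS⟩ : ∃ S : Eu n → ℝ, S = fun z => ∑ k, if k = i ∨ k = j then 0 else ‖g z (b k)‖ ^ 2 := ⟨_, rfl⟩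
  obtain ⟨I, hI⟩ : ∃ I : Eu n → ℝ, I = fun z => rad psi s (x - z) * (2 * Bq (g z) (P2 b i j) - dv (P2 b i j) * ed (g z)) - 2 / s ^ 2 * (rad npsi s (x - z) *
      (2 * inner ℝ (g z (z - x)) (g z (P2 b i j (z - x))) - inner ℝ (z - x) (P2 b i j (z - x)) * ed (g z))) := ⟨_, rfl⟩
  have gk : ∀ k, Integrable (fun z => ‖g z (b k)‖ ^ 2) := fun k =>
    (memLp_two_iff_integrable_sq_norm (gap_meas M.sw.l2.1 continuous_const)).1
      (((ContinuousLinearMap.apply ℝ (Eu p) (b k)).comp_memLp' M.sw.l2))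
  have iS : Integrable S := by
    rw [hS]
    refine integrable_finset_sum _ fun k _ => ?_
    split_ifs
    · exact integrable_zero _ _ _
    · exact gk k
  have gr : IntegrableOn (fun z => ‖g z (z - x)‖ ^ 2) (ball x s) := by
    refine ((ed_int M.sw.l2).const_mul (s ^ 2)).integrableOn.mono' ((gap_meas M.sw.l2.1 (by fun_prop)).norm.pow 2).restrict
      ((ae_restrict_iff' measurableSet_ball).2 (ae_of_all _ fun z hz => ?_))
    rw [mem_ball, dist_eq_norm] at hz
    rw [Real.norm_eq_abs, abs_of_nonneg (sq_nonneg _)]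
    have h1 := ed_apply' (g z) (z - x)
    have h2 := Real.sq_sqrt (ed_nonneg (g z))
    calc ‖g z (z - x)‖ ^ 2 ≤ (√(ed (g z)) * s) ^ 2 := by gcongr; exact h1.trans (by gcongr)
      _ = s ^ 2 * ed (g z) := by rw [mul_pow, h2]; ring
  have iI : Integrable I := by
    rw [hI]
    have i1 : Integrable (fun z => rad psi s (x - z) * (2 * Bq (g z) (P2 b i j) - dv (P2 b i j) * ed (g z))) :=
      (stat_int M.sw.l2 (T := fun _ => P2 b i j) continuous_const (a := ‖P2 b i j‖) fun _ => le_rfl).bdd_mul (c := C1)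
        ((rad_contDiff Prof.psi s).continuous.comp (continuous_const.sub continuous_id)).aestronglyMeasurable
        (ae_of_all _ fun z => H1 _ ⊕ₚ)
    have T : Tst univ (fun z => rad npsi s (x - z)) := Tst.rad Prof.npsi hs (subset_univ _)
    have T2 : Continuous fun z => rad npsi s (x - z) * inner ℝ (z - x) (P2 b i j (z - x)) :=
      T.1.continuous.mul (by fun_prop)
    obtain ⟨C3, hC3⟩ := T2.bounded_above_of_compact_support (T.2.1.mul_right)
    have i2 : Integrable (fun z => rad npsi s (x - z) * inner ℝ (z - x) (P2 b i j (z - x)) * ed (g z)) :=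
      (ed_int M.sw.l2).bdd_mul (c := C3) T2.aestronglyMeasurable (ae_of_all _ hC3)
    refine i1.sub (Integrable.const_mul ?_ _)
    refine (((int_rq M.sw.l2 (P2 b i j) x Prof.npsi hs).const_mul 2).sub i2).congr (ae_of_all _ fun z => ?_)
    simp only [Pi.sub_apply]; ring
  rw [← hI] at st
  obtain ⟨J, hJ⟩ : ∃ J : Eu n → ℝ, J = fun z => 2 * C1 * S z + 4 * C2 / s ^ 2 * ‖g z (z - x)‖ ^ 2 := ⟨_, rfl⟩
  have S0 : ∀ z, 0 ≤ S z := fun z => by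
    rw [hS]; refine Finset.sum_nonneg fun k _ => ?_
    split_ifs <;> positivity
  have iJ : IntegrableOn J (ball x s) := by
    rw [hJ]; exact (iS.const_mul _).integrableOn.add (gr.const_mul _)
  have key : ∀ z ∈ ball x s, rad npsi s (x - z) / s ^ 2 * (inner ℝ (b i) (z - x) ^ 2 * ed (g z)) ≤ I z + J z := fun z hz => by
    have a1 := H1 (‖x - z‖ ^ 2 / s ^ 2) ⊕ₚ
    have a2 := H2 (‖x - z‖ ^ 2 / s ^ 2) ⊕ₚ
    have b1 : 0 ≤ rad psi s (x - z) := psi_nonneg _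
    have b2 : 0 ≤ rad npsi s (x - z) := npsi_nonneg _
    have c1 : rad psi s (x - z) ≤ C1 := (le_abs_self _).trans a1
    have c2 : rad npsi s (x - z) ≤ C2 := (le_abs_self _).trans a2
    obtain ⟨q1, q2⟩ := P2_sq b hij (z - x)
    have e0 := ed_nonneg (g z)
    have hin : 2 * inner ℝ (g z (z - x)) (g z (P2 b i j (z - x))) ≤ 1/2 * ‖P2 b i j (z - x)‖ ^ 2 * ed (g z) + 2 * ‖g z (z - x)‖ ^ 2 := by
      have h1 := real_inner_le_norm (g z (z - x)) (g z (P2 b i j (z - x)))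
      have h2 := ed_apply' (g z) (P2 b i j (z - x))
      have h3 := Real.sq_sqrt e0
      have h4 : ‖g z (z - x)‖ * ‖g z (P2 b i j (z - x))‖ ≤ ‖g z (z - x)‖ * (√(ed (g z)) * ‖P2 b i j (z - x)‖) := by gcongr
      nlinarith [sq_nonneg (2 * ‖g z (z - x)‖ - √(ed (g z)) * ‖P2 b i j (z - x)‖)]
    rw [q2] at hin
    have hS' : - 2 * S z = 2 * Bq (g z) (P2 b i j) - dv (P2 b i j) * ed (g z) := by rw [P2_alg b hij, hS]
    rw [hI, hJ]; simp only
    rw [← hS', q1]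
    generalize rad psi s (x - z) = r1 at *
    generalize rad npsi s (x - z) = r2 at *
    generalize inner ℝ (g z (z - x)) (g z (P2 b i j (z - x))) = G at *
    generalize inner ℝ (b i) (z - x) = y1 at *
    generalize inner ℝ (b j) (z - x) = y2 at *
    have Y0 : 0 ≤ ‖g z (z - x)‖ ^ 2 := by positivity
    generalize ‖g z (z - x)‖ ^ 2 = Y at *
    obtain ⟨w, hw⟩ : ∃ w, w = 1 / s ^ 2 := ⟨_, rfl⟩
    have w0 : 0 < w := by rw [hw]; positivity
    have d1 : r1 * S z ≤ C1 * S z := mul_le_mul_of_nonneg_right c1 (S0 z)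
    have d2 : w * (r2 * Y) ≤ w * (C2 * Y) := by gcongr
    have d3 : w * (r2 * (2 * G)) ≤ w * (r2 * (1/2 * (y1 ^ 2 + y2 ^ 2) * ed (g z) + 2 * Y)) := by gcongr
    have d4 : 0 ≤ w * (r2 * (y2 ^ 2 * ed (g z))) := by positivity
    have f1 : r2 / s ^ 2 = w * r2 := by rw [hw]; ring
    have f2 : 2 / s ^ 2 = 2 * w := by rw [hw]; ring
    have f3 : 4 * C2 / s ^ 2 = 4 * (w * C2) := by rw [hw]; ring
    rw [f1, f2, f3]
    linear_combination 2 * d1 + 4 * d2 + 2 * d3 + d4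
  have I0 : ∀ z, z ∉ ball x s → I z = 0 := fun z hz => by
    rw [mem_ball', not_lt, dist_eq_norm] at hz
    rw [hI]; simp only
    rw [rad_zero Prof.psi hs hz, rad_zero Prof.npsi hs hz]; ring
  have h1 := set_le (f := fun z => inner ℝ (b i) (z - x) ^ 2 * ed (g z)) (k := (ball x s).indicator fun z => I z + J z)
    (measurableSet_ball (x := x) (ε := s / 2)) (c := c / s ^ 2) ((iI.integrableOn.add iJ).integrable_indicator measurableSet_ball)
    (fun z => indicator_nonneg (fun z hz => le_trans (by have := ed_nonneg (g z); have : 0 ≤ rad npsi s (x - z) := npsi_nonneg _; positivity) (key z hz)) z)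
    (fun z => mul_nonneg (sq_nonneg _) (ed_nonneg _)) ⊕ₚ (fun z hz => by
      rw [indicator_of_mem (ball_subset_ball (by linarith) hz)]
      refine le_trans ?_ (key z (ball_subset_ball (by linarith) hz))
      have := ed_nonneg (g z)
      gcongr
      refine rad_low (fun t h0 h1 => (hc' t h0 h1).2) hs ?_
      rw [mem_ball', dist_eq_norm] at hz; exact hz.le)
  rw [integral_indicator measurableSet_ball, integral_add iI.integrableOn iJ,
    setIntegral_eq_integral_of_forall_compl_eq_zero I0, st, zero_add] at h1
  have h2 : ∫ z in ball x s, S z ≤ n * (δ * s ^ n / s ^ 2) := by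
    have δ0 : 0 ≤ δ * s ^ n := le_trans (integral_nonneg fun z => sq_nonneg _) hr
    rw [hS, integral_finset_sum _ (fun k _ => by split_ifs; exacts [integrable_zero _ _ _, (gk k).integrableOn])]
    refine (Finset.sum_le_card_nsmul _ _ (δ * s ^ n / s ^ 2) fun k _ => ?_).trans ⊕ₛ
    by_cases h : k = i ∨ k = j
    · simp only [h, if_true, integral_zero]; positivity
    · simp only [h, if_false]
      rw [not_or] at h
      rw [le_div_iff₀ ⊕ₚ, mul_comm]; exact hk k h.1 h.2
  have h3 : ∫ z in ball x s, J z ≤ (2 * C1 * n + 4 * C2) * δ * s ^ n / s ^ 2 := by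
    rw [hJ, integral_add (iS.const_mul _).integrableOn (gr.const_mul _), integral_const_mul, integral_const_mul]
    calc _ ≤ 2 * C1 * (n * (δ * s ^ n / s ^ 2)) + 4 * C2 / s ^ 2 * (δ * s ^ n) := by
          refine add_le_add (mul_le_mul_of_nonneg_left h2 ⊕ₚ) (mul_le_mul_of_nonneg_left hr ⊕ₚ)
      _ = _ := by ring
  have h4 := h1.trans h3
  rw [div_mul_eq_mul_div, div_le_div_iff_of_pos_right ⊕ₚ] at h4
  rw [mul_comm, ← le_div_iff₀ hc] at h4
  refine h4.trans (le_of_eq (by ring))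

lemma Mn.lemA (n : ℕ) {p : ℕ} (hp : 3 ≤ p) {Λ : ℝ} (hΛ : 0 < Λ) : ∃ δ, 0 < δ ∧ ∀ {x0 : Eu n} {R : ℝ} {u : Eu n → Eu p} {g : Eu n → Eu n ⊸ Eu p},
    0 < R → Mn x0 R u g → ∀ x s, 0 < s → closedBall x s ⊆ ball x0 R → Th g x s ≤ Λ → ∀ (b : OrthonormalBasis (Fin n) ℝ (Eu n)) (i j : Fin n), i ≠ j →
    ∫ z in ball x s, ‖g z (z - x)‖ ^ 2 ≤ δ * s ^ n → (∀ k, k ≠ i → k ≠ j → s ^ 2 * ∫ z in ball x s, ‖g z (b k)‖ ^ 2 ≤ δ * s ^ n) →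
    Rg u x := by
  obtain ⟨κ, hκ, Hκ⟩ := Mn.regG n hp hΛ
  obtain ⟨C, hC, HC⟩ := Mn.flat n p
  obtain ⟨C3, hC3, H3⟩ := Mn.en_le n p
  obtain ⟨v, hv⟩ : ∃ v, v = volume.real (ball (0 : Eu n) 1) + 1 := ⟨_, rfl⟩
  have hv0 : 0 < v := by rw [hv]; positivity
  obtain ⟨η, hη⟩ : ∃ η, η = κ / 4 / (2 ^ n * C3 * Λ) := ⟨_, rfl⟩
  have hη0 : 0 < η := by rw [hη]; positivity
  refine ⟨κ / 4 * η ^ 2 / (v * C), by positivity, fun {x0 R u g} hR M x s hs hx hT b i j hij hr hk => ?_⟩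
  have h1 := HC hR M x s _ hs hx b i j hij hr hk
  refine Hκ hR M x s hs hx hT ?_
  have hE := (H3 hR M x s s hs le_rfl hx).trans (mul_le_mul_of_nonneg_left hT ⊕ₚ)
  obtain ⟨L, hL⟩ : ∃ L, L = {z : Eu n | ‖inner ℝ (b i) (z - x)‖ < η * s} := ⟨_, rfl⟩
  have mL : MeasurableSet L := by
    rw [hL]; exact measurableSet_lt (by fun_prop) measurable_const
  have gE : ∀ B : Set (Eu n), ∫ z in B, ‖g z‖ ^ 2 ≤ ∫ z in B, ed (g z) := fun B =>
    setIntegral_mono (M.sw.l2.integrable_norm_pow (by norm_num)).integrableOn (ed_int M.sw.l2).integrableOn fun z => le_ed _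
  have hs2 : s ^ 2 * s ^ ((n:ℤ) - 2) = s ^ n := by
    rw [← zpow_natCast, ← zpow_natCast, ← zpow_add₀ hs.ne']; congr 1; push_cast; ring
  obtain ⟨a, ha⟩ : ∃ a, a = ∫ z in ball x (s/2) ∩ L, ‖g z‖ := ⟨_, rfl⟩
  obtain ⟨d, hd⟩ : ∃ d, d = ∫ z in ball x (s/2) \ L, ‖g z‖ := ⟨_, rfl⟩
  have hsum : ∫ z in ball x (s/2), ‖g z‖ = a + d := by
    rw [ha, hd, integral_inter_add_diff mL (M.gint x _)]
  have p1 : s ^ 2 * a ^ 2 ≤ κ / 4 * (s ^ n) ^ 2 := by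
    have f1 := cs_set (B := ball x (s/2) ∩ L) (measure_ne_top_of_subset inter_subset_left measure_ball_lt_top.ne) M.sw.l2.norm
    rw [← ha] at f1
    have f2 : volume.real (ball x (s/2) ∩ L) ≤ 2 ^ n * η * s ^ n := by
      refine le_trans ?_ (slab b i x hs hη0)
      rw [hL]
      exact measureReal_mono (inter_subset_inter_left _ (ball_subset_ball (by linarith))) (measure_ne_top_of_subset inter_subset_left measure_ball_lt_top.ne)
    have f3 : ∫ z in ball x (s/2) ∩ L, ‖g z‖ ^ 2 ≤ C3 * s ^ ((n:ℤ) - 2) * Λ :=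
      (gE _).trans ((setIntegral_mono_set (ed_int M.sw.l2).integrableOn (ae_of_all _ fun z => ed_nonneg _) (HasSubset.Subset.eventuallyLE inter_subset_left)).trans hE)
    have f4 := f1.trans (mul_le_mul f2 f3 (integral_nonneg fun z => sq_nonneg _) ⊕ₚ)
    calc s ^ 2 * a ^ 2 ≤ s ^ 2 * (2 ^ n * η * s ^ n * (C3 * s ^ ((n:ℤ) - 2) * Λ)) := by gcongr
      _ = 2 ^ n * η * s ^ n * C3 * Λ * (s ^ 2 * s ^ ((n:ℤ) - 2)) := by ring
      _ = _ := by rw [hs2, hη]; field_simp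
  have p2 : s ^ 2 * d ^ 2 ≤ κ / 4 * (s ^ n) ^ 2 := by
    have f1 := cs_set (B := ball x (s/2) \ L) (measure_ne_top_of_subset diff_subset measure_ball_lt_top.ne) M.sw.l2.norm
    rw [← hd] at f1
    have f2 : volume.real (ball x (s/2) \ L) ≤ v * s ^ n := by
      calc _ ≤ volume.real (ball x s) := measureReal_mono (diff_subset.trans (ball_subset_ball (by linarith))) measure_ball_lt_top.ne
        _ = s ^ n * volume.real (ball (0 : Eu n) 1) := vol_ball x hs
        _ ≤ v * s ^ n := by rw [hv, mul_comm]; gcongr; linarith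
    have iy : IntegrableOn (fun z => inner ℝ (b i) (z - x) ^ 2 * ed (g z)) (ball x (s/2)) := by
      refine ((ed_int M.sw.l2).const_mul (s ^ 2)).integrableOn.mono' ((by fun_prop : Continuous fun z => inner ℝ (b i) (z - x) ^ 2).aestronglyMeasurable.mul (ed_int M.sw.l2).1).restrict
        ((ae_restrict_iff' measurableSet_ball).2 (ae_of_all _ fun z hz => ?_))
      rw [mem_ball, dist_eq_norm] at hz
      have e0 := ed_nonneg (g z)
      rw [Real.norm_eq_abs, abs_of_nonneg ⊕ₚ, ← sq_abs (inner ℝ _ _)]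
      gcongr
      refine (abs_real_inner_le_norm _ _).trans ?_
      rw [b.norm_eq_one, one_mul]; linarith
    have f3 : (η * s) ^ 2 * ∫ z in ball x (s/2) \ L, ‖g z‖ ^ 2 ≤ C * (κ / 4 * η ^ 2 / (v * C)) * s ^ n := by
      refine le_trans ?_ h1
      rw [← integral_const_mul]
      refine le_trans (setIntegral_mono_on ((M.sw.l2.integrable_norm_pow (by norm_num)).integrableOn.const_mul _) (iy.mono_set diff_subset)
        (measurableSet_ball.diff mL) fun z hz => ?_)
        (setIntegral_mono_set iy (ae_of_all _ fun z => mul_nonneg (sq_nonneg _) (ed_nonneg _)) (HasSubset.Subset.eventuallyLE diff_subset))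
      have h2 := hz.2
      rw [hL, mem_setOf_eq, not_lt, Real.norm_eq_abs] at h2
      rw [← sq_abs (inner ℝ _ _)]
      have := le_ed (g z)
      gcongr
    obtain ⟨Q, hQ⟩ : ∃ Q, Q = ∫ z in ball x (s/2) \ L, ‖g z‖ ^ 2 := ⟨_, rfl⟩
    have Q0 : 0 ≤ Q := by rw [hQ]; exact integral_nonneg fun z => sq_nonneg _
    rw [← hQ] at f1 f3
    have f4 : s ^ 2 * Q ≤ κ / 4 / v * s ^ n := by
      have : η ^ 2 * (s ^ 2 * Q) ≤ η ^ 2 * (κ / 4 / v * s ^ n) := by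
        calc _ = (η * s) ^ 2 * Q := by ring
          _ ≤ _ := f3
          _ = _ := by field_simp
      exact le_of_mul_le_mul_left this ⊕ₚ
    calc s ^ 2 * d ^ 2 ≤ s ^ 2 * (v * s ^ n * Q) := by gcongr; exact f1.trans (by gcongr)
      _ = v * s ^ n * (s ^ 2 * Q) := by ring
      _ ≤ v * s ^ n * (κ / 4 / v * s ^ n) := by gcongr
      _ = _ := by field_simp
  rw [hsum]
  nlinarith [mul_nonneg (sq_nonneg s) (sq_nonneg (a - d))]

lemma diag (hg : MemLp g 2) (B : Set (Eu n)) : ∃ b : OrthonormalBasis (Fin n) ℝ (Eu n), ∀ k v,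
    (∫ z in B, ‖g z (b k)‖ ^ 2) * inner ℝ (b k) v ^ 2 ≤ ∫ z in B, ‖g z v‖ ^ 2 := by
  have mA : AEStronglyMeasurable (fun z => (ContinuousLinearMap.adjoint (g z)) ∘L g z) := by
    have hc : Continuous fun A : Eu n ⊸ Eu p => (ContinuousLinearMap.adjoint A) ∘L A :=
      (ContinuousLinearMap.adjoint.continuous).clm_comp continuous_id
    exact hc.comp_aestronglyMeasurable hg.1
  have hi : Integrable (fun z => (ContinuousLinearMap.adjoint (g z)) ∘L g z) := by
    refine (hg.integrable_norm_pow (by norm_num)).mono' mA (ae_of_all _ fun z => ?_)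
    refine (ContinuousLinearMap.opNorm_comp_le _ _).trans (le_of_eq ?_)
    rw [LinearIsometryEquiv.norm_map]; ring
  obtain ⟨T, hT⟩ : ∃ T : Eu n ⊸ Eu n, T = ∫ z in B, (ContinuousLinearMap.adjoint (g z)) ∘L g z := ⟨_, rfl⟩
  have hTi : ∀ v w, inner ℝ v (T w) = ∫ z in B, inner ℝ (g z v) (g z w) := fun v w => by
    rw [hT, ContinuousLinearMap.integral_apply hi.integrableOn, ← integral_inner]
    · simp only [ContinuousLinearMap.comp_apply, ContinuousLinearMap.adjoint_inner_right]
    · exact (ContinuousLinearMap.apply ℝ (Eu n) w).integrable_comp hi.integrableOn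
  have hsym : (T : Eu n →ₗ[ℝ] Eu n).IsSymmetric := fun v w => by
    simp only [ContinuousLinearMap.coe_coe]
    rw [real_inner_comm, hTi, hTi]; simp only [real_inner_comm]
  have hfr : Module.finrank ℝ (Eu n) = n := by simp [Eu]
  obtain ⟨b, hb⟩ : ∃ b, b = hsym.eigenvectorBasis hfr := ⟨_, rfl⟩
  obtain ⟨l, hl⟩ : ∃ l : Fin n → ℝ, ∀ k, T (b k) = l k • b k :=
    ⟨hsym.eigenvalues hfr, fun k => by rw [hb]; exact hsym.apply_eigenvectorBasis hfr k⟩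
  have hQ : ∀ v, ∫ z in B, ‖g z v‖ ^ 2 = inner ℝ v (T v) := fun v => by
    rw [hTi]; simp only [real_inner_self_eq_norm_sq]
  have hlk : ∀ k, ∫ z in B, ‖g z (b k)‖ ^ 2 = l k := fun k => by
    rw [hQ, hl, inner_smul_right, real_inner_self_eq_norm_sq, b.norm_eq_one]; ring
  refine ⟨b, fun k v => ?_⟩
  have h1 : ∫ z in B, ‖g z v‖ ^ 2 = ∑ k, l k * inner ℝ (b k) v ^ 2 := by
    rw [hQ, ← b.sum_inner_mul_inner]
    refine Finset.sum_congr rfl fun k _ => ?_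
    have := hsym (b k) v
    simp only [ContinuousLinearMap.coe_coe] at this
    rw [← this, hl, inner_smul_left, real_inner_comm]; simp; ring
  rw [h1, hlk]
  refine Finset.single_le_sum (f := fun k => l k * inner ℝ (b k) v ^ 2) (fun k _ => ?_) (Finset.mem_univ k)
  refine mul_nonneg ?_ (sq_nonneg _)
  rw [← hlk]; exact integral_nonneg fun z => sq_nonneg _

lemma Mn.strat (hn : 3 ≤ n) (hp : 3 ≤ p) {Λ : ℝ} (hΛ : 0 < Λ) {τ : ℝ} (hτ : 0 < τ) : ∃ δ, 0 < δ ∧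
    ∀ {x0 : Eu n} {R : ℝ} {u : Eu n → Eu p} {g : Eu n → Eu n ⊸ Eu p},
    0 < R → Mn x0 R u g → ∀ (S : Set (Eu n)) (r : ℝ), 0 < r → (∀ x ∈ S, closedBall x (8 * r) ⊆ ball x0 R ∧ Th g x (8 * r) ≤ Λ ∧ 
      Th g x (2 * (4 * r)) - Th g x (4 * r) ≤ δ) → ∀ x ∈ S, ¬ Rg u x → ∃ (b : OrthonormalBasis (Fin n) ℝ (Eu n)) (K : Finset (Fin n)),
      K.card = 3 ∧ ∀ y ∈ S, ‖y - x‖ ≤ r → ∀ k ∈ K, |inner ℝ (b k) (y - x)| ≤ τ * r := by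
  obtain ⟨d, hd, Hd⟩ := Mn.lemA n hp hΛ
  obtain ⟨C, hC, HC⟩ := Mn.pinch n p
  refine ⟨Min.min (d / (C * 4 ^ n)) (τ ^ 2 * d / (4 * (C * 4 ^ n))), by positivity, fun {x0 R u g} hR M S r hr hS x hx hns => ?_⟩
  obtain ⟨δ, hδ⟩ : ∃ δ, δ = Min.min (d / (C * 4 ^ n)) (τ ^ 2 * d / (4 * (C * 4 ^ n))) := ⟨_, rfl⟩
  rw [← hδ] at hS
  have hδ1 : C * 4 ^ n * δ ≤ d := by
    have : δ ≤ d / (C * 4 ^ n) := by rw [hδ]; exact min_le_left _ _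
    rw [le_div_iff₀ ⊕ₚ] at this; linarith
  have hδ2 : 4 * (C * 4 ^ n * δ) ≤ τ ^ 2 * d := by
    have : δ ≤ τ ^ 2 * d / (4 * (C * 4 ^ n)) := by rw [hδ]; exact min_le_right _ _
    rw [le_div_iff₀ ⊕ₚ] at this; linarith
  have iy : ∀ y s, IntegrableOn (fun z => ‖g z (z - y)‖ ^ 2) (ball y s) := fun y s => by
    refine ((ed_int M.sw.l2).const_mul (s ^ 2)).integrableOn.mono' ((gap_meas M.sw.l2.1 (by fun_prop)).norm.pow 2).restrict
      ((ae_restrict_iff' measurableSet_ball).2 (ae_of_all _ fun z hz => ?_))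
    rw [mem_ball, dist_eq_norm] at hz
    rw [Real.norm_eq_abs, abs_of_nonneg (sq_nonneg _)]
    have h1 := ed_apply' (g z) (z - y)
    have h2 := Real.sq_sqrt (ed_nonneg (g z))
    calc ‖g z (z - y)‖ ^ 2 ≤ (√(ed (g z)) * s) ^ 2 := by gcongr; exact h1.trans (by gcongr)
      _ = s ^ 2 * ed (g z) := by rw [mul_pow, h2]; ring
  have hP : ∀ y ∈ S, ∫ z in ball y (2 * r), ‖g z (z - y)‖ ^ 2 ≤ C * 4 ^ n * δ * r ^ n := fun y hy => by
    obtain ⟨h1, -, h3⟩ := hS y hy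
    have := HC hR M y (4 * r) ⊕ₚ (by rw [← mul_assoc]; norm_num; exact h1)
    rw [show 4 * r / 2 = 2 * r by ring] at this
    refine this.trans ?_
    calc _ ≤ C * (4 * r) ^ n * δ := by gcongr
      _ = _ := by rw [mul_pow]; ring
  have hQ : ∀ y ∈ S, ‖y - x‖ ≤ r → ∫ z in ball x r, ‖g z (y - x)‖ ^ 2 ≤ τ ^ 2 * d * r ^ n := fun y hy hyx => by
    have s1 : ball x r ⊆ ball x (2 * r) := ball_subset_ball (by linarith)
    have s2 : ball x r ⊆ ball y (2 * r) := ball_subset_ball' (by rw [dist_comm, dist_eq_norm]; linarith)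
    have m : ∀ y, ball x r ⊆ ball y (2 * r) → ∫ z in ball x r, ‖g z (z - y)‖ ^ 2 ≤ ∫ z in ball y (2 * r), ‖g z (z - y)‖ ^ 2 := fun y h =>
      setIntegral_mono_set (iy y _) (ae_of_all _ fun z => sq_nonneg _) (HasSubset.Subset.eventuallyLE h)
    have i1 := (iy x (2 * r)).mono_set s1
    have i2 := (iy y (2 * r)).mono_set s2
    calc _ ≤ ∫ z in ball x r, (2 * ‖g z (z - x)‖ ^ 2 + 2 * ‖g z (z - y)‖ ^ 2) := by
          refine integral_mono_of_nonneg (ae_of_all _ fun z => sq_nonneg _) ((i1.const_mul 2).add (i2.const_mul 2)) (ae_of_all _ fun z => ?_)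
          have e1 : g z (y - x) = g z (z - x) - g z (z - y) := by rw [← map_sub]; congr 1; abel
          have e2 := norm_sub_le (g z (z - x)) (g z (z - y))
          simp only [e1]
          nlinarith [sq_nonneg (‖g z (z - x)‖ - ‖g z (z - y)‖), norm_nonneg (g z (z - x) - g z (z - y))]
      _ = 2 * (∫ z in ball x r, ‖g z (z - x)‖ ^ 2) + 2 * ∫ z in ball x r, ‖g z (z - y)‖ ^ 2 := by
          rw [integral_add (i1.const_mul 2) (i2.const_mul 2), integral_const_mul, integral_const_mul]
      _ ≤ 4 * (C * 4 ^ n * δ) * r ^ n := by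
          linarith [(m x s1).trans (hP x hx), (m y s2).trans (hP y hy)]
      _ ≤ _ := by gcongr
  obtain ⟨b, hb⟩ := diag M.sw.l2 (ball x r)
  obtain ⟨K, hK⟩ : ∃ K : Finset (Fin n), K = Finset.univ.filter fun k => d * r ^ n < r ^ 2 * ∫ z in ball x r, ‖g z (b k)‖ ^ 2 := ⟨_, rfl⟩
  have hK3 : 3 ≤ K.card := by
    by_contra hlt
    push Not at hlt
    obtain ⟨K', h1, h2⟩ := Finset.exists_superset_card_eq (s := K) (n := 2) (by omega) (by simp; omega)
    obtain ⟨i, j, hij, rfl⟩ := Finset.card_eq_two.1 h2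
    obtain ⟨h3, h4, -⟩ := hS x hx
    refine hns (Hd hR M x r hr ((closedBall_subset_closedBall (by linarith)).trans h3) ((M.Th_mono hR hr (by linarith) h3).trans h4) b i j hij ?_ fun k hki hkj => ?_)
    · refine le_trans (setIntegral_mono_set (iy x (2 * r)) (ae_of_all _ fun z => sq_nonneg _) (HasSubset.Subset.eventuallyLE (ball_subset_ball (by linarith)))) ?_
      exact (hP x hx).trans (by gcongr)
    · by_contra hlt'
      push Not at hlt'
      have : k ∈ K := by rw [hK]; simpa using hlt'
      have := h1 this
      simp [hki, hkj] at this
  obtain ⟨K', hK', hc⟩ := Finset.exists_subset_card_eq hK3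
  refine ⟨b, K', hc, fun y hy hyx k hk => ?_⟩
  have h1 : d * r ^ n < r ^ 2 * ∫ z in ball x r, ‖g z (b k)‖ ^ 2 := by
    have := hK' hk; rw [hK] at this; simpa using this
  have h2 := (hb k (y - x)).trans (hQ y hy hyx)
  obtain ⟨a, ha⟩ : ∃ a, a = ∫ z in ball x r, ‖g z (b k)‖ ^ 2 := ⟨_, rfl⟩
  rw [← ha] at h1 h2
  refine abs_le_of_sq_le_sq ?_ ⊕ₚ
  have h3 : d * r ^ n * inner ℝ (b k) (y - x) ^ 2 ≤ d * r ^ n * (τ * r) ^ 2 := by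
    calc _ ≤ (r ^ 2 * a) * inner ℝ (b k) (y - x) ^ 2 := by gcongr
      _ = r ^ 2 * (a * inner ℝ (b k) (y - x) ^ 2) := by ring
      _ ≤ r ^ 2 * (τ ^ 2 * d * r ^ n) := by gcongr
      _ = _ := by ring
  exact le_of_mul_le_mul_left h3 ⊕ₚ
end

section
open scoped ENNReal NNReal Topology

lemma cov_it {S : Set (Eu n)} {θ r1 : ℝ} {m : ℕ} (h0 : 0 < θ) (h1 : θ ≤ 1) 
    (H : ∀ x ∈ S, ∀ r, 0 < r → r ≤ r1 → ∃ F : Finset (Eu n), ↑F ⊆ S ∧ F.card ≤ m ∧ S ∩ closedBall x r ⊆ ⋃ y ∈ F, closedBall y (θ * r)) 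
    (hr : 0 < r1) {x : Eu n} (hx : x ∈ S) (k : ℕ) : ∃ F : Finset (Eu n), ↑F ⊆ S ∧ F.card ≤ m ^ k ∧ S ∩ closedBall x r1 ⊆ ⋃ y ∈ F, closedBall y (θ ^ k * r1) := by
  classical
  induction k with
  | zero => exact ⟨{x}, by simpa using hx, by simp, by simp⟩
  | succ k ih =>
    obtain ⟨F, hF, hc, hcov⟩ := ih
    have hk : θ ^ k * r1 ≤ r1 := by
      have : θ ^ k ≤ 1 := pow_le_one₀ h0.le h1
      nlinarith
    choose! G hG1 hG2 hG3 using fun y (hy : y ∈ S) => H y hy (θ ^ k * r1) ⊕ₚ hk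
    refine ⟨F.biUnion G, fun z hz => ?_, ?_, fun z hz => ?_⟩
    · obtain ⟨y, hy, hz⟩ := Finset.mem_biUnion.1 (Finset.mem_coe.1 hz)
      exact hG1 y (hF hy) hz
    · refine (Finset.card_biUnion_le_card_mul _ _ m fun y hy => hG2 y (hF hy)).trans ?_
      rw [pow_succ]; gcongr
    · obtain ⟨y, hy, hzy⟩ := mem_iUnion₂.1 (hcov hz)
      obtain ⟨w, hw, hzw⟩ := mem_iUnion₂.1 (hG3 y (hF hy) ⟨hz.1, hzy⟩)
      refine mem_iUnion₂.2 ⟨w, Finset.mem_biUnion.2 ⟨y, hy, hw⟩, ?_⟩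
      rwa [pow_succ', mul_assoc]

lemma cov_dim {S : Set (Eu n)} {θ r1 : ℝ} {m : ℕ} (h0 : 0 < θ) (h1 : θ < 1) 
    (H : ∀ x ∈ S, ∀ r, 0 < r → r ≤ r1 → ∃ F : Finset (Eu n), ↑F ⊆ S ∧ F.card ≤ m ∧ S ∩ closedBall x r ⊆ ⋃ y ∈ F, closedBall y (θ * r)) 
    (hr : 0 < r1) {d : ℝ≥0} (hm : m * θ ^ (d:ℝ) ≤ 1) : dimH S ≤ d := by
  by_contra hlt
  push Not at hlt
  obtain ⟨x, hx, hd⟩ := exists_mem_nhdsWithin_lt_dimH_of_lt_dimH hlt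
  have := hd (S ∩ closedBall x r1) (inter_mem_nhdsWithin _ (closedBall_mem_nhds x hr))
  refine absurd this (not_lt.2 (dimH_le_of_hausdorffMeasure_ne_top ?_))
  choose F _ hF2 hF3 using fun k => cov_it h0 h1.le H hr hx k
  have ed1 : ∀ k (y : Eu n), ediam (closedBall y (θ ^ k * r1)) ≤ ENNReal.ofReal (2 * (θ ^ k * r1)) := fun k y => by
    refine ediam_le fun a ha c hc => ?_
    rw [edist_dist]
    refine ENNReal.ofReal_le_ofReal ?_
    rw [mem_closedBall] at ha; rw [mem_closedBall'] at hc
    linarith [dist_triangle a y c]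
  have hle := Measure.hausdorffMeasure_le_liminf_sum (d:ℝ) (S ∩ closedBall x r1) (l := atTop) (ι := fun k : ℕ => {y // y ∈ F k})
    (fun k : ℕ => ENNReal.ofReal (2 * (θ ^ k * r1))) (by
      have : Tendsto (fun k : ℕ => 2 * (θ ^ k * r1)) atTop (𝓝 (2 * (0 * r1))) :=
        ((tendsto_pow_atTop_nhds_zero_of_lt_one h0.le h1).mul_const _).const_mul _
      simpa using ENNReal.tendsto_ofReal this) (fun k y => closedBall y.1 (θ ^ k * r1)) (Eventually.of_forall fun k y => ed1 k y)
      (Eventually.of_forall fun k z hz => by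
        obtain ⟨y, hy, hzy⟩ := mem_iUnion₂.1 (hF3 k hz)
        exact mem_iUnion.2 ⟨⟨y, hy⟩, hzy⟩)
  refine ne_top_of_le_ne_top (b := ENNReal.ofReal ((2 * r1) ^ (d:ℝ))) ENNReal.ofReal_ne_top (hle.trans ?_)
  refine (liminf_le_liminf (Eventually.of_forall fun k => ?_)).trans (liminf_const _).le
  calc ∑ y : {y // y ∈ F k}, ediam (closedBall y.1 (θ ^ k * r1)) ^ (d:ℝ) 
      ≤ ∑ y : {y // y ∈ F k}, ENNReal.ofReal (2 * (θ ^ k * r1)) ^ (d:ℝ) := by gcongr with y; exact ed1 k y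
    _ = (F k).card * ENNReal.ofReal (2 * (θ ^ k * r1)) ^ (d:ℝ) := by simp
    _ = ENNReal.ofReal ((F k).card * (2 * (θ ^ k * r1)) ^ (d:ℝ)) := by
        rw [ENNReal.ofReal_mul (p := ((F k).card : ℝ)) ⊕ₚ, ENNReal.ofReal_rpow_of_nonneg ⊕ₚ ⊕ₚ, ENNReal.ofReal_natCast]
    _ ≤ _ := by
        refine ENNReal.ofReal_le_ofReal ?_
        have e1 : (2 * (θ ^ k * r1)) ^ (d:ℝ) = (θ ^ (d:ℝ)) ^ k * (2 * r1) ^ (d:ℝ) := by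
          rw [show 2 * (θ ^ k * r1) = θ ^ k * (2 * r1) by ring, Real.mul_rpow ⊕ₚ ⊕ₚ,
            ← Real.rpow_natCast, ← Real.rpow_natCast, ← Real.rpow_mul h0.le, ← Real.rpow_mul h0.le, mul_comm (k:ℝ)]
        have e2 : ((F k).card : ℝ) ≤ (m:ℝ) ^ k := by exact_mod_cast hF2 k
        calc _ ≤ (m:ℝ) ^ k * ((θ ^ (d:ℝ)) ^ k * (2 * r1) ^ (d:ℝ)) := by rw [e1]; gcongr
          _ = (m * θ ^ (d:ℝ)) ^ k * (2 * r1) ^ (d:ℝ) := by rw [mul_pow]; ring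
          _ ≤ 1 * (2 * r1) ^ (d:ℝ) := by gcongr; exact pow_le_one₀ ⊕ₚ hm
          _ = _ := one_mul _

lemma grid {S : Set (Eu n)} {N : ℕ} (hN : 0 < N) {x : Eu n} {r : ℝ} (hr : 0 < r) (b : OrthonormalBasis (Fin n) ℝ (Eu n)) (K : Finset (Fin n))
    (hK : K.card = 3) (h : ∀ y ∈ S, ‖y - x‖ ≤ r → ∀ k ∈ K, |inner ℝ (b k) (y - x)| ≤ 1 / N * r) :
    ∃ F : Finset (Eu n), ↑F ⊆ S ∧ F.card ≤ 27 * (2 * N + 1) ^ (n - 3) ∧ S ∩ closedBall x r ⊆ ⋃ y ∈ F, closedBall y (n / N * r) := by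
  classical
  have N0 : (0:ℝ) < N := by exact_mod_cast hN
  obtain ⟨f, hf⟩ : ∃ f : Eu n → Fin n → ℤ, f = fun y k => ⌊inner ℝ (b k) (y - x) * (N / r)⌋ := ⟨_, rfl⟩
  obtain ⟨G, hG⟩ : ∃ G : Finset (Fin n → ℤ), G = Fintype.piFinset fun k => if k ∈ K then Finset.Icc (-1) 1 else Finset.Icc (-(N:ℤ)) N := ⟨_, rfl⟩
  have fb : ∀ {a : ℝ} {c : ℕ}, |a| ≤ c / N * r → ⌊a * (N / r)⌋ ∈ Finset.Icc (-(c:ℤ)) c := fun {a c} ha => by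
    have h1 : |a * (N / r)| ≤ c := by
      rw [abs_mul, abs_of_pos (by positivity : 0 < (N:ℝ) / r)]
      calc _ ≤ c / N * r * (N / r) := by gcongr
        _ = c := by field_simp
    rw [abs_le] at h1
    rw [Finset.mem_Icc]
    refine ⟨Int.le_floor.2 (by push_cast; exact h1.1), ?_⟩
    have := (Int.floor_le (a * (N / r))).trans h1.2
    exact_mod_cast this
  have hfG : ∀ y ∈ S ∩ closedBall x r, f y ∈ G := fun y hy => by
    have hyx : ‖y - x‖ ≤ r := by rw [← dist_eq_norm]; exact hy.2
    rw [hG, Fintype.mem_piFinset, hf]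
    intro k
    simp only
    split_ifs with hk
    · exact_mod_cast fb (c := 1) (by simpa using h y hy.1 hyx k hk)
    · refine fb ?_
      rw [div_self N0.ne', one_mul]
      refine (abs_real_inner_le_norm _ _).trans ?_
      rw [b.norm_eq_one, one_mul]; exact hyx
  have hcard : G.card = 27 * (2 * N + 1) ^ (n - 3) := by
    rw [hG, Fintype.card_piFinset]
    have : ∀ k, (if k ∈ K then Finset.Icc (-1:ℤ) 1 else Finset.Icc (-(N:ℤ)) N).card = if k ∈ K then 3 else 2 * N + 1 := fun k => by
      split_ifs
      · rfl
      · simp; omega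
    simp only [this]
    rw [Finset.prod_ite, Finset.prod_const, Finset.prod_const]
    have c1 : (Finset.univ.filter fun k => k ∈ K).card = 3 := by rw [← hK]; congr 1; ext; simp
    have c2 : (Finset.univ.filter fun k => k ∉ K).card = n - 3 := by
      rw [show (Finset.univ.filter fun k => k ∉ K) = Kᶜ by ext; simp, Finset.card_compl, hK]; simp
    rw [c1, c2]; norm_num
  obtain ⟨G', hG'⟩ : ∃ G', G' = G.filter fun a => ∃ y ∈ S ∩ closedBall x r, f y = a := ⟨_, rfl⟩
  have hsel : ∀ a ∈ G', ∃ y ∈ S ∩ closedBall x r, f y = a := fun a ha => by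
    rw [hG'] at ha; exact (Finset.mem_filter.1 ha).2
  choose! q hq1 hq2 using hsel
  refine ⟨G'.image q, fun z hz => ?_, ?_, fun y hy => ?_⟩
  · obtain ⟨a, ha, rfl⟩ := Finset.mem_image.1 (Finset.mem_coe.1 hz)
    exact (hq1 a ha).1
  · refine Finset.card_image_le.trans ?_
    rw [← hcard, hG']; exact Finset.card_filter_le _ _
  · have hy' : f y ∈ G' := by rw [hG', Finset.mem_filter]; exact ⟨hfG y hy, y, hy, rfl⟩
    refine mem_iUnion₂.2 ⟨q (f y), Finset.mem_image_of_mem _ hy', ?_⟩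
    have e := hq2 _ hy'
    rw [mem_closedBall, dist_eq_norm]
    generalize q (f y) = w at e
    have hk : ∀ k, |inner ℝ (b k) (y - w)| ≤ r / N := fun k => by
      have ek := congrFun e k
      rw [hf] at ek; simp only at ek
      have := Int.abs_sub_lt_one_of_floor_eq_floor ek
      rw [← sub_mul, ← inner_sub_right, abs_mul, abs_of_pos (by positivity : 0 < (N:ℝ) / r), ← mul_div_assoc, div_lt_one hr] at this
      rw [le_div_iff₀ N0, ← abs_neg, ← inner_neg_right]
      rw [show -(y - w) = w - x - (y - x) by abel]; exact this.le
    have h2 : ‖y - w‖ ^ 2 ≤ (n / N * r) ^ 2 := by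
      rw [← b.sum_sq_norm_inner_right]
      calc _ ≤ ∑ k : Fin n, (r / N) ^ 2 := by gcongr with k; exact hk k
        _ = n * (r / N) ^ 2 := by simp
        _ ≤ n ^ 2 * (r / N) ^ 2 := by
            gcongr
            exact_mod_cast Nat.le_self_pow (by norm_num) n
        _ = _ := by ring
    exact le_of_sq_le_sq h2 ⊕ₚ
end

section
open scoped ENNReal NNReal Topology
variable {p : ℕ} {x0 : Eu n} {R : ℝ} {u : Eu n → Eu p} {g : Eu n → Eu n ⊸ Eu p}

lemma pick (hn : 3 ≤ n) {d : ℝ} (hd : ((n - 3 : ℕ) : ℝ) < d) : ∃ N : ℕ, 0 < N ∧ (n:ℝ) / N < 1 ∧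
    ((27 * (2 * N + 1) ^ (n - 3) : ℕ) : ℝ) * ((n:ℝ) / N) ^ d ≤ 1 := by
  obtain ⟨C, hC⟩ : ∃ C, C = 27 * 3 ^ (n - 3) * (n:ℝ) ^ d := ⟨_, rfl⟩
  have h1 : Tendsto (fun N : ℕ => C * (N:ℝ) ^ (-(d - ((n - 3 : ℕ) : ℝ)))) atTop (𝓝 (C * 0)) :=
    ((tendsto_rpow_neg_atTop (sub_pos.2 hd)).comp tendsto_natCast_atTop_atTop).const_mul C
  rw [mul_zero] at h1
  obtain ⟨N, hN1, hN2⟩ := ((h1.eventually (ge_mem_nhds one_pos)).and (eventually_gt_atTop n)).exists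
  have N0 : 0 < N := by omega
  have N0' : (0:ℝ) < N := by exact_mod_cast N0
  refine ⟨N, N0, (div_lt_one N0').2 (by exact_mod_cast hN2), le_trans ?_ hN1⟩
  have e1 : (2 * (N:ℝ) + 1) ^ (n - 3) ≤ (3 * N) ^ (n - 3) := by
    gcongr
    have : (1:ℝ) ≤ N := by exact_mod_cast N0
    linarith
  push_cast
  calc _ ≤ 27 * (3 * N) ^ (n - 3) * ((n:ℝ) / N) ^ d := by gcongr
    _ = _ := by
      rw [hC, mul_pow, Real.div_rpow ⊕ₚ N0'.le, neg_sub, Real.rpow_sub N0', Real.rpow_natCast]; ring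

lemma Mn.dim (hn : 3 ≤ n) (hp : 3 ≤ p) (hR : 0 < R) (M : Mn x0 R u g) {d : ℝ≥0} (hd : ((n - 3 : ℕ) : ℝ) < d) :
    dimH {x | x ∈ ball x0 (R/2) ∧ ¬ Rg u x} ≤ d := by
  obtain ⟨N, N0, hN1, hN2⟩ := pick hn hd
  have N0' : (0:ℝ) < N := by exact_mod_cast N0
  have n0' : (0:ℝ) < n := by exact_mod_cast (by omega : 0 < n)
  obtain ⟨C1, hC1, H1⟩ := Prof.psi.bdd
  obtain ⟨Λ, hΛ⟩ : ∃ Λ, Λ = (R/4) ^ (2 - (n:ℤ)) * (C1 * ∫ z, ed (g z)) + 1 := ⟨_, rfl⟩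
  have E0 : 0 ≤ ∫ z, ed (g z) := integral_nonneg fun z => ed_nonneg _
  have hΛ0 : 0 < Λ := by rw [hΛ]; positivity
  have hΛ1 : ∀ x, Th g x (R/4) ≤ Λ := fun x => by
    have : cv psi (R/4) (fun z => ed (g z)) x ≤ C1 * ∫ z, ed (g z) := by
      rw [← integral_const_mul]
      refine integral_mono (cv_integrable Prof.psi ⊕ₚ (ed_int M.sw.l2).locallyIntegrable x) ((ed_int M.sw.l2).const_mul _) fun z => ?_
      exact mul_le_mul_of_nonneg_right ((le_abs_self _).trans (H1 _ ⊕ₚ)) (ed_nonneg _)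
    rw [hΛ, Th]
    have := mul_le_mul_of_nonneg_left this (by positivity : 0 ≤ (R/4) ^ (2 - (n:ℤ)))
    linarith
  obtain ⟨δ, hδ, Hδ⟩ := Mn.strat hn hp hΛ0 (τ := 1 / N) ⊕ₚ
  have hin : ∀ x ∈ ball x0 (R/2), ∀ s, s ≤ R/4 → closedBall x s ⊆ ball x0 R := fun x hx s hs => by
    refine (closedBall_subset_ball' (ε₂ := R) ?_)
    rw [mem_ball] at hx; linarith
  obtain ⟨S, hS⟩ : ∃ S : ℕ → Set (Eu n), S = fun j : ℕ => {x | x ∈ ball x0 (R/2) ∧ ¬ Rg u x ∧ ∀ r, 0 < r → r ≤ 1 / ((j:ℝ) + 1) → Th g x (2 * r) - Th g x r ≤ δ} := ⟨_, rfl⟩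
  have hU : {x | x ∈ ball x0 (R/2) ∧ ¬ Rg u x} ⊆ ⋃ j, S j := fun x hx => by
    obtain ⟨a, ha⟩ : ∃ a, a = sInf (Th g x '' Ioc 0 (R/4)) := ⟨_, rfl⟩
    have hne : (Th g x '' Ioc 0 (R/4)).Nonempty := ⟨_, R/4, ⟨by positivity, le_rfl⟩, rfl⟩
    have hbd : BddBelow (Th g x '' Ioc 0 (R/4)) := ⟨0, by rintro _ ⟨t, ht, rfl⟩; exact Th_nonneg g x ht.1⟩
    obtain ⟨_, ⟨t, ht, rfl⟩, hlt⟩ := exists_lt_of_csInf_lt hne (by rw [← ha]; linarith : sInf (Th g x '' Ioc 0 (R/4)) < a + δ)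
    obtain ⟨j, hj⟩ := exists_nat_one_div_lt (by have := ht.1; positivity : 0 < t / 2)
    refine mem_iUnion.2 ⟨j, ?_⟩
    rw [hS]
    refine ⟨hx.1, hx.2, fun r r0 hr => ?_⟩
    have h2 : 2 * r ≤ t := by linarith
    have h3 := M.Th_mono hR (by positivity : 0 < 2 * r) h2 (hin x hx.1 t ht.2)
    have h4 : a ≤ Th g x r := by rw [ha]; exact csInf_le hbd ⟨r, ⟨r0, by linarith [ht.2]⟩, rfl⟩
    linarith
  refine (dimH_mono hU).trans ?_
  rw [dimH_iUnion]
  refine iSup_le fun j => ?_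
  refine cov_dim (r1 := Min.min (R/32) (1 / (4 * ((j:ℝ) + 1)))) ⊕ₚ hN1 (fun x hx r r0 hr => ?_) ⊕ₚ hN2
  have hr1 : r ≤ R/32 := hr.trans (min_le_left _ _)
  have hr2 : 4 * r ≤ 1 / ((j:ℝ) + 1) := by
    have := hr.trans (min_le_right _ _)
    rw [le_div_iff₀ ⊕ₚ] at this ⊢; linarith
  rw [hS] at hx
  obtain ⟨b, K, hK, hb⟩ := Hδ hR M (S j) r r0 (fun y hy => by
    rw [hS] at hy
    refine ⟨hin y hy.1 _ (by linarith), (M.Th_mono hR ⊕ₚ (by linarith) (hin y hy.1 (R/4) le_rfl)).trans (hΛ1 y), hy.2.2 _ ⊕ₚ hr2⟩) x (by rw [hS]; exact hx) hx.2.1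
  exact grid N0 r0 b K hK hb

lemma Rg.mem {Ω : Set (Eu n)} {u u0 : Eu n → Eu p} (hB : closedBall x0 R ⊆ Ω) (he : ∀ᵐ x, x ∈ ball x0 R → u0 x = u x) {x : Eu n} (hx : x ∈ ball x0 R) (h : Rg u0 x) :
    x ∈ regSet n p Ω u := by
  obtain ⟨ρ, v, hρ, hv, hev⟩ := h
  refine ⟨hB (ball_subset_closedBall hx), ball x ρ ∩ ball x0 R, isOpen_ball.inter isOpen_ball, ⟨mem_ball_self hρ, hx⟩,
    fun z hz => hB (ball_subset_closedBall hz.2), v, hv.mono inter_subset_left, ?_⟩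
  rw [ae_restrict_iff' (measurableSet_ball.inter measurableSet_ball)]
  filter_upwards [he, hev] with z h1 h2 hz
  rw [← h1 hz.2, h2 hz.1]
end
end

/-- Corollary 3 of Section 3.3 of the paper, for energy minimizing maps into the unit
sphere: the singular set `sing(u) = Ω ∖ reg(u)` has Hausdorff dimension at most
`n - 3`. -/
theorem singular_set_dimH_le
    (n p : ℕ) (hn : 3 ≤ n) (hp : 2 ≤ p)
    (Ω : Set (EuclideanSpace ℝ (Fin n))) (hΩ : IsOpen Ω)
    (u : EuclideanSpace ℝ (Fin n) → EuclideanSpace ℝ (Fin p))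
    (g : EuclideanSpace ℝ (Fin n) →
      (EuclideanSpace ℝ (Fin n) →L[ℝ] EuclideanSpace ℝ (Fin p)))
    (hu : IsEnergyMinimizingToSphere n p Ω u g) :
    dimH (Ω \ regSet n p Ω u) ≤ ((n - 3 : ℕ) : ENNReal) := by
  by_contra hlt
  push Not at hlt
  obtain ⟨d, hd1, hd2⟩ := ENNReal.lt_iff_exists_nnreal_btwn.1 hlt
  obtain ⟨x, hx, hd⟩ := exists_mem_nhdsWithin_lt_dimH_of_lt_dimH hd2
  obtain ⟨R, hR, hB⟩ := nhds_basis_closedBall.mem_iff.1 (hΩ.mem_nhds hx.1)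
  obtain ⟨u0, g0, M, he⟩ := Mn.of_min hΩ hu hR hB
  rcases hp.eq_or_lt with rfl | hp3
  · exact hx.2 (Rg.mem hB he (mem_ball_self hR) (M.reg2 hR (mem_ball_self hR)))
  · have h1 := hd ((Ω \ regSet n p Ω u) ∩ ball x (R/2)) (inter_mem_nhdsWithin _ (ball_mem_nhds x (by positivity)))
    refine absurd h1 (not_lt.2 (le_trans (dimH_mono fun y hy => ?_) (M.dim hn hp3 hR (d := d) (by exact_mod_cast hd1))))
    refine ⟨hy.2, fun hr => hy.1.2 (Rg.mem hB he (ball_subset_ball (by linarith) hy.2) hr)⟩
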